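/- Let S_0(n,r) be the 0-Schur algebra over an algebraically closed field k. Then: (1) for n ≥ 3, S_0(n,r) is τ-tilting finite if and only if r ≤ 3; (2) for n = 2 and every r ≥ 2, S_0(2,r) is τ-tilting finite. -/

import Mathlib

open MulOpposite CategoryTheory CategoryTheory.Limits

noncomputable section

/-- A submodule `N ≤ M` is superfluous if `N ⊔ K = ⊤` implies `K = ⊤`. -/
def SuperfluousSubmodule {R M : Type} [Ring R] [AddCommGroup M] [Module R M]
    (N : Submodule R M) : Prop :=
  ∀ K : Submodule R M, N ⊔ K = ⊤ → K = ⊤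

section TauTilting

variable (k : Type) [Field k]
variable (B : Type) [Ring B] [Algebra k B]

/-- A minimal projective presentation `P1 → P0 → M → 0` of a right `B`-module `M`. -/
def IsMinimalProjPresentation (M P1 P0 : ModuleCat.{0} Bᵐᵒᵖ)
    (f : P1 →ₗ[Bᵐᵒᵖ] P0) (g : P0 →ₗ[Bᵐᵒᵖ] M) : Prop :=
  Module.Projective Bᵐᵒᵖ P1 ∧ Module.Projective Bᵐᵒᵖ P0 ∧
    Function.Surjective g ∧ LinearMap.range f = LinearMap.ker g ∧
    SuperfluousSubmodule (LinearMap.ker g) ∧ SuperfluousSubmodule (LinearMap.ker f)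

/-- Left multiplication by `b` on the left `B`-module `Hom_B(P, B)` of a right module `P`. -/
def leftMulHom {P : Type} [AddCommGroup P] [Module Bᵐᵒᵖ P] (b : B)
    (h : P →ₗ[Bᵐᵒᵖ] B) : P →ₗ[Bᵐᵒᵖ] B where
  toFun p := b * h p
  map_add' x y := by simp [mul_add]
  map_smul' r p := by
    simp only [map_smul, RingHom.id_apply]
    rw [MulOpposite.smul_eq_mul_unop, MulOpposite.smul_eq_mul_unop, mul_assoc]

/-- `M` is τ-rigid:  `Hom_B(M, τM) = 0`, where `τM = D(Tr M)` is computed from a minimal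
projective presentation `P1 --f--> P0 → M → 0`, `Tr M = coker(Hom(P0,B) → Hom(P1,B))`, and
`D = Hom_k(-, k)`.  A right-module map `M → D(Tr M)` is encoded as an additive map
`β : M →+ Hom_k(Hom_B(P1, B), k)` which is balanced (`β (m·b) = β m (b·-)`) and vanishes on
the image of `Hom(P0,B)`, i.e. descends to the cokernel `Tr M`. -/
def IsTauRigid (M : ModuleCat.{0} Bᵐᵒᵖ) : Prop :=
  ∀ (P1 P0 : ModuleCat.{0} Bᵐᵒᵖ) (f : P1 →ₗ[Bᵐᵒᵖ] P0) (g : P0 →ₗ[Bᵐᵒᵖ] M),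
    IsMinimalProjPresentation B M P1 P0 f g →
    ∀ β : M →+ ((P1 →ₗ[Bᵐᵒᵖ] B) →ₗ[k] k),
      (∀ (m : M) (b : B) (h : P1 →ₗ[Bᵐᵒᵖ] B),
        β (op b • m) h = β m (leftMulHom B b h)) →
      (∀ (m : M) (g0 : P0 →ₗ[Bᵐᵒᵖ] B), β m (g0.comp f) = 0) →
      β = 0

/-- A module is indecomposable if it is nonzero and admits no nontrivial direct sum
decomposition. -/
def IndecomposableMod (M : ModuleCat.{0} Bᵐᵒᵖ) : Prop :=
  Nontrivial M ∧ ∀ (L L' : ModuleCat.{0} Bᵐᵒᵖ),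
    Nonempty (M ≃ₗ[Bᵐᵒᵖ] (L × L')) → Subsingleton L ∨ Subsingleton L'

/-- A module is basic (multiplicity-free) if it has no repeated direct summand. -/
def IsBasicMod (M : ModuleCat.{0} Bᵐᵒᵖ) : Prop :=
  ∀ (L C : ModuleCat.{0} Bᵐᵒᵖ),
    Nonempty (M ≃ₗ[Bᵐᵒᵖ] (L × L × C)) → Subsingleton L

/-- `L` is an indecomposable direct summand of `M`. -/
def IsIndecSummand (L M : ModuleCat.{0} Bᵐᵒᵖ) : Prop :=
  IndecomposableMod B L ∧ ∃ L' : ModuleCat.{0} Bᵐᵒᵖ, Nonempty (M ≃ₗ[Bᵐᵒᵖ] (L × L'))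

/-- The rank of the Grothendieck group `K_0(B)` is `n`, i.e. there are exactly `n`
isomorphism classes of simple right `B`-modules. -/
def RankK0Is (n : ℕ) : Prop :=
  ∃ S : Fin n → ModuleCat.{0} Bᵐᵒᵖ,
    (∀ i, IsSimpleModule Bᵐᵒᵖ (S i)) ∧
    (∀ i j, i ≠ j → IsEmpty ((S i) ≃ₗ[Bᵐᵒᵖ] (S j))) ∧
    (∀ T : ModuleCat.{0} Bᵐᵒᵖ, IsSimpleModule Bᵐᵒᵖ T → ∃ i, Nonempty (T ≃ₗ[Bᵐᵒᵖ] S i))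

/-- The number of isomorphism classes of indecomposable direct summands of `M` is `n`. -/
def NumIndecSummandsIs (M : ModuleCat.{0} Bᵐᵒᵖ) (n : ℕ) : Prop :=
  ∃ N : Fin n → ModuleCat.{0} Bᵐᵒᵖ,
    (∀ i, IsIndecSummand B (N i) M) ∧
    (∀ i j, i ≠ j → IsEmpty ((N i) ≃ₗ[Bᵐᵒᵖ] (N j))) ∧
    (∀ L, IsIndecSummand B L M → ∃ i, Nonempty (L ≃ₗ[Bᵐᵒᵖ] N i))

/-- `M` is a τ-tilting module over `B`: it is a finitely generated τ-rigid module whose number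
of non-isomorphic indecomposable direct summands equals the rank of `K_0(B)`. -/
def IsTauTiltingMod (M : ModuleCat.{0} Bᵐᵒᵖ) : Prop :=
  Module.Finite Bᵐᵒᵖ M ∧ IsTauRigid k B M ∧
    ∃ n : ℕ, NumIndecSummandsIs B M n ∧ RankK0Is B n

end TauTilting

section Support

variable (k : Type) [Field k]
variable (A : Type) [Ring A] [Algebra k A]

/-- The quotient of `A` by the two-sided ideal `AeA` generated by `e`. -/
def IdemQuot (e : A) : Type := ((TwoSidedIdeal.span {e}).ringCon).Quotient

instance (e : A) : Ring (IdemQuot A e) :=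
  inferInstanceAs (Ring ((TwoSidedIdeal.span {e}).ringCon).Quotient)

/-- The quotient map `A → A/AeA`. -/
def IdemQuot.mk (e : A) : A →+* IdemQuot A e := RingCon.mk' _

instance (e : A) : Algebra k (IdemQuot A e) :=
  RingHom.toAlgebra' ((IdemQuot.mk A e).comp (algebraMap k A)) (by
    intro c x
    induction x using Quotient.ind with
    | _ a =>
      show (IdemQuot.mk A e) (algebraMap k A c) * (IdemQuot.mk A e) a
          = (IdemQuot.mk A e) a * (IdemQuot.mk A e) (algebraMap k A c)
      rw [← map_mul, ← map_mul, Algebra.commutes])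

/-- `M` is a support τ-tilting module over `A`: there is an idempotent `e ∈ A` such that `M` is
(the restriction of) a τ-tilting module over `A/AeA`. -/
def IsSupportTauTilting (M : ModuleCat.{0} Aᵐᵒᵖ) : Prop :=
  ∃ e : A, IsIdempotentElem e ∧
    ∃ N : ModuleCat.{0} (IdemQuot A e)ᵐᵒᵖ,
      IsTauTiltingMod k (IdemQuot A e) N ∧
      letI : Module Aᵐᵒᵖ N := Module.compHom N (RingHom.op (IdemQuot.mk A e))
      Nonempty (M ≃ₛₗ[RingHom.id Aᵐᵒᵖ] N)

/-- `A` is τ-tilting finite: it admits only finitely many basic support τ-tilting modules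
up to isomorphism. -/
def TauTiltingFinite : Prop :=
  ∃ (n : ℕ) (R : Fin n → ModuleCat.{0} Aᵐᵒᵖ),
    ∀ M : ModuleCat.{0} Aᵐᵒᵖ, IsSupportTauTilting k A M → IsBasicMod A M →
      ∃ i, Nonempty (M ≃ₗ[Aᵐᵒᵖ] R i)

/-- `A` is representation-finite: it has only finitely many isomorphism classes of finitely
generated indecomposable right modules. -/
def RepresentationFinite : Prop :=
  ∃ (n : ℕ) (R : Fin n → ModuleCat.{0} Aᵐᵒᵖ),
    ∀ M : ModuleCat.{0} Aᵐᵒᵖ, Module.Finite Aᵐᵒᵖ M → IndecomposableMod A M →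
      ∃ i, Nonempty (M ≃ₗ[Aᵐᵒᵖ] R i)

end Support

section Schur
variable (k : Type) [Field k]

/-- Generators `T_{s_1}, ..., T_{s_{r-1}}` of the 0-Hecke algebra of the symmetric group
`S_r`, indexed by `i` with `i + 2 ≤ r` (the adjacent transposition `(i+1, i+2)`). -/
def AGen (r : ℕ) : Type := {i : ℕ // i + 2 ≤ r}

/-- The defining relations of the type `A_{r-1}` 0-Hecke algebra: `T_i² = -T_i`, the braid
relations `T_i T_j T_i = T_j T_i T_j` for `|i - j| = 1`, and the commutation relations
`T_i T_j = T_j T_i` for `|i - j| ≥ 2`. -/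
inductive heckeARel (r : ℕ) : FreeAlgebra k (AGen r) → FreeAlgebra k (AGen r) → Prop
  | sq (i : AGen r) : heckeARel r (FreeAlgebra.ι k i * FreeAlgebra.ι k i) (- FreeAlgebra.ι k i)
  | braid (i j : AGen r) (h : i.1 + 1 = j.1 ∨ j.1 + 1 = i.1) :
      heckeARel r (FreeAlgebra.ι k i * FreeAlgebra.ι k j * FreeAlgebra.ι k i)
        (FreeAlgebra.ι k j * FreeAlgebra.ι k i * FreeAlgebra.ι k j)
  | comm (i j : AGen r) (h : i.1 + 2 ≤ j.1 ∨ j.1 + 2 ≤ i.1) :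
      heckeARel r (FreeAlgebra.ι k i * FreeAlgebra.ι k j)
        (FreeAlgebra.ι k j * FreeAlgebra.ι k i)

/-- The 0-Hecke algebra `H_0(S_r)` of the symmetric group of degree `r`. -/
def HeckeA (r : ℕ) : Type := RingQuot (heckeARel k r)

instance (r : ℕ) : Ring (HeckeA k r) := inferInstanceAs (Ring (RingQuot (heckeARel k r)))
instance (r : ℕ) : Algebra k (HeckeA k r) :=
  inferInstanceAs (Algebra k (RingQuot (heckeARel k r)))

/-- The generator `T_{s_{i+1}}` of `H_0(S_r)`. -/
def TGen (r : ℕ) (i : AGen r) : HeckeA k r :=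
  RingQuot.mkAlgHom k (heckeARel k r) (FreeAlgebra.ι k i)

/-- The adjacent transposition `s_{i+1} = (i+1, i+2)` in the symmetric group `S_r`. -/
def adjSwap (r : ℕ) (i : AGen r) : Equiv.Perm (Fin r) :=
  Equiv.swap ⟨i.1, by have := i.2; omega⟩ ⟨i.1 + 1, by have := i.2; omega⟩

/-- The number of inversions of a permutation, i.e. its Coxeter length. -/
def invCount {r : ℕ} (w : Equiv.Perm (Fin r)) : ℕ :=
  (Finset.univ.filter (fun p : Fin r × Fin r => p.1 < p.2 ∧ w p.2 < w p.1)).card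

/-- `T` is the standard basis `(T_w)_{w ∈ S_r}` of `H_0(S_r)`: it sends the identity to `1`,
adjacent transpositions to the generators, and satisfies `T_{w s} = T_w T_s` whenever
`ℓ(w s) = ℓ(w) + 1`. -/
def IsHeckeBasis (r : ℕ) (T : Equiv.Perm (Fin r) → HeckeA k r) : Prop :=
  T 1 = 1 ∧
  (∀ i : AGen r, T (adjSwap r i) = TGen k r i) ∧
  (∀ (w : Equiv.Perm (Fin r)) (i : AGen r),
    invCount (w * adjSwap r i) = invCount w + 1 →
    T (w * adjSwap r i) = T w * TGen k r i)

/-- The set `Ω(n,r)` of compositions of `r` with at most `n` parts. -/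
def Comp (n r : ℕ) : Type := {lam : Fin n → ℕ // ∑ i, lam i = r}

/-- The partial sum `λ_1 + ⋯ + λ_i`. -/
def psum {n : ℕ} (lam : Fin n → ℕ) (i : Fin n) : ℕ :=
  ∑ j ∈ Finset.univ.filter (fun j : Fin n => (j : ℕ) < (i : ℕ)), lam j

/-- The Young subgroup `S_λ = S_{λ_1} × ⋯ × S_{λ_n} ≤ S_r`, as the set of permutations
preserving each of the consecutive blocks of sizes `λ_1, ..., λ_n`. -/
def YoungFinset {n r : ℕ} (lam : Fin n → ℕ) : Finset (Equiv.Perm (Fin r)) :=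
  Finset.univ.filter (fun w => ∀ (x : Fin r) (i : Fin n),
    (psum lam i ≤ (x : ℕ) ∧ (x : ℕ) < psum lam i + lam i) →
    (psum lam i ≤ ((w x) : ℕ) ∧ ((w x) : ℕ) < psum lam i + lam i))

/-- The element `x_λ = ∑_{w ∈ S_λ} T_w` of `H_0(S_r)`. -/
def xElt {n r : ℕ} (T : Equiv.Perm (Fin r) → HeckeA k r) (lam : Comp n r) : HeckeA k r :=
  ∑ w ∈ YoungFinset lam.1, T w

/-- The right ideal `x_λ H_0(S_r)`, as a right submodule of `H_0(S_r)`. -/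
def xIdeal {n r : ℕ} (T : Equiv.Perm (Fin r) → HeckeA k r) (lam : Comp n r) :
    Submodule (HeckeA k r)ᵐᵒᵖ (HeckeA k r) :=
  Submodule.span (HeckeA k r)ᵐᵒᵖ {xElt k T lam}

/-- The right `H_0(S_r)`-module `⊕_{λ ∈ Ω(n,r)} x_λ H_0(S_r)`. -/
def SchurModule (n r : ℕ) (T : Equiv.Perm (Fin r) → HeckeA k r) : Type :=
  ∀ lam : Comp n r, (xIdeal k T lam : Type)

instance (n r : ℕ) (T : Equiv.Perm (Fin r) → HeckeA k r) : AddCommGroup (SchurModule k n r T) :=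
  inferInstanceAs (AddCommGroup (∀ lam : Comp n r, (xIdeal k T lam : Type)))
instance (n r : ℕ) (T : Equiv.Perm (Fin r) → HeckeA k r) :
    Module (HeckeA k r)ᵐᵒᵖ (SchurModule k n r T) :=
  inferInstanceAs (Module (HeckeA k r)ᵐᵒᵖ (∀ lam : Comp n r, (xIdeal k T lam : Type)))
instance (n r : ℕ) (T : Equiv.Perm (Fin r) → HeckeA k r) : Module k (SchurModule k n r T) :=
  inferInstanceAs (Module k (∀ lam : Comp n r, (xIdeal k T lam : Type)))
instance (n r : ℕ) (T : Equiv.Perm (Fin r) → HeckeA k r) :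
    SMulCommClass (HeckeA k r)ᵐᵒᵖ k (SchurModule k n r T) :=
  inferInstanceAs (SMulCommClass (HeckeA k r)ᵐᵒᵖ k (∀ lam : Comp n r, (xIdeal k T lam : Type)))
instance (n r : ℕ) (T : Equiv.Perm (Fin r) → HeckeA k r) :
    IsScalarTower k (HeckeA k r)ᵐᵒᵖ (SchurModule k n r T) :=
  inferInstanceAs (IsScalarTower k (HeckeA k r)ᵐᵒᵖ (∀ lam : Comp n r, (xIdeal k T lam : Type)))

/-- The 0-Schur algebra `S_0(n,r) = End_{H_0(S_r)}(⊕_{λ ∈ Ω(n,r)} x_λ H_0(S_r))`. -/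
def Schur0 (n r : ℕ) (T : Equiv.Perm (Fin r) → HeckeA k r) : Type :=
  Module.End (HeckeA k r)ᵐᵒᵖ (SchurModule k n r T)

instance (n r : ℕ) (T : Equiv.Perm (Fin r) → HeckeA k r) : Ring (Schur0 k n r T) :=
  inferInstanceAs (Ring (Module.End (HeckeA k r)ᵐᵒᵖ (SchurModule k n r T)))

instance (n r : ℕ) (T : Equiv.Perm (Fin r) → HeckeA k r) : Algebra k (Schur0 k n r T) :=
  inferInstanceAs (Algebra k (Module.End (HeckeA k r)ᵐᵒᵖ (SchurModule k n r T)))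

end Schur

section Superfluous

variable {S : Type} [Ring S] {M M' P P' : Type} [AddCommGroup M] [Module S M]
  [AddCommGroup M'] [Module S M'] [AddCommGroup P] [Module S P] [AddCommGroup P'] [Module S P']

theorem SuperfluousSubmodule.map {N : Submodule S M} (hN : SuperfluousSubmodule N)
    (f : M →ₗ[S] M') : SuperfluousSubmodule (N.map f) := by
  intro K hK
  have h1 : N ⊔ K.comap f = ⊤ := by
    rw [eq_top_iff]
    intro m _
    have : f m ∈ N.map f ⊔ K := hK ▸ Submodule.mem_top
    obtain ⟨_, ⟨n, hn, rfl⟩, x, hx, h⟩ := Submodule.mem_sup.1 this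
    refine Submodule.mem_sup.2 ⟨n, hn, m - n, ?_, by abel⟩
    rw [Submodule.mem_comap, map_sub, ← h]
    simpa using hx
  have h2 := hN _ h1
  have h3 : N.map f ≤ K := by
    rw [Submodule.map_le_iff_le_comap, h2]
    exact le_top
  rwa [sup_eq_right.2 h3] at hK

theorem SuperfluousSubmodule.mono {N N' : Submodule S M} (hN : SuperfluousSubmodule N)
    (h : N' ≤ N) : SuperfluousSubmodule N' := fun K hK =>
  hN K (top_le_iff.1 (hK ▸ sup_le_sup_right h K))

theorem SuperfluousSubmodule.sup {N N' : Submodule S M} (hN : SuperfluousSubmodule N)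
    (hN' : SuperfluousSubmodule N') : SuperfluousSubmodule (N ⊔ N') := fun K hK =>
  hN' K (hN _ (by rw [← sup_assoc, hK]))

/-- `g` is a projective cover: a surjection from a projective module with superfluous kernel. -/
structure IsProjCover (g : P →ₗ[S] M) : Prop where
  proj : Module.Projective S P
  surj : Function.Surjective g
  superfluous : SuperfluousSubmodule (LinearMap.ker g)

theorem IsProjCover.prodMap {g : P →ₗ[S] M} {g' : P' →ₗ[S] M'} (h : IsProjCover g)
    (h' : IsProjCover g') : IsProjCover (g.prodMap g') := by
  refine ⟨?_, Function.Surjective.prodMap h.surj h'.surj, ?_⟩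
  · have := h.proj
    have := h'.proj
    infer_instance
  · refine ((h.superfluous.map (LinearMap.inl S P P')).sup
      (h'.superfluous.map (LinearMap.inr S P P'))).mono ?_
    rintro ⟨p, p'⟩ hp
    rw [LinearMap.mem_ker, LinearMap.prodMap_apply, Prod.mk_eq_zero] at hp
    exact Submodule.mem_sup.2 ⟨(p, 0), ⟨p, hp.1, rfl⟩, (0, p'), ⟨p', hp.2, rfl⟩, by simp⟩

theorem IsProjCover.surjective_of_comp {g : P →ₗ[S] M} (h : IsProjCover g) (θ : M' →ₗ[S] P)
    (hθ : Function.Surjective (g ∘ₗ θ)) : Function.Surjective θ := by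
  rw [← LinearMap.range_eq_top]
  refine h.superfluous _ ?_
  rw [eq_top_iff]
  intro p _
  obtain ⟨m, hm⟩ := hθ (g p)
  refine Submodule.mem_sup.2 ⟨p - θ m, ?_, θ m, ⟨m, rfl⟩, by abel⟩
  rw [LinearMap.mem_ker, map_sub, ← hm]
  simp

theorem IsProjCover.equiv [IsNoetherian S P] {g : P →ₗ[S] M}
    {g' : P' →ₗ[S] M} (h : IsProjCover g) (h' : IsProjCover g') : Nonempty (P ≃ₗ[S] P') := by
  have := h.proj
  have := h'.proj
  obtain ⟨θ, hθ⟩ := Module.projective_lifting_property g' g h'.surj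
  obtain ⟨η, hη⟩ := Module.projective_lifting_property g g' h.surj
  have s1 := h'.surjective_of_comp θ (by rw [hθ]; exact h.surj)
  have s2 := h.surjective_of_comp η (by rw [hη]; exact h'.surj)
  have i1 := IsNoetherian.injective_of_surjective_endomorphism (η ∘ₗ θ) (s2.comp s1)
  exact ⟨LinearEquiv.ofBijective θ ⟨Function.Injective.of_comp (f := η) (by simpa using i1), s1⟩⟩

theorem exists_cover_summand [IsNoetherian S P] [IsArtinian S P] [Module.Projective S P]
    (g : P →ₗ[S] M) (hg : Function.Surjective g) :
    ∃ K Q : Submodule S P, IsCompl K Q ∧ Q ≤ LinearMap.ker g ∧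
      IsProjCover (g.domRestrict K) := by
  obtain ⟨K, hK, hmin⟩ := IsArtinian.set_has_minimal {K : Submodule S P | K.map g = ⊤}
    ⟨⊤, by simpa [LinearMap.range_eq_top] using hg⟩
  have hKs : Function.Surjective (g.domRestrict K) := by
    intro m
    have : m ∈ K.map g := by rw [hK]; trivial
    obtain ⟨p, hp, rfl⟩ := this
    exact ⟨⟨p, hp⟩, rfl⟩
  obtain ⟨θ, hθ⟩ := Module.projective_lifting_property (g.domRestrict K) g hKs
  have hθ' : ∀ p, g (θ p) = g p := fun p => LinearMap.congr_fun hθ p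
  have hmin' : ∀ L : Submodule S K, (L.map K.subtype).map g = ⊤ → L = ⊤ := by
    intro L hL
    have h1 := hmin (L.map K.subtype) hL
    have h2 : L.map K.subtype ≤ K := Submodule.map_subtype_le K L
    have h3 : L.map K.subtype = K := by
      by_contra hne
      exact h1 (lt_of_le_of_ne h2 hne)
    rw [eq_top_iff]
    intro x _
    have : (x : P) ∈ L.map K.subtype := by rw [h3]; exact x.2
    obtain ⟨y, hy, hxy⟩ := this
    have : y = x := Subtype.ext hxy
    rwa [← this]
  have hs : Function.Surjective (θ ∘ₗ K.subtype) := by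
    rw [← LinearMap.range_eq_top]
    apply hmin'
    rw [eq_top_iff]
    intro m _
    obtain ⟨x, rfl⟩ := hKs m
    exact ⟨θ x, ⟨θ x, ⟨x, rfl⟩, rfl⟩, hθ' x⟩
  have hi := IsNoetherian.injective_of_surjective_endomorphism _ hs
  have hc : IsCompl K (LinearMap.ker θ) := by
    constructor
    · rw [Submodule.disjoint_def]
      intro x hx hx'
      have := @hi ⟨x, hx⟩ 0 (by simpa using hx')
      simpa using congrArg Subtype.val this
    · rw [codisjoint_iff, eq_top_iff]
      intro p _
      obtain ⟨x, hx⟩ := hs (θ p)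
      refine Submodule.mem_sup.2 ⟨x, x.2, p - x, ?_, by abel⟩
      rw [LinearMap.mem_ker, map_sub, ← hx]
      simp
  refine ⟨K, LinearMap.ker θ, hc, ?_, ?_, hKs, ?_⟩
  · intro p hp
    rw [LinearMap.mem_ker] at hp ⊢
    rw [← hθ', hp]
    simp
  · refine Module.Projective.of_split K.subtype (Submodule.projectionOnto K _ hc) ?_
    ext x
    simp
  · intro L hL
    apply hmin'
    rw [eq_top_iff]
    intro m _
    obtain ⟨x, rfl⟩ := hKs m
    have : x ∈ LinearMap.ker (g.domRestrict K) ⊔ L := hL ▸ Submodule.mem_top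
    obtain ⟨y, hy, z, hz, rfl⟩ := Submodule.mem_sup.1 this
    refine ⟨z, ⟨z, hz, rfl⟩, ?_⟩
    have : g y = 0 := hy
    simp [this]

theorem exists_proj_cover [IsArtinianRing S] [IsNoetherianRing S] [Module.Finite S M] :
    ∃ (n : ℕ) (P : Submodule S (Fin n → S)) (g : P →ₗ[S] M), IsProjCover g := by
  obtain ⟨n, g, hg⟩ := Module.Finite.exists_fin' S M
  obtain ⟨K, _, _, _, h⟩ := exists_cover_summand g hg
  exact ⟨n, K, _, h⟩

theorem exists_min_pres [IsArtinianRing S] [IsNoetherianRing S] [Module.Finite S M] :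
    ∃ (n m : ℕ) (P1 : Submodule S (Fin n → S)) (P0 : Submodule S (Fin m → S))
      (f : P1 →ₗ[S] P0) (g : P0 →ₗ[S] M), Module.Projective S P1 ∧ Module.Projective S P0 ∧
    Function.Surjective g ∧ LinearMap.range f = LinearMap.ker g ∧
    SuperfluousSubmodule (LinearMap.ker g) ∧ SuperfluousSubmodule (LinearMap.ker f) := by
  obtain ⟨m, P0, g, hg⟩ := exists_proj_cover (S := S) (M := M)
  obtain ⟨n, P1, f, hf⟩ := exists_proj_cover (S := S) (M := LinearMap.ker g)
  refine ⟨n, m, P1, P0, (LinearMap.ker g).subtype ∘ₗ f, g, hf.proj, hg.proj, hg.surj, ?_,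
    hg.superfluous, ?_⟩
  · rw [LinearMap.range_comp, LinearMap.range_eq_top.2 hf.surj, Submodule.map_top,
      Submodule.range_subtype]
  · rw [LinearMap.ker_comp_of_ker_eq_bot _ (Submodule.ker_subtype _)]
    exact hf.superfluous

/-- A module with a superfluous submodule whose quotient image is finitely generated is
finitely generated. -/
theorem finite_of_superfluous_ker [Module.Finite S M] (g : P →ₗ[S] M)
    (hg : Function.Surjective g) (h : SuperfluousSubmodule (LinearMap.ker g)) :
    Module.Finite S P := by
  obtain ⟨n, s, hs⟩ := Module.Finite.exists_fin (R := S) (M := M)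
  choose t ht using fun i => hg (s i)
  refine ⟨⟨Set.Finite.toFinset (Set.finite_range t), ?_⟩⟩
  rw [Set.Finite.coe_toFinset]
  apply h
  rw [eq_top_iff]
  intro p _
  have : g p ∈ (Submodule.span S (Set.range t)).map g := by
    rw [Submodule.map_span, ← Set.range_comp]
    have : (g ∘ t) = s := funext ht
    rw [this, hs]
    trivial
  obtain ⟨q, hq, hqp⟩ := this
  refine Submodule.mem_sup.2 ⟨p - q, ?_, q, hq, by abel⟩
  simp [hqp]

end Superfluous

section Vanishing

/-- Every right exact sequence `X → E → U → 0` splits. -/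
def ExtVanish (S : Type) [Ring S] (U X : Type) [AddCommGroup U] [Module S U] [AddCommGroup X]
    [Module S X] : Prop :=
  ∀ (E : Type) [AddCommGroup E] [Module S E] (φ : X →ₗ[S] E) (π : E →ₗ[S] U),
    Function.Surjective π → LinearMap.ker π = LinearMap.range φ →
      ∃ σ : U →ₗ[S] E, π ∘ₗ σ = LinearMap.id

/-- Every homomorphism `P1 → X` factors through `f : P1 → P0`. -/
def HomVanish {S : Type} [Ring S] {P1 P0 : Type} [AddCommGroup P1] [Module S P1]
    [AddCommGroup P0] [Module S P0] (f : P1 →ₗ[S] P0) (X : Type) [AddCommGroup X]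
    [Module S X] : Prop :=
  ∀ h : P1 →ₗ[S] X, ∃ u : P0 →ₗ[S] X, u ∘ₗ f = h

variable {S : Type} [Ring S] {U X P0 P1 : Type} [AddCommGroup U] [Module S U]
  [AddCommGroup X] [Module S X] [AddCommGroup P0] [Module S P0] [AddCommGroup P1] [Module S P1]

theorem HomVanish.extVanish {f : P1 →ₗ[S] P0} {g : P0 →ₗ[S] U} [Module.Projective S P0]
    [Module.Projective S P1] (hg : Function.Surjective g)
    (hfg : LinearMap.range f = LinearMap.ker g) (hf : HomVanish f X) : ExtVanish S U X := by
  intro E _ _ φ π hπ hφ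
  obtain ⟨a, ha⟩ := Module.projective_lifting_property π g hπ
  have h1 : ∀ p, a (f p) ∈ LinearMap.range φ := by
    intro p
    rw [← hφ, LinearMap.mem_ker]
    have := LinearMap.congr_fun ha (f p)
    rw [LinearMap.comp_apply] at this
    rw [this]
    have : f p ∈ LinearMap.ker g := hfg ▸ ⟨p, rfl⟩
    exact this
  obtain ⟨h, hh⟩ := Module.projective_lifting_property φ.rangeRestrict
    ((a ∘ₗ f).codRestrict _ h1) φ.surjective_rangeRestrict
  obtain ⟨u, rfl⟩ := hf h
  have h2 : LinearMap.ker g ≤ LinearMap.ker (a - φ ∘ₗ u) := by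
    rw [← hfg]
    rintro _ ⟨p, rfl⟩
    have := congrArg Subtype.val (LinearMap.congr_fun hh p)
    simp only [LinearMap.comp_apply, LinearMap.codRestrict_apply] at this
    rw [LinearMap.mem_ker, LinearMap.sub_apply, ← this]
    simp
  refine ⟨(LinearMap.ker g).liftQ _ h2 ∘ₗ (g.quotKerEquivOfSurjective hg).symm.toLinearMap, ?_⟩
  ext x
  obtain ⟨p, rfl⟩ := hg x
  have h3 : (g.quotKerEquivOfSurjective hg).symm (g p) = Submodule.Quotient.mk p := by
    rw [LinearEquiv.symm_apply_eq]
    rfl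
  have h4 : π (φ (u p)) = 0 := by
    have : φ (u p) ∈ LinearMap.ker π := hφ ▸ ⟨u p, rfl⟩
    exact this
  have h5 : π (a p) = g p := LinearMap.congr_fun ha p
  simp [h3, h4, h5]

theorem ExtVanish.homVanish [IsArtinian S X] {f : P1 →ₗ[S] P0} {g : P0 →ₗ[S] U}
    [Module.Projective S P0] (hg : Function.Surjective g)
    (hfg : LinearMap.range f = LinearMap.ker g)
    (hs : SuperfluousSubmodule (LinearMap.ker f)) (hE : ExtVanish S U X) : HomVanish f X := by
  have key : ∀ h : P1 →ₗ[S] X, ∃ u : P0 →ₗ[S] X,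
      LinearMap.range (h - u ∘ₗ f) ≤ (LinearMap.ker f).map h := by
    intro h
    let D : Submodule S (P0 × X) := LinearMap.range (f.prod (-h))
    let φ : X →ₗ[S] (P0 × X) ⧸ D := D.mkQ ∘ₗ LinearMap.inr S P0 X
    have hD : D ≤ LinearMap.ker (g ∘ₗ LinearMap.fst S P0 X) := by
      rintro _ ⟨p, rfl⟩
      have : f p ∈ LinearMap.ker g := hfg ▸ ⟨p, rfl⟩
      simpa using this
    let π : ((P0 × X) ⧸ D) →ₗ[S] U := D.liftQ _ hD
    have hπ : Function.Surjective π := by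
      intro x
      obtain ⟨p, rfl⟩ := hg x
      exact ⟨D.mkQ (p, 0), rfl⟩
    have hφ : LinearMap.ker π = LinearMap.range φ := by
      apply le_antisymm
      · intro e he
        obtain ⟨⟨p, x⟩, rfl⟩ := D.mkQ_surjective e
        have hp : g p = 0 := he
        have : p ∈ LinearMap.range f := hfg ▸ hp
        obtain ⟨q, rfl⟩ := this
        refine ⟨x + h q, ?_⟩
        rw [LinearMap.comp_apply, ← sub_eq_zero, ← map_sub, Submodule.mkQ_apply,
          Submodule.Quotient.mk_eq_zero]
        refine ⟨-q, ?_⟩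
        simp
      · rintro _ ⟨x, rfl⟩
        exact map_zero g
    obtain ⟨σ, hσ⟩ := hE _ φ π hπ hφ
    let ρ : ((P0 × X) ⧸ D) →ₗ[S] LinearMap.range φ :=
      (LinearMap.id - σ ∘ₗ π).codRestrict _ (by
        intro e
        rw [← hφ, LinearMap.mem_ker]
        have := LinearMap.congr_fun hσ (π e)
        simp only [LinearMap.comp_apply, LinearMap.id_apply] at this
        simp [this])
    obtain ⟨u, hu⟩ := Module.projective_lifting_property φ.rangeRestrict
      (ρ ∘ₗ D.mkQ ∘ₗ LinearMap.inl S P0 X) φ.surjective_rangeRestrict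
    refine ⟨u, ?_⟩
    rintro _ ⟨p, rfl⟩
    have h1 : φ (u (f p)) = (ρ (D.mkQ (f p, 0)) : (P0 × X) ⧸ D) :=
      congrArg Subtype.val (LinearMap.congr_fun hu (f p))
    have h2 : D.mkQ (f p, 0) = φ (h p) := by
      rw [LinearMap.comp_apply, ← sub_eq_zero, ← map_sub, Submodule.mkQ_apply,
          Submodule.Quotient.mk_eq_zero]
      exact ⟨p, by simp⟩
    have h3 : (ρ (φ (h p)) : (P0 × X) ⧸ D) = φ (h p) := by
      have : φ (h p) ∈ LinearMap.ker π := hφ ▸ ⟨h p, rfl⟩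
      have : π (φ (h p)) = 0 := this
      simp [ρ, this]
    have h4 : φ (h p - u (f p)) = 0 := by
      rw [map_sub, h1, h2, h3, sub_self]
    have h5 : ((0 : P0), h p - u (f p)) ∈ D := by
      rwa [LinearMap.comp_apply, Submodule.mkQ_apply, Submodule.Quotient.mk_eq_zero] at h4
    obtain ⟨q, hq⟩ := h5
    refine ⟨-q, by simpa using congrArg Prod.fst hq, ?_⟩
    simpa using congrArg Prod.snd hq
  intro h
  obtain ⟨u, hu, hmin⟩ := WellFounded.has_min
    (r := fun a b : P0 →ₗ[S] X => LinearMap.range (h - a ∘ₗ f) < LinearMap.range (h - b ∘ₗ f))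
    (InvImage.wf _ wellFounded_lt) Set.univ ⟨0, trivial⟩
  obtain ⟨v, hv⟩ := key (h - u ∘ₗ f)
  have h1 : (h - u ∘ₗ f) - v ∘ₗ f = h - (u + v) ∘ₗ f := by
    ext; simp [sub_sub]
  rw [h1] at hv
  have h2 : (LinearMap.ker f).map (h - u ∘ₗ f) = LinearMap.range (h - u ∘ₗ f) := by
    apply le_antisymm (LinearMap.map_le_range)
    by_contra hne
    exact hmin (u + v) trivial (lt_of_le_not_ge
      (hv.trans LinearMap.map_le_range) (fun hle => hne (hle.trans hv)))
  have h3 : LinearMap.ker (h - u ∘ₗ f) = ⊤ := by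
    apply hs
    rw [eq_top_iff]
    intro p _
    have : (h - u ∘ₗ f) p ∈ (LinearMap.ker f).map (h - u ∘ₗ f) := h2 ▸ ⟨p, rfl⟩
    obtain ⟨q, hq, hqp⟩ := this
    refine Submodule.mem_sup.2 ⟨q, hq, p - q, ?_, by abel⟩
    rw [LinearMap.mem_ker, map_sub, hqp, sub_self]
  refine ⟨u, ?_⟩
  rw [LinearMap.ker_eq_top, sub_eq_zero] at h3
  exact h3.symm

end Vanishing

section Duality

variable {B : Type} [Ring B]

/-- A finite dual basis of a finitely generated projective right module. -/
theorem exists_dual_basis (P : Type) [AddCommGroup P] [Module Bᵐᵒᵖ P]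
    [Module.Projective Bᵐᵒᵖ P] [Module.Finite Bᵐᵒᵖ P] :
    ∃ (n : ℕ) (y : Fin n → P) (η : Fin n → (P →ₗ[Bᵐᵒᵖ] B)),
      ∀ p, ∑ l, op (η l p) • y l = p := by
  obtain ⟨n, g, hg⟩ := Module.Finite.exists_fin' Bᵐᵒᵖ P
  obtain ⟨s, hs⟩ := LinearMap.exists_rightInverse_of_surjective g (LinearMap.range_eq_top.2 hg)
  let un : Bᵐᵒᵖ →ₗ[Bᵐᵒᵖ] B :=
    { toFun := unop
      map_add' := fun _ _ => rfl
      map_smul' := fun r x => by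
        rw [MulOpposite.smul_eq_mul_unop]
        rfl }
  refine ⟨n, fun l => g (Pi.single l 1), fun l => un ∘ₗ LinearMap.proj l ∘ₗ s, fun p => ?_⟩
  have h1 : ∀ l, op ((un ∘ₗ LinearMap.proj l ∘ₗ s) p) = s p l := fun l => rfl
  simp only [h1, ← map_smul, ← map_sum]
  conv_rhs => rw [← LinearMap.id_apply (R := Bᵐᵒᵖ) p, ← hs, LinearMap.comp_apply]
  congr 1
  ext i
  simp [Finset.sum_apply, Pi.single_apply]

/-- For `m ∈ M` and `h : P → B`, the homomorphism `p ↦ m · h(p)`. -/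
def rankOneHom {P M : Type} [AddCommGroup P] [Module Bᵐᵒᵖ P] [AddCommGroup M] [Module Bᵐᵒᵖ M]
    (m : M) (h : P →ₗ[Bᵐᵒᵖ] B) : P →ₗ[Bᵐᵒᵖ] M where
  toFun p := op (h p) • m
  map_add' x y := by simp [add_smul]
  map_smul' r x := by
    rw [map_smul, MulOpposite.smul_eq_mul_unop, op_mul, op_unop, mul_smul, RingHom.id_apply]

variable (k : Type) [Field k] [Algebra k B]

theorem eq_zero_of_homVanish {M P0 P1 : Type} [AddCommGroup M] [Module Bᵐᵒᵖ M]
    [AddCommGroup P0] [Module Bᵐᵒᵖ P0] [AddCommGroup P1] [Module Bᵐᵒᵖ P1]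
    [Module.Projective Bᵐᵒᵖ P1] [Module.Finite Bᵐᵒᵖ P1] [Module.Projective Bᵐᵒᵖ P0]
    [Module.Finite Bᵐᵒᵖ P0] (f : P1 →ₗ[Bᵐᵒᵖ] P0) (hf : HomVanish f M)
    (β : M →+ ((P1 →ₗ[Bᵐᵒᵖ] B) →ₗ[k] k))
    (h1 : ∀ (m : M) (b : B) (h : P1 →ₗ[Bᵐᵒᵖ] B), β (op b • m) h = β m (leftMulHom B b h))
    (h2 : ∀ (m : M) (g0 : P0 →ₗ[Bᵐᵒᵖ] B), β m (g0.comp f) = 0) : β = 0 := by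
  obtain ⟨n1, y, η, hy⟩ := exists_dual_basis (B := B) P1
  obtain ⟨n0, z, ζ, hz⟩ := exists_dual_basis (B := B) P0
  have expand : ∀ h : P1 →ₗ[Bᵐᵒᵖ] B, ∑ l, leftMulHom B (h (y l)) (η l) = h := by
    intro h
    ext p
    conv_rhs => rw [← hy p, map_sum]
    rw [LinearMap.sum_apply]
    refine Finset.sum_congr rfl fun l _ => ?_
    rw [map_smul, MulOpposite.smul_eq_mul_unop]
    rfl
  ext m h
  obtain ⟨u, hu⟩ := hf (rankOneHom m h)
  have hu' : ∀ p, op (h p) • m = u (f p) := fun p => (LinearMap.congr_fun hu p).symm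
  rw [← expand h, map_sum]
  simp only [← h1, hu']
  have h3 : ∀ q, u q = ∑ j, op (ζ j q) • u (z j) := by
    intro q
    conv_lhs => rw [← hz q, map_sum]
    simp only [map_smul]
  have h4 : ∀ l, β (u (f (y l))) (η l)
      = ∑ j, β (u (z j)) (leftMulHom B ((ζ j).comp f (y l)) (η l)) := by
    intro l
    rw [h3 (f (y l)), map_sum, LinearMap.sum_apply]
    simp only [h1]
    rfl
  simp only [h4]
  rw [Finset.sum_comm]
  simp only [← map_sum, expand, h2]
  simp

variable [Module.Finite k B]

theorem isTauRigid_of_extVanish (M : ModuleCat.{0} Bᵐᵒᵖ) [Module.Finite Bᵐᵒᵖ M]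
    (h : ExtVanish Bᵐᵒᵖ M M) : IsTauRigid k B M := by
  intro P1 P0 f g ⟨hP1, hP0, hg, hfg, hsg, hsf⟩ β h1 h2
  have : IsArtinianRing Bᵐᵒᵖ := IsArtinianRing.of_finite k _
  have : IsNoetherianRing Bᵐᵒᵖ := IsNoetherianRing.of_finite k _
  have hf0 := finite_of_superfluous_ker g hg hsg
  have hf1 : Module.Finite Bᵐᵒᵖ P1 := by
    refine finite_of_superfluous_ker f.rangeRestrict f.surjective_rangeRestrict ?_
    rwa [LinearMap.ker_rangeRestrict]
  exact eq_zero_of_homVanish k f (h.homVanish hg hfg hsf) β h1 h2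

theorem IsTauRigid.homVanish {M : ModuleCat.{0} Bᵐᵒᵖ} [Module.Finite Bᵐᵒᵖ M]
    (h : IsTauRigid k B M) (P1 P0 : ModuleCat.{0} Bᵐᵒᵖ) (f : P1 →ₗ[Bᵐᵒᵖ] P0)
    (g : P0 →ₗ[Bᵐᵒᵖ] M) (hfg : IsMinimalProjPresentation B M P1 P0 f g) : HomVanish f M := by
  have : IsNoetherianRing Bᵐᵒᵖ := IsNoetherianRing.of_finite k _
  have ⟨hP1, hP0, hg, hfg', hsg, hsf⟩ := hfg
  have hf0 := finite_of_superfluous_ker g hg hsg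
  have hf1 : Module.Finite Bᵐᵒᵖ P1 := by
    refine finite_of_superfluous_ker f.rangeRestrict f.surjective_rangeRestrict ?_
    rwa [LinearMap.ker_rangeRestrict]
  obtain ⟨n1, y, η, hy⟩ := exists_dual_basis (B := B) P1
  let i1 : Module k M := Module.compHom M (algebraMap k Bᵐᵒᵖ)
  have i2 : IsScalarTower k Bᵐᵒᵖ M := ⟨fun c s m => by
    rw [Algebra.smul_def, mul_smul]; rfl⟩
  have i3 : SMulCommClass Bᵐᵒᵖ k M := IsScalarTower.to_smulCommClass'
  by_contra hne
  unfold HomVanish at hne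
  push Not at hne
  obtain ⟨h0, hh0⟩ := hne
  let D : Submodule k (P1 →ₗ[Bᵐᵒᵖ] M) :=
    { carrier := {h | ∃ u : P0 →ₗ[Bᵐᵒᵖ] M, u ∘ₗ f = h}
      add_mem' := by
        rintro _ _ ⟨u, rfl⟩ ⟨v, rfl⟩
        exact ⟨u + v, LinearMap.add_comp _ _ _⟩
      zero_mem' := ⟨0, LinearMap.zero_comp _⟩
      smul_mem' := by
        rintro c _ ⟨u, rfl⟩
        exact ⟨c • u, LinearMap.smul_comp _ _ _⟩ }
  have hD : h0 ∉ D := fun ⟨u, hu⟩ => hh0 u hu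
  obtain ⟨ℓ, hℓ, hDℓ⟩ := Submodule.exists_le_ker_of_notMem hD
  let β : M →+ ((P1 →ₗ[Bᵐᵒᵖ] B) →ₗ[k] k) :=
    { toFun := fun m =>
        { toFun := fun h => ℓ (rankOneHom m h)
          map_add' := fun a b => by
            rw [← map_add]; congr 1; ext p; simp [rankOneHom, add_smul]
          map_smul' := fun c a => by
            rw [RingHom.id_apply, ← map_smul]; congr 1; ext p; simp [rankOneHom] }
      map_zero' := by
        ext h
        have : rankOneHom (0 : M) h = 0 := by ext p; simp [rankOneHom]
        simp [this]
      map_add' := fun a b => by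
        ext h
        have : rankOneHom (a + b) h = rankOneHom a h + rankOneHom b h := by
          ext p; simp [rankOneHom]
        simp [this] }
  have hβ : β = 0 := by
    refine h P1 P0 f g hfg β ?_ ?_
    · intro m b h'
      change ℓ _ = ℓ _
      congr 1
      ext p
      change op (h' p) • op b • m = op (b * h' p) • m
      rw [op_mul, mul_smul]
    · intro m g0
      exact hDℓ ⟨rankOneHom m g0, rfl⟩
  apply hℓ
  have h5 : h0 = ∑ l, rankOneHom (h0 (y l)) (η l) := by
    ext p
    rw [LinearMap.sum_apply]
    conv_lhs => rw [← hy p, map_sum]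
    simp only [map_smul]
    rfl
  rw [h5, map_sum]
  exact Finset.sum_eq_zero fun l _ => LinearMap.congr_fun (DFunLike.congr_fun hβ (h0 (y l))) (η l)

theorem IsTauRigid.extVanish {M : ModuleCat.{0} Bᵐᵒᵖ} [Module.Finite Bᵐᵒᵖ M]
    (h : IsTauRigid k B M) : ExtVanish Bᵐᵒᵖ M M := by
  have : IsArtinianRing Bᵐᵒᵖ := IsArtinianRing.of_finite k _
  have : IsNoetherianRing Bᵐᵒᵖ := IsNoetherianRing.of_finite k _
  obtain ⟨n, m, P1, P0, f, g, hfg⟩ := exists_min_pres (S := Bᵐᵒᵖ) (M := M)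
  have h1 := h.homVanish k (ModuleCat.of _ P1) (ModuleCat.of _ P0) f g hfg
  have := hfg.1
  have := hfg.2.1
  exact HomVanish.extVanish hfg.2.2.1 hfg.2.2.2.1 h1

end Duality

section Retracts

variable {S : Type} [Ring S] {U V X Y M L : Type} [AddCommGroup U] [Module S U]
  [AddCommGroup V] [Module S V] [AddCommGroup X] [Module S X] [AddCommGroup Y] [Module S Y]
  [AddCommGroup M] [Module S M] [AddCommGroup L] [Module S L]

variable (S) in
/-- `L` is a direct summand of `M`. -/
def IsRetract (L M : Type) [AddCommGroup L] [Module S L] [AddCommGroup M] [Module S M] : Prop :=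
  ∃ (i : L →ₗ[S] M) (p : M →ₗ[S] L), p ∘ₗ i = LinearMap.id

/-- The complement of a split submodule. -/
def splitEquiv (i : L →ₗ[S] M) (p : M →ₗ[S] L) (h : p ∘ₗ i = LinearMap.id) :
    M ≃ₗ[S] L × LinearMap.ker p :=
  have h' : ∀ l, p (i l) = l := fun l => LinearMap.congr_fun h l
  LinearEquiv.ofLinearMap
    (p.prod ((LinearMap.id - i ∘ₗ p).codRestrict (LinearMap.ker p) fun m => by simp [h']))
    (i.coprod (LinearMap.ker p).subtype)
    (by ext x <;> simp [h'])
    (by ext x; simp)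

theorem IsRetract.refl : IsRetract S M M := ⟨LinearMap.id, LinearMap.id, rfl⟩

theorem IsRetract.trans (h : IsRetract S U X) (h' : IsRetract S X Y) : IsRetract S U Y := by
  obtain ⟨i, p, h⟩ := h
  obtain ⟨j, q, h'⟩ := h'
  refine ⟨j ∘ₗ i, p ∘ₗ q, ?_⟩
  ext x
  have h1 := LinearMap.congr_fun h' (i x)
  have h2 := LinearMap.congr_fun h x
  simp only [LinearMap.comp_apply, LinearMap.id_apply] at *
  rw [h1, h2]

theorem LinearEquiv.isRetract (e : L ≃ₗ[S] M) : IsRetract S L M :=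
  ⟨e.toLinearMap, e.symm.toLinearMap, by ext; simp⟩

theorem isRetract_prod_left : IsRetract S L (L × X) :=
  ⟨LinearMap.inl S L X, LinearMap.fst S L X, by ext; simp⟩

theorem isRetract_prod_right : IsRetract S L (X × L) :=
  ⟨LinearMap.inr S X L, LinearMap.snd S X L, by ext; simp⟩

theorem isRetract_pi {ι : Type} (N : ι → Type) [∀ i, AddCommGroup (N i)]
    [∀ i, Module S (N i)] (i : ι) : IsRetract S (N i) (∀ i, N i) := by
  classical
  exact ⟨LinearMap.single S N i, LinearMap.proj i, by ext; simp⟩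

theorem IsRetract.pi {ι : Type} {N N' : ι → Type} [∀ i, AddCommGroup (N i)]
    [∀ i, Module S (N i)] [∀ i, AddCommGroup (N' i)] [∀ i, Module S (N' i)]
    (h : ∀ i, IsRetract S (N i) (N' i)) : IsRetract S (∀ i, N i) (∀ i, N' i) := by
  choose i p h using h
  refine ⟨LinearMap.pi fun j => i j ∘ₗ LinearMap.proj j,
    LinearMap.pi fun j => p j ∘ₗ LinearMap.proj j, ?_⟩
  ext x j
  exact LinearMap.congr_fun (h j) (x j)

theorem IsRetract.surjective {i : L →ₗ[S] M} {p : M →ₗ[S] L} (h : p ∘ₗ i = LinearMap.id) :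
    Function.Surjective p := fun x => ⟨i x, LinearMap.congr_fun h x⟩

theorem ExtVanish.retract_left (hE : ExtVanish S U X) (h : IsRetract S V U) :
    ExtVanish S V X := by
  obtain ⟨i, p, h⟩ := h
  intro E _ _ φ π hπ hφ
  let E' : Submodule S (E × U) :=
    LinearMap.ker (π ∘ₗ LinearMap.fst S E U - p ∘ₗ LinearMap.snd S E U)
  have hE' : ∀ x : E × U, x ∈ E' ↔ π x.1 = p x.2 := fun x => by
    simp [E', sub_eq_zero]
  have hφ0 : ∀ x, π (φ x) = 0 := fun x => by
    have : φ x ∈ LinearMap.ker π := hφ ▸ ⟨x, rfl⟩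
    exact this
  let φ' : X →ₗ[S] E' := (LinearMap.inl S E U ∘ₗ φ).codRestrict E' fun x => by
    rw [hE']; simp [hφ0]
  obtain ⟨σ, hσ⟩ := hE E' φ' (LinearMap.snd S E U ∘ₗ E'.subtype)
    (by
      intro u
      obtain ⟨e, he⟩ := hπ (p u)
      exact ⟨⟨(e, u), (hE' _).2 he⟩, rfl⟩)
    (by
      apply le_antisymm
      · rintro ⟨⟨e, u⟩, hx⟩ h0
        have hu : u = 0 := h0
        subst hu
        rw [hE'] at hx
        have : e ∈ LinearMap.ker π := by simpa using hx
        rw [hφ] at this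
        obtain ⟨x, rfl⟩ := this
        exact ⟨x, Subtype.ext rfl⟩
      · rintro _ ⟨x, rfl⟩
        rfl)
  refine ⟨LinearMap.fst S E U ∘ₗ E'.subtype ∘ₗ σ ∘ₗ i, ?_⟩
  ext v
  have h1 := (hE' _).1 (σ (i v)).2
  have h2 : (σ (i v) : E × U).2 = i v := LinearMap.congr_fun hσ (i v)
  rw [h2] at h1
  exact h1.trans (LinearMap.congr_fun h v)

theorem ExtVanish.quotient_right (hE : ExtVanish S U X) (q : X →ₗ[S] Y)
    (hq : Function.Surjective q) : ExtVanish S U Y := by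
  intro E _ _ φ π hπ hφ
  refine hE E (φ ∘ₗ q) π hπ ?_
  rw [hφ, LinearMap.range_comp, LinearMap.range_eq_top.2 hq, Submodule.map_top]

theorem ExtVanish.retract (hE : ExtVanish S U U) (h : IsRetract S V U) : ExtVanish S V V := by
  have h1 := hE.retract_left h
  obtain ⟨i, p, h⟩ := h
  exact h1.quotient_right p (IsRetract.surjective h)

end Retracts

section KrullSchmidt

variable {S : Type} [Ring S]

variable (S) in
/-- A nonzero module without nontrivial idempotent endomorphisms. -/
def IsIndec (M : Type) [AddCommGroup M] [Module S M] : Prop :=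
  Nontrivial M ∧ ∀ e : M →ₗ[S] M, e ∘ₗ e = e → e = 0 ∨ e = LinearMap.id

theorem indecomposableMod_iff {B : Type} [Ring B] (M : ModuleCat.{0} Bᵐᵒᵖ) :
    IndecomposableMod B M ↔ IsIndec Bᵐᵒᵖ M := by
  constructor
  · rintro ⟨h1, h2⟩
    refine ⟨h1, fun e he => ?_⟩
    have he' : ∀ x, e (e x) = e x := fun x => LinearMap.congr_fun he x
    have h3 : e.rangeRestrict ∘ₗ (LinearMap.range e).subtype = LinearMap.id := by
      ext ⟨_, x, rfl⟩
      simp [he']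
    have φ := splitEquiv _ _ h3
    rcases h2 (ModuleCat.of _ (LinearMap.range e)) (ModuleCat.of _ (LinearMap.ker e.rangeRestrict))
      ⟨φ⟩ with h | h
    · left
      ext x
      exact congrArg Subtype.val (@Subsingleton.elim _ h ⟨e x, x, rfl⟩ 0)
    · right
      ext x
      have hx : x - e x ∈ LinearMap.ker e.rangeRestrict := by
        rw [LinearMap.ker_rangeRestrict, LinearMap.mem_ker, map_sub, he', sub_self]
      have := congrArg Subtype.val (@Subsingleton.elim _ h ⟨x - e x, hx⟩ 0)
      exact (sub_eq_zero.1 this).symm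
  · rintro ⟨h1, h2⟩
    refine ⟨h1, fun L L' ⟨φ⟩ => ?_⟩
    rcases h2 (φ.symm.toLinearMap ∘ₗ LinearMap.inl _ _ _ ∘ₗ LinearMap.fst _ _ _ ∘ₗ φ.toLinearMap)
      (by ext; simp) with h | h
    · left
      refine subsingleton_of_forall_eq 0 fun l => ?_
      have := LinearMap.congr_fun h (φ.symm (l, 0))
      simpa using this
    · right
      refine subsingleton_of_forall_eq 0 fun l => ?_
      have := LinearMap.congr_fun h (φ.symm (0, l))
      have := congrArg φ this
      simp at this
      exact this.symm

variable {M L N : Type} [AddCommGroup M] [Module S M] [AddCommGroup L] [Module S L]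
  [AddCommGroup N] [Module S N]

theorem IsIndec.of_equiv (h : IsIndec S M) (e : M ≃ₗ[S] N) : IsIndec S N := by
  have := h.1
  refine ⟨e.symm.toEquiv.nontrivial, fun u hu => ?_⟩
  have hu' : ∀ x, u (u x) = u x := fun x => LinearMap.congr_fun hu x
  rcases h.2 (e.symm.toLinearMap ∘ₗ u ∘ₗ e.toLinearMap) (by ext; simp [hu']) with h | h
  · left
    ext x
    have := LinearMap.congr_fun h (e.symm x)
    simpa using this
  · right
    ext x
    have := LinearMap.congr_fun h (e.symm x)
    simpa using this

theorem IsIndec.nilpotent_or_isUnit [IsArtinian S M] [IsNoetherian S M] (h : IsIndec S M)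
    (f : Module.End S M) : IsNilpotent f ∨ IsUnit f := by
  obtain ⟨n, hn⟩ := (f.eventually_isCompl_ker_pow_range_pow.and
    (Filter.eventually_ge_atTop 1)).exists
  obtain ⟨hc, hn1⟩ := hn
  rcases h.2 (Submodule.projection _ _ hc) (by
    ext x
    rw [LinearMap.comp_apply, Submodule.projection_apply _ x, Submodule.projection_apply,
      Submodule.projectionOnto_apply_left]) with h0 | h0
  · right
    have hk : LinearMap.ker (f ^ n) = ⊥ := by
      rw [eq_bot_iff]
      intro x hx
      have := LinearMap.congr_fun h0 x
      rw [Submodule.projection_apply, Submodule.projectionOnto_apply_of_mem_left hc hx] at this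
      exact this
    have hi : Function.Injective f := by
      rw [← LinearMap.ker_eq_bot, eq_bot_iff, ← hk]
      intro x hx
      have hx' : f x = 0 := hx
      obtain ⟨m, rfl⟩ := Nat.exists_eq_add_of_le' hn1
      rw [LinearMap.mem_ker, pow_succ, Module.End.mul_apply, hx', map_zero]
    rw [Module.End.isUnit_iff]
    exact IsArtinian.bijective_of_injective_endomorphism f hi
  · left
    refine ⟨n, ?_⟩
    ext x
    have := LinearMap.congr_fun h0 x
    rw [LinearMap.id_apply, Submodule.projection_apply] at this
    have h1 : x ∈ LinearMap.ker (f ^ n) := by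
      rw [← this]
      exact Subtype.mem _
    exact h1

theorem IsIndec.isLocalRing [IsArtinian S M] [IsNoetherian S M] (h : IsIndec S M) :
    IsLocalRing (Module.End S M) := by
  have := h.1
  refine IsLocalRing.of_isUnit_or_isUnit_one_sub_self fun a => ?_
  rcases h.nilpotent_or_isUnit a with h | h
  · exact Or.inr h.isUnit_one_sub
  · exact Or.inl h

theorem IsIndec.bijective_of_isUnit (hN : IsIndec S N) (hL : Nontrivial L) (a : L →ₗ[S] N)
    (b : N →ₗ[S] L) (h : IsUnit (b ∘ₗ a : Module.End S L)) :
    Function.Bijective a ∧ Function.Bijective b := by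
  obtain ⟨u, hu⟩ := h
  have h1 : ∀ x, (↑u⁻¹ : Module.End S L) (b (a x)) = x := fun x => by
    have : (↑u⁻¹ : Module.End S L) * ↑u = 1 := u.inv_mul
    rw [hu] at this
    exact LinearMap.congr_fun this x
  have h1' : ∀ x, b (a ((↑u⁻¹ : Module.End S L) x)) = x := fun x => by
    have : ↑u * (↑u⁻¹ : Module.End S L) = 1 := u.mul_inv
    rw [hu] at this
    exact LinearMap.congr_fun this x
  have h2 : a ∘ₗ (↑u⁻¹ : Module.End S L) ∘ₗ b = LinearMap.id := by
    rcases hN.2 (a ∘ₗ (↑u⁻¹ : Module.End S L) ∘ₗ b) (by ext; simp [h1]) with h | h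
    · exfalso
      obtain ⟨x, hx⟩ := exists_ne (0 : L)
      apply hx
      have := LinearMap.congr_fun h (a x)
      simp only [LinearMap.comp_apply, h1, LinearMap.zero_apply] at this
      rw [← h1 x, this]
      simp
    · exact h
  have h3 : ∀ y, a ((↑u⁻¹ : Module.End S L) (b y)) = y := fun y => LinearMap.congr_fun h2 y
  refine ⟨⟨Function.LeftInverse.injective (g := fun y => (↑u⁻¹ : Module.End S L) (b y)) h1,
    fun y => ⟨_, h3 y⟩⟩, ⟨?_, fun x => ⟨_, h1' x⟩⟩⟩
  intro y y' hy
  rw [← h3 y, ← h3 y', hy]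

theorem sum_through_pi {ι : Type} [Fintype ι] [DecidableEq ι] {F : ι → Type}
    [∀ i, AddCommGroup (F i)] [∀ i, Module S (F i)] (j : L →ₗ[S] ∀ i, F i)
    (p : (∀ i, F i) →ₗ[S] N) :
    p ∘ₗ j = ∑ i, (p ∘ₗ LinearMap.single S F i) ∘ₗ (LinearMap.proj i ∘ₗ j) := by
  ext x
  rw [LinearMap.sum_apply]
  simp only [LinearMap.comp_apply, LinearMap.proj_apply, ← map_sum]
  congr 1
  ext i
  simp [Finset.sum_apply]

theorem IsIndec.equiv_of_isRetract_pi [IsArtinian S L] [IsNoetherian S L] (hL : IsIndec S L)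
    {ι : Type} [Finite ι] {F : ι → Type} [∀ i, AddCommGroup (F i)] [∀ i, Module S (F i)]
    (hF : ∀ i, IsIndec S (F i)) (h : IsRetract S L (∀ i, F i)) :
    ∃ i, Nonempty (L ≃ₗ[S] F i) := by
  classical
  have := Fintype.ofFinite ι
  have := hL.isLocalRing
  obtain ⟨j, p, h⟩ := h
  rw [sum_through_pi] at h
  have h1 : IsUnit (∑ i, (((p ∘ₗ LinearMap.single S F i) ∘ₗ (LinearMap.proj i ∘ₗ j)) :
      Module.End S L)) := by
    rw [h]; exact isUnit_one
  obtain ⟨i, _, hi⟩ := IsLocalRing.exists_of_isUnit_sum h1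
  exact ⟨i, ⟨LinearEquiv.ofBijective _ ((hF i).bijective_of_isUnit hL.1 _ _ hi).1⟩⟩

theorem IsIndec.not_isRetract_prod_self [IsArtinian S L] [IsNoetherian S L] (hL : IsIndec S L)
    {ι : Type} [Finite ι] {F : ι → Type} [∀ i, AddCommGroup (F i)] [∀ i, Module S (F i)]
    (hF : ∀ i, IsIndec S (F i)) (hne : ∀ i j, i ≠ j → IsEmpty (F i ≃ₗ[S] F j)) :
    ¬ IsRetract S (L × L) (∀ i, F i) := by
  classical
  have := Fintype.ofFinite ι
  have := hL.isLocalRing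
  rintro ⟨j, p, h⟩
  let c (a : L →ₗ[S] L × L) (b : L × L →ₗ[S] L) (i : ι) : Module.End S L :=
    ((b ∘ₗ p) ∘ₗ LinearMap.single S F i) ∘ₗ (LinearMap.proj i ∘ₗ (j ∘ₗ a))
  have hc : ∀ a b, (b ∘ₗ a : Module.End S L) = ∑ i, c a b i := by
    intro a b
    have h1 : b ∘ₗ a = (b ∘ₗ p) ∘ₗ (j ∘ₗ a) := by
      ext x
      have := LinearMap.congr_fun h (a x)
      simp only [LinearMap.comp_apply, LinearMap.id_apply] at this
      simp [this]
    rw [h1, sum_through_pi]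
  have h1 : IsUnit (∑ i, c (LinearMap.inl S L L) (LinearMap.fst S L L) i) := by
    rw [← hc]
    have : LinearMap.fst S L L ∘ₗ LinearMap.inl S L L = LinearMap.id := by ext; simp
    rw [this]
    exact isUnit_one
  have h2 : IsUnit (∑ i, c (LinearMap.inr S L L) (LinearMap.snd S L L) i) := by
    rw [← hc]
    have : LinearMap.snd S L L ∘ₗ LinearMap.inr S L L = LinearMap.id := by ext; simp
    rw [this]
    exact isUnit_one
  obtain ⟨i, _, hi⟩ := IsLocalRing.exists_of_isUnit_sum h1
  obtain ⟨i', _, hi'⟩ := IsLocalRing.exists_of_isUnit_sum h2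
  have b1 := (hF i).bijective_of_isUnit hL.1 _ _ hi
  have b2 := (hF i').bijective_of_isUnit hL.1 _ _ hi'
  have e1 := LinearEquiv.ofBijective _ b1.1
  have hii : i = i' := by
    by_contra hii
    exact (hne i i' hii).false (e1.symm.trans (LinearEquiv.ofBijective _ b2.1))
  subst hii
  have h3 : ¬ IsUnit (∑ i, c (LinearMap.inr S L L) (LinearMap.fst S L L) i) := by
    rw [← hc]
    have : LinearMap.fst S L L ∘ₗ LinearMap.inr S L L = 0 := by ext; simp
    rw [this]
    have := hL.1
    exact not_isUnit_zero
  have h4 : IsUnit (c (LinearMap.inr S L L) (LinearMap.fst S L L) i) := by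
    rw [Module.End.isUnit_iff]
    exact b1.2.comp b2.1
  rw [← Finset.add_sum_erase _ _ (Finset.mem_univ i)] at h3
  have h5 : IsUnit (-∑ x ∈ Finset.univ.erase i,
      c (LinearMap.inr S L L) (LinearMap.fst S L L) x) := by
    have := IsLocalRing.isUnit_or_isUnit_of_isUnit_add
      (a := ∑ i, c (LinearMap.inr S L L) (LinearMap.fst S L L) i)
      (b := -∑ x ∈ Finset.univ.erase i, c (LinearMap.inr S L L) (LinearMap.fst S L L) x) (by
        rw [← Finset.add_sum_erase _ _ (Finset.mem_univ i), add_neg_cancel_right]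
        exact h4)
    rw [← Finset.add_sum_erase _ _ (Finset.mem_univ i)] at this
    exact this.resolve_left h3
  rw [IsUnit.neg_iff] at h5
  obtain ⟨l, hl, hl'⟩ := IsLocalRing.exists_of_isUnit_sum h5
  have b3 := (hF l).bijective_of_isUnit hL.1 _ _ hl'
  exact (hne l i (Finset.ne_of_mem_erase hl)).false
    ((LinearEquiv.ofBijective _ b3.1).symm.trans e1)

theorem exists_indec_decomposition_aux [IsArtinian S M] (K : Submodule S M) :
    ∃ (ι : Type) (_ : Fintype ι) (F : ι → Submodule S M), (∀ i, IsIndec S (F i)) ∧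
      Nonempty (K ≃ₗ[S] ∀ i, F i) := by
  induction K using WellFoundedLT.induction with
  | ind K ih =>
  by_cases h0 : Subsingleton K
  · exact ⟨Empty, inferInstance, fun i => i.elim, fun i => i.elim,
      ⟨(0 : K ≃ₗ[S] ∀ i : Empty, (i.elim : Submodule S M))⟩⟩
  rw [not_subsingleton_iff_nontrivial] at h0
  by_cases h1 : IsIndec S K
  · exact ⟨Unit, inferInstance, fun _ => K, fun _ => h1,
      ⟨(LinearEquiv.funUnique Unit S K).symm⟩⟩
  · unfold IsIndec at h1
    push Not at h1
    obtain ⟨e, he, he0, he1⟩ := h1 h0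
    have he' : ∀ x, e (e x) = e x := fun x => LinearMap.congr_fun he x
    have h3 : e.rangeRestrict ∘ₗ (LinearMap.range e).subtype = LinearMap.id := by
      ext ⟨_, x, rfl⟩
      simp [he']
    have φ := splitEquiv _ _ h3
    have sub : ∀ Q : Submodule S K, Q ≠ ⊤ → Q.map K.subtype < K := by
      intro Q hQ
      refine lt_of_le_of_ne (Submodule.map_subtype_le K Q) fun h => hQ ?_
      rw [eq_top_iff]
      intro x _
      have : (x : M) ∈ Q.map K.subtype := by rw [h]; exact x.2
      obtain ⟨y, hy, hxy⟩ := this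
      rwa [← (Subtype.ext hxy : y = x)]
    have hr : LinearMap.range e ≠ ⊤ := by
      intro h
      apply he1
      ext x
      obtain ⟨y, rfl⟩ := LinearMap.range_eq_top.1 h x
      simp [he']
    have hk : LinearMap.ker e.rangeRestrict ≠ ⊤ := by
      rw [LinearMap.ker_rangeRestrict]
      exact fun h => he0 (LinearMap.ker_eq_top.1 h)
    obtain ⟨ι1, f1, F1, hF1, ⟨e1⟩⟩ := ih _ (sub _ hr)
    obtain ⟨ι2, f2, F2, hF2, ⟨e2⟩⟩ := ih _ (sub _ hk)
    refine ⟨ι1 ⊕ ι2, inferInstance, Sum.elim F1 F2, ?_, ⟨?_⟩⟩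
    · rintro (i | i)
      · exact hF1 i
      · exact hF2 i
    · refine (φ.trans (LinearEquiv.prodCongr
        ((Submodule.equivMapOfInjective K.subtype K.subtype_injective _).trans e1)
        ((Submodule.equivMapOfInjective K.subtype K.subtype_injective _).trans e2))).trans
        (LinearEquiv.sumPiEquivProdPi S ι1 ι2 (fun i => (Sum.elim F1 F2 i : Submodule S M))).symm

variable (M) in
theorem exists_indec_decomposition [IsArtinian S M] :
    ∃ (ι : Type) (_ : Fintype ι) (F : ι → Submodule S M), (∀ i, IsIndec S (F i)) ∧
      Nonempty (M ≃ₗ[S] ∀ i, F i) := by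
  obtain ⟨ι, h, F, hF, ⟨e⟩⟩ := exists_indec_decomposition_aux (⊤ : Submodule S M)
  exact ⟨ι, h, F, hF, ⟨Submodule.topEquiv.symm.trans e⟩⟩

end KrullSchmidt

section Restriction

variable {S S' : Type} [Ring S] [Ring S']

/-- Restriction of scalars along `f`. -/
def ResMod (_f : S →+* S') (N : Type) : Type := N

variable (f : S →+* S') (N N' : Type) [AddCommGroup N] [Module S' N] [AddCommGroup N']
  [Module S' N']

instance : AddCommGroup (ResMod f N) := inferInstanceAs (AddCommGroup N)
instance : Module S (ResMod f N) := Module.compHom N f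

variable {N N'}

/-- A linear map, regarded after restriction of scalars. -/
def resMap (h : N →ₗ[S'] N') : ResMod f N →ₗ[S] ResMod f N' where
  toFun := h
  map_add' := h.map_add
  map_smul' s x := h.map_smul (f s) x

/-- A linear equivalence, regarded after restriction of scalars. -/
def resEquiv (h : N ≃ₗ[S'] N') : ResMod f N ≃ₗ[S] ResMod f N' where
  __ := resMap f h.toLinearMap
  invFun := h.symm
  left_inv := h.left_inv
  right_inv := h.right_inv

variable {f}

/-- For surjective `f`, a linear map between restricted modules is linear over the target. -/
def unresMap (hf : Function.Surjective f) (h : ResMod f N →ₗ[S] ResMod f N') : N →ₗ[S'] N' where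
  toFun := h
  map_add' := h.map_add
  map_smul' s x := by
    obtain ⟨t, rfl⟩ := hf s
    exact h.map_smul t x

theorem isIndec_resMod (hf : Function.Surjective f) (hN : IsIndec S' N) :
    IsIndec S (ResMod f N) := by
  refine ⟨hN.1, fun e he => ?_⟩
  rcases hN.2 (unresMap hf e) (LinearMap.ext fun x => LinearMap.congr_fun he x) with h | h
  · exact Or.inl (LinearMap.ext fun x => LinearMap.congr_fun h x)
  · exact Or.inr (LinearMap.ext fun x => LinearMap.congr_fun h x)

theorem finite_resMod (hf : Function.Surjective f) [Module.Finite S' N] :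
    Module.Finite S (ResMod f N) := by
  obtain ⟨s, hs⟩ := Module.Finite.fg_top (R := S') (M := N)
  let t : Finset (ResMod f N) := s
  refine ⟨⟨t, ?_⟩⟩
  rw [eq_top_iff]
  rintro (x : N) -
  have hx : x ∈ Submodule.span S' (s : Set N) := hs ▸ Submodule.mem_top
  let T : Submodule S (ResMod f N) := Submodule.span S (t : Set (ResMod f N))
  let K : Submodule S' N :=
    { carrier := (T : Set (ResMod f N))
      add_mem' := fun {a b} ha hb => T.add_mem ha hb
      zero_mem' := T.zero_mem
      smul_mem' := fun c {a} ha => by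
        obtain ⟨t, rfl⟩ := hf c
        exact T.smul_mem t ha }
  have hK : Submodule.span S' (s : Set N) ≤ K :=
    Submodule.span_le.2 fun y hy =>
      Submodule.subset_span (R := S) (s := (t : Set (ResMod f N))) hy
  exact hK hx

end Restriction

section IdemQuotient

variable {A : Type} [Ring A] (e : A)

theorem idemQuot_mk_surjective : Function.Surjective (IdemQuot.mk A e) :=
  fun x => Quotient.inductionOn x fun a => ⟨a, rfl⟩

theorem idemQuot_mk_eq_zero {a : A} :
    IdemQuot.mk A e a = 0 ↔ a ∈ TwoSidedIdeal.span {e} := by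
  rw [TwoSidedIdeal.mem_iff]
  exact Quotient.eq (r := ((TwoSidedIdeal.span {e}).ringCon).toSetoid) (x := a) (y := 0)

/-- The quotient map on opposite rings. -/
abbrev idemQuotOp : Aᵐᵒᵖ →+* (IdemQuot A e)ᵐᵒᵖ := RingHom.op (IdemQuot.mk A e)

theorem idemQuotOp_surjective : Function.Surjective (idemQuotOp e) := fun x => by
  obtain ⟨a, ha⟩ := idemQuot_mk_surjective e (unop x)
  exact ⟨op a, congrArg op ha⟩

/-- The universal property of the quotient by the ideal generated by `e`. -/
def idemQuotLift {R : Type} [Ring R] (g : A →+* R) (h : g e = 0) : IdemQuot A e →+* R :=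
  RingCon.lift _ g (by
    have h1 : TwoSidedIdeal.span {e} ≤ TwoSidedIdeal.ker g := by
      rw [TwoSidedIdeal.span_le]
      intro x hx
      rw [Set.mem_singleton_iff] at hx
      subst hx
      exact (TwoSidedIdeal.mem_ker _).2 h
    exact TwoSidedIdeal.ringCon_le_iff.1 h1)

theorem idemQuotLift_mk {R : Type} [Ring R] (g : A →+* R) (h : g e = 0) (a : A) :
    idemQuotLift e g h (IdemQuot.mk A e a) = g a := rfl

/-- The action of `A/AeA` on a right module killed by `e`. -/
def idemQuotEnd {E : Type} [AddCommGroup E] [Module Aᵐᵒᵖ E]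
    (h : ∀ x : E, op e • x = 0) : (IdemQuot A e)ᵐᵒᵖ →+* AddMonoid.End E :=
  let g : A →+* (AddMonoid.End E)ᵐᵒᵖ :=
    { toFun := fun a => op (Module.toAddMonoidEnd Aᵐᵒᵖ E (op a))
      map_one' := by simp
      map_mul' := fun a b => by simp
      map_zero' := by simp
      map_add' := fun a b => by simp }
  have hg : g e = 0 := by
    have : Module.toAddMonoidEnd Aᵐᵒᵖ E (op e) = 0 := by
      ext x
      exact h x
    change op (Module.toAddMonoidEnd Aᵐᵒᵖ E (op e)) = 0
    rw [this]; rfl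
  { toFun := fun x => unop (idemQuotLift e g hg (unop x))
    map_one' := by simp
    map_mul' := fun a b => by simp
    map_zero' := by simp
    map_add' := fun a b => by simp }

/-- A right module killed by `e` is a module over the quotient by the ideal generated by `e`. -/
@[reducible] def idemQuotModule {E : Type} [AddCommGroup E] [Module Aᵐᵒᵖ E]
    (h : ∀ x : E, op e • x = 0) : Module (IdemQuot A e)ᵐᵒᵖ E :=
  Module.compHom E (idemQuotEnd e h)

variable (k : Type) [Field k] [Algebra k A]

instance idemQuot_finite [Module.Finite k A] : Module.Finite k (IdemQuot A e) := by
  let g : A →ₗ[k] IdemQuot A e :=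
    { toFun := IdemQuot.mk A e
      map_add' := map_add _
      map_smul' := fun c a => by
        rw [Algebra.smul_def, map_mul, RingHom.id_apply, Algebra.smul_def]
        rfl }
  exact Module.Finite.of_surjective g (idemQuot_mk_surjective e)

end IdemQuotient

section RelativeExt

/-- Every extension of `U` by a homomorphic image of `X` which is annihilated by `t` splits. -/
def ExtVanishAt {S : Type} [Ring S] (t : S) (U X : Type) [AddCommGroup U] [Module S U]
    [AddCommGroup X] [Module S X] : Prop :=
  ∀ (E : Type) [AddCommGroup E] [Module S E] (φ : X →ₗ[S] E) (π : E →ₗ[S] U),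
    (∀ x : E, t • x = 0) → Function.Surjective π → LinearMap.ker π = LinearMap.range φ →
      ∃ σ : U →ₗ[S] E, π ∘ₗ σ = LinearMap.id

variable {S : Type} [Ring S] {t : S} {U V X Y D : Type} [AddCommGroup U] [Module S U]
  [AddCommGroup X] [Module S X] [AddCommGroup V] [Module S V] [AddCommGroup Y] [Module S Y]
  [AddCommGroup D] [Module S D]

theorem ExtVanishAt.quotient_right (hE : ExtVanishAt t U X) (q : X →ₗ[S] Y)
    (hq : Function.Surjective q) : ExtVanishAt t U Y := by
  intro E _ _ φ π ht hπ hφ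
  refine hE E (φ ∘ₗ q) π ht hπ ?_
  rw [hφ, LinearMap.range_comp, LinearMap.range_eq_top.2 hq, Submodule.map_top]

/-- Lifting along a surjection whose kernel is an image of `X`. -/
theorem ExtVanishAt.lift (hE : ExtVanishAt t U X) (hU : ∀ x : U, t • x = 0)
    (hY : ∀ x : Y, t • x = 0) (φ : X →ₗ[S] Y) (q : Y →ₗ[S] D) (hq : Function.Surjective q)
    (hφ : LinearMap.ker q = LinearMap.range φ) (f : U →ₗ[S] D) :
    ∃ g : U →ₗ[S] Y, q ∘ₗ g = f := by
  let E : Submodule S (Y × U) :=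
    LinearMap.eqLocus (q ∘ₗ LinearMap.fst S Y U) (f ∘ₗ LinearMap.snd S Y U)
  have hE0 : ∀ x, q (φ x) = 0 := fun x => by
    have : φ x ∈ LinearMap.ker q := hφ ▸ ⟨x, rfl⟩
    exact this
  let φ' : X →ₗ[S] E := (φ.prod 0).codRestrict E fun x => by
    change q (φ x) = f 0
    rw [hE0, map_zero]
  let π : E →ₗ[S] U := LinearMap.snd S Y U ∘ₗ E.subtype
  obtain ⟨σ, hσ⟩ := hE E φ' π (fun x => Subtype.ext (Prod.ext (hY _) (hU _)))
    (fun u => by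
      obtain ⟨y, hy⟩ := hq (f u)
      exact ⟨⟨(y, u), hy⟩, rfl⟩) (by
      ext ⟨⟨y, u⟩, hx⟩
      have hx' : q y = f u := hx
      constructor
      · intro h
        have h0 : u = 0 := h
        subst h0
        have : y ∈ LinearMap.ker q := by rw [LinearMap.mem_ker, hx', map_zero]
        rw [hφ] at this
        obtain ⟨x, rfl⟩ := this
        exact ⟨x, rfl⟩
      · rintro ⟨x, h⟩
        have h1 : (φ x, (0 : U)) = (y, u) := congrArg Subtype.val h
        exact (congrArg Prod.snd h1).symm)
  refine ⟨LinearMap.fst S Y U ∘ₗ E.subtype ∘ₗ σ, ?_⟩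
  ext u
  have h1 : q (σ u).1.1 = f (σ u).1.2 := (σ u).2
  have h2 : (σ u).1.2 = u := LinearMap.congr_fun hσ u
  rw [h2] at h1
  exact h1

theorem ExtVanishAt.retract_left (hE : ExtVanishAt t U X) (hU : ∀ x : U, t • x = 0)
    (h : IsRetract S V U) : ExtVanishAt t V X := by
  obtain ⟨i, p, h⟩ := h
  intro E _ _ φ π ht hπ hφ
  obtain ⟨g, hg⟩ := hE.lift hU ht φ π hπ hφ p
  exact ⟨g ∘ₗ i, by rw [← LinearMap.comp_assoc, hg, h]⟩

theorem ExtVanishAt.retract (hE : ExtVanishAt t U U) (hU : ∀ x : U, t • x = 0)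
    (h : IsRetract S V U) : ExtVanishAt t V V := by
  have h1 := hE.retract_left hU h
  obtain ⟨i, p, h⟩ := h
  exact h1.quotient_right p (IsRetract.surjective h)

end RelativeExt

section CentralReduction

variable {S : Type} [Ring S] {c : S} (hc : ∀ s, c * s = s * c)
  {N N' : Type} [AddCommGroup N] [Module S N] [AddCommGroup N'] [Module S N']

/-- Multiplication by a central element. -/
def centralMul (N : Type) [AddCommGroup N] [Module S N] {c : S} (hc : ∀ s, c * s = s * c) :
    N →ₗ[S] N where
  toFun x := c • x
  map_add' := smul_add c
  map_smul' s x := by rw [RingHom.id_apply, smul_smul, smul_smul, hc]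

@[simp] theorem centralMul_apply (x : N) : centralMul N hc x = c • x := rfl

include hc in
theorem central_pow (n : ℕ) (s : S) : c ^ n * s = s * c ^ n :=
  ((show Commute c s from hc s).pow_left n).eq

/-- The reduction `N / cN`. -/
abbrev CentralQuot (N : Type) [AddCommGroup N] [Module S N] {c : S}
    (hc : ∀ s, c * s = s * c) : Type := N ⧸ LinearMap.range (centralMul N hc)

theorem centralQuot_smul (x : CentralQuot N hc) : c • x = 0 := by
  obtain ⟨x, rfl⟩ := Submodule.mkQ_surjective _ x
  rw [← map_smul]
  exact (Submodule.Quotient.mk_eq_zero _).2 ⟨x, rfl⟩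

omit hc in
/-- Nilpotent Nakayama. -/
theorem eq_top_of_sup_central (hn : IsNilpotent c) (K : Submodule S N)
    (h : ∀ x : N, ∃ y ∈ K, ∃ z, x = y + c • z) : K = ⊤ := by
  obtain ⟨n, hn⟩ := hn
  have key : ∀ m, ∀ x : N, ∃ y ∈ K, ∃ z, x = y + c ^ m • z := by
    intro m
    induction m with
    | zero => exact fun x => ⟨0, K.zero_mem, x, by simp⟩
    | succ m ih =>
      intro x
      obtain ⟨y, hy, z, rfl⟩ := ih x
      obtain ⟨y', hy', z', rfl⟩ := h z
      exact ⟨y + c ^ m • y', K.add_mem hy (K.smul_mem _ hy'), z', by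
        rw [smul_add, add_assoc, smul_smul, ← pow_succ]⟩
  rw [eq_top_iff]
  intro x _
  obtain ⟨y, hy, z, rfl⟩ := key n x
  rw [hn, zero_smul, add_zero]
  exact hy

theorem centralQuot_nontrivial (hn : IsNilpotent c) [Nontrivial N] :
    Nontrivial (CentralQuot N hc) := by
  rw [Submodule.Quotient.nontrivial_iff]
  intro h
  have h1 : (⊥ : Submodule S N) = ⊤ := eq_top_of_sup_central hn ⊥ fun x => by
    obtain ⟨z, hz⟩ : x ∈ LinearMap.range (centralMul N hc) := h ▸ Submodule.mem_top
    exact ⟨0, Submodule.zero_mem _, z, by rw [zero_add]; exact hz.symm⟩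
  exact bot_ne_top h1

theorem ExtVanishAt.isIndec_centralQuot [IsArtinian S N] [IsNoetherian S N]
    (hn : IsNilpotent c) {t : S} (hE : ExtVanishAt t N N) (ht : ∀ x : N, t • x = 0)
    (hN : IsIndec S N) : IsIndec S (CentralQuot N hc) := by
  have := hN.1
  refine ⟨centralQuot_nontrivial hc hn, fun e he => ?_⟩
  have he' : ∀ x, e (e x) = e x := fun x => LinearMap.congr_fun he x
  obtain ⟨ε, hε⟩ := hE.lift ht ht (centralMul N hc) (Submodule.mkQ _)
    (Submodule.mkQ_surjective _) (Submodule.ker_mkQ _) (e ∘ₗ Submodule.mkQ _)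
  have hε' : ∀ x, Submodule.mkQ _ (ε x) = e (Submodule.mkQ _ x) := fun x =>
    LinearMap.congr_fun hε x
  rcases hN.nilpotent_or_isUnit ε with ⟨n, hn⟩ | h
  · left
    have h1 : ∀ n x, Submodule.mkQ _ ((ε ^ (n + 1)) x) = e (Submodule.mkQ _ x) := by
      intro n
      induction n with
      | zero => simpa using hε'
      | succ n ih =>
        intro x
        rw [pow_succ, Module.End.mul_apply, ih, hε', he']
    ext x
    have h2 := h1 n x
    rw [pow_succ, hn, zero_mul, LinearMap.zero_apply, map_zero] at h2
    exact h2.symm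
  · right
    have h1 : Function.Surjective ε := (Module.End.isUnit_iff _).1 h |>.2
    refine LinearMap.ext fun x => ?_
    obtain ⟨x, rfl⟩ := Submodule.mkQ_surjective _ x
    obtain ⟨x, rfl⟩ := h1 x
    rw [hε', he', LinearMap.id_apply]

/-- A homomorphism to `N' / cN'` lifts, provided that `N / cN ≅ N' / cN'` and `N` is rigid. -/
theorem ExtVanishAt.exists_surjective (hn : IsNilpotent c) {t : S} (hE : ExtVanishAt t N N)
    (ht : ∀ x : N, t • x = 0) (ht' : ∀ x : N', t • x = 0)
    (θ : CentralQuot N hc ≃ₗ[S] CentralQuot N' hc) :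
    ∃ g : N →ₗ[S] N', Function.Surjective g := by
  let C : ℕ → Submodule S N' := fun i => LinearMap.range (centralMul N' (central_pow hc i))
  have hC : ∀ i, C (i + 1) ≤ C i := by
    rintro i _ ⟨x, rfl⟩
    exact ⟨c • x, by simp [smul_smul, pow_succ, (hc _).symm]⟩
  have hE' : ExtVanishAt t N (CentralQuot N' hc) :=
    hE.quotient_right (θ.toLinearMap ∘ₗ Submodule.mkQ _)
      (θ.surjective.comp (Submodule.mkQ_surjective _))
  have key : ∀ i, ∃ g : N →ₗ[S] N' ⧸ C (i + 1), ∀ x y, g x = Submodule.mkQ _ y →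
      θ (Submodule.mkQ _ x) = Submodule.mkQ _ y := by
    intro i
    induction i with
    | zero =>
      have h1 : LinearMap.range (centralMul N' hc) = C 1 := by
        ext x
        simp [C]
      refine ⟨(Submodule.quotEquivOfEq _ _ h1).toLinearMap ∘ₗ θ.toLinearMap ∘ₗ Submodule.mkQ _,
        fun x y h => ?_⟩
      apply (Submodule.quotEquivOfEq _ _ h1).injective
      rw [Submodule.mkQ_apply, Submodule.mkQ_apply, Submodule.quotEquivOfEq_mk]
      exact h
    | succ i ih =>
      obtain ⟨g, hg⟩ := ih
      let q : (N' ⧸ C (i + 1 + 1)) →ₗ[S] N' ⧸ C (i + 1) :=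
        Submodule.mapQ _ _ LinearMap.id (hC _)
      let φ : CentralQuot N' hc →ₗ[S] N' ⧸ C (i + 1 + 1) :=
        Submodule.mapQ _ _ (centralMul N' (central_pow hc (i + 1))) (by
          rintro _ ⟨x, rfl⟩
          refine ⟨x, ?_⟩
          rw [centralMul_apply, centralMul_apply, centralMul_apply, smul_smul, pow_succ])
      obtain ⟨g', hg'⟩ := hE'.lift ht (fun x => by
          obtain ⟨x, rfl⟩ := Submodule.mkQ_surjective _ x
          rw [← map_smul, ht', map_zero]) φ q (fun x => by
          obtain ⟨x, rfl⟩ := Submodule.mkQ_surjective _ x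
          exact ⟨Submodule.mkQ _ x, rfl⟩) (by
          ext x
          obtain ⟨x, rfl⟩ := Submodule.mkQ_surjective _ x
          constructor
          · intro h
            have h1 : x ∈ C (i + 1) := (Submodule.Quotient.mk_eq_zero _).1 h
            obtain ⟨y, rfl⟩ := h1
            exact ⟨Submodule.mkQ _ y, rfl⟩
          · rintro ⟨y, hy⟩
            obtain ⟨y, rfl⟩ := Submodule.mkQ_surjective _ y
            rw [← hy]
            exact (Submodule.Quotient.mk_eq_zero _).2 ⟨y, rfl⟩) g
      refine ⟨g', fun x y h => hg x y ?_⟩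
      rw [← hg', LinearMap.comp_apply, h]
      rfl
  obtain ⟨n, hn'⟩ := hn
  obtain ⟨g, hg⟩ := key n
  have h0 : C (n + 1) = ⊥ := by
    rw [eq_bot_iff]
    rintro _ ⟨x, rfl⟩
    simp [pow_succ, hn']
  let g' : N →ₗ[S] N' := (Submodule.quotEquivOfEqBot _ h0).toLinearMap ∘ₗ g
  have hg' : ∀ x, g x = Submodule.mkQ _ (g' x) := fun x =>
    ((Submodule.quotEquivOfEqBot _ h0).symm_apply_apply (g x)).symm
  refine ⟨g', LinearMap.range_eq_top.1 (eq_top_of_sup_central ⟨n, hn'⟩ _ fun y => ?_)⟩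
  obtain ⟨x, hx⟩ := Submodule.mkQ_surjective _ (θ.symm (Submodule.mkQ _ y))
  have h1 := hg x _ (hg' x)
  rw [hx, LinearEquiv.apply_symm_apply] at h1
  obtain ⟨z, hz⟩ := (Submodule.Quotient.eq _).1 h1
  exact ⟨_, ⟨x, rfl⟩, z, by
    have : c • z = y - g' x := hz
    rw [this]; abel⟩

include hc in
theorem smul_eq_zero_of_centralQuot (hn : IsNilpotent c) {e : S} (he : IsIdempotentElem e)
    (h : ∀ x : CentralQuot N hc, e • x = 0) (x : N) : e • x = 0 := by
  have h1 : ∀ x : N, ∃ y, e • x = c • y := fun x => by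
    have := h (Submodule.mkQ _ x)
    rw [← map_smul] at this
    obtain ⟨y, hy⟩ := (Submodule.Quotient.mk_eq_zero _).1 this
    exact ⟨y, hy.symm⟩
  have h2 : ∀ n, ∀ x : N, ∃ y, e • x = c ^ n • y := by
    intro n
    induction n with
    | zero => exact fun x => ⟨e • x, by simp⟩
    | succ n ih =>
      intro x
      obtain ⟨y, hy⟩ := h1 x
      obtain ⟨z, hz⟩ := ih y
      refine ⟨z, ?_⟩
      rw [← he.eq, mul_smul, hy, smul_smul, ← hc, mul_smul, hz, smul_smul, pow_succ']
  obtain ⟨n, hn⟩ := hn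
  obtain ⟨y, hy⟩ := h2 n x
  rw [hy, hn, zero_smul]

/-- A rigid module over an idempotent quotient is determined by its central reduction. -/
theorem nonempty_equiv_of_centralQuot [IsNoetherian S N] [IsNoetherian S N']
    (hn : IsNilpotent c) {t t' : S}
    (hi : IsIdempotentElem t) (hi' : IsIdempotentElem t') (hE : ExtVanishAt t N N)
    (hE' : ExtVanishAt t' N' N') (ht : ∀ x : N, t • x = 0) (ht' : ∀ x : N', t' • x = 0)
    (θ : CentralQuot N hc ≃ₗ[S] CentralQuot N' hc) : Nonempty (N ≃ₗ[S] N') := by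
  have h1 : ∀ x : N', t • x = 0 := smul_eq_zero_of_centralQuot hc hn hi fun x => by
    apply θ.symm.injective
    obtain ⟨y, hy⟩ := Submodule.mkQ_surjective _ (θ.symm x)
    rw [map_smul, map_zero, ← hy, ← map_smul, ht, map_zero]
  have h2 : ∀ x : N, t' • x = 0 := smul_eq_zero_of_centralQuot hc hn hi' fun x => by
    apply θ.injective
    obtain ⟨y, hy⟩ := Submodule.mkQ_surjective _ (θ x)
    rw [map_smul, map_zero, ← hy, ← map_smul, ht', map_zero]
  obtain ⟨g, hg⟩ := hE.exists_surjective hc hn ht h1 θ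
  obtain ⟨g', hg'⟩ := hE'.exists_surjective hc hn ht' h2 θ.symm
  have h3 : Function.Injective (g' ∘ₗ g) :=
    IsNoetherian.injective_of_surjective_endomorphism _ (hg'.comp hg)
  have h4 : Function.Injective g := fun x y h => h3 (congrArg g' h)
  exact ⟨LinearEquiv.ofBijective g ⟨h4, hg⟩⟩

end CentralReduction

section FiniteCriterion

variable (k : Type) [Field k] (A : Type) [Ring A] [Algebra k A]

theorem resMod_smul_eq_zero {A : Type} [Ring A] (e : A) {N : Type} [AddCommGroup N]
    [Module (IdemQuot A e)ᵐᵒᵖ N] (x : ResMod (idemQuotOp e) N) : op e • x = 0 := by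
  have h2 : idemQuotOp e (op e) = 0 :=
    congrArg op ((idemQuot_mk_eq_zero e).2 (TwoSidedIdeal.subset_span rfl))
  have h3 : ∀ x : N, idemQuotOp e (op e) • x = 0 := fun x => by rw [h2]; exact zero_smul _ _
  exact h3 x

theorem ExtVanish.resMod {A : Type} [Ring A] (e : A) {N : Type} [AddCommGroup N]
    [Module (IdemQuot A e)ᵐᵒᵖ N] (hE : ExtVanish (IdemQuot A e)ᵐᵒᵖ N N) :
    ExtVanishAt (op e) (ResMod (idemQuotOp e) N) (ResMod (idemQuotOp e) N) := by
  intro E _ _ φ π ht hπ hφ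
  let _ : Module (IdemQuot A e)ᵐᵒᵖ E := idemQuotModule e ht
  let φ' : N →ₗ[(IdemQuot A e)ᵐᵒᵖ] E :=
    { toFun := φ
      map_add' := φ.map_add
      map_smul' := fun s x => by
        obtain ⟨a, rfl⟩ := idemQuotOp_surjective e s
        exact φ.map_smul a x }
  let π' : E →ₗ[(IdemQuot A e)ᵐᵒᵖ] N :=
    { toFun := π
      map_add' := π.map_add
      map_smul' := fun s x => by
        obtain ⟨a, rfl⟩ := idemQuotOp_surjective e s
        exact π.map_smul a x }
  obtain ⟨σ, hσ⟩ := hE E φ' π' hπ (by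
    ext x
    exact (Submodule.ext_iff.1 hφ x))
  exact ⟨{ toFun := σ
           map_add' := σ.map_add
           map_smul' := fun s x => σ.map_smul (idemQuotOp e s) x },
    LinearMap.ext fun x => LinearMap.congr_fun hσ x⟩

theorem IsSupportTauTilting.exists_extVanishAt [Module.Finite k A] {M : ModuleCat.{0} Aᵐᵒᵖ}
    (h : IsSupportTauTilting k A M) :
    Module.Finite Aᵐᵒᵖ M ∧ ∃ e : Aᵐᵒᵖ, IsIdempotentElem e ∧ (∀ x : M, e • x = 0) ∧
      ExtVanishAt e M M := by
  obtain ⟨e, he, N, ⟨hN1, hN2, -⟩, ⟨i⟩⟩ := h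
  let i' : M ≃ₗ[Aᵐᵒᵖ] ResMod (idemQuotOp e) N := i
  have hf := finite_resMod (f := idemQuotOp e) (N := N) (idemQuotOp_surjective e)
  refine ⟨Module.Finite.equiv i'.symm, op e, congrArg op he, fun x => i'.injective ?_,
    (ExtVanish.resMod e (hN2.extVanish k)).retract (resMod_smul_eq_zero e) i'.isRetract⟩
  rw [map_smul, resMod_smul_eq_zero, map_zero]

/-- If finitely many indecomposable modules are annihilated by a central nilpotent element, then
the algebra is τ-tilting finite. -/
theorem tauTiltingFinite_of_central [Module.Finite k A] (c : Aᵐᵒᵖ) (hc : ∀ s, c * s = s * c)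
    (hn : IsNilpotent c) {J : Type} [Finite J] (R : J → ModuleCat.{0} Aᵐᵒᵖ)
    (hR : ∀ (X : Type) [AddCommGroup X] [Module Aᵐᵒᵖ X], Module.Finite Aᵐᵒᵖ X →
      IsIndec Aᵐᵒᵖ X → (∀ x : X, c • x = 0) → ∃ j, Nonempty (X ≃ₗ[Aᵐᵒᵖ] R j)) :
    TauTiltingFinite k A := by
  classical
  have : IsArtinianRing Aᵐᵒᵖ := IsArtinianRing.of_finite k _
  have : IsNoetherianRing Aᵐᵒᵖ := IsNoetherianRing.of_finite k _
  let good : J → ModuleCat.{0} Aᵐᵒᵖ → Prop := fun j N =>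
    Module.Finite Aᵐᵒᵖ N ∧ (∃ t : Aᵐᵒᵖ, IsIdempotentElem t ∧ (∀ x : N, t • x = 0) ∧
      ExtVanishAt t N N) ∧ Nonempty (CentralQuot N hc ≃ₗ[Aᵐᵒᵖ] R j)
  have huniq : ∀ j N N', good j N → good j N' → Nonempty (N ≃ₗ[Aᵐᵒᵖ] N') := by
    rintro j N N' ⟨h1, ⟨t, ht, ht1, ht2⟩, ⟨θ⟩⟩ ⟨h1', ⟨t', ht', ht1', ht2'⟩, ⟨θ'⟩⟩
    exact nonempty_equiv_of_centralQuot hc hn ht ht' ht2 ht2' ht1 ht1' (θ.trans θ'.symm)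
  let Rep : J → ModuleCat.{0} Aᵐᵒᵖ := fun j =>
    if h : ∃ N, good j N then h.choose else ModuleCat.of _ PUnit
  have hRep : ∀ j N, good j N → Nonempty (N ≃ₗ[Aᵐᵒᵖ] Rep j) := by
    intro j N h
    have h' : ∃ N, good j N := ⟨N, h⟩
    have h2 : Rep j = h'.choose := dif_pos h'
    rw [h2]
    exact huniq j N _ h h'.choose_spec
  obtain ⟨n, ⟨en⟩⟩ := Finite.exists_equiv_fin (Set J)
  refine ⟨n, fun i => ModuleCat.of Aᵐᵒᵖ (∀ x : en.symm i, Rep x), fun M hM hb => ?_⟩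
  obtain ⟨hf, e, he, heM, hE⟩ := hM.exists_extVanishAt k A
  have : IsArtinian Aᵐᵒᵖ M := isArtinian_of_fg_of_artinian' 
  obtain ⟨ι, _, F, hF, ⟨Φ⟩⟩ := exists_indec_decomposition (S := Aᵐᵒᵖ) (M := M)
  have hret : ∀ i, IsRetract Aᵐᵒᵖ (F i) M := fun i =>
    (isRetract_pi (fun i => F i) i).trans Φ.symm.isRetract
  have hgood : ∀ i, ∃ j, good j (ModuleCat.of Aᵐᵒᵖ (F i)) := by
    intro i
    have hEi := hE.retract heM (hret i)
    have hti : ∀ x : F i, e • x = 0 := fun x => Subtype.ext (heM x.1)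
    obtain ⟨j, hj⟩ := hR (CentralQuot (F i) hc) inferInstance
      (hEi.isIndec_centralQuot hc hn hti (hF i)) (centralQuot_smul hc)
    exact ⟨j, ⟨inferInstanceAs (Module.Finite Aᵐᵒᵖ (F i)), ⟨e, he, hti, hEi⟩, hj⟩⟩
  choose j hj using hgood
  have hne : ∀ a b, a ≠ b → IsEmpty (F a ≃ₗ[Aᵐᵒᵖ] F b) := by
    intro a b hab
    refine ⟨fun θ => ?_⟩
    have hr : IsRetract Aᵐᵒᵖ (F a × F a) M := by
      refine IsRetract.trans ?_ Φ.symm.isRetract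
      refine ⟨(LinearMap.single Aᵐᵒᵖ (fun i => F i) a).coprod
        (LinearMap.single Aᵐᵒᵖ (fun i => F i) b ∘ₗ θ.toLinearMap),
        (LinearMap.proj a).prod (θ.symm.toLinearMap ∘ₗ LinearMap.proj b), ?_⟩
      ext x <;> simp [hab, hab.symm]
    obtain ⟨i, p, hip⟩ := hr
    have h1 := hb (ModuleCat.of _ (F a)) (ModuleCat.of _ (LinearMap.ker p))
      ⟨(splitEquiv i p hip).trans (LinearEquiv.prodAssoc Aᵐᵒᵖ _ _ _)⟩
    exact (not_subsingleton_iff_nontrivial.2 (hF a).1) h1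
  have hinj : Function.Injective j := by
    intro a b hab
    by_contra h
    have h1 := huniq (j a) _ _ (hj a) (hab ▸ hj b)
    exact (hne a b h).false h1.some
  suffices h : Nonempty (M ≃ₗ[Aᵐᵒᵖ] (∀ x : Set.range j, Rep x)) by
    refine ⟨en (Set.range j), ?_⟩
    change Nonempty (M ≃ₗ[Aᵐᵒᵖ] (∀ x : en.symm (en (Set.range j)), Rep x))
    rwa [Equiv.symm_apply_apply]
  let ρ : ι ≃ Set.range j := Equiv.ofInjective j hinj
  have hrep : ∀ i, Nonempty (F i ≃ₗ[Aᵐᵒᵖ] Rep (ρ i)) := fun i => hRep (j i) _ (hj i)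
  exact ⟨Φ.trans ((LinearEquiv.piCongrRight fun i => (hrep i).some).trans
    (LinearEquiv.piCongrLeft Aᵐᵒᵖ (fun x : Set.range j => Rep x) ρ))⟩

end FiniteCriterion

section StringDecomposition

variable {k : Type} [Field k]

theorem isCompl_span_zero_top {V : Type} [AddCommGroup V] [Module k V] :
    IsCompl (Submodule.span k {(0 : V)}) ⊤ := by
  rw [Submodule.span_zero_singleton]
  exact isCompl_bot_top

theorem isCompl_span_ker {V : Type} [AddCommGroup V] [Module k V] (φ : V →ₗ[k] k) {x : V}
    (h : φ x ≠ 0) : IsCompl (Submodule.span k {x}) (LinearMap.ker φ) := by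
  constructor
  · rw [Submodule.disjoint_def]
    intro v hv hv'
    obtain ⟨a, rfl⟩ := Submodule.mem_span_singleton.1 hv
    rw [LinearMap.mem_ker, map_smul, smul_eq_mul, mul_eq_zero] at hv'
    rw [hv'.resolve_right h, zero_smul]
  · rw [codisjoint_iff, eq_top_iff]
    intro v _
    rw [Submodule.mem_sup]
    refine ⟨(φ v / φ x) • x, Submodule.smul_mem _ _ (Submodule.mem_span_singleton_self x),
      v - (φ v / φ x) • x, ?_, by abel⟩
    rw [LinearMap.mem_ker, map_sub, map_smul, smul_eq_mul, div_mul_cancel₀ _ h, sub_self]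

/-- A nonzero string direct summand of a representation of the linear quiver with arrows in both
directions whose two-cycles vanish, compatible with a chain of subspaces at the first vertex. -/
structure StringSummand (V : ℕ → Type) [∀ a, AddCommGroup (V a)] [∀ a, Module k (V a)]
    (E : ∀ a, V a →ₗ[k] V (a + 1)) (F : ∀ a, V (a + 1) →ₗ[k] V a)
    (G : Set (Submodule k (V 0))) (y : ∀ a, V a) (Z : ∀ a, Submodule k (V a)) : Prop where
  ne_zero : ∃ a, y a ≠ 0
  isCompl : ∀ a, IsCompl (Submodule.span k {y a}) (Z a)
  up : ∀ a, E a (y a) = 0 ∨ E a (y a) = y (a + 1)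
  down : ∀ a, F a (y (a + 1)) = 0 ∨ F a (y (a + 1)) = y a
  up_le : ∀ a, ∀ z ∈ Z a, E a z ∈ Z (a + 1)
  down_le : ∀ a, ∀ z ∈ Z (a + 1), F a z ∈ Z a
  compat : ∀ g ∈ G, y 0 ∈ g ∨ g ≤ Z 0

theorem StringSummand.cons {V : ℕ → Type} [∀ a, AddCommGroup (V a)] [∀ a, Module k (V a)]
    {E : ∀ a, V a →ₗ[k] V (a + 1)} {F : ∀ a, V (a + 1) →ₗ[k] V a}
    {G : Set (Submodule k (V 0))} {G' : Set (Submodule k (V 1))} {y : ∀ a, V (a + 1)}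
    {Z : ∀ a, Submodule k (V (a + 1))}
    (h : StringSummand (fun a => V (a + 1)) (fun a => E (a + 1)) (fun a => F (a + 1)) G' y Z)
    (x : V 0) (Z0 : Submodule k (V 0)) (h1 : IsCompl (Submodule.span k {x}) Z0)
    (h2 : E 0 x = 0 ∨ E 0 x = y 0) (h3 : F 0 (y 0) = 0 ∨ F 0 (y 0) = x)
    (h4 : ∀ z ∈ Z0, E 0 z ∈ Z 0) (h5 : ∀ z ∈ Z 0, F 0 z ∈ Z0)
    (h6 : ∀ g ∈ G, x ∈ g ∨ g ≤ Z0) : ∃ y Z, StringSummand V E F G y Z := by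
  refine ⟨fun a => Nat.rec x (fun a _ => y a) a, fun a => Nat.rec Z0 (fun a _ => Z a) a, ?_⟩
  obtain ⟨b, hb⟩ := h.ne_zero
  exact
    { ne_zero := ⟨b + 1, hb⟩
      isCompl := fun a => by cases a with
        | zero => exact h1
        | succ a => exact h.isCompl a
      up := fun a => by cases a with
        | zero => exact h2
        | succ a => exact h.up a
      down := fun a => by cases a with
        | zero => exact h3
        | succ a => exact h.down a
      up_le := fun a => by cases a with
        | zero => exact h4
        | succ a => exact h.up_le a
      down_le := fun a => by cases a with
        | zero => exact h5
        | succ a => exact h.down_le a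
      compat := h6 }

theorem exists_stringSummand (N : ℕ) : ∀ (V : ℕ → Type) [∀ a, AddCommGroup (V a)]
    [∀ a, Module k (V a)] [∀ a, Module.Finite k (V a)]
    (E : ∀ a, V a →ₗ[k] V (a + 1)) (F : ∀ a, V (a + 1) →ₗ[k] V a)
    (G : Set (Submodule k (V 0))), (∀ a x, E a (F a x) = 0) → (∀ a x, F a (E a x) = 0) →
    (∀ a, N ≤ a → Subsingleton (V a)) → (∃ a, Nontrivial (V a)) →
    ⊥ ∈ G → ⊤ ∈ G → (∀ g ∈ G, ∀ h ∈ G, g ≤ h ∨ h ≤ g) →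
    ∃ y Z, StringSummand V E F G y Z := by
  induction N with
  | zero =>
    intro V _ _ _ E F G _ _ hV ⟨a, ha⟩
    exact absurd (hV a (Nat.zero_le a)) (not_subsingleton_iff_nontrivial.2 ha)
  | succ N ih =>
    intro V _ _ _ E F G hEF hFE hV hne hbot htop hch
    by_cases htriv : ∀ a, Subsingleton (V (a + 1))
    · have h0 : Nontrivial (V 0) := by
        obtain ⟨a, ha⟩ := hne
        cases a with
        | zero => exact ha
        | succ a => exact absurd (htriv a) (not_subsingleton_iff_nontrivial.2 ha)
      obtain ⟨g, ⟨hg, hg0⟩, hmin⟩ := WellFounded.has_min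
        (wellFounded_lt (α := Submodule k (V 0))) {g | g ∈ G ∧ g ≠ ⊥} ⟨⊤, htop, top_ne_bot⟩
      obtain ⟨v, hv, hv0⟩ := Submodule.exists_mem_ne_zero_of_ne_bot hg0
      obtain ⟨Z0, hZ0⟩ := Submodule.exists_isCompl (Submodule.span k {v})
      refine ⟨fun a => Nat.rec v (fun a _ => 0) a, fun a => Nat.rec Z0 (fun a _ => ⊤) a, ?_⟩
      have hs : ∀ a (x y : V (a + 1)), x = y := fun a x y => (htriv a).elim x y
      exact
        { ne_zero := ⟨0, hv0⟩
          isCompl := fun a => by cases a with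
            | zero => exact hZ0
            | succ a => exact isCompl_span_zero_top
          up := fun a => Or.inl (hs a _ _)
          down := fun a => Or.inl (by
            rw [hs a (Nat.rec v (fun a _ => 0) (a + 1)) 0, map_zero])
          up_le := fun a z _ => by rw [hs a (E a z) 0]; exact Submodule.zero_mem _
          down_le := fun a z _ => by
            rw [hs a z 0, map_zero]; exact Submodule.zero_mem _
          compat := fun h hh => by
            rcases hch g hg h hh with h1 | h1
            · exact Or.inl (h1 hv)
            · by_cases h2 : h = ⊥
              · exact Or.inr (h2 ▸ bot_le)
              · have h3 := hmin h ⟨hh, h2⟩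
                rw [← (h1.lt_or_eq.resolve_left h3)] at hv
                exact Or.inl hv }
    · push Not at htriv
      obtain ⟨b, hb⟩ := htriv
      obtain ⟨y, Z, hyZ⟩ := ih (fun a => V (a + 1)) (fun a => E (a + 1)) (fun a => F (a + 1))
        ((fun g => g.map (E 0)) '' G ∪ (fun g => g.comap (F 0)) '' G)
        (fun a => hEF _) (fun a => hFE _) (fun a ha => hV _ (by omega))
        ⟨b, hb⟩
        (Or.inl ⟨⊥, hbot, Submodule.map_bot _⟩) (Or.inr ⟨⊤, htop, Submodule.comap_top _⟩) (by
          have hmix : ∀ g h : Submodule k (V 0), g.map (E 0) ≤ h.comap (F 0) := by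
            rintro g h _ ⟨x, _, rfl⟩
            rw [Submodule.mem_comap, hFE]
            exact Submodule.zero_mem _
          rintro _ (⟨g, hg, rfl⟩ | ⟨g, hg, rfl⟩) _ (⟨h, hh, rfl⟩ | ⟨h, hh, rfl⟩)
          · exact (hch g hg h hh).imp (fun h => Submodule.map_mono h) fun h => Submodule.map_mono h
          · exact Or.inl (hmix _ _)
          · exact Or.inr (hmix _ _)
          · exact (hch g hg h hh).imp (fun h => Submodule.comap_mono h)
              fun h => Submodule.comap_mono h)
      have hmap : ∀ g ∈ G, y 0 ∈ g.map (E 0) ∨ g.map (E 0) ≤ Z 0 := fun g hg =>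
        hyZ.compat _ (Or.inl ⟨g, hg, rfl⟩)
      have hcomap : ∀ g ∈ G, F 0 (y 0) ∈ g ∨ g.comap (F 0) ≤ Z 0 := fun g hg =>
        hyZ.compat _ (Or.inr ⟨g, hg, rfl⟩)
      have hdisj : ∀ c : k, c • y 0 ∈ Z 0 → c • y 0 = 0 := fun c hc =>
        Submodule.disjoint_def.1 (hyZ.isCompl 0).disjoint _
          (Submodule.smul_mem _ _ (Submodule.mem_span_singleton_self _)) hc
      have hdec : ∀ v, ∃ c : k, ∃ z ∈ Z 0, c • y 0 + z = v := by
        intro v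
        have hv : v ∈ Submodule.span k {y 0} ⊔ Z 0 :=
          (hyZ.isCompl 0).sup_eq_top ▸ Submodule.mem_top
        obtain ⟨u, hu, z, hz, rfl⟩ := Submodule.mem_sup.1 hv
        obtain ⟨c, rfl⟩ := Submodule.mem_span_singleton.1 hu
        exact ⟨c, z, hz, rfl⟩
      by_cases hF : F 0 (y 0) = 0
      · by_cases hA : y 0 ≠ 0 ∧ y 0 ∈ LinearMap.range (E 0)
        · obtain ⟨hy0, hy1⟩ := hA
          obtain ⟨g, ⟨hg, hgy⟩, hmin⟩ := WellFounded.has_min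
            (wellFounded_lt (α := Submodule k (V 0))) {g | g ∈ G ∧ y 0 ∈ g.map (E 0)}
            ⟨⊤, htop, by rwa [Submodule.map_top]⟩
          obtain ⟨x, hx, hxy⟩ := hgy
          refine hyZ.cons x ((Z 0).comap (E 0)) ⟨?_, ?_⟩ (Or.inr hxy) (Or.inl hF)
            (fun z hz => hz) (fun z hz => ?_) fun h hh => ?_
          · rw [Submodule.disjoint_def]
            intro v hv hv'
            obtain ⟨c, rfl⟩ := Submodule.mem_span_singleton.1 hv
            rw [Submodule.mem_comap, map_smul, hxy] at hv'
            rw [(smul_eq_zero.1 (hdisj c hv')).resolve_right hy0, zero_smul]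
          · rw [codisjoint_iff, eq_top_iff]
            intro v _
            obtain ⟨c, z, hz, hv⟩ := hdec (E 0 v)
            rw [Submodule.mem_sup]
            refine ⟨c • x, Submodule.smul_mem _ _ (Submodule.mem_span_singleton_self _),
              v - c • x, ?_, by abel⟩
            rw [Submodule.mem_comap, map_sub, map_smul, hxy, ← hv, add_sub_cancel_left]
            exact hz
          · rw [Submodule.mem_comap, hEF]
            exact Submodule.zero_mem _
          · by_cases hle : g ≤ h
            · exact Or.inl (hle hx)
            · have hlt : h < g := lt_of_le_not_ge ((hch g hg h hh).resolve_left hle) hle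
              have h1 : y 0 ∉ h.map (E 0) := fun h2 => hmin h ⟨hh, h2⟩ hlt
              exact Or.inr (Submodule.map_le_iff_le_comap.1 ((hmap h hh).resolve_left h1))
        · refine hyZ.cons 0 ⊤ isCompl_span_zero_top (Or.inl (map_zero _)) (Or.inl hF)
            (fun z _ => ?_) (fun z _ => Submodule.mem_top)
            fun g _ => Or.inl (Submodule.zero_mem g)
          by_cases hy0 : y 0 = 0
          · obtain ⟨c, z', hz', h⟩ := hdec (E 0 z)
            have h' : E 0 z = z' := by
              rw [← h, hy0, smul_zero]
              exact zero_add z'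
            rw [h']
            exact hz'
          · have h1 : y 0 ∉ LinearMap.range (E 0) := fun h => hA ⟨hy0, h⟩
            have h2 := hmap ⊤ htop
            rw [Submodule.map_top] at h2
            exact h2.resolve_left h1 ⟨z, rfl⟩
      · obtain ⟨g, ⟨hg, hgy⟩, hmax⟩ := WellFounded.has_min
            (wellFounded_gt (α := Submodule k (V 0))) {g | g ∈ G ∧ F 0 (y 0) ∉ g}
            ⟨⊥, hbot, hF⟩
        have hy0 : y 0 ≠ 0 := fun h => hF (by rw [h, map_zero])
        have hx : F 0 (y 0) ∉ g ⊔ (Z 0).map (F 0) := by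
          intro h
          obtain ⟨u, hu, _, ⟨z, hz, rfl⟩, h⟩ := Submodule.mem_sup.1 h
          have h1 : y 0 - z ∈ g.comap (F 0) := by
            rw [Submodule.mem_comap, map_sub, ← h, add_sub_cancel_right]
            exact hu
          have h2 := (hcomap g hg).resolve_left hgy h1
          have h3 : (1 : k) • y 0 ∈ Z 0 := by
            rw [one_smul]
            simpa using Submodule.add_mem _ h2 hz
          exact hy0 (by simpa using hdisj 1 h3)
        obtain ⟨φ, hφ1, hφ2⟩ := Submodule.exists_le_ker_of_notMem hx
        refine hyZ.cons (F 0 (y 0)) (LinearMap.ker φ) (isCompl_span_ker φ hφ1)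
          (Or.inl (hEF _ _)) (Or.inr rfl) (fun z _ => ?_)
          (fun z hz => hφ2 (Submodule.mem_sup_right ⟨z, hz, rfl⟩)) fun h hh => ?_
        · refine (hmap ⊤ htop).resolve_left (fun h => ?_) ⟨z, Submodule.mem_top, rfl⟩
          obtain ⟨u, _, hu⟩ := h
          exact hF (by rw [← hu, hFE])
        · by_cases hxh : F 0 (y 0) ∈ h
          · exact Or.inl hxh
          · right
            rcases hch g hg h hh with h1 | h1
            · have h2 := hmax h ⟨hh, hxh⟩
              rw [← (h1.lt_or_eq.resolve_left h2)]
              exact le_sup_left.trans hφ2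
            · exact h1.trans (le_sup_left.trans hφ2)

end StringDecomposition

section ChainData

variable {k : Type} [Field k] {S : Type} [Ring S] [Algebra k S]

/-- The straight path `E_{a+n-1} ⋯ E_a`. -/
def upPath (γ E : ℕ → S) (a : ℕ) : ℕ → S
  | 0 => γ a
  | n + 1 => E (a + n) * upPath γ E a n

/-- The straight path `F_b ⋯ F_{b+n-1}`. -/
def downPath (γ F : ℕ → S) (b : ℕ) : ℕ → S
  | 0 => γ b
  | n + 1 => downPath γ F b n * F (b + n)

variable (k) in
/-- Idempotents `γ_a` exhibiting `S / cS`, up to Morita equivalence, as a quotient of the path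
algebra of the linear quiver with arrows in both directions, with vanishing two-cycles. -/
structure ChainData (c : S) (N : ℕ) (γ E F : ℕ → S) : Prop where
  idem : ∀ a, γ a * γ a = γ a
  vanish : ∀ a, N ≤ a → γ a = 0
  left_E : ∀ a, γ (a + 1) * E a = E a
  E_right : ∀ a, E a * γ a = E a
  left_F : ∀ a, γ a * F a = F a
  F_right : ∀ a, F a * γ (a + 1) = F a
  EF : ∀ a, ∃ s, E a * F a = c * s
  FE : ∀ a, ∃ s, F a * E a = c * s
  full : ∃ (m : ℕ) (u v : Fin m → S) (a : Fin m → ℕ), ∑ i, u i * γ (a i) * v i = 1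
  up : ∀ a n s, ∃ (κ : k) (s' : S), γ (a + n) * s * γ a = κ • upPath γ E a n + c * s'
  down : ∀ b n s, ∃ (κ : k) (s' : S), γ b * s * γ (b + n) = κ • downPath γ F b n + c * s'

namespace ChainData

variable {c : S} {N : ℕ} {γ E F : ℕ → S} (h : ChainData k c N γ E F)
  {X : Type} [AddCommGroup X] [Module S X] [Module k X] [IsScalarTower k S X]

/-- Families of vectors that are stable under the arrows. -/
structure Stable (γ E F : ℕ → S) (W : ℕ → Submodule k X) : Prop where
  mem : ∀ a, ∀ x ∈ W a, γ a • x = x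
  up : ∀ a, ∀ x ∈ W a, E a • x ∈ W (a + 1)
  down : ∀ a, ∀ x ∈ W (a + 1), F a • x ∈ W a

omit [IsScalarTower k S X] in
theorem Stable.upPath_mem {W : ℕ → Submodule k X} (hW : Stable γ E F W) (a n : ℕ) (x : X)
    (hx : x ∈ W a) : upPath γ E a n • x ∈ W (a + n) := by
  induction n with
  | zero => rw [upPath, hW.mem a x hx]; exact hx
  | succ n ih => rw [upPath, mul_smul]; exact hW.up _ _ ih

omit [IsScalarTower k S X] in
theorem Stable.downPath_mem {W : ℕ → Submodule k X} (hW : Stable γ E F W) (b n : ℕ) :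
    ∀ x ∈ W (b + n), downPath γ F b n • x ∈ W b := by
  induction n with
  | zero => intro x hx; rw [downPath, hW.mem b x hx]; exact hx
  | succ n ih => intro x hx; rw [downPath, mul_smul]; exact ih _ (hW.down _ _ hx)

include h in
theorem smul_mem_stable (hcS : ∀ s, c * s = s * c) (hcX : ∀ x : X, c • x = 0)
    {W : ℕ → Submodule k X} (hW : Stable γ E F W) (a b : ℕ) (s : S) (x : X) (hx : x ∈ W a) :
    (γ b * s) • x ∈ W b := by
  have key : ∀ p : S, p • x ∈ W b → (∃ (κ : k) (s' : S), γ b * s * γ a = κ • p + c * s') →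
      (γ b * s) • x ∈ W b := by
    rintro p hp ⟨κ, s', h1⟩
    have h2 : (γ b * s) • x = (γ b * s * γ a) • x := by
      rw [mul_smul (γ b * s), hW.mem a x hx]
    rw [h2, h1, add_smul, hcS, mul_smul, hcX, smul_zero, add_zero, smul_assoc]
    exact Submodule.smul_mem _ _ hp
  rcases le_total a b with hab | hab
  · obtain ⟨n, rfl⟩ := Nat.exists_eq_add_of_le hab
    exact key _ (hW.upPath_mem a n x hx) (h.up a n s)
  · obtain ⟨n, rfl⟩ := Nat.exists_eq_add_of_le hab
    exact key _ (hW.downPath_mem b n x hx) (h.down b n s)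

/-- The submodule generated by a family of vectors. -/
def gen (S : Type) [Ring S] [Algebra k S] [Module S X] (W : ℕ → Submodule k X) :
    Submodule S X :=
  Submodule.span S (⋃ a, (W a : Set X))

include h in
theorem smul_gen_mem (hcS : ∀ s, c * s = s * c) (hcX : ∀ x : X, c • x = 0)
    {W : ℕ → Submodule k X} (hW : Stable γ E F W) (b : ℕ) (x : X) (hx : x ∈ gen S W) :
    γ b • x ∈ W b := by
  have key : ∀ s : S, (γ b * s) • x ∈ W b := by
    unfold gen at hx
    induction hx using Submodule.span_induction with
    | mem x hx =>
      intro s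
      obtain ⟨a, ha⟩ := Set.mem_iUnion.1 hx
      exact h.smul_mem_stable hcS hcX hW a b s x ha
    | zero => intro s; rw [smul_zero]; exact Submodule.zero_mem _
    | add x y _ _ hx hy => intro s; rw [smul_add]; exact Submodule.add_mem _ (hx s) (hy s)
    | smul t x _ hx => intro s; rw [smul_smul, mul_assoc]; exact hx _
  have h1 := key 1
  rwa [mul_one] at h1

include h in
omit [Module k X] [IsScalarTower k S X] in
theorem eq_zero_of_smul {x : X} (hx : ∀ b (s : S), γ b • s • x = 0) : x = 0 := by
  obtain ⟨m, u, v, a, h1⟩ := h.full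
  rw [← one_smul S x, ← h1, Finset.sum_smul]
  exact Finset.sum_eq_zero fun i _ => by
    rw [mul_smul, mul_smul, hx, smul_zero]

include h in
omit [Module k X] [IsScalarTower k S X] in
theorem eq_top_of_mem {K : Submodule S X} (hK : ∀ b x, γ b • x ∈ K) : K = ⊤ := by
  obtain ⟨m, u, v, a, h1⟩ := h.full
  rw [eq_top_iff]
  intro x _
  rw [← one_smul S x, ← h1, Finset.sum_smul]
  refine Submodule.sum_mem _ fun i _ => ?_
  rw [mul_smul, mul_smul]
  exact Submodule.smul_mem _ _ (hK _ _)

/-- The subspace `γ_a X`. -/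
def corner (X : Type) [AddCommGroup X] [Module S X] [Module k X] [IsScalarTower k S X]
    (e : S) : Submodule k X where
  carrier := {x | e • x = x}
  add_mem' {x y} hx hy := by
    rw [Set.mem_ofPred_eq, smul_add, hx, hy]
  zero_mem' := smul_zero e
  smul_mem' r x hx := by
    have : SMulCommClass k S X := IsScalarTower.to_smulCommClass
    rw [Set.mem_ofPred_eq, ← smul_comm, hx]

/-- The action of an arrow between corners. -/
def cornerMap (e f g : S) (hg : f * g = g) : corner (k := k) X e →ₗ[k] corner (k := k) X f where
  toFun x := ⟨g • x.1, by
    change f • g • x.1 = g • x.1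
    rw [smul_smul, hg]⟩
  map_add' x y := Subtype.ext (smul_add _ _ _)
  map_smul' r x := by
    have : SMulCommClass k S X := IsScalarTower.to_smulCommClass
    exact Subtype.ext (smul_comm g r x.1)

/-- A generating string of vectors. -/
structure GenString (γ E F : ℕ → S) (y : ℕ → X) : Prop where
  mem : ∀ a, γ a • y a = y a
  up : ∀ a, E a • y a = 0 ∨ E a • y a = y (a + 1)
  down : ∀ a, F a • y (a + 1) = 0 ∨ F a • y (a + 1) = y a

theorem GenString.stable {y : ℕ → X} (hy : GenString γ E F y) :
    Stable (k := k) γ E F fun a => Submodule.span k {y a} where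
  mem a x hx := by
    have : SMulCommClass k S X := IsScalarTower.to_smulCommClass
    obtain ⟨r, rfl⟩ := Submodule.mem_span_singleton.1 hx
    rw [← smul_comm, hy.mem]
  up a x hx := by
    have : SMulCommClass k S X := IsScalarTower.to_smulCommClass
    obtain ⟨r, rfl⟩ := Submodule.mem_span_singleton.1 hx
    rw [← smul_comm]
    refine Submodule.smul_mem _ _ ?_
    rcases hy.up a with h | h <;> rw [h]
    · exact Submodule.zero_mem _
    · exact Submodule.mem_span_singleton_self _
  down a x hx := by
    have : SMulCommClass k S X := IsScalarTower.to_smulCommClass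
    obtain ⟨r, rfl⟩ := Submodule.mem_span_singleton.1 hx
    rw [← smul_comm]
    refine Submodule.smul_mem _ _ ?_
    rcases hy.down a with h | h <;> rw [h]
    · exact Submodule.zero_mem _
    · exact Submodule.mem_span_singleton_self _

include h in
theorem exists_genString [Module.Finite k X] (hcS : ∀ s, c * s = s * c)
    (hcX : ∀ x : X, c • x = 0) (hX : IsIndec S X) :
    ∃ y : ℕ → X, GenString γ E F y ∧ gen S (fun a => Submodule.span k {y a}) = ⊤ := by
  let V : ℕ → Submodule k X := fun a => corner X (γ a)
  have hcs : ∀ s (x : X), (c * s) • x = 0 := fun s x => by rw [hcS, mul_smul, hcX, smul_zero]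
  obtain ⟨y, Z, hyZ⟩ := exists_stringSummand N (fun a => V a)
    (fun a => cornerMap (γ a) (γ (a + 1)) (E a) (h.left_E a))
    (fun a => cornerMap (γ (a + 1)) (γ a) (F a) (h.left_F a)) {⊥, ⊤}
    (fun a x => Subtype.ext (by
      obtain ⟨s, hs⟩ := h.EF a
      change E a • F a • x.1 = 0
      rw [smul_smul, hs, hcs]))
    (fun a x => Subtype.ext (by
      obtain ⟨s, hs⟩ := h.FE a
      change F a • E a • x.1 = 0
      rw [smul_smul, hs, hcs]))
    (fun a ha => ⟨fun x y => by
      have : ∀ x : V a, x = 0 := fun x => Subtype.ext (by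
        have h1 : γ a • x.1 = x.1 := x.2
        rw [← h1, h.vanish a ha, zero_smul]; rfl)
      rw [this x, this y]⟩)
    (by
      by_contra hno
      push Not at hno
      have := hX.1
      obtain ⟨x, hx⟩ := exists_ne (0 : X)
      refine hx (h.eq_zero_of_smul fun b s => ?_)
      have h1 : γ b • s • x ∈ V b := by
        change γ b • γ b • s • x = γ b • s • x
        rw [smul_smul, h.idem]
      have h2 := hno b
      exact congrArg Subtype.val (Subsingleton.elim (⟨_, h1⟩ : V b) 0))
    (Or.inl rfl) (Or.inr rfl) (by
      rintro _ (rfl | rfl) _ (rfl | rfl) <;> simp)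
  have hy : GenString γ E F (fun a => (y a : X)) :=
    { mem := fun a => (y a).2
      up := fun a => (hyZ.up a).imp (congrArg Subtype.val) (congrArg Subtype.val)
      down := fun a => (hyZ.down a).imp (congrArg Subtype.val) (congrArg Subtype.val) }
  refine ⟨fun a => y a, hy, ?_⟩
  let Y : ℕ → Submodule k X := fun a => Submodule.span k {(y a : X)}
  let Z' : ℕ → Submodule k X := fun a => (Z a).map (V a).subtype
  have hZ : Stable γ E F Z' :=
    { mem := by
        rintro a _ ⟨z, -, rfl⟩
        exact z.2
      up := by
        rintro a _ ⟨z, hz, rfl⟩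
        exact ⟨_, hyZ.up_le a z hz, rfl⟩
      down := by
        rintro a _ ⟨z, hz, rfl⟩
        exact ⟨_, hyZ.down_le a z hz, rfl⟩ }
  have hcompl : IsCompl (gen S Y) (gen S Z') := by
    constructor
    · rw [Submodule.disjoint_def]
      intro x hx hx'
      refine h.eq_zero_of_smul fun b s => ?_
      have h1 := h.smul_gen_mem hcS hcX hy.stable b _ (Submodule.smul_mem _ s hx)
      obtain ⟨z, hz, hz'⟩ := h.smul_gen_mem hcS hcX hZ b _ (Submodule.smul_mem _ s hx')
      obtain ⟨r, hr⟩ := Submodule.mem_span_singleton.1 h1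
      rw [← hr] at hz' ⊢
      have hz1 : z = r • y b := Subtype.ext hz'
      have h2 := Submodule.disjoint_def.1 (hyZ.isCompl b).disjoint z
        (hz1 ▸ Submodule.smul_mem _ _ (Submodule.mem_span_singleton_self _)) hz
      rw [← hz', h2]; rfl
    · rw [codisjoint_iff]
      refine h.eq_top_of_mem fun b x => ?_
      have h1 : γ b • x ∈ V b := by
        change γ b • γ b • x = γ b • x
        rw [smul_smul, h.idem]
      have h2 : (⟨γ b • x, h1⟩ : V b) ∈ Submodule.span k {y b} ⊔ Z b :=
        (hyZ.isCompl b).sup_eq_top ▸ Submodule.mem_top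
      obtain ⟨u, hu, z, hz, huz⟩ := Submodule.mem_sup.1 h2
      obtain ⟨r, rfl⟩ := Submodule.mem_span_singleton.1 hu
      rw [← show r • (y b : X) + (z : X) = γ b • x from congrArg Subtype.val huz]
      refine Submodule.add_mem _ (Submodule.mem_sup_left (Submodule.subset_span ?_))
        (Submodule.mem_sup_right (Submodule.subset_span ?_))
      · exact Set.mem_iUnion.2 ⟨b, Submodule.smul_mem _ _ (Submodule.mem_span_singleton_self _)⟩
      · exact Set.mem_iUnion.2 ⟨b, z, hz, rfl⟩
  obtain ⟨a, ha⟩ := hyZ.ne_zero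
  have hYa : (y a : X) ∈ gen S Y :=
    Submodule.subset_span (Set.mem_iUnion.2 ⟨a, Submodule.mem_span_singleton_self _⟩)
  rcases hX.2 ((gen S Y).subtype ∘ₗ Submodule.projectionOnto _ _ hcompl) (by
    ext x
    exact congrArg Subtype.val (Submodule.projectionOnto_apply_left hcompl _)) with h1 | h1
  · exfalso
    apply ha
    have h2 := LinearMap.congr_fun h1 (y a : X)
    have h3 : Submodule.projectionOnto _ _ hcompl (y a : X) = ⟨_, hYa⟩ :=
      Submodule.projectionOnto_apply_left hcompl ⟨_, hYa⟩
    rw [LinearMap.comp_apply, h3] at h2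
    exact Subtype.ext h2
  · rw [eq_top_iff]
    intro x _
    rw [← LinearMap.id_apply (R := S) x, ← h1]
    exact Subtype.property _

include h in
theorem gen_prod_bijective (hcS : ∀ s, c * s = s * c) {X' : Type} [AddCommGroup X']
    [Module S X'] [Module k X'] [IsScalarTower k S X'] (hcX : ∀ x : X, c • x = 0)
    (hcX' : ∀ x : X', c • x = 0) {y : ℕ → X} {y' : ℕ → X'}
    (hy : GenString γ E F fun a => (y a, y' a)) (h0 : ∀ a, y a = 0 → y' a = 0)
    (hgen : gen S (fun a => Submodule.span k {y a}) = ⊤) :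
    Function.Bijective (LinearMap.fst S X X' ∘ₗ
      (gen S (fun a => Submodule.span k {(y a, y' a)})).subtype) := by
  constructor
  · rw [← LinearMap.ker_eq_bot, LinearMap.ker_eq_bot']
    rintro ⟨⟨x, x'⟩, hx⟩ h1
    have h1' : x = 0 := h1
    subst h1'
    refine Subtype.ext (Prod.ext rfl (h.eq_zero_of_smul fun b s => ?_))
    have h2 := h.smul_gen_mem hcS (fun x => Prod.ext (hcX _) (hcX' _)) hy.stable b _
      (Submodule.smul_mem _ s hx)
    obtain ⟨r, hr⟩ := Submodule.mem_span_singleton.1 h2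
    have h3 : r • y b = 0 := by
      have := congrArg Prod.fst hr
      simpa using this
    have h4 : r • y' b = γ b • s • x' := congrArg Prod.snd hr
    rw [← h4]
    rcases smul_eq_zero.1 h3 with h5 | h5
    · rw [h5, zero_smul]
    · rw [h0 b h5, smul_zero]
  · rw [← LinearMap.range_eq_top, eq_top_iff, ← hgen, gen, Submodule.span_le]
    intro x hx
    obtain ⟨a, ha⟩ := Set.mem_iUnion.1 hx
    obtain ⟨r, rfl⟩ := Submodule.mem_span_singleton.1 ha
    exact ⟨⟨r • (y a, y' a), Submodule.subset_span (Set.mem_iUnion.2 ⟨a,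
      Submodule.smul_mem _ _ (Submodule.mem_span_singleton_self _)⟩)⟩, rfl⟩

/-- The combinatorial type of a generating string. -/
def code (N : ℕ) (E F : ℕ → S) (y : ℕ → X) : Fin N → Prop × Prop × Prop := fun a =>
  (y a = 0, E a • y a = 0, F a • y (a + 1) = 0)

include h in
theorem nonempty_equiv_of_code (hcS : ∀ s, c * s = s * c) {X' : Type} [AddCommGroup X']
    [Module S X'] [Module k X'] [IsScalarTower k S X'] (hcX : ∀ x : X, c • x = 0)
    (hcX' : ∀ x : X', c • x = 0) {y : ℕ → X} {y' : ℕ → X'} (hy : GenString γ E F y)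
    (hy' : GenString γ E F y') (hgen : gen S (fun a => Submodule.span k {y a}) = ⊤)
    (hgen' : gen S (fun a => Submodule.span k {y' a}) = ⊤)
    (hcode : code N E F y = code N E F y') : Nonempty (X ≃ₗ[S] X') := by
  have hz : ∀ a, N ≤ a → y a = 0 ∧ y' a = 0 := fun a ha =>
    ⟨by rw [← hy.mem, h.vanish a ha, zero_smul], by rw [← hy'.mem, h.vanish a ha, zero_smul]⟩
  have h1 : ∀ a, y a = 0 ↔ y' a = 0 := fun a => by
    rcases lt_or_ge a N with ha | ha
    · exact iff_of_eq (congrArg Prod.fst (congrFun hcode ⟨a, ha⟩))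
    · simp [hz a ha]
  have h2 : ∀ a, E a • y a = 0 ↔ E a • y' a = 0 := fun a => by
    rcases lt_or_ge a N with ha | ha
    · exact iff_of_eq (congrArg (fun x => x.2.1) (congrFun hcode ⟨a, ha⟩))
    · simp [hz a ha]
  have h3 : ∀ a, F a • y (a + 1) = 0 ↔ F a • y' (a + 1) = 0 := fun a => by
    rcases lt_or_ge a N with ha | ha
    · exact iff_of_eq (congrArg (fun x => x.2.2) (congrFun hcode ⟨a, ha⟩))
    · simp [hz (a + 1) (by omega)]
  have hw : GenString γ E F fun a => (y a, y' a) :=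
    { mem := fun a => Prod.ext (hy.mem a) (hy'.mem a)
      up := fun a => by
        rcases hy.up a with h4 | h4
        · exact Or.inl (Prod.ext h4 ((h2 a).1 h4))
        · rcases hy'.up a with h5 | h5
          · exact Or.inl (Prod.ext ((h2 a).2 h5) h5)
          · exact Or.inr (Prod.ext h4 h5)
      down := fun a => by
        rcases hy.down a with h4 | h4
        · exact Or.inl (Prod.ext h4 ((h3 a).1 h4))
        · rcases hy'.down a with h5 | h5
          · exact Or.inl (Prod.ext ((h3 a).2 h5) h5)
          · exact Or.inr (Prod.ext h4 h5) }
  have hw' : GenString γ E F fun a => (y' a, y a) :=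
    { mem := fun a => Prod.ext (hy'.mem a) (hy.mem a)
      up := fun a => (hw.up a).imp (congrArg Prod.swap) (congrArg Prod.swap)
      down := fun a => (hw.down a).imp (congrArg Prod.swap) (congrArg Prod.swap) }
  let e1 := LinearEquiv.ofBijective _
    (h.gen_prod_bijective (k := k) hcS hcX hcX' hw (fun a => (h1 a).1) hgen)
  let e2 := LinearEquiv.ofBijective _
    (h.gen_prod_bijective (k := k) hcS hcX' hcX hw' (fun a => (h1 a).2) hgen')
  let D := gen S (fun a => Submodule.span k {(y a, y' a)})
  let D' := gen S (fun a => Submodule.span k {(y' a, y a)})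
  have hD : D.map (LinearEquiv.prodComm S X X').toLinearMap = D' := by
    refine le_antisymm ?_ ?_
    · rw [Submodule.map_le_iff_le_comap]
      refine Submodule.span_le.2 fun x hx => ?_
      obtain ⟨a, ha⟩ := Set.mem_iUnion.1 hx
      obtain ⟨r, rfl⟩ := Submodule.mem_span_singleton.1 ha
      exact Submodule.subset_span (Set.mem_iUnion.2 ⟨a, Submodule.mem_span_singleton.2 ⟨r, rfl⟩⟩)
    · refine Submodule.span_le.2 fun x hx => ?_
      obtain ⟨a, ha⟩ := Set.mem_iUnion.1 hx
      obtain ⟨r, rfl⟩ := Submodule.mem_span_singleton.1 ha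
      exact ⟨r • (y a, y' a), Submodule.subset_span (Set.mem_iUnion.2 ⟨a,
        Submodule.mem_span_singleton.2 ⟨r, rfl⟩⟩), rfl⟩
  exact ⟨e1.symm.trans (((LinearEquiv.prodComm S X X').submoduleMap D).trans
    ((LinearEquiv.ofEq _ _ hD).trans e2))⟩

end ChainData

/-- An algebra with chain data for some central nilpotent element is τ-tilting finite. -/
theorem ChainData.tauTiltingFinite {A : Type} [Ring A] [Algebra k A] [Module.Finite k A]
    {c : Aᵐᵒᵖ} (hcS : ∀ s, c * s = s * c) (hn : IsNilpotent c) {N : ℕ} {γ E F : ℕ → Aᵐᵒᵖ}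
    (h : ChainData k c N γ E F) : TauTiltingFinite k A := by
  classical
  let good : (Fin N → Prop × Prop × Prop) → ModuleCat.{0} Aᵐᵒᵖ → Prop := fun w X =>
    (∀ x : X, c • x = 0) ∧
    let _ : Module k X := Module.compHom X (algebraMap k Aᵐᵒᵖ)
    ∃ y : ℕ → X, GenString γ E F y ∧ gen Aᵐᵒᵖ (fun a => Submodule.span k {y a}) = ⊤ ∧
      code N E F y = w
  let R : (Fin N → Prop × Prop × Prop) → ModuleCat.{0} Aᵐᵒᵖ := fun w =>
    if h : ∃ X, good w X then h.choose else ModuleCat.of _ PUnit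
  refine tauTiltingFinite_of_central k A c hcS hn R fun X _ _ hf hX hcX => ?_
  let _ : Module k X := Module.compHom X (algebraMap k Aᵐᵒᵖ)
  have : IsScalarTower k Aᵐᵒᵖ X := ⟨fun r s x => by
    rw [Algebra.smul_def, mul_smul]; rfl⟩
  have : Module.Finite k X := Module.Finite.trans Aᵐᵒᵖ X
  obtain ⟨y, hy, hgen⟩ := h.exists_genString (k := k) hcS hcX hX
  have hgood : ∃ X, good (code N E F y) X := ⟨ModuleCat.of _ X, hcX, y, hy, hgen, rfl⟩
  refine ⟨code N E F y, ?_⟩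
  have hR : R (code N E F y) = hgood.choose := dif_pos hgood
  rw [hR]
  obtain ⟨hcX', y', hy', hgen', hcode⟩ := hgood.choose_spec
  let _ : Module k hgood.choose := Module.compHom hgood.choose (algebraMap k Aᵐᵒᵖ)
  have : IsScalarTower k Aᵐᵒᵖ hgood.choose := ⟨fun r s x => by
    rw [Algebra.smul_def, mul_smul]; rfl⟩
  exact h.nonempty_equiv_of_code hcS hcX hcX' hy hy' hgen hgen' hcode.symm

end ChainData

section HomVanishing

variable {S : Type} [Ring S] {P1 P0 X Y : Type} [AddCommGroup P1] [Module S P1]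
  [AddCommGroup P0] [Module S P0] [AddCommGroup X] [Module S X] [AddCommGroup Y] [Module S Y]
  {f : P1 →ₗ[S] P0}

theorem HomVanish.retract (h : HomVanish f X) (r : IsRetract S Y X) : HomVanish f Y := by
  obtain ⟨i, p, hip⟩ := r
  intro φ
  obtain ⟨u, hu⟩ := h (i ∘ₗ φ)
  exact ⟨p ∘ₗ u, by rw [LinearMap.comp_assoc, hu, ← LinearMap.comp_assoc, hip,
    LinearMap.id_comp]⟩

theorem HomVanish.pi {ι : Type} {X : ι → Type} [∀ i, AddCommGroup (X i)] [∀ i, Module S (X i)]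
    (h : ∀ i, HomVanish f (X i)) : HomVanish f (∀ i, X i) := by
  intro φ
  choose u hu using fun i => h i (LinearMap.proj i ∘ₗ φ)
  refine ⟨LinearMap.pi u, LinearMap.ext fun x => funext fun i => ?_⟩
  exact LinearMap.congr_fun (hu i) x

theorem HomVanish.quotient_right [Module.Projective S P1] (h : HomVanish f X)
    (q : X →ₗ[S] Y) (hq : Function.Surjective q) : HomVanish f Y := by
  intro φ
  obtain ⟨ψ, hψ⟩ := Module.projective_lifting_property q φ hq
  obtain ⟨u, hu⟩ := h ψ
  exact ⟨q ∘ₗ u, by rw [LinearMap.comp_assoc, hu, hψ]⟩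

theorem HomVanish.prod (h : HomVanish f X) (h' : HomVanish f Y) : HomVanish f (X × Y) := by
  intro φ
  obtain ⟨u, hu⟩ := h (LinearMap.fst S X Y ∘ₗ φ)
  obtain ⟨v, hv⟩ := h' (LinearMap.snd S X Y ∘ₗ φ)
  exact ⟨u.prod v, LinearMap.ext fun x =>
    Prod.ext (LinearMap.congr_fun hu x) (LinearMap.congr_fun hv x)⟩

/-- The product of a family of linear maps. -/
def piMapLin {ι : Type} {X Y : ι → Type} [∀ i, AddCommGroup (X i)] [∀ i, Module S (X i)]
    [∀ i, AddCommGroup (Y i)] [∀ i, Module S (Y i)] (f : ∀ i, X i →ₗ[S] Y i) :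
    (∀ i, X i) →ₗ[S] (∀ i, Y i) :=
  LinearMap.pi fun i => f i ∘ₗ LinearMap.proj i

theorem HomVanish.piMap {ι : Type} [Finite ι] {P P' : ι → Type} [∀ i, AddCommGroup (P i)]
    [∀ i, Module S (P i)] [∀ i, AddCommGroup (P' i)] [∀ i, Module S (P' i)]
    {f : ∀ i, P i →ₗ[S] P' i} (h : ∀ i, HomVanish (f i) X) : HomVanish (piMapLin f) X := by
  classical
  cases nonempty_fintype ι
  intro φ
  choose u hu using fun i => h i (φ ∘ₗ LinearMap.single S P i)
  refine ⟨∑ i, u i ∘ₗ LinearMap.proj i, ?_⟩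
  apply LinearMap.pi_ext'
  intro i
  rw [← hu i]
  ext x
  simp only [LinearMap.comp_apply, LinearMap.sum_apply, LinearMap.proj_apply]
  rw [Finset.sum_eq_single i]
  · simp [piMapLin]
  · intro j _ hj
    simp [piMapLin, hj]
  · simp

end HomVanishing

section Sincere

variable {S : Type} [Ring S]

variable (S) in
/-- A module is sincere if every nonzero finitely generated projective module maps nontrivially
to it. -/
def IsSincere (T : Type) [AddCommGroup T] [Module S T] : Prop :=
  ∀ (Q : Type) [AddCommGroup Q] [Module S Q], Module.Finite S Q → Module.Projective S Q →
    (∀ h : Q →ₗ[S] T, h = 0) → Subsingleton Q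

variable {T P1 P0 : Type} [AddCommGroup T] [Module S T] [AddCommGroup P1] [Module S P1]
  [AddCommGroup P0] [Module S P0] {f : P1 →ₗ[S] P0}

theorem IsSincere.of_retract {U : Type} [AddCommGroup U] [Module S U] (hU : IsSincere S U)
    (h : IsRetract S U T) : IsSincere S T := by
  obtain ⟨i, p, hip⟩ := h
  intro Q _ _ hQ hQ' h0
  refine hU Q hQ hQ' fun φ => ?_
  have := h0 (i ∘ₗ φ)
  rw [← LinearMap.id_comp φ, ← hip, LinearMap.comp_assoc, this, LinearMap.comp_zero]

theorem IsSincere.superfluous_ker [IsNoetherian S P1] [IsArtinian S P1]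
    [Module.Projective S P1] (hT : IsSincere S T) (hf : HomVanish f T) :
    SuperfluousSubmodule (LinearMap.ker f) := by
  obtain ⟨K, Q, hKQ, hQ, hc⟩ := exists_cover_summand f.rangeRestrict f.surjective_rangeRestrict
  rw [LinearMap.ker_rangeRestrict] at hQ
  have hr : Q.projectionOnto K hKQ.symm ∘ₗ Q.subtype = LinearMap.id :=
    LinearMap.ext fun x => Submodule.projectionOnto_apply_left hKQ.symm x
  have hQ0 : Subsingleton Q := by
    refine hT Q inferInstance (Module.Projective.of_split _ _ hr) fun h => ?_
    obtain ⟨u, hu⟩ := hf (h ∘ₗ Q.projectionOnto K hKQ.symm)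
    have h1 : h = (h ∘ₗ Q.projectionOnto K hKQ.symm) ∘ₗ Q.subtype := by
      rw [LinearMap.comp_assoc, hr, LinearMap.comp_id]
    rw [h1, ← hu]
    ext x
    simp [LinearMap.mem_ker.1 (hQ x.2)]
  have hQb : Q = ⊥ := Submodule.subsingleton_iff_eq_bot.1 hQ0
  have hK : K = ⊤ := by simpa [hQb] using hKQ.sup_eq_top
  refine (hc.superfluous.map K.subtype).mono fun x hx => ?_
  refine ⟨⟨x, hK ▸ Submodule.mem_top⟩, ?_, rfl⟩
  exact Subtype.ext hx

/-- A presentation `P1 → P0 → M → 0` by finitely generated projective modules such that every map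
`P1 → T` factors through `P0`. -/
structure IsVanishingPres (T : Type) [AddCommGroup T] [Module S T] {M : Type} [AddCommGroup M]
    [Module S M] (f : P1 →ₗ[S] P0) (g : P0 →ₗ[S] M) : Prop where
  fin1 : Module.Finite S P1
  fin0 : Module.Finite S P0
  proj1 : Module.Projective S P1
  proj0 : Module.Projective S P0
  surj : Function.Surjective g
  exact : LinearMap.range f = LinearMap.ker g
  vanish : HomVanish f T

theorem IsVanishingPres.comp_eq_zero {M : Type} [AddCommGroup M] [Module S M]
    {g : P0 →ₗ[S] M} (h : IsVanishingPres T f g) (x : P1) : g (f x) = 0 := by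
  rw [← LinearMap.mem_ker, ← h.exact]
  exact ⟨x, rfl⟩

theorem IsVanishingPres.isProjCover_pullback [IsNoetherianRing S] [IsArtinianRing S]
    (hT : IsSincere S T) {M P1' P0' : Type} [AddCommGroup M] [Module S M] [AddCommGroup P1']
    [Module S P1'] [AddCommGroup P0'] [Module S P0'] {g : P0 →ₗ[S] M} {f' : P1' →ₗ[S] P0'}
    {g' : P0' →ₗ[S] M} (h : IsVanishingPres T f g) (h' : IsVanishingPres T f' g') :
    ∃ φ : (P0 × P1') →ₗ[S] LinearMap.ker (g ∘ₗ LinearMap.fst S P0 P0' -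
      g' ∘ₗ LinearMap.snd S P0 P0'), IsProjCover φ := by
  have := h.fin0; have := h.proj0; have := h'.fin1; have := h'.proj1
  obtain ⟨σ, hσ⟩ := Module.projective_lifting_property g' g h'.surj
  have hσ' : ∀ x, g' (σ x) = g x := LinearMap.congr_fun hσ
  refine ⟨((LinearMap.fst S P0 P1').prod (σ ∘ₗ LinearMap.fst S P0 P1' +
    f' ∘ₗ LinearMap.snd S P0 P1')).codRestrict _ ?_, inferInstance, ?_, ?_⟩
  · rintro ⟨x, y⟩
    simp [hσ', h'.comp_eq_zero]
  · rintro ⟨⟨x, y⟩, hxy⟩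
    have h1 : g x - g' y = 0 := hxy
    have h2 : y - σ x ∈ LinearMap.range f' := by
      rw [h'.exact, LinearMap.mem_ker, map_sub, hσ', ← neg_sub, h1, neg_zero]
    obtain ⟨z, hz⟩ := h2
    refine ⟨(x, z), Subtype.ext (Prod.ext rfl ?_)⟩
    change σ x + f' z = y
    rw [hz]; abel
  · refine ((hT.superfluous_ker h'.vanish).map (LinearMap.inr S P0 P1')).mono ?_
    rintro ⟨x, y⟩ hxy
    have h1 := congrArg Subtype.val (LinearMap.mem_ker.1 hxy)
    have h2 : x = 0 := congrArg Prod.fst h1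
    have h3 : σ x + f' y = 0 := congrArg Prod.snd h1
    subst h2
    rw [map_zero, zero_add] at h3
    exact ⟨y, h3, rfl⟩

/-- Any two vanishing presentations of the same module define the same virtual projective. -/
theorem IsVanishingPres.nonempty_equiv [IsNoetherianRing S] [IsArtinianRing S]
    (hT : IsSincere S T) {M P1' P0' : Type} [AddCommGroup M] [Module S M] [AddCommGroup P1']
    [Module S P1'] [AddCommGroup P0'] [Module S P0'] {g : P0 →ₗ[S] M} {f' : P1' →ₗ[S] P0'}
    {g' : P0' →ₗ[S] M} (h : IsVanishingPres T f g) (h' : IsVanishingPres T f' g') :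
    Nonempty ((P0 × P1') ≃ₗ[S] (P0' × P1)) := by
  obtain ⟨φ, hφ⟩ := h.isProjCover_pullback hT h'
  obtain ⟨ψ, hψ⟩ := h'.isProjCover_pullback hT h
  have := h.fin0; have := h.proj0; have := h'.fin1; have := h'.proj1
  have hswap : ∀ x : P0' × P0, x ∈ LinearMap.ker (g' ∘ₗ LinearMap.fst S P0' P0 -
      g ∘ₗ LinearMap.snd S P0' P0) → LinearEquiv.prodComm S P0' P0 x ∈
      LinearMap.ker (g ∘ₗ LinearMap.fst S P0 P0' - g' ∘ₗ LinearMap.snd S P0 P0') := by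
    rintro ⟨x, y⟩ hxy
    have h1 : g' x - g y = 0 := hxy
    change g y - g' x = 0
    rw [← neg_sub, h1, neg_zero]
  let e := ((LinearEquiv.prodComm S P0' P0).toLinearMap.restrict hswap) ∘ₗ ψ
  have he : IsProjCover e := by
    refine ⟨hψ.proj, ?_, hψ.superfluous.mono ?_⟩
    · rintro ⟨⟨x, y⟩, hxy⟩
      have h1 : g x - g' y = 0 := hxy
      obtain ⟨z, hz⟩ := hψ.surj ⟨(y, x), show g' y - g x = 0 by rw [← neg_sub, h1, neg_zero]⟩
      exact ⟨z, Subtype.ext (congrArg Prod.swap (congrArg Subtype.val hz))⟩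
    · intro x hx
      have h1 : Prod.swap (ψ x : P0' × P0) = 0 := congrArg Subtype.val (LinearMap.mem_ker.1 hx)
      exact Subtype.ext (Prod.swap_injective h1)
  exact hφ.equiv he

end Sincere

section HomDim

variable (k S : Type) [Field k] [Ring S] [Algebra k S]

/-- The dimension over `k` of `Hom_S(P, X)`. -/
def homDim (P X : Type) [AddCommGroup P] [Module S P] [AddCommGroup X] [Module S X] : ℕ :=
  letI : Module k X := Module.compHom X (algebraMap k S)
  haveI : IsScalarTower k S X := ⟨fun c s x => by
    change (c • s) • x = algebraMap k S c • s • x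
    rw [Algebra.smul_def, mul_smul]⟩
  Module.finrank k (P →ₗ[S] X)

variable {S} {P P' X X' M P1 P0 : Type} [AddCommGroup P] [Module S P] [AddCommGroup P']
  [Module S P'] [AddCommGroup X] [Module S X] [AddCommGroup X'] [Module S X']
  [AddCommGroup M] [Module S M] [AddCommGroup P1] [Module S P1] [AddCommGroup P0] [Module S P0]

theorem exists_scalarTower (X : Type) [AddCommGroup X] [Module S X] :
    ∃ _i : Module k X, IsScalarTower k S X := by
  letI : Module k X := Module.compHom X (algebraMap k S)
  refine ⟨inferInstance, ⟨fun c s x => ?_⟩⟩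
  change (c • s) • x = algebraMap k S c • s • x
  rw [Algebra.smul_def, mul_smul]

theorem homDim_eq [i : Module k X] [IsScalarTower k S X] :
    homDim k S P X = Module.finrank k (P →ₗ[S] X) := by
  have : i = Module.compHom X (algebraMap k S) := by
    ext c x
    exact (algebraMap_smul S c x).symm
  subst this
  rfl

theorem finite_hom [Module.Finite k S] [Module.Finite S P] [Module.Finite S X] [Module k X]
    [IsScalarTower k S X] : Module.Finite k (P →ₗ[S] X) := by
  have : Module.Finite k X := Module.Finite.trans S X
  obtain ⟨n, φ, hφ⟩ := Module.Finite.exists_fin' S P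
  let L : (P →ₗ[S] X) →ₗ[k] (Fin n → X) :=
    { toFun := fun h i => h (φ (Pi.single i 1))
      map_add' := fun _ _ => rfl
      map_smul' := fun _ _ => rfl }
  refine Module.Finite.of_injective L fun h h' hh => ?_
  have h1 : h ∘ₗ φ = h' ∘ₗ φ := by
    apply LinearMap.pi_ext'
    intro i
    ext
    exact congrFun hh i
  exact LinearMap.ext fun x => by
    obtain ⟨y, rfl⟩ := hφ x
    exact LinearMap.congr_fun h1 y

/-- Postcomposition with a linear map. -/
def postcompLin [Module k X] [IsScalarTower k S X] [Module k X'] [IsScalarTower k S X']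
    (q : X →ₗ[S] X') : (P →ₗ[S] X) →ₗ[k] (P →ₗ[S] X') where
  toFun h := q ∘ₗ h
  map_add' _ _ := LinearMap.comp_add _ _ _
  map_smul' c h := LinearMap.ext fun x => LinearMap.map_smul_of_tower q c (h x)

/-- Precomposition with a linear map. -/
def precompLin [Module k X] [IsScalarTower k S X] (q : P' →ₗ[S] P) :
    (P →ₗ[S] X) →ₗ[k] (P' →ₗ[S] X) where
  toFun h := h ∘ₗ q
  map_add' _ _ := LinearMap.add_comp _ _ _
  map_smul' _ _ := rfl

theorem homDim_congr (e : P ≃ₗ[S] P') : homDim k S P X = homDim k S P' X := by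
  obtain ⟨_, _⟩ := exists_scalarTower k (S := S) X
  rw [homDim_eq, homDim_eq]
  refine LinearEquiv.finrank_eq (LinearEquiv.ofLinearMap (precompLin k e.symm.toLinearMap)
    (precompLin k e.toLinearMap) ?_ ?_)
  · ext h x; simp [precompLin]
  · ext h x; simp [precompLin]

theorem homDim_congr_right (e : X ≃ₗ[S] X') : homDim k S P X = homDim k S P X' := by
  obtain ⟨_, _⟩ := exists_scalarTower k (S := S) X
  obtain ⟨_, _⟩ := exists_scalarTower k (S := S) X'
  rw [homDim_eq, homDim_eq]
  refine LinearEquiv.finrank_eq (LinearEquiv.ofLinearMap (postcompLin k e.toLinearMap)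
    (postcompLin k e.symm.toLinearMap) ?_ ?_)
  · ext h x; simp [postcompLin]
  · ext h x; simp [postcompLin]

variable [Module.Finite k S]

theorem homDim_eq_zero_iff [Module.Finite S P] [Module.Finite S X] :
    homDim k S P X = 0 ↔ ∀ h : P →ₗ[S] X, h = 0 := by
  obtain ⟨_, _⟩ := exists_scalarTower k (S := S) X
  have : Module.Finite k (P →ₗ[S] X) := finite_hom k
  rw [homDim_eq, Module.finrank_eq_zero_iff_of_free, subsingleton_iff_forall_eq 0]

omit [Module.Finite k S] in
theorem homDim_of_subsingleton [Subsingleton X] : homDim k S P X = 0 := by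
  obtain ⟨_, _⟩ := exists_scalarTower k (S := S) X
  rw [homDim_eq]
  have : Subsingleton (P →ₗ[S] X) := ⟨fun a b => LinearMap.ext fun x => Subsingleton.elim _ _⟩
  exact Module.finrank_zero_of_subsingleton

theorem homDim_pi [Module.Finite S X] {ι : Type} [Fintype ι] (Q : ι → Type)
    [∀ i, AddCommGroup (Q i)] [∀ i, Module S (Q i)] [∀ i, Module.Finite S (Q i)] :
    homDim k S (∀ i, Q i) X = ∑ i, homDim k S (Q i) X := by
  classical
  obtain ⟨_, _⟩ := exists_scalarTower k (S := S) X
  have h := fun i => finite_hom k (S := S) (P := Q i) (X := X)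
  simp_rw [homDim_eq]
  rw [← Module.finrank_pi_fintype k]
  exact LinearEquiv.finrank_eq (LinearMap.lsum S Q k).symm

theorem homDim_prod [Module.Finite S X] [Module.Finite S P] [Module.Finite S P'] :
    homDim k S (P × P') X = homDim k S P X + homDim k S P' X := by
  obtain ⟨_, _⟩ := exists_scalarTower k (S := S) X
  have h := finite_hom k (S := S) (P := P) (X := X)
  have h' := finite_hom k (S := S) (P := P') (X := X)
  simp_rw [homDim_eq]
  rw [← Module.finrank_prod]
  exact LinearEquiv.finrank_eq (LinearMap.coprodEquiv k).symm

theorem homDim_submodule [Module.Finite S X] [Module.Finite S P] [Module.Projective S P]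
    (N : Submodule S X) : homDim k S P X = homDim k S P N + homDim k S P (X ⧸ N) := by
  have := IsNoetherianRing.of_finite k S
  obtain ⟨_, _⟩ := exists_scalarTower k (S := S) X
  obtain ⟨_, _⟩ := exists_scalarTower k (S := S) N
  obtain ⟨_, _⟩ := exists_scalarTower k (S := S) (X ⧸ N)
  have h := finite_hom k (S := S) (P := P) (X := X)
  simp_rw [homDim_eq]
  have hq : Function.Surjective (postcompLin k (P := P) N.mkQ) := fun φ =>
    Module.projective_lifting_property N.mkQ φ N.mkQ_surjective
  have hi : Function.Injective (postcompLin k (P := P) N.subtype) := fun φ ψ h =>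
    LinearMap.ext fun x => Subtype.ext (LinearMap.congr_fun h x)
  have hk : LinearMap.ker (postcompLin k (P := P) N.mkQ) =
      LinearMap.range (postcompLin k (P := P) N.subtype) := by
    ext φ
    constructor
    · intro hφ
      have h1 : ∀ x, φ x ∈ N := fun x =>
        (Submodule.Quotient.mk_eq_zero N).1 (LinearMap.congr_fun (LinearMap.mem_ker.1 hφ) x)
      exact ⟨φ.codRestrict N h1, rfl⟩
    · rintro ⟨ψ, rfl⟩
      exact LinearMap.ext fun x => (Submodule.Quotient.mk_eq_zero N).2 (ψ x).2
  rw [← (postcompLin k (P := P) N.mkQ).finrank_range_add_finrank_ker, hk,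
    LinearMap.range_eq_top.2 hq, finrank_top, LinearMap.finrank_range_of_inj hi, add_comm]

theorem homDim_presentation [Module.Finite S X] [Module.Finite S P0] {f : P1 →ₗ[S] P0}
    {g : P0 →ₗ[S] M} (hg : Function.Surjective g) (hfg : LinearMap.range f = LinearMap.ker g)
    (hf : HomVanish f X) : homDim k S P0 X = homDim k S M X + homDim k S P1 X := by
  obtain ⟨_, _⟩ := exists_scalarTower k (S := S) X
  have h := finite_hom k (S := S) (P := P0) (X := X)
  simp_rw [homDim_eq]
  have hq : Function.Surjective (precompLin k (X := X) f) := hf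
  have hi : Function.Injective (precompLin k (X := X) g) := fun φ ψ h =>
    LinearMap.ext fun x => by
      obtain ⟨y, rfl⟩ := hg x
      exact LinearMap.congr_fun h y
  have hk : LinearMap.ker (precompLin k (X := X) f) =
      LinearMap.range (precompLin k (X := X) g) := by
    ext φ
    constructor
    · intro hφ
      have h1 : LinearMap.ker g ≤ LinearMap.ker φ := by
        rw [← hfg]
        rintro _ ⟨x, rfl⟩
        exact LinearMap.congr_fun (LinearMap.mem_ker.1 hφ) x
      refine ⟨(LinearMap.ker g).liftQ φ h1 ∘ₗ (g.quotKerEquivOfSurjective hg).symm.toLinearMap,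
        LinearMap.ext fun x => ?_⟩
      change (LinearMap.ker g).liftQ φ h1 ((g.quotKerEquivOfSurjective hg).symm (g x)) = φ x
      rw [LinearEquiv.symm_apply_eq _ |>.2 (g.quotKerEquivOfSurjective_apply_mk hg x).symm]
      rfl
    · rintro ⟨ψ, rfl⟩
      refine LinearMap.ext fun x => ?_
      have h1 : g (f x) = 0 := by
        rw [← LinearMap.mem_ker, ← hfg]
        exact ⟨x, rfl⟩
      change ψ (g (f x)) = 0
      rw [h1, map_zero]
  rw [← (precompLin k (X := X) f).finrank_range_add_finrank_ker, hk,
    LinearMap.range_eq_top.2 hq, finrank_top, LinearMap.finrank_range_of_inj hi, add_comm]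

end HomDim

section NilIdeal

theorem subsingleton_of_le_nil_smul {E M : Type} [Ring E] [AddCommGroup M] [Module E M]
    [Module.Finite E M] (I : Ideal E) (hI : ∀ a ∈ I, IsNilpotent a)
    (h : ∀ x : M, x ∈ I • (⊤ : Submodule E M)) : Subsingleton M := by
  have h1 : I ≤ Ring.jacobson E := by
    rw [← Ideal.jacobson_bot]
    intro x hx
    rw [Ideal.mem_jacobson_iff]
    intro y
    obtain ⟨u, hu⟩ := (hI (y * x) (I.mul_mem_left y hx)).isUnit_one_add
    refine ⟨(↑u⁻¹ : E), ?_⟩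
    rw [Ideal.mem_bot, mul_assoc, sub_eq_zero]
    have h2 : (↑u⁻¹ : E) * (1 + y * x) = 1 := by rw [← hu, Units.inv_mul]
    rw [mul_add, mul_one, add_comm] at h2
    exact h2
  have h2 : (⊤ : Submodule E M) = ⊥ :=
    Module.Finite.fg_top.eq_bot_of_le_jacobson_smul fun x _ => Submodule.smul_mono_left h1 (h x)
  exact (Submodule.subsingleton_iff E).1 (subsingleton_of_bot_eq_top h2.symm)

end NilIdeal

section CommonSummand

variable (k : Type) [Field k] {S : Type} [Ring S] [Algebra k S] [Module.Finite k S]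
  {M N : Type} [AddCommGroup M] [Module S M] [AddCommGroup N] [Module S N]

variable (M N) in
/-- The endomorphisms of `M` factoring through a finite power of `N`. -/
def factorIdeal : Ideal (Module.End S M) where
  carrier := {a | ∃ (ι : Type) (_ : Finite ι) (α : M →ₗ[S] (ι → N)) (β : (ι → N) →ₗ[S] M),
    a = β ∘ₗ α}
  zero_mem' := ⟨Unit, inferInstance, 0, 0, by simp⟩
  add_mem' := by
    rintro _ _ ⟨ι, _, α, β, rfl⟩ ⟨ι', _, α', β', rfl⟩
    refine ⟨ι ⊕ ι', inferInstance, LinearMap.pi (Sum.elim (fun i => LinearMap.proj i ∘ₗ α)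
      (fun i => LinearMap.proj i ∘ₗ α')), β ∘ₗ LinearMap.funLeft S N Sum.inl +
      β' ∘ₗ LinearMap.funLeft S N Sum.inr, LinearMap.ext fun x => ?_⟩
    rfl
  smul_mem' := by
    rintro c _ ⟨ι, h, α, β, rfl⟩
    exact ⟨ι, h, α, c ∘ₗ β, rfl⟩

variable [Module.Finite S M]

include k in
theorem exists_common_retract [Nontrivial M] {l l' : ℕ} (q : (Fin l → N) →ₗ[S] M)
    (hq : Function.Surjective q) (q' : (Fin l' → M) →ₗ[S] N) (hq' : Function.Surjective q') :
    ∃ (L : Type) (_ : AddCommGroup L) (_ : Module S L) (ι : Type) (_ : Finite ι),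
      Nontrivial L ∧ IsRetract S L M ∧ IsRetract S L (ι → N) := by
  have hna : ∃ a ∈ factorIdeal (S := S) M N, ¬ IsNilpotent a := by
    by_contra! hcon
    obtain ⟨_, _⟩ := exists_scalarTower k (S := S) M
    have : Module.Finite k M := Module.Finite.trans S M
    have : Module.Finite (Module.End S M) M := Module.Finite.of_restrictScalars_finite k _ _
    refine not_subsingleton M (subsingleton_of_le_nil_smul _ hcon fun x => ?_)
    have key : ∀ (β : N →ₗ[S] M) (n : N),
        β n ∈ factorIdeal (S := S) M N • (⊤ : Submodule (Module.End S M) M) := by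
      intro β n
      obtain ⟨m, rfl⟩ := hq' n
      have h1 : m = ∑ j, Pi.single j (m j) := (Finset.univ_sum_single m).symm
      rw [h1, map_sum, map_sum]
      refine Submodule.sum_mem _ fun j _ => ?_
      have h2 : (β ∘ₗ q' ∘ₗ LinearMap.single S (fun _ => M) j : Module.End S M) ∈
          factorIdeal (S := S) M N := by
        refine ⟨Unit, inferInstance, LinearMap.pi fun _ => q' ∘ₗ
          LinearMap.single S (fun _ => M) j, β ∘ₗ LinearMap.proj (), rfl⟩
      exact Submodule.smul_mem_smul h2 (Submodule.mem_top (x := m j))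
    obtain ⟨n, rfl⟩ := hq x
    have h1 : n = ∑ j, Pi.single j (n j) := (Finset.univ_sum_single n).symm
    rw [h1, map_sum]
    exact Submodule.sum_mem _ fun j _ => key (q ∘ₗ LinearMap.single S (fun _ => N) j) (n j)
  have := IsNoetherianRing.of_finite k S
  have := IsArtinianRing.of_finite k S
  obtain ⟨_, ⟨ι, hι, α, β, rfl⟩, ha⟩ := hna
  set a : Module.End S M := β ∘ₗ α with hadef
  obtain ⟨n, hc, hn1⟩ := (a.eventually_isCompl_ker_pow_range_pow.and
    (Filter.eventually_ge_atTop 1)).exists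
  obtain ⟨m, rfl⟩ := Nat.exists_eq_add_of_le' hn1
  have hnz : Nontrivial (LinearMap.range (a ^ (m + 1))) := by
    rw [Submodule.nontrivial_iff_ne_bot]
    exact fun h => ha ⟨m + 1, LinearMap.range_eq_bot.1 h⟩
  -- `a` restricts to an automorphism of the range of its power
  have hmem : ∀ x ∈ LinearMap.range (a ^ (m + 1)), a x ∈ LinearMap.range (a ^ (m + 1)) := by
    rintro _ ⟨y, rfl⟩
    exact ⟨a y, by rw [← Module.End.mul_apply, ← Module.End.mul_apply, ← pow_succ, ← pow_succ']⟩
  have hinj : Function.Injective (a.restrict hmem) := by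
    rw [← LinearMap.ker_eq_bot, eq_bot_iff]
    rintro ⟨x, hx⟩ hax
    have h1 : a x = 0 := congrArg Subtype.val (LinearMap.mem_ker.1 hax)
    have h2 : x ∈ LinearMap.ker (a ^ (m + 1)) := by
      rw [LinearMap.mem_ker, pow_succ, Module.End.mul_apply, h1, map_zero]
    have h3 : x ∈ (⊥ : Submodule S M) := hc.inf_eq_bot ▸ ⟨h2, hx⟩
    exact Subtype.ext ((Submodule.mem_bot S).1 h3)
  have hbij := IsArtinian.bijective_of_injective_endomorphism _ hinj
  let e := LinearEquiv.ofBijective _ hbij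
  let i := (LinearMap.range (a ^ (m + 1))).subtype
  let p := (LinearMap.range (a ^ (m + 1))).projectionOnto _ hc.symm
  have hpi : p ∘ₗ i = LinearMap.id :=
    LinearMap.ext fun x => Submodule.projectionOnto_apply_left hc.symm x
  refine ⟨LinearMap.range (a ^ (m + 1)), inferInstance, inferInstance, ι, hι, hnz, ⟨i, p, hpi⟩,
    α ∘ₗ i, e.symm.toLinearMap ∘ₗ p ∘ₗ β, LinearMap.ext fun x => ?_⟩
  change e.symm (p (a x)) = x
  rw [LinearEquiv.symm_apply_eq]
  exact Submodule.projectionOnto_apply_left hc.symm ⟨a x, hmem _ x.2⟩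

end CommonSummand

section Index

variable (k : Type) [Field k] {S : Type} [Ring S] [Algebra k S]
  {T M N : Type} [AddCommGroup T] [Module S T] [AddCommGroup M] [Module S M] [AddCommGroup N]
  [Module S N]

variable (T M) in
/-- `v` is the index of `M` with respect to `T`: the alternating dimension of homomorphisms from a
presentation of `M` which is vanishing on `T`. -/
def IsIndex (v : ModuleCat.{0} S → ℤ) : Prop :=
  ∃ (P1 P0 : ModuleCat.{0} S) (f : P1 →ₗ[S] P0) (g : P0 →ₗ[S] M), IsVanishingPres T f g ∧
    ∀ X : ModuleCat.{0} S, Module.Finite S X → v X = homDim k S P0 X - homDim k S P1 X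

variable {k}

theorem IsVanishingPres.isIndex {P1 P0 : Type} [AddCommGroup P1] [Module S P1] [AddCommGroup P0]
    [Module S P0] {f : P1 →ₗ[S] P0} {g : P0 →ₗ[S] M} (h : IsVanishingPres T f g) :
    IsIndex k T M (fun X : ModuleCat.{0} S => (homDim k S P0 X : ℤ) - homDim k S P1 X) :=
  ⟨ModuleCat.of S P1, ModuleCat.of S P0, f, g, h, fun _ _ => rfl⟩

theorem IsIndex.congr {v : ModuleCat.{0} S → ℤ} (h : IsIndex k T M v) (e : M ≃ₗ[S] N) :
    IsIndex k T N v := by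
  obtain ⟨P1, P0, f, g, h, hv⟩ := h
  refine ⟨P1, P0, f, e.toLinearMap ∘ₗ g, ⟨h.fin1, h.fin0, h.proj1, h.proj0,
    e.surjective.comp h.surj, ?_, h.vanish⟩, hv⟩
  rw [h.exact, LinearEquiv.ker_comp]

variable [Module.Finite k S]

theorem IsIndex.unique (hT : IsSincere S T) {v v' : ModuleCat.{0} S → ℤ} (h : IsIndex k T M v)
    (h' : IsIndex k T M v') (X : ModuleCat.{0} S) (hX : Module.Finite S X) : v X = v' X := by
  have := IsNoetherianRing.of_finite k S
  have := IsArtinianRing.of_finite k S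
  obtain ⟨P1, P0, f, g, h, hv⟩ := h
  obtain ⟨P1', P0', f', g', h', hv'⟩ := h'
  obtain ⟨e⟩ := h.nonempty_equiv hT h'
  have := h.fin1; have := h.fin0; have := h'.fin1; have := h'.fin0
  have h1 := homDim_congr k (X := X) e
  rw [homDim_prod, homDim_prod] at h1
  rw [hv X hX, hv' X hX]
  omega

theorem IsIndex.pi {ι : Type} [Fintype ι] {M : ι → Type} [∀ i, AddCommGroup (M i)]
    [∀ i, Module S (M i)] {v : ι → ModuleCat.{0} S → ℤ} (h : ∀ i, IsIndex k T (M i) (v i)) :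
    IsIndex k T (∀ i, M i) (fun X => ∑ i, v i X) := by
  classical
  choose P1 P0 f g h hv using h
  have h1 := fun i => (h i).fin1
  have h2 := fun i => (h i).fin0
  have h3 := fun i => (h i).proj1
  have h4 := fun i => (h i).proj0
  refine ⟨ModuleCat.of S (∀ i, P1 i), ModuleCat.of S (∀ i, P0 i), piMapLin f, piMapLin g,
    ⟨inferInstanceAs (Module.Finite S (∀ i, P1 i)), inferInstanceAs (Module.Finite S (∀ i, P0 i)),
    Module.Projective.of_equiv (DFinsupp.linearEquivFunOnFintype (R := S) (M := fun i => P1 i)) ,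
    Module.Projective.of_equiv (DFinsupp.linearEquivFunOnFintype (R := S) (M := fun i => P0 i)),
    ?_, ?_, HomVanish.piMap fun i => (h i).vanish⟩, ?_⟩
  · intro y
    choose x hx using fun i => (h i).surj (y i)
    exact ⟨x, funext hx⟩
  · ext y
    constructor
    · rintro ⟨x, rfl⟩
      exact funext fun i => (h i).comp_eq_zero (x i)
    · intro hy
      have h5 : ∀ i, y i ∈ LinearMap.range (f i) := fun i => by
        rw [(h i).exact]
        exact congrFun (LinearMap.mem_ker.1 hy) i
      choose x hx using h5
      exact ⟨x, funext hx⟩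
  · intro X hX
    rw [homDim_pi k (Q := fun i => P0 i), homDim_pi k (Q := fun i => P1 i)]
    push_cast
    rw [← Finset.sum_sub_distrib]
    exact Finset.sum_congr rfl fun i _ => hv i X hX

theorem exists_isIndex [Module.Finite S M] [Module.Finite S T] (hE : ExtVanish S M T) :
    ∃ v : ModuleCat.{0} S → ℤ, IsIndex k T M v := by
  have := IsNoetherianRing.of_finite k S
  have := IsArtinianRing.of_finite k S
  obtain ⟨n, m, P1, P0, f, g, hp1, hp0, hg, hfg, -, hs⟩ := exists_min_pres (S := S) (M := M)
  exact ⟨_, IsVanishingPres.isIndex (f := f) (g := g) ⟨inferInstance, inferInstance, hp1, hp0,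
    hg, hfg, hE.homVanish hg hfg hs⟩⟩

theorem IsIndex.eq_homDim {v : ModuleCat.{0} S → ℤ} (h : IsIndex k T M v) {ι : Type}
    {X : ModuleCat.{0} S} (hX : Module.Finite S X) (q : (ι → T) →ₗ[S] X)
    (hq : Function.Surjective q) : v X = homDim k S M X := by
  obtain ⟨P1, P0, f, g, h, hv⟩ := h
  have := h.fin0; have := h.proj1
  have h1 : HomVanish f X := (HomVanish.pi fun _ => h.vanish).quotient_right q hq
  rw [hv X hX, homDim_presentation k h.surj h.exact h1]
  push_cast
  ring

theorem IsIndex.additive {v : ModuleCat.{0} S → ℤ} (h : IsIndex k T M v) (X : ModuleCat.{0} S)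
    (hX : Module.Finite S X) (L : Submodule S X) :
    v X = v (ModuleCat.of S L) + v (ModuleCat.of S (X ⧸ L)) := by
  have := IsNoetherianRing.of_finite k S
  obtain ⟨P1, P0, f, g, h, hv⟩ := h
  have := h.fin0; have := h.proj1; have := h.proj0; have := h.fin1
  rw [hv X hX, hv (ModuleCat.of S L) (inferInstanceAs (Module.Finite S L)),
    hv (ModuleCat.of S (X ⧸ L)) (inferInstanceAs (Module.Finite S (X ⧸ L))),
    homDim_submodule k L, homDim_submodule (P := P1) k L]
  push_cast
  ring

omit [Module.Finite k S] in
theorem IsIndex.congr_right {v : ModuleCat.{0} S → ℤ} (h : IsIndex k T M v)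
    {X Y : ModuleCat.{0} S} (hX : Module.Finite S X) (e : X ≃ₗ[S] Y) : v X = v Y := by
  obtain ⟨P1, P0, f, g, h, hv⟩ := h
  rw [hv X hX, hv Y (Module.Finite.equiv e), homDim_congr_right k e, homDim_congr_right k e]

omit [Module.Finite k S] in
/-- A map to a quotient lifts when the kernel is a quotient of a power of `T`. -/
theorem IsIndex.lift {v : ModuleCat.{0} S → ℤ} (h : IsIndex k T M v) {ι : Type}
    (R : Submodule S N) (q : (ι → T) →ₗ[S] R) (hq : Function.Surjective q) (φ : M →ₗ[S] N ⧸ R) :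
    ∃ ψ : M →ₗ[S] N, R.mkQ ∘ₗ ψ = φ := by
  obtain ⟨P1, P0, f, g, h, -⟩ := h
  have := h.proj1; have := h.proj0
  have h1 : HomVanish f R := (HomVanish.pi fun _ => h.vanish).quotient_right q hq
  obtain ⟨a, ha⟩ := Module.projective_lifting_property R.mkQ (φ ∘ₗ g) R.mkQ_surjective
  have ha' : ∀ x, R.mkQ (a x) = φ (g x) := LinearMap.congr_fun ha
  have h2 : ∀ x, (a ∘ₗ f) x ∈ R := fun x => by
    rw [← Submodule.Quotient.mk_eq_zero]
    change R.mkQ (a (f x)) = 0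
    rw [ha', h.comp_eq_zero, map_zero]
  obtain ⟨u, hu⟩ := h1 ((a ∘ₗ f).codRestrict R h2)
  have hu' : ∀ x, (u (f x) : N) = a (f x) := fun x =>
    congrArg Subtype.val (LinearMap.congr_fun hu x)
  have h3 : LinearMap.ker g ≤ LinearMap.ker (a - R.subtype ∘ₗ u) := by
    rw [← h.exact]
    rintro _ ⟨x, rfl⟩
    simp [hu']
  refine ⟨(LinearMap.ker g).liftQ _ h3 ∘ₗ (g.quotKerEquivOfSurjective h.surj).symm.toLinearMap,
    LinearMap.ext fun y => ?_⟩
  obtain ⟨x, rfl⟩ := h.surj y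
  change R.mkQ ((LinearMap.ker g).liftQ _ h3 ((g.quotKerEquivOfSurjective h.surj).symm (g x))) = _
  rw [LinearEquiv.symm_apply_eq _ |>.2 (g.quotKerEquivOfSurjective_apply_mk h.surj x).symm]
  change R.mkQ (a x - (u x : N)) = _
  rw [map_sub, ha', sub_eq_self]
  exact (Submodule.Quotient.mk_eq_zero R).2 (u x).2

theorem IsIndex.exists_surjective [Module.Finite S M] [Module.Finite S N]
    {v : ModuleCat.{0} S → ℤ} (h : IsIndex k T M v)
    {ι ι' : Type} (p : (ι → T) →ₗ[S] M) (hp : Function.Surjective p)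
    (p' : (ι' → T) →ₗ[S] N) (hp' : Function.Surjective p')
    (hX : ∀ X : ModuleCat.{0} S, Module.Finite S X → ∀ q : (ι' → T) →ₗ[S] X,
      Function.Surjective q → (∀ φ : M →ₗ[S] X, φ = 0) → ∀ φ : N →ₗ[S] X, φ = 0) :
    ∃ (l : ℕ) (q : (Fin l → M) →ₗ[S] N), Function.Surjective q := by
  obtain ⟨_, _⟩ := exists_scalarTower k (S := S) N
  have hfin : Module.Finite k (M →ₗ[S] N) := finite_hom k
  obtain ⟨l, b, hb⟩ := Module.Finite.exists_fin (R := k) (M := M →ₗ[S] N)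
  let q : (Fin l → M) →ₗ[S] N := ∑ i, b i ∘ₗ LinearMap.proj i
  have hqb : ∀ i x, q (Pi.single i x) = b i x := fun i x => by
    simp only [q, LinearMap.sum_apply, LinearMap.comp_apply, LinearMap.proj_apply]
    rw [Finset.sum_eq_single i]
    · simp
    · intro j _ hj
      simp [hj]
    · simp
  have hR : ∀ (φ : M →ₗ[S] N) x, φ x ∈ LinearMap.range q := by
    intro φ x
    have h1 : φ ∈ Submodule.span k (Set.range b) := hb ▸ Submodule.mem_top
    induction h1 using Submodule.span_induction with
    | mem φ h =>
      obtain ⟨i, rfl⟩ := h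
      exact ⟨_, hqb i x⟩
    | zero => exact Submodule.zero_mem _
    | add a b _ _ h1 h2 => exact Submodule.add_mem _ h1 h2
    | smul c a _ h =>
      rw [LinearMap.smul_apply, ← algebraMap_smul S c (a x)]
      exact Submodule.smul_mem _ _ h
  refine ⟨l, q, ?_⟩
  rw [← LinearMap.range_eq_top, ← Submodule.ker_mkQ (LinearMap.range q), LinearMap.ker_eq_top]
  refine hX (ModuleCat.of S (N ⧸ LinearMap.range q))
    (inferInstanceAs (Module.Finite S (N ⧸ LinearMap.range q)))
    ((LinearMap.range q).mkQ ∘ₗ p') ((Submodule.mkQ_surjective _).comp hp') ?_ _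
  intro φ
  let q2 : (Fin l × ι → T) →ₗ[S] LinearMap.range q := q.rangeRestrict ∘ₗ
    LinearMap.pi fun i => p ∘ₗ LinearMap.funLeft S T (fun j => (i, j))
  obtain ⟨ψ, rfl⟩ := h.lift (LinearMap.range q) q2 (by
    refine q.surjective_rangeRestrict.comp fun y => ?_
    choose x hx using fun i => hp (y i)
    exact ⟨fun z => x z.1 z.2, funext hx⟩) φ
  exact LinearMap.ext fun x => (Submodule.Quotient.mk_eq_zero _).2 (hR ψ x)

end Index

section IndexIndependence

variable (k : Type) [Field k] {S : Type} [Ring S] [Algebra k S] [Module.Finite k S]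
  {T : Type} [AddCommGroup T] [Module S T]

include k in
theorem exists_indec_retract {L : Type} [AddCommGroup L] [Module S L] [Module.Finite S L]
    [Nontrivial L] : ∃ L' : Submodule S L, IsIndec S L' ∧ IsRetract S L' L := by
  have := IsArtinianRing.of_finite k S
  obtain ⟨ι, _, F, hF, ⟨e⟩⟩ := exists_indec_decomposition (S := S) L
  have : Nontrivial (∀ i, F i) := e.symm.toEquiv.nontrivial
  have hne : Nonempty ι := by
    by_contra h
    rw [not_nonempty_iff] at h
    exact not_subsingleton (∀ i, F i) inferInstance
  obtain ⟨i⟩ := hne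
  exact ⟨F i, hF i, (isRetract_pi (fun i => F i) i).trans e.symm.isRetract⟩

variable {k}

omit [Module.Finite k S] in
theorem IsIndex.eq_zero_of_subsingleton {M : Type} [AddCommGroup M] [Module S M]
    {v : ModuleCat.{0} S → ℤ} (h : IsIndex k T M v) (X : ModuleCat.{0} S) (hX : Subsingleton X) :
    v X = 0 := by
  obtain ⟨P1, P0, f, g, h, hv⟩ := h
  rw [hv X inferInstance, homDim_of_subsingleton, homDim_of_subsingleton]
  simp

variable {ι : Type} [Fintype ι] {G : ι → Type} [∀ i, AddCommGroup (G i)] [∀ i, Module S (G i)]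
  {v : ι → ModuleCat.{0} S → ℤ}

theorem IsIndex.sum_eq_zero (hv : ∀ i, IsIndex k T (G i) (v i)) {κ : Type}
    {Sm : κ → ModuleCat.{0} S}
    (hSm : ∀ X : ModuleCat.{0} S, IsSimpleModule S X → ∃ j, Nonempty (X ≃ₗ[S] Sm j)) (c : ι → ℤ)
    (hc : ∀ j, ∑ i, c i * v i (Sm j) = 0) (X : ModuleCat.{0} S) (hX : Module.Finite S X) :
    ∑ i, c i * v i X = 0 := by
  have := IsNoetherianRing.of_finite k S
  have := IsArtinianRing.of_finite k S
  have key : ∀ (X : Type) [AddCommGroup X] [Module S X], IsFiniteLength S X →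
      ∑ i, c i * v i (ModuleCat.of S X) = 0 := by
    intro X _ _ h
    induction h with
    | of_subsingleton =>
      refine Finset.sum_eq_zero fun i _ => ?_
      rw [(hv i).eq_zero_of_subsingleton _ (by assumption), mul_zero]
    | @of_simple_quotient M _ _ N _ h ih =>
      have hN := isFiniteLength_iff_isNoetherian_isArtinian.1 h
      have := hN.1
      have : IsNoetherian S M :=
        (isFiniteLength_iff_isNoetherian_isArtinian.1 (IsFiniteLength.of_simple_quotient h)).1
      obtain ⟨j, ⟨e⟩⟩ := hSm (ModuleCat.of S (M ⧸ N)) (by assumption)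
      have h1 : ∀ i, v i (ModuleCat.of S M) = v i (ModuleCat.of S N) + v i (Sm j) := fun i => by
        rw [(hv i).additive (ModuleCat.of S M) (inferInstanceAs (Module.Finite S M)) N,
          (hv i).congr_right (X := ModuleCat.of S (M ⧸ N)) (Y := Sm j)
            (inferInstanceAs (Module.Finite S (M ⧸ N))) e]
      simp only [h1, mul_add, Finset.sum_add_distrib, ih, hc, add_zero]
  exact key X (isFiniteLength_iff_isNoetherian_isArtinian.2 ⟨inferInstance, inferInstance⟩)

theorem IsRetract.exists_surjective_pi {κ : Type} {F : κ → Type} [∀ i, AddCommGroup (F i)]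
    [∀ i, Module S (F i)] (h : ∀ i, IsRetract S (F i) T) :
    ∃ p : (κ → T) →ₗ[S] (∀ i, F i), Function.Surjective p := by
  obtain ⟨i, p, hip⟩ := IsRetract.pi (N' := fun _ => T) h
  exact ⟨p, IsRetract.surjective hip⟩

theorem IsIndex.homDim_sum [Module.Finite S T] (hv : ∀ i, IsIndex k T (G i) (v i)) {κ : Type}
    {Sm : κ → ModuleCat.{0} S}
    (hSm : ∀ X : ModuleCat.{0} S, IsSimpleModule S X → ∃ j, Nonempty (X ≃ₗ[S] Sm j)) (c : ι → ℤ)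
    (hc : ∀ j, ∑ i, c i * v i (Sm j) = 0) {X : ModuleCat.{0} S} (hX : Module.Finite S X)
    {α : Type} (q : (α → T) →ₗ[S] X) (hq : Function.Surjective q) :
    ∑ i, c i * (homDim k S (G i) X : ℤ) = 0 := by
  rw [← IsIndex.sum_eq_zero hv hSm c hc X hX]
  exact Finset.sum_congr rfl fun i _ => by rw [(hv i).eq_homDim hX q hq]

/-- Given a relation between the values at `X` of nonnegative functions, vanishing on the positive
part forces vanishing on the negative part. -/
theorem sum_sign_vanish {c : ι → ℤ} {d : ι → ℕ} (h : ∑ i, c i * (d i : ℤ) = 0)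
    (hp : ∀ i, 0 < c i → d i = 0) (i : ι) (hi : c i < 0) : d i = 0 := by
  have h1 : ∀ j ∈ Finset.univ, c j * (d j : ℤ) ≤ 0 := fun j _ => by
    rcases lt_or_ge 0 (c j) with h | h
    · simp [hp j h]
    · exact mul_nonpos_of_nonpos_of_nonneg h (by positivity)
  have h2 := (Finset.sum_eq_zero_iff_of_nonpos h1).1 h i (Finset.mem_univ i)
  rcases mul_eq_zero.1 h2 with h | h
  · omega
  · exact_mod_cast h

theorem IsIndex.exists_surjective_of_relation [Module.Finite S T]
    (hG : ∀ i, IsRetract S (G i) T) (hv : ∀ i, IsIndex k T (G i) (v i)) {κ : Type}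
    {Sm : κ → ModuleCat.{0} S}
    (hSm : ∀ X : ModuleCat.{0} S, IsSimpleModule S X → ∃ j, Nonempty (X ≃ₗ[S] Sm j)) (c : ι → ℤ)
    (hc : ∀ j, ∑ i, c i * v i (Sm j) = 0) :
    ∃ (l : ℕ) (q : (Fin l → ∀ i : {i // 0 < c i}, G i) →ₗ[S] (∀ i : {i // c i < 0}, G i)),
      Function.Surjective q := by
  classical
  have hfin : ∀ i, Module.Finite S (G i) := fun i => by
    obtain ⟨a, b, hab⟩ := hG i
    exact Module.Finite.of_surjective b (IsRetract.surjective hab)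
  obtain ⟨p, hp⟩ := IsRetract.exists_surjective_pi (T := T)
    (F := fun i : {i // 0 < c i} => G i) fun i => hG i
  obtain ⟨p', hp'⟩ := IsRetract.exists_surjective_pi (T := T)
    (F := fun i : {i // c i < 0} => G i) fun i => hG i
  refine IsIndex.exists_surjective (IsIndex.pi (M := fun i : {i // 0 < c i} => G i)
    fun i => hv i) p hp p' hp' ?_
  intro X hX q hq hz
  have h1 := IsIndex.homDim_sum hv hSm c hc hX q hq
  have h2 := sum_sign_vanish h1 fun i hi => by
    rw [homDim_eq_zero_iff k]
    intro φ
    have h3 := hz (φ ∘ₗ LinearMap.proj (φ := fun i : {i // 0 < c i} => G i) ⟨i, hi⟩)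
    refine LinearMap.ext fun x => ?_
    have h4 := LinearMap.congr_fun h3 (Pi.single ⟨i, hi⟩ x)
    simpa using h4
  intro φ
  refine LinearMap.pi_ext fun i x => ?_
  have h5 := (homDim_eq_zero_iff k).1 (h2 i i.2) (φ ∘ₗ LinearMap.single S (fun i : {i // c i < 0} => G i) i)
  exact LinearMap.congr_fun h5 x

/-- The indices of pairwise non-isomorphic indecomposable summands are independent. -/
theorem IsIndex.independent [Module.Finite S T]
    (hG : ∀ i, IsRetract S (G i) T) (hI : ∀ i, IsIndec S (G i))
    (hne : ∀ i j, i ≠ j → IsEmpty (G i ≃ₗ[S] G j))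
    (hv : ∀ i, IsIndex k T (G i) (v i)) {κ : Type} {Sm : κ → ModuleCat.{0} S}
    (hSm : ∀ X : ModuleCat.{0} S, IsSimpleModule S X → ∃ j, Nonempty (X ≃ₗ[S] Sm j)) (c : ι → ℤ)
    (hc : ∀ j, ∑ i, c i * v i (Sm j) = 0) : c = 0 := by
  classical
  have hAr := IsArtinianRing.of_finite k S
  have hNo := IsNoetherianRing.of_finite k S
  have hfin : ∀ i, Module.Finite S (G i) := fun i => by
    obtain ⟨a, b, hab⟩ := hG i
    exact Module.Finite.of_surjective b (IsRetract.surjective hab)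
  have key : ∀ c : ι → ℤ, (∀ j, ∑ i, c i * v i (Sm j) = 0) → ∀ i, c i ≤ 0 := by
    intro c hc i0
    by_contra! hi0
    obtain ⟨l, q, hq⟩ := IsIndex.exists_surjective_of_relation hG hv hSm c hc
    obtain ⟨l', q', hq'⟩ := IsIndex.exists_surjective_of_relation hG hv hSm (-c)
      (fun j => by simp [hc j])
    let N := ∀ i : {i // c i < 0}, G i
    let M := ∀ i : {i // 0 < c i}, G i
    let e1 : (∀ i : {i // 0 < (-c) i}, G i) ≃ₗ[S] N :=
      LinearEquiv.piCongrLeft S (fun i : {i // c i < 0} => G i)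
        (Equiv.subtypeEquivRight fun i => by simp)
    let e2 : (∀ i : {i // (-c) i < 0}, G i) ≃ₗ[S] M :=
      LinearEquiv.piCongrLeft S (fun i : {i // 0 < c i} => G i)
        (Equiv.subtypeEquivRight fun i => by simp)
    have : Nontrivial (G i0) := (hI i0).1
    have hM : Nontrivial M :=
      (Function.surjective_eval (⟨i0, hi0⟩ : {i // 0 < c i})).nontrivial
    let q'' : (Fin l' → N) →ₗ[S] M := e2.toLinearMap ∘ₗ q' ∘ₗ
      (LinearEquiv.piCongrRight fun _ : Fin l' => e1.symm).toLinearMap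
    have hq'' : Function.Surjective q'' :=
      e2.surjective.comp (hq'.comp (LinearEquiv.surjective _))
    obtain ⟨L, _, _, α, _, hL, hLM, hLN⟩ := exists_common_retract k q'' hq'' q hq
    have hLf : Module.Finite S L := by
      obtain ⟨a, b, hab⟩ := hLM
      exact Module.Finite.of_surjective b (IsRetract.surjective hab)
    obtain ⟨L', hL', hr⟩ := exists_indec_retract k (S := S) (L := L)
    obtain ⟨i, ⟨ei⟩⟩ := hL'.equiv_of_isRetract_pi
      (F := fun i : {i // 0 < c i} => G i) (fun i => hI i) (hr.trans hLM)
    let e3 : (∀ x : (_ : α) × {i // c i < 0}, G x.2) ≃ₗ[S] (α → N) :=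
      LinearEquiv.piCurry S (fun (_ : α) (i : {i // c i < 0}) => G i)
    obtain ⟨j, ⟨ej⟩⟩ := hL'.equiv_of_isRetract_pi
      (F := fun x : (_ : α) × {i // c i < 0} => G x.2) (fun x => hI x.2)
      ((hr.trans hLN).trans e3.symm.isRetract)
    have hij : (i : ι) ≠ j.2 := fun h => by
      have h1 := i.2
      have h2 := j.2.2
      rw [h] at h1
      exact lt_asymm h1 h2
    exact (hne _ _ hij).false (ei.symm.trans ej)
  funext i
  refine le_antisymm (key c hc i) ?_
  have h := key (-c) (fun j => by simp [hc j]) i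
  simpa using h

end IndexIndependence

section Representatives

variable {S : Type} [Ring S]

/-- A finite family of modules has representatives for its isomorphism classes. -/
theorem exists_representatives {ι : Type} [Finite ι] (F : ι → ModuleCat.{0} S) :
    ∃ (n : ℕ) (σ : Fin n → ι), (∀ a b, a ≠ b → IsEmpty (F (σ a) ≃ₗ[S] F (σ b))) ∧
      ∀ j, ∃ a, Nonempty (F j ≃ₗ[S] F (σ a)) := by
  let r : Setoid ι := ⟨fun i j => Nonempty (F i ≃ₗ[S] F j), fun i => ⟨LinearEquiv.refl S _⟩,
    fun ⟨e⟩ => ⟨e.symm⟩, fun ⟨e⟩ ⟨e'⟩ => ⟨e.trans e'⟩⟩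
  obtain ⟨n, ⟨φ⟩⟩ := Finite.exists_equiv_fin (Quotient r)
  refine ⟨n, fun a => (φ.symm a).out, fun a b hab => ⟨fun e => hab ?_⟩, fun j =>
    ⟨φ (Quotient.mk r j), ?_⟩⟩
  · have h : Quotient.mk r (φ.symm a).out = Quotient.mk r (φ.symm b).out := Quotient.sound ⟨e⟩
    rw [Quotient.out_eq, Quotient.out_eq] at h
    exact φ.symm.injective h
  · beta_reduce
    rw [Equiv.symm_apply_apply]
    exact Quotient.exact (s := r) (Quotient.out_eq _).symm

end Representatives

section Simples

variable {S : Type} [Ring S] {P X Y : Type} [AddCommGroup P] [Module S P] [AddCommGroup X]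
  [Module S X] [AddCommGroup Y] [Module S Y]

/-- A projective module with simple top maps only to its top among the simple modules. -/
theorem IsProjCover.nonempty_equiv_of_ne_zero [IsSimpleModule S X] [IsSimpleModule S Y]
    {g : P →ₗ[S] X} (hg : IsProjCover g) (φ : P →ₗ[S] Y) (hφ : φ ≠ 0) : Nonempty (X ≃ₗ[S] Y) := by
  have hs : Function.Surjective φ := φ.surjective_of_ne_zero hφ
  have h1 : IsCoatom (LinearMap.ker φ) := LinearMap.isCoatom_ker_of_surjective hs
  have h2 : IsCoatom (LinearMap.ker g) := LinearMap.isCoatom_ker_of_surjective hg.surj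
  have h3 : LinearMap.ker g = LinearMap.ker φ := by
    by_contra hne
    exact h1.1 (hg.superfluous _ (h2.sup_eq_top_of_ne h1 hne))
  exact ⟨((g.quotKerEquivOfSurjective hg.surj).symm.trans
    (Submodule.quotEquivOfEq _ _ h3)).trans (φ.quotKerEquivOfSurjective hs)⟩

theorem IsIndec.isProjCover [IsArtinian S P] [IsNoetherian S P] [Module.Projective S P]
    (hP : IsIndec S P) [Nontrivial X] (g : P →ₗ[S] X) (hg : Function.Surjective g) :
    IsProjCover g := by
  obtain ⟨K, Q, hKQ, hQ, hc⟩ := exists_cover_summand g hg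
  have hi : (K.projectionOnto Q hKQ) ∘ₗ K.subtype = LinearMap.id :=
    LinearMap.ext fun x => Submodule.projectionOnto_apply_left hKQ x
  have hK : K = ⊤ := by
    have h := hP.2 (K.subtype ∘ₗ K.projectionOnto Q hKQ) (by
      change (K.subtype ∘ₗ _) ∘ₗ (K.subtype ∘ₗ _) = _
      rw [LinearMap.comp_assoc, ← LinearMap.comp_assoc _ K.subtype, hi, LinearMap.id_comp])
    rcases h with h | h
    · exfalso
      have h0 : ∀ x : K, x = 0 := fun x => by
        have := LinearMap.congr_fun h (x : P)
        simpa using this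
      obtain ⟨y, hy⟩ := exists_ne (0 : X)
      obtain ⟨x, hx⟩ := hc.surj y
      rw [h0 x, map_zero] at hx
      exact hy hx.symm
    · rw [eq_top_iff]
      intro x _
      have := LinearMap.congr_fun h x
      rw [LinearMap.comp_apply] at this
      rw [LinearMap.id_apply] at this
      exact this ▸ (K.projectionOnto Q hKQ x).2
  refine ⟨inferInstance, hg, fun N hN => ?_⟩
  have h1 := hc.superfluous (N.comap K.subtype) ?_
  · rw [eq_top_iff]
    intro x _
    have h2 : (⟨x, hK ▸ Submodule.mem_top⟩ : K) ∈ N.comap K.subtype := h1 ▸ Submodule.mem_top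
    exact h2
  · rw [eq_top_iff]
    rintro ⟨x, hx⟩ -
    obtain ⟨y, hy, z, hz, hyz⟩ := Submodule.mem_sup.1 (hN ▸ Submodule.mem_top : x ∈ _)
    refine Submodule.mem_sup.2 ⟨⟨y, hK ▸ Submodule.mem_top⟩, hy, ⟨z, hK ▸ Submodule.mem_top⟩, hz,
      Subtype.ext hyz⟩

variable (k : Type) [Field k] (S) [Algebra k S] [Module.Finite k S]

theorem exists_simples : ∃ (n : ℕ) (P Sm : Fin n → ModuleCat.{0} S),
    (∀ j, Module.Finite S (P j)) ∧ (∀ j, Module.Projective S (P j)) ∧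
    (∀ j, IsSimpleModule S (Sm j)) ∧ (∀ i j, i ≠ j → IsEmpty (Sm i ≃ₗ[S] Sm j)) ∧
    (∀ X : ModuleCat.{0} S, IsSimpleModule S X → ∃ j, Nonempty (X ≃ₗ[S] Sm j)) ∧
    ∀ i j, homDim k S (P i) (Sm j) = 0 ↔ i ≠ j := by
  have := IsNoetherianRing.of_finite k S
  have := IsArtinianRing.of_finite k S
  obtain ⟨ι, _, F, hF, ⟨e⟩⟩ := exists_indec_decomposition (S := S) S
  have hproj : ∀ i, Module.Projective S (F i) := fun i => by
    obtain ⟨a, b, hab⟩ := (isRetract_pi (fun i => F i) i).trans e.symm.isRetract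
    exact Module.Projective.of_split a b hab
  let J := {i : ι // ∃ X : ModuleCat.{0} S, IsSimpleModule S X ∧
    ∃ g : F i →ₗ[S] X, Function.Surjective g}
  choose X hX g hg using fun j : J => j.2
  have hcov : ∀ j, IsProjCover (g j) := fun j => by
    have := hX j
    have := IsSimpleModule.nontrivial S (X j)
    exact (hF j).isProjCover (g j) (hg j)
  obtain ⟨n, σ, hσ, hσ'⟩ := exists_representatives X
  refine ⟨n, fun a => ModuleCat.of S (F (σ a)), fun a => X (σ a),
    fun j => inferInstanceAs (Module.Finite S (F (σ j))), fun j => hproj (σ j),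
    fun j => hX (σ j), hσ, ?_, ?_⟩
  · intro Y hY
    have := IsSimpleModule.nontrivial S Y
    obtain ⟨y, hy⟩ := exists_ne (0 : Y)
    classical
    have h1 : ∃ i, (LinearMap.toSpanSingleton S Y y ∘ₗ e.symm.toLinearMap) ∘ₗ
        LinearMap.single S (fun i => F i) i ≠ 0 := by
      by_contra! hcon
      have h2 : LinearMap.toSpanSingleton S Y y ∘ₗ e.symm.toLinearMap = 0 :=
        LinearMap.pi_ext fun i x => LinearMap.congr_fun (hcon i) x
      have h3 := LinearMap.congr_fun h2 (e 1)
      simp at h3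
      exact hy h3
    obtain ⟨i, hi⟩ := h1
    have hs := LinearMap.surjective_of_ne_zero hi
    let j : J := ⟨i, Y, hY, _, hs⟩
    have := hX j
    obtain ⟨e1⟩ := (hcov j).nonempty_equiv_of_ne_zero _ hi
    obtain ⟨a, ⟨e2⟩⟩ := hσ' j
    exact ⟨a, ⟨e1.symm.trans e2⟩⟩
  · intro i j
    have := hX (σ i)
    have := hX (σ j)
    have : Module.Finite S (X (σ j)) := inferInstance
    rw [homDim_eq_zero_iff k (P := F (σ i))]
    constructor
    · rintro h rfl
      have := IsSimpleModule.nontrivial S (X (σ i))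
      obtain ⟨y, hy⟩ := exists_ne (0 : X (σ i))
      obtain ⟨x, hx⟩ := hg (σ i) y
      rw [h (g (σ i))] at hx
      exact hy hx.symm
    · intro h φ
      by_contra hφ
      obtain ⟨e⟩ := (hcov (σ i)).nonempty_equiv_of_ne_zero φ hφ
      exact (hσ i j h).false e

end Simples

section Bongartz

variable (k : Type) [Field k] {S : Type} [Ring S] [Algebra k S] [Module.Finite k S]
  {U P1 P0 : Type} [AddCommGroup U] [Module S U] [AddCommGroup P1] [Module S P1]
  [AddCommGroup P0] [Module S P0] {f : P1 →ₗ[S] P0} {g : P0 →ₗ[S] U}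

/-- The universal extension of a power of `U` by a projective module. -/
theorem exists_universal_extension (h : IsVanishingPres U f g) (P : Type) [AddCommGroup P]
    [Module S P] [Module.Finite S P] [Module.Projective S P] :
    ∃ (E Q1 Q0 : ModuleCat.{0} S) (F : Q1 →ₗ[S] Q0) (G : Q0 →ₗ[S] E) (m : ℕ),
      HomVanish f E ∧ Module.Finite S Q1 ∧ Module.Finite S Q0 ∧ Module.Projective S Q1 ∧
      Module.Projective S Q0 ∧ Function.Surjective G ∧ LinearMap.range F = LinearMap.ker G ∧
      (∀ X : ModuleCat.{0} S, HomVanish f X → HomVanish F X) ∧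
      ∀ X : ModuleCat.{0} S, Module.Finite S X → homDim k S Q0 X + m * homDim k S P1 X =
        homDim k S Q1 X + m * homDim k S P0 X + homDim k S P X := by
  have := h.fin1; have := h.fin0; have := h.proj1; have := h.proj0
  obtain ⟨_, _⟩ := exists_scalarTower k (S := S) P
  have hpi : ∀ (m : ℕ) (Q : Type) [AddCommGroup Q] [Module S Q] [Module.Projective S Q],
      Module.Projective S (Fin m → Q) := fun m Q _ _ _ =>
    Module.Projective.of_equiv (DFinsupp.linearEquivFunOnFintype (R := S) (M := fun _ : Fin m => Q))
  have hfin : Module.Finite k (P1 →ₗ[S] P) := finite_hom k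
  obtain ⟨m, b, hb⟩ := Module.Finite.exists_fin (R := k) (M := P1 →ₗ[S] P)
  let H : (Fin m → P1) →ₗ[S] P := ∑ i, b i ∘ₗ LinearMap.proj i
  have hH : ∀ i x, H (Pi.single i x) = b i x := fun i x => by
    simp only [H, LinearMap.sum_apply, LinearMap.comp_apply, LinearMap.proj_apply]
    rw [Finset.sum_eq_single i]
    · simp
    · intro j _ hj
      simp [hj]
    · simp
  let F : (Fin m → P1) →ₗ[S] (Fin m → P0) × P := (piMapLin fun _ => f).prod H
  let G := (LinearMap.range F).mkQ
  let E := ((Fin m → P0) × P) ⧸ LinearMap.range F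
  obtain ⟨_, _⟩ := exists_scalarTower k (S := S) E
  let π : E →ₗ[S] (Fin m → U) := (LinearMap.range F).liftQ
    ((piMapLin fun _ => g) ∘ₗ LinearMap.fst S _ _) (by
      rintro _ ⟨x, rfl⟩
      exact funext fun i => h.comp_eq_zero (x i))
  have hπG : ∀ x, π (G x) = fun i => g (x.1 i) := fun x => rfl
  let inc : P →ₗ[S] E := G ∘ₗ LinearMap.inr S _ _
  have hπs : Function.Surjective π := fun y => by
    choose x hx using fun i => h.surj (y i)
    exact ⟨G (x, 0), funext hx⟩
  have hker : ∀ e : E, π e = 0 → ∃ p, inc p = e := by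
    intro e he
    obtain ⟨⟨a, p⟩, rfl⟩ := (LinearMap.range F).mkQ_surjective e
    have h1 : ∀ i, a i ∈ LinearMap.range f := fun i => by
      rw [h.exact]
      exact congrFun he i
    choose x hx using h1
    refine ⟨p - H x, ?_⟩
    have h2 : G (F x) = 0 := (Submodule.Quotient.mk_eq_zero _).2 ⟨x, rfl⟩
    have h3 : (LinearMap.inr S (Fin m → P0) P (p - H x)) = (a, p) - F x := by
      refine Prod.ext ?_ rfl
      change (0 : Fin m → P0) = a - fun i => f (x i)
      rw [show (fun i => f (x i)) = a from funext hx, sub_self]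
    change G _ = G (a, p)
    rw [h3, map_sub, h2, sub_zero]
  have hinc : ∀ φ : P1 →ₗ[S] P, ∃ w : P0 →ₗ[S] E, inc ∘ₗ φ = w ∘ₗ f := by
    intro φ
    have h1 : φ ∈ Submodule.span k (Set.range b) := hb ▸ Submodule.mem_top
    induction h1 using Submodule.span_induction with
    | mem φ h =>
      obtain ⟨i, rfl⟩ := h
      refine ⟨-(G ∘ₗ LinearMap.inl S _ _ ∘ₗ LinearMap.single S (fun _ => P0) i),
        LinearMap.ext fun x => ?_⟩
      have h2 : G (F (Pi.single i x)) = 0 := (Submodule.Quotient.mk_eq_zero _).2 ⟨_, rfl⟩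
      have h3 : F (Pi.single i x) = LinearMap.inl S _ _ (Pi.single i (f x)) +
          LinearMap.inr S _ _ (b i x) := by
        refine Prod.ext ?_ ?_
        · change (fun j => f ((Pi.single i x : Fin m → P1) j)) = _ + _
          funext j
          by_cases hj : j = i
          · subst hj; simp
          · simp [hj]
        · change H _ = _ + _
          simp [hH]
      rw [h3, map_add] at h2
      exact (neg_eq_of_add_eq_zero_right h2).symm
    | zero => exact ⟨0, by simp⟩
    | add a b _ _ h1 h2 =>
      obtain ⟨w, hw⟩ := h1
      obtain ⟨w', hw'⟩ := h2
      exact ⟨w + w', by rw [LinearMap.comp_add, hw, hw', LinearMap.add_comp]⟩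
    | smul c a _ h =>
      obtain ⟨w, hw⟩ := h
      refine ⟨c • w, LinearMap.ext fun x => ?_⟩
      change inc (c • a x) = c • w (f x)
      rw [← algebraMap_smul S c (a x), map_smul, algebraMap_smul]
      exact congrArg (c • ·) (LinearMap.congr_fun hw x)
  refine ⟨ModuleCat.of S E, ModuleCat.of S (Fin m → P1), ModuleCat.of S ((Fin m → P0) × P), F, G,
    m, ?_, inferInstanceAs (Module.Finite S (Fin m → P1)),
    inferInstanceAs (Module.Finite S ((Fin m → P0) × P)),
    hpi m P1, (by have := hpi m P0; exact inferInstanceAs (Module.Projective S (_ × P))), Submodule.mkQ_surjective _,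
    (Submodule.ker_mkQ _).symm, ?_, ?_⟩
  · intro φ
    change P1 →ₗ[S] E at φ
    obtain ⟨u, hu⟩ := (HomVanish.pi (X := fun _ : Fin m => U) fun _ => h.vanish) (π ∘ₗ φ)
    obtain ⟨u', hu'⟩ := Module.projective_lifting_property π u hπs
    have h1 : ∀ x, (φ - u' ∘ₗ f) x ∈ LinearMap.range inc := fun x => by
      refine hker _ ?_
      rw [LinearMap.sub_apply, map_sub, LinearMap.comp_apply]
      have h2 := LinearMap.congr_fun hu' (f x)
      have h3 := LinearMap.congr_fun hu x
      rw [LinearMap.comp_apply] at h2 h3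
      rw [h2, sub_eq_zero]
      exact h3.symm
    obtain ⟨ψ, hψ⟩ := Module.projective_lifting_property inc.rangeRestrict
      ((φ - u' ∘ₗ f).codRestrict _ h1) inc.surjective_rangeRestrict
    obtain ⟨w, hw⟩ := hinc ψ
    refine ⟨w + u', LinearMap.ext fun x => ?_⟩
    have h2 : inc (ψ x) = φ x - u' (f x) := congrArg Subtype.val (LinearMap.congr_fun hψ x)
    have h3 : inc (ψ x) = w (f x) := LinearMap.congr_fun hw x
    have h4 : φ x = w (f x) + u' (f x) := by rw [← h3, h2, sub_add_cancel]
    exact h4.symm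
  · intro X hX φ
    choose u hu using fun i => hX (φ ∘ₗ LinearMap.single S (fun _ => P1) i)
    refine ⟨(∑ i, u i ∘ₗ LinearMap.proj i) ∘ₗ LinearMap.fst S _ _, ?_⟩
    have h1 : ∀ i x, u i (f x) = φ (Pi.single i x) := fun i x => by
      have := LinearMap.congr_fun (hu i) x
      exact this
    refine LinearMap.pi_ext fun i x => ?_
    have h2 : (∑ j, u j ∘ₗ LinearMap.proj j) (fun j => f ((Pi.single i x : Fin m → P1) j)) =
        φ (Pi.single i x) := by
      simp only [LinearMap.sum_apply, LinearMap.comp_apply, LinearMap.proj_apply]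
      rw [Finset.sum_eq_single i]
      · rw [Pi.single_eq_same, h1]
      · intro j _ hj
        rw [Pi.single_eq_of_ne hj, map_zero, map_zero]
      · simp
    exact h2
  · intro X hX
    have h1 := homDim_prod k (S := S) (P := Fin m → P0) (P' := P) (X := X)
    have h2 := homDim_pi k (S := S) (X := X) (Q := fun _ : Fin m => P0)
    have h3 := homDim_pi k (S := S) (X := X) (Q := fun _ : Fin m => P1)
    simp only [Finset.sum_const, Finset.card_univ, Fintype.card_fin, smul_eq_mul] at h2 h3
    change homDim k S ((Fin m → P0) × P) X + _ = homDim k S (Fin m → P1) X + _ + _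
    rw [h1, h2, h3]
    ring

end Bongartz

section Completion

theorem HomVanish.prodMap {S : Type} [Ring S] {P1 P0 Q1 Q0 X : Type} [AddCommGroup P1]
    [Module S P1] [AddCommGroup P0] [Module S P0] [AddCommGroup Q1] [Module S Q1]
    [AddCommGroup Q0] [Module S Q0] [AddCommGroup X] [Module S X] {f : P1 →ₗ[S] P0}
    {F : Q1 →ₗ[S] Q0} (h : HomVanish f X) (h' : HomVanish F X) : HomVanish (f.prodMap F) X := by
  intro φ
  obtain ⟨u, hu⟩ := h (φ ∘ₗ LinearMap.inl S P1 Q1)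
  obtain ⟨w, hw⟩ := h' (φ ∘ₗ LinearMap.inr S P1 Q1)
  refine ⟨u.coprod w, ?_⟩
  refine LinearMap.prod_ext ?_ ?_
  · refine LinearMap.ext fun x => ?_
    have := LinearMap.congr_fun hu x
    simpa using this
  · refine LinearMap.ext fun x => ?_
    have := LinearMap.congr_fun hw x
    simpa using this

variable (k : Type) [Field k] {S : Type} [Ring S] [Algebra k S] [Module.Finite k S]

variable {k} in
/-- The index of a summand of `T` is a combination of indices of indecomposable summands. -/
theorem IsIndex.exists_combination {T R : Type} [AddCommGroup T] [Module S T] [AddCommGroup R]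
    [Module S R] [Module.Finite S R] (hT : IsSincere S T) {κ : Type} [Fintype κ]
    {G : κ → ModuleCat.{0} S} {v : κ → ModuleCat.{0} S → ℤ} (hv : ∀ a, IsIndex k T (G a) (v a))
    (hG : ∀ L : ModuleCat.{0} S, IsIndec S L → Module.Finite S L → IsRetract S L T →
      ∃ a, Nonempty (L ≃ₗ[S] G a)) (hR : IsRetract S R T) {w : ModuleCat.{0} S → ℤ}
    (hw : IsIndex k T R w) :
    ∃ c : κ → ℤ, ∀ X : ModuleCat.{0} S, Module.Finite S X → w X = ∑ a, c a * v a X := by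
  classical
  have := IsNoetherianRing.of_finite k S
  have := IsArtinianRing.of_finite k S
  obtain ⟨ι, _, F, hF, ⟨e⟩⟩ := exists_indec_decomposition (S := S) R
  have h1 : ∀ i, ∃ a, Nonempty (F i ≃ₗ[S] G a) := fun i =>
    hG (ModuleCat.of S (F i)) (hF i) (inferInstanceAs (Module.Finite S (F i)))
      (((isRetract_pi (fun i => F i) i).trans e.symm.isRetract).trans hR)
  choose a ea using h1
  have h2 : IsIndex k T (∀ i, F i) (fun X => ∑ i, v (a i) X) :=
    IsIndex.pi fun i => (hv (a i)).congr (ea i).some.symm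
  refine ⟨fun b => ∑ i, if a i = b then 1 else 0, fun X hX => ?_⟩
  rw [hw.unique hT (h2.congr e.symm) X hX]
  simp only [Finset.sum_mul, ite_mul, one_mul, zero_mul]
  rw [Finset.sum_comm]
  simp

include k in
theorem exists_maximal_rigid {U P1 P0 : Type} [AddCommGroup U] [Module S U] [AddCommGroup P1]
    [Module S P1] [AddCommGroup P0] [Module S P0] {f : P1 →ₗ[S] P0} {g : P0 →ₗ[S] U}
    (h : IsVanishingPres U f g) (hU : IsSincere S U) :
    ∃ (n : ℕ) (G Sm : Fin n → ModuleCat.{0} S), (∀ i, Module.Finite S (G i)) ∧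
      (∀ i, IsIndec S (G i)) ∧ (∀ i j, i ≠ j → IsEmpty (G i ≃ₗ[S] G j)) ∧
      (∃ N, IsRetract S U (Fin N → ∀ i, G i)) ∧ HomVanish f (∀ i, G i) ∧
      ExtVanish S (∀ i, G i) (∀ i, G i) ∧
      (∀ j, IsSimpleModule S (Sm j)) ∧ (∀ i j, i ≠ j → IsEmpty (Sm i ≃ₗ[S] Sm j)) ∧
      ∀ X : ModuleCat.{0} S, IsSimpleModule S X → ∃ j, Nonempty (X ≃ₗ[S] Sm j) := by
  classical
  have := IsNoetherianRing.of_finite k S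
  have := IsArtinianRing.of_finite k S
  obtain ⟨n, P, Sm, hPf, hPp, hS1, hS2, hS3, hPS⟩ := exists_simples S k
  choose E Q1 Q0 F Γ m hE hQ1 hQ0 hQ1p hQ0p hΓ hFΓ hvan hdim using
    fun j => exists_universal_extension k h (P j)
  have := h.fin1; have := h.fin0; have := h.proj1; have := h.proj0
  have hUf : Module.Finite S U := Module.Finite.of_surjective g h.surj
  have hEf : ∀ j, Module.Finite S (E j) := fun j => Module.Finite.of_surjective (Γ j) (hΓ j)
  let T := U × ∀ j, E j
  have hfT : HomVanish f T := h.vanish.prod (HomVanish.pi hE)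
  have hFT : ∀ j, HomVanish (F j) T := fun j => hvan j (ModuleCat.of S T) hfT
  have hTs : IsSincere S T := hU.of_retract isRetract_prod_left
  have hpi : ∀ (Q : Fin n → ModuleCat.{0} S), (∀ j, Module.Projective S (Q j)) →
      Module.Projective S (∀ j, Q j) := fun Q _ =>
    Module.Projective.of_equiv (DFinsupp.linearEquivFunOnFintype (R := S) (M := fun j => Q j))
  have := hpi Q1 hQ1p
  have := hpi Q0 hQ0p
  have hTT : ExtVanish S T T := by
    refine HomVanish.extVanish (f := f.prodMap (piMapLin F)) (g := g.prodMap (piMapLin Γ)) ?_ ?_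
      (hfT.prodMap (HomVanish.piMap hFT))
    · rintro ⟨x, y⟩
      obtain ⟨x', rfl⟩ := h.surj x
      choose y' hy' using fun j => hΓ j (y j)
      exact ⟨(x', y'), Prod.ext rfl (funext hy')⟩
    · ext ⟨x, y⟩
      constructor
      · rintro ⟨⟨x', y'⟩, hxy⟩
        rw [Prod.ext_iff] at hxy
        obtain ⟨rfl, rfl⟩ := hxy
        refine Prod.ext (h.comp_eq_zero x') (funext fun j => ?_)
        have h1 : F j (y' j) ∈ LinearMap.ker (Γ j) := hFΓ j ▸ ⟨_, rfl⟩
        exact h1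
      · intro hxy
        have h1 := congrArg Prod.fst (LinearMap.mem_ker.1 hxy)
        have h2 := congrArg Prod.snd (LinearMap.mem_ker.1 hxy)
        have h3 : x ∈ LinearMap.range f := by
          rw [h.exact]
          exact h1
        have h4 : ∀ j, y j ∈ LinearMap.range (F j) := fun j => by
          rw [hFΓ j]
          exact congrFun h2 j
        obtain ⟨x', rfl⟩ := h3
        choose y' hy' using h4
        exact ⟨(x', y'), Prod.ext rfl (funext hy')⟩
  obtain ⟨ι, _, D, hD, ⟨e⟩⟩ := exists_indec_decomposition (S := S) T
  obtain ⟨n', σ, hσ, hσ'⟩ := exists_representatives fun i => ModuleCat.of S (D i)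
  let G : Fin n' → ModuleCat.{0} S := fun a => ModuleCat.of S (D (σ a))
  have hGf : ∀ a, Module.Finite S (G a) := fun a => inferInstanceAs (Module.Finite S (D (σ a)))
  have hGr : ∀ a, IsRetract S (G a) T := fun a =>
    (isRetract_pi (fun i => D i) (σ a)).trans e.symm.isRetract
  have hGi : ∀ a, IsIndec S (G a) := fun a => hD (σ a)
  choose v hv using fun a => exists_isIndex (k := k) (hTT.retract_left (hGr a))
  have hGall : ∀ L : ModuleCat.{0} S, IsIndec S L → Module.Finite S L → IsRetract S L T →
      ∃ a, Nonempty (L ≃ₗ[S] G a) := by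
    intro L hL _ hr
    obtain ⟨i, ⟨ei⟩⟩ := hL.equiv_of_isRetract_pi hD (hr.trans e.isRetract)
    obtain ⟨a, ⟨ea⟩⟩ := hσ' i
    exact ⟨a, ⟨ei.trans ea⟩⟩
  obtain ⟨c0, hc0⟩ := IsIndex.exists_combination hTs hv hGall isRetract_prod_left
    (IsVanishingPres.isIndex (k := k) (T := T) (f := f) (g := g)
      ⟨h.fin1, h.fin0, h.proj1, h.proj0, h.surj, h.exact, hfT⟩)
  choose c hc using fun j => IsIndex.exists_combination hTs hv hGall
    ((isRetract_pi (fun j => E j) j).trans isRetract_prod_right)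
    (IsVanishingPres.isIndex (k := k) (T := T) (f := F j) (g := Γ j)
      ⟨hQ1 j, hQ0 j, hQ1p j, hQ0p j, hΓ j, hFΓ j, hFT j⟩)
  let w : Fin n' → Fin n → ℚ := fun a s => (v a (Sm s) : ℚ)
  have hlin : LinearIndependent ℚ w := by
    rw [← LinearIndependent.iff_fractionRing ℤ ℚ, Fintype.linearIndependent_iff]
    intro d hd a
    refine congrFun (IsIndex.independent hGr hGi hσ hv hS3 d fun s => ?_) a
    have := congrFun hd s
    simp only [w, Finset.sum_apply, Pi.smul_apply, Pi.zero_apply] at this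
    simp only [zsmul_eq_mul] at this
    exact_mod_cast this
  have hspan : Submodule.span ℚ (Set.range w) = ⊤ := by
    rw [eq_top_iff, ← (Pi.basisFun ℚ (Fin n)).span_eq, Submodule.span_le]
    rintro _ ⟨j, rfl⟩
    have h1 : ∀ s, (homDim k S (P j) (Sm s) : ℚ) = ∑ a, ((c j a - m j * c0 a : ℤ) : ℚ) * w a s := by
      intro s
      have := hS1 s
      have hfs : Module.Finite S (Sm s) := inferInstance
      have h2 := hc0 (Sm s) hfs
      have h3 := hc j (Sm s) hfs
      have h4 := hdim j (Sm s) hfs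
      have h5 : (homDim k S (P j) (Sm s) : ℤ) = ∑ a, (c j a - m j * c0 a) * v a (Sm s) := by
        simp only [sub_mul, Finset.sum_sub_distrib, mul_assoc, ← Finset.mul_sum]
        rw [← h2, ← h3]
        zify at h4
        linarith
      simp only [w]
      exact_mod_cast congrArg (Int.cast : ℤ → ℚ) h5
    have h2 : (Pi.basisFun ℚ (Fin n)) j =
        ((homDim k S (P j) (Sm j) : ℚ)⁻¹) • ∑ a, ((c j a - m j * c0 a : ℤ) : ℚ) • w a := by
      funext s
      simp only [Pi.basisFun_apply, Pi.smul_apply, Finset.sum_apply, smul_eq_mul]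
      rw [← h1 s]
      by_cases hs : s = j
      · subst hs
        rw [Pi.single_eq_same, inv_mul_cancel₀]
        have := (hPS s s).not.2 (by simp)
        exact_mod_cast this
      · rw [Pi.single_eq_of_ne hs, (hPS j s).2 (Ne.symm hs)]
        simp
    rw [h2]
    exact Submodule.smul_mem _ _ (Submodule.sum_mem _ fun a _ =>
      Submodule.smul_mem _ _ (Submodule.subset_span ⟨a, rfl⟩))
  have hn : n' = n := by
    have h1 := hlin.fintype_card_le_finrank
    have h2 := finrank_range_le_card (R := ℚ) w
    rw [Set.finrank, hspan, finrank_top] at h2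
    simp at h1 h2
    omega
  subst hn
  -- the product of the representatives is a summand of `T`
  have hσi : Function.Injective σ := fun a b hab => by
    by_contra hne
    exact (hσ a b hne).false (hab ▸ LinearEquiv.refl S _)
  have hGT : IsRetract S (∀ a, G a) T := by
    refine IsRetract.trans ⟨∑ a, LinearMap.single S (fun i => D i) (σ a) ∘ₗ LinearMap.proj a,
      LinearMap.pi fun a => LinearMap.proj (σ a), ?_⟩ e.symm.isRetract
    refine LinearMap.ext fun x => funext fun a => ?_
    simp only [LinearMap.comp_apply, LinearMap.pi_apply, LinearMap.proj_apply,
      LinearMap.sum_apply, Finset.sum_apply, LinearMap.id_apply]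
    rw [Finset.sum_eq_single a]
    · exact Pi.single_eq_same (M := fun i => D i) _ _
    · intro b _ hb
      exact Pi.single_eq_of_ne (M := fun i => D i) (fun h => hb (hσi h).symm) _
    · simp
  refine ⟨n', G, Sm, hGf, hGi, hσ, ?_, hfT.retract hGT, hTT.retract hGT, hS1, hS2, hS3⟩
  choose a ea using hσ'
  refine ⟨Fintype.card ι, ?_⟩
  have h1 : IsRetract S (∀ i, D i) (ι → ∀ a, G a) := IsRetract.pi fun i =>
    (ea i).some.isRetract.trans (isRetract_pi (fun a => G a) (a i))
  exact ((isRetract_prod_left.trans e.isRetract).trans h1).trans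
    (LinearEquiv.funCongrLeft S _ (Fintype.equivFin ι).symm).isRetract

variable {B : Type} [Ring B] [Algebra k B] [Module.Finite k B]

theorem exists_tauTilting_completion {U P1 P0 : Type} [AddCommGroup U] [Module Bᵐᵒᵖ U]
    [AddCommGroup P1] [Module Bᵐᵒᵖ P1] [AddCommGroup P0] [Module Bᵐᵒᵖ P0]
    {f : P1 →ₗ[Bᵐᵒᵖ] P0} {g : P0 →ₗ[Bᵐᵒᵖ] U} (h : IsVanishingPres U f g)
    (hU : IsSincere Bᵐᵒᵖ U) :
    ∃ M : ModuleCat.{0} Bᵐᵒᵖ, IsTauTiltingMod k B M ∧ IsBasicMod B M ∧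
      (∃ N, IsRetract Bᵐᵒᵖ U (Fin N → M)) ∧ HomVanish f M := by
  have hfin : Module.Finite k Bᵐᵒᵖ := Module.Finite.equiv (opLinearEquiv k : B ≃ₗ[k] Bᵐᵒᵖ)
  have := IsNoetherianRing.of_finite k Bᵐᵒᵖ
  have := IsArtinianRing.of_finite k Bᵐᵒᵖ
  obtain ⟨n, G, Sm, hGf, hGi, hGn, hUr, hfG, hGG, h1, h2, h3⟩ := exists_maximal_rigid k h hU
  have hMf : Module.Finite Bᵐᵒᵖ (ModuleCat.of Bᵐᵒᵖ (∀ i, G i)) :=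
    inferInstanceAs (Module.Finite Bᵐᵒᵖ (∀ i, G i))
  refine ⟨ModuleCat.of Bᵐᵒᵖ (∀ i, G i), ⟨hMf, isTauRigid_of_extVanish k _ hGG, n,
    ⟨G, fun i => ⟨(indecomposableMod_iff _).2 (hGi i), ?_⟩, hGn, ?_⟩, ⟨Sm, h1, h2, h3⟩⟩, ?_,
    hUr, hfG⟩
  · obtain ⟨a, b, hab⟩ := isRetract_pi (S := Bᵐᵒᵖ) (fun i => G i) i
    exact ⟨ModuleCat.of Bᵐᵒᵖ (LinearMap.ker b), ⟨splitEquiv a b hab⟩⟩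
  · rintro L ⟨hL, L', ⟨e⟩⟩
    have hr : IsRetract Bᵐᵒᵖ L (∀ i, G i) := isRetract_prod_left.trans e.symm.isRetract
    have : Module.Finite Bᵐᵒᵖ L := by
      obtain ⟨a, b, hab⟩ := hr
      exact Module.Finite.of_surjective b (IsRetract.surjective hab)
    exact ((indecomposableMod_iff _).1 hL).equiv_of_isRetract_pi hGi hr
  · rintro L C ⟨e⟩
    by_contra hL
    rw [not_subsingleton_iff_nontrivial] at hL
    have hr : IsRetract Bᵐᵒᵖ L (∀ i, G i) := isRetract_prod_left.trans e.symm.isRetract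
    have : Module.Finite Bᵐᵒᵖ L := by
      obtain ⟨a, b, hab⟩ := hr
      exact Module.Finite.of_surjective b (IsRetract.surjective hab)
    obtain ⟨L', hL', a, b, hab⟩ := exists_indec_retract k (S := Bᵐᵒᵖ) (L := L)
    refine hL'.not_isRetract_prod_self hGi hGn (IsRetract.trans ?_ e.symm.isRetract)
    refine ⟨a.prodMap (LinearMap.inl _ _ _ ∘ₗ a), b.prodMap (b ∘ₗ LinearMap.fst _ _ _), ?_⟩
    refine LinearMap.ext fun x => Prod.ext (LinearMap.congr_fun hab x.1)
      (LinearMap.congr_fun hab x.2)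

end Completion

section Sincerity

theorem IsSincere.of_annihilator_nil {S : Type} [Ring S] {U : Type} [AddCommGroup U] [Module S U]
    (h : ∀ s : S, (∀ u : U, s • u = 0) → IsNilpotent s) : IsSincere S U := by
  intro Q _ _ hfin hproj hQ
  obtain ⟨n, g, hg⟩ := Module.Finite.exists_fin' S Q
  obtain ⟨σ, hσ⟩ := Module.projective_lifting_property g LinearMap.id hg
  refine subsingleton_of_le_nil_smul (Module.annihilator S U)
    (fun a ha => h a (Module.mem_annihilator.1 ha)) fun x => ?_
  have h1 : x = ∑ i, σ x i • g (Pi.single i 1) := by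
    conv_lhs => rw [← LinearMap.id_apply (R := S) x, ← hσ, LinearMap.comp_apply,
      ← Finset.univ_sum_single (σ x), map_sum]
    refine Finset.sum_congr rfl fun i _ => ?_
    rw [← map_smul, ← Pi.single_smul, smul_eq_mul, mul_one]
  rw [h1]
  refine Submodule.sum_mem _ fun i _ => Submodule.smul_mem_smul ?_ Submodule.mem_top
  refine Module.mem_annihilator.2 fun u => ?_
  exact LinearMap.congr_fun (hQ (LinearMap.toSpanSingleton S U u ∘ₗ LinearMap.proj i ∘ₗ σ)) x

variable (k : Type) [Field k] {A : Type} [Ring A] [Algebra k A]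

include k in
theorem exists_idempotent_of_not_isNilpotent [Module.Finite k A] {y : A} (hy : ¬ IsNilpotent y) :
    ∃ r, r * y = y * r ∧ IsIdempotentElem (r * y) ∧ r * y ≠ 0 := by
  let C := Algebra.adjoin k {y}
  have : IsMulCommutative C := Algebra.isMulCommutative_adjoin k (by
    rintro a rfl b rfl; rfl)
  have : IsArtinianRing C := IsArtinianRing.of_finite k C
  let y' : C := ⟨y, Algebra.subset_adjoin rfl⟩
  have hy' : ¬ IsNilpotent y' := fun ⟨n, hn⟩ => hy ⟨n, congrArg Subtype.val hn⟩
  obtain ⟨n, z, hz⟩ := IsArtinian.exists_pow_succ_smul_dvd y' (1 : C)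
  simp only [smul_eq_mul, mul_one] at hz
  have h0 : ∀ m, y' ^ (n + 1) * y' ^ m * z ^ m = y' ^ (n + 1) := by
    intro m
    induction m with
    | zero => simp
    | succ m ih =>
      calc y' ^ (n + 1) * y' ^ (m + 1) * z ^ (m + 1)
          = y' * (y' ^ n.succ * z) * y' ^ m * z ^ m := by rw [Nat.succ_eq_add_one]; ring
        _ = y' ^ (n + 1) * y' ^ m * z ^ m := by rw [hz]; ring
        _ = _ := ih
  let e : C := y' ^ (n + 1) * z ^ (n + 1)
  have he : e * e = e := by
    calc e * e = (y' ^ (n + 1) * y' ^ (n + 1) * z ^ (n + 1)) * z ^ (n + 1) := by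
          simp only [e]; ring
      _ = e := by rw [h0]
  have he0 : e ≠ 0 := by
    intro he0
    refine hy' ⟨n + 1, ?_⟩
    rw [← h0 (n + 1), mul_assoc]
    change y' ^ (n + 1) * e = 0
    rw [he0, mul_zero]
  let r : C := y' ^ n * z ^ (n + 1)
  have hr : r * y' = e := by simp only [r, e]; ring
  refine ⟨r, ?_, ?_, ?_⟩
  · exact congrArg Subtype.val (mul_comm r y')
  · exact congrArg Subtype.val (show (r * y') * (r * y') = r * y' by rw [hr, he])
  · exact fun h => he0 (hr ▸ Subtype.ext h)

include k in
theorem exists_maximal_idempotent [Module.Finite k A] (U : Type) [AddCommGroup U]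
    [Module Aᵐᵒᵖ U] :
    ∃ e : A, IsIdempotentElem e ∧ (∀ u : U, op e • u = 0) ∧
      ∀ y : A, (∀ u : U, op y • u = 0) → e * y = 0 → y * e = 0 → IsNilpotent y := by
  classical
  let d : A → ℕ := fun e => Module.finrank k (LinearMap.range (LinearMap.mulLeft k e))
  let P : ℕ → Prop := fun m => ∃ e : A, IsIdempotentElem e ∧ (∀ u : U, op e • u = 0) ∧ d e = m
  have hP0 : P (d 0) := ⟨0, IsIdempotentElem.zero, fun u => by rw [MulOpposite.op_zero, zero_smul], rfl⟩
  have hle : ∀ e, d e ≤ Module.finrank k A := fun e => Submodule.finrank_le _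
  obtain ⟨e, he, heU, hd⟩ := Nat.findGreatest_spec (P := P) (hle 0) hP0
  refine ⟨e, he, heU, fun y hyU hey hye => ?_⟩
  by_contra hy
  obtain ⟨r, hr, hi, h0⟩ := exists_idempotent_of_not_isNilpotent k hy
  have h1 : e * (r * y) = 0 := by rw [hr, ← mul_assoc, hey, zero_mul]
  have h2 : (r * y) * e = 0 := by rw [mul_assoc, hye, mul_zero]
  have he' : IsIdempotentElem (e + r * y) := by
    have hi' : r * y * (r * y) = r * y := hi
    have he2 : e * e = e := he
    rw [IsIdempotentElem, add_mul, mul_add, mul_add, h1, h2, hi', he2, add_zero, zero_add]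
  have hU' : ∀ u : U, op (e + r * y) • u = 0 := fun u => by
    rw [MulOpposite.op_add, add_smul, heU, zero_add, op_mul, mul_smul, hyU]
  have hlt : d e < d (e + r * y) := by
    refine Submodule.finrank_lt_finrank_of_lt (lt_of_le_of_ne ?_ ?_)
    · rintro _ ⟨a, rfl⟩
      refine ⟨e * a, ?_⟩
      have he2 : e * e = e := he
      simp only [LinearMap.mulLeft_apply]
      rw [← mul_assoc, add_mul, h2, he2, add_zero]
    · intro heq
      have : r * y ∈ LinearMap.range (LinearMap.mulLeft k e) := by
        rw [heq]
        refine ⟨r * y, ?_⟩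
        have hi' : r * y * (r * y) = r * y := hi
        simp only [LinearMap.mulLeft_apply]
        rw [add_mul, h1, hi', zero_add]
      obtain ⟨a, ha⟩ := this
      simp only [LinearMap.mulLeft_apply] at ha
      apply h0
      have he2 : e * e = e := he
      rw [← h1, ← ha, ← mul_assoc, he2]
  have := Nat.le_findGreatest (P := P) (hle (e + r * y)) ⟨_, he', hU', rfl⟩
  omega

end Sincerity

section BaseChange

variable {A : Type} [Ring A] (e : A)

/-- The submodule generated by `P e`. -/
def idemSubmodule (P : Type) [AddCommGroup P] [Module Aᵐᵒᵖ P] : Submodule Aᵐᵒᵖ P :=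
  Submodule.span Aᵐᵒᵖ (Set.range fun p : P => op e • p)

/-- The largest quotient of a right module killed by `e`. -/
def BaseQuot (P : Type) [AddCommGroup P] [Module Aᵐᵒᵖ P] : Type := P ⧸ idemSubmodule e P

variable (P P' : Type) [AddCommGroup P] [Module Aᵐᵒᵖ P] [AddCommGroup P'] [Module Aᵐᵒᵖ P']

instance : AddCommGroup (BaseQuot e P) := inferInstanceAs (AddCommGroup (P ⧸ idemSubmodule e P))

instance : Module (IdemQuot A e)ᵐᵒᵖ (BaseQuot e P) :=
  idemQuotModule (E := P ⧸ idemSubmodule e P) e (by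
    intro x
    obtain ⟨p, rfl⟩ := Submodule.mkQ_surjective _ x
    rw [← map_smul, Submodule.mkQ_apply, Submodule.Quotient.mk_eq_zero]
    exact Submodule.subset_span ⟨p, rfl⟩)

variable {P P'}

/-- The projection onto the largest quotient killed by `e`. -/
def baseMk : P →ₗ[Aᵐᵒᵖ] ResMod (idemQuotOp e) (BaseQuot e P) where
  toFun := (idemSubmodule e P).mkQ
  map_add' := map_add _
  map_smul' s x := (map_smul (idemSubmodule e P).mkQ s x :)

theorem baseMk_surjective : Function.Surjective (baseMk e (P := P)) :=
  Submodule.mkQ_surjective _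

theorem baseMk_eq_zero {p : P} : baseMk e p = 0 ↔ p ∈ idemSubmodule e P :=
  Submodule.Quotient.mk_eq_zero _

variable {e}
variable {X : Type} [AddCommGroup X] [Module (IdemQuot A e)ᵐᵒᵖ X]

/-- The universal property of the largest quotient killed by `e`. -/
def baseLift (h : P →ₗ[Aᵐᵒᵖ] ResMod (idemQuotOp e) X) :
    BaseQuot e P →ₗ[(IdemQuot A e)ᵐᵒᵖ] X :=
  let g : (P ⧸ idemSubmodule e P) →ₗ[Aᵐᵒᵖ] ResMod (idemQuotOp e) X :=
    (idemSubmodule e P).liftQ h (Submodule.span_le.2 (by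
      rintro _ ⟨p, rfl⟩
      simp only [SetLike.mem_coe, LinearMap.mem_ker, map_smul]
      exact resMod_smul_eq_zero e _))
  { toFun := g
    map_add' := g.map_add
    map_smul' := fun s x => by
      obtain ⟨a, rfl⟩ := idemQuotOp_surjective e s
      exact g.map_smul a x }

theorem baseLift_mk (h : P →ₗ[Aᵐᵒᵖ] ResMod (idemQuotOp e) X) (p : P) :
    baseLift h (baseMk e p) = h p := rfl

theorem baseQuot_ext {h h' : BaseQuot e P →ₗ[(IdemQuot A e)ᵐᵒᵖ] X}
    (H : ∀ p : P, h (baseMk e p) = h' (baseMk e p)) : h = h' := by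
  ext x
  obtain ⟨p, rfl⟩ := baseMk_surjective e x
  exact H p

instance [Module.Finite Aᵐᵒᵖ P] : Module.Finite (IdemQuot A e)ᵐᵒᵖ (BaseQuot e P) := by
  obtain ⟨s, hs⟩ := Module.Finite.fg_top (R := Aᵐᵒᵖ) (M := P)
  classical
  let t : Finset (BaseQuot e P) := s.image (baseMk e)
  refine ⟨⟨t, ?_⟩⟩
  rw [eq_top_iff]
  rintro x -
  obtain ⟨p, rfl⟩ := baseMk_surjective e x
  have hp : p ∈ Submodule.span Aᵐᵒᵖ (s : Set P) := hs ▸ Submodule.mem_top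
  induction hp using Submodule.span_induction with
  | mem p hp =>
    exact Submodule.subset_span (s := (t : Set (BaseQuot e P)))
      (Finset.mem_coe.2 (Finset.mem_image_of_mem _ hp))
  | zero => rw [map_zero]; exact Submodule.zero_mem _
  | add p q _ _ h1 h2 => rw [map_add]; exact Submodule.add_mem _ h1 h2
  | smul a p _ h1 =>
    rw [map_smul]
    exact Submodule.smul_mem _ (idemQuotOp e a) h1

instance [Module.Projective Aᵐᵒᵖ P] : Module.Projective (IdemQuot A e)ᵐᵒᵖ (BaseQuot e P) := by
  refine Module.Projective.of_lifting_property'' fun f hf => ?_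
  obtain ⟨g, hg⟩ := Module.projective_lifting_property (resMap (idemQuotOp e) f)
    (baseMk e (P := P)) hf
  exact ⟨baseLift g, baseQuot_ext fun p => LinearMap.congr_fun hg p⟩

/-- Functoriality of the largest quotient killed by `e`. -/
def baseMap (f : P →ₗ[Aᵐᵒᵖ] P') :
    BaseQuot e P →ₗ[(IdemQuot A e)ᵐᵒᵖ] BaseQuot e P' := baseLift (baseMk e ∘ₗ f)

theorem homVanish_baseMap {f : P →ₗ[Aᵐᵒᵖ] P'} :
    HomVanish (baseMap (e := e) f) X ↔ HomVanish f (ResMod (idemQuotOp e) X) := by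
  constructor
  · intro h t
    obtain ⟨u, hu⟩ := h (baseLift t)
    refine ⟨resMap _ u ∘ₗ baseMk e, LinearMap.ext fun p => ?_⟩
    exact LinearMap.congr_fun hu (baseMk e p)
  · intro h t
    obtain ⟨u, hu⟩ := h (resMap _ t ∘ₗ baseMk e)
    exact ⟨baseLift u, baseQuot_ext fun p => LinearMap.congr_fun hu p⟩

theorem IsVanishingPres.baseChange {f : P →ₗ[Aᵐᵒᵖ] P'}
    {g : P' →ₗ[Aᵐᵒᵖ] ResMod (idemQuotOp e) X}
    (h : IsVanishingPres (ResMod (idemQuotOp e) X) f g) :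
    IsVanishingPres X (baseMap (e := e) f) (baseLift g) := by
  have := h.fin1
  have := h.fin0
  have := h.proj1
  have := h.proj0
  refine ⟨inferInstance, inferInstance, inferInstance, inferInstance, fun x => ?_, ?_,
    homVanish_baseMap.2 h.vanish⟩
  · obtain ⟨p, hp⟩ := h.surj x
    exact ⟨baseMk e p, hp⟩
  · ext x
    obtain ⟨p, rfl⟩ := baseMk_surjective e x
    constructor
    · rintro ⟨y, hy⟩
      obtain ⟨q, rfl⟩ := baseMk_surjective e y
      rw [← hy]
      exact h.comp_eq_zero q
    · intro hp
      have hp' : p ∈ LinearMap.ker g := hp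
      rw [← h.exact] at hp'
      obtain ⟨q, rfl⟩ := hp'
      exact ⟨baseMk e q, rfl⟩

end BaseChange

section Completion

variable (k : Type) [Field k] {A : Type} [Ring A] [Algebra k A] [Module.Finite k A]

theorem isBasicMod_resMod {e : A} {N : ModuleCat.{0} (IdemQuot A e)ᵐᵒᵖ}
    (h : IsBasicMod (IdemQuot A e) N) :
    IsBasicMod A (ModuleCat.of Aᵐᵒᵖ (ResMod (idemQuotOp e) N)) := by
  rintro L C ⟨i⟩
  have i' : ResMod (idemQuotOp e) N ≃ₗ[Aᵐᵒᵖ] (L × L × C) := i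
  have h0 : ∀ x : L × L × C, op e • x = 0 := fun x => by
    obtain ⟨y, rfl⟩ := i'.surjective x
    rw [← map_smul, resMod_smul_eq_zero, map_zero]
  have hL : ∀ x : L, op e • x = 0 := fun x => congrArg Prod.fst (h0 (x, 0, 0))
  have hC : ∀ x : C, op e • x = 0 := fun x => congrArg (fun z => z.2.2) (h0 (0, 0, x))
  let _ : Module (IdemQuot A e)ᵐᵒᵖ L := idemQuotModule e hL
  let _ : Module (IdemQuot A e)ᵐᵒᵖ C := idemQuotModule e hC
  refine h (ModuleCat.of _ L) (ModuleCat.of _ C) ⟨?_⟩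
  exact
    { toFun := i'
      map_add' := i'.map_add
      map_smul' := fun s x => by
        obtain ⟨a, rfl⟩ := idemQuotOp_surjective e s
        exact i'.map_smul a x
      invFun := i'.symm
      left_inv := i'.left_inv
      right_inv := i'.right_inv }

/-- Every finitely generated module presented by a morphism of projectives with vanishing
self-obstruction is a summand of a power of a basic support τ-tilting module. -/
theorem exists_supportTauTilting_completion {U P1 P0 : Type} [AddCommGroup U] [Module Aᵐᵒᵖ U]
    [AddCommGroup P1] [Module Aᵐᵒᵖ P1] [AddCommGroup P0] [Module Aᵐᵒᵖ P0]
    {f : P1 →ₗ[Aᵐᵒᵖ] P0} {g : P0 →ₗ[Aᵐᵒᵖ] U} (h : IsVanishingPres U f g) :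
    ∃ M : ModuleCat.{0} Aᵐᵒᵖ, IsSupportTauTilting k A M ∧ IsBasicMod A M ∧
      (∃ N, IsRetract Aᵐᵒᵖ U (Fin N → M)) ∧ HomVanish f M := by
  obtain ⟨e, he, heU, hnil⟩ := exists_maximal_idempotent k (A := A) U
  have : Module.Finite k (IdemQuot A e) := idemQuot_finite e k
  let _ : Module (IdemQuot A e)ᵐᵒᵖ U := idemQuotModule e heU
  let j : U →ₗ[Aᵐᵒᵖ] ResMod (idemQuotOp e) U :=
    { toFun := fun x => x
      map_add' := fun _ _ => rfl
      map_smul' := fun _ _ => rfl }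
  let j' : ResMod (idemQuotOp e) U →ₗ[Aᵐᵒᵖ] U :=
    { toFun := fun x => x
      map_add' := fun _ _ => rfl
      map_smul' := fun _ _ => rfl }
  have h' : IsVanishingPres (ResMod (idemQuotOp e) U) f (j ∘ₗ g) :=
    ⟨h.fin1, h.fin0, h.proj1, h.proj0, h.surj, h.exact,
      h.vanish.retract ⟨j', j, rfl⟩⟩
  have hs : IsSincere (IdemQuot A e)ᵐᵒᵖ U := by
    refine IsSincere.of_annihilator_nil fun s hs => ?_
    obtain ⟨a, rfl⟩ := idemQuotOp_surjective e s
    obtain ⟨a, rfl⟩ := op_surjective a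
    have ha : ∀ u : U, op a • u = 0 := hs
    have hee : e * e = e := he
    have he1 : e * (1 - e) = 0 := by rw [mul_sub, hee, mul_one, sub_self]
    have he2 : (1 - e) * e = 0 := by rw [sub_mul, hee, one_mul, sub_self]
    have he0 : IdemQuot.mk A e e = 0 :=
      (idemQuot_mk_eq_zero e).2 (TwoSidedIdeal.subset_span rfl)
    obtain ⟨n, hn⟩ := hnil ((1 - e) * a * (1 - e))
      (fun u => by rw [op_mul, op_mul, mul_smul, mul_smul, MulOpposite.op_sub, sub_smul, op_one, one_smul,
        heU, sub_zero, ha])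
      (by rw [← mul_assoc, ← mul_assoc, he1, zero_mul, zero_mul])
      (by rw [mul_assoc, he2, mul_zero])
    have h1 : IdemQuot.mk A e a ^ n = 0 := by
      have := congrArg (IdemQuot.mk A e) hn
      simpa only [map_pow, map_mul, map_sub, map_one, he0, sub_zero, one_mul, mul_one,
        map_zero] using this
    exact ⟨n, congrArg op h1⟩
  obtain ⟨N, h1, h2, ⟨n, i, p, hip⟩, h4⟩ :=
    exists_tauTilting_completion k h'.baseChange hs
  let i' : U →ₗ[Aᵐᵒᵖ] (Fin n → ResMod (idemQuotOp e) N) :=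
    { toFun := i
      map_add' := i.map_add
      map_smul' := fun s x => i.map_smul (idemQuotOp e s) x }
  let p' : (Fin n → ResMod (idemQuotOp e) N) →ₗ[Aᵐᵒᵖ] U :=
    { toFun := p
      map_add' := p.map_add
      map_smul' := fun s x => p.map_smul (idemQuotOp e s) x }
  exact ⟨ModuleCat.of Aᵐᵒᵖ (ResMod (idemQuotOp e) N), ⟨e, he, N, h1,
    ⟨LinearEquiv.refl Aᵐᵒᵖ (ResMod (idemQuotOp e) N)⟩⟩,
    isBasicMod_resMod h2, ⟨n, i', p', LinearMap.ext fun x => LinearMap.congr_fun hip x⟩,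
    (homVanish_baseMap (X := N)).1 h4⟩

end Completion

section BlockMaps

theorem projective_pi {S : Type} [Ring S] {ι : Type} [Finite ι] (X : ι → Type)
    [∀ i, AddCommGroup (X i)] [∀ i, Module S (X i)] [∀ i, Module.Projective S (X i)] :
    Module.Projective S (∀ i, X i) := by
  classical
  have := Fintype.ofFinite ι
  exact Module.Projective.of_equiv (DFinsupp.linearEquivFunOnFintype (R := S) (M := X))

set_option linter.unusedSectionVars false

variable {k S : Type} [Field k] [Ring S] [Algebra k S] {I J : Type} [Fintype I] [Fintype J]
  [DecidableEq I] [DecidableEq J]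
  {Q : I → Type} {R : J → Type} [∀ i, AddCommGroup (Q i)] [∀ j, AddCommGroup (R j)]
  [∀ i, Module S (Q i)] [∀ j, Module S (R j)] [∀ i, Module k (Q i)] [∀ j, Module k (R j)]
  [∀ i, IsScalarTower k S (Q i)] [∀ j, IsScalarTower k S (R j)]
  {q q' : I → Type} {r r' : J → Type} [∀ i, Fintype (q i)] [∀ j, Fintype (r j)]
  [∀ i, DecidableEq (q i)] [∀ j, DecidableEq (r j)]
  [∀ i, Fintype (q' i)] [∀ j, Fintype (r' j)]
  [∀ i, DecidableEq (q' i)] [∀ j, DecidableEq (r' j)]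

/-- The linear map with prescribed entries between finite products of powers. -/
def entryMap (h : ∀ j i, r j → q i → (Q i →ₗ[S] R j)) :
    (∀ i, q i → Q i) →ₗ[S] (∀ j, r j → R j) :=
  LinearMap.pi fun j => LinearMap.pi fun b =>
    ∑ i, ∑ a, h j i b a ∘ₗ LinearMap.proj a ∘ₗ LinearMap.proj i

theorem entryMap_apply (h : ∀ j i, r j → q i → (Q i →ₗ[S] R j)) (p : ∀ i, q i → Q i) (j : J)
    (b : r j) : entryMap h p j b = ∑ i, ∑ a, h j i b a (p i a) := by
  simp [entryMap]

theorem entryMap_single (h : ∀ j i, r j → q i → (Q i →ₗ[S] R j)) (i : I) (a : q i) (x : Q i)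
    (j : J) (b : r j) :
    entryMap h (Pi.single i (Pi.single a x)) j b = h j i b a x := by
  rw [entryMap_apply, Finset.sum_eq_single i, Finset.sum_eq_single a]
  · simp
  · intro a' _ ha
    simp [Pi.single_eq_of_ne ha]
  · simp
  · intro i' _ hi
    simp [Pi.single_eq_of_ne hi]
  · simp

theorem single_single_ext {Y : Type} [AddCommGroup Y] [Module S Y]
    {f g : (∀ i, q i → Q i) →ₗ[S] Y}
    (h : ∀ i a x, f (Pi.single i (Pi.single a x)) = g (Pi.single i (Pi.single a x))) : f = g :=
  LinearMap.pi_ext' fun i => LinearMap.pi_ext' fun a => LinearMap.ext fun x => h i a x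

theorem exists_entryMap (f : (∀ i, q i → Q i) →ₗ[S] (∀ j, r j → R j)) :
    ∃ h : ∀ j i, r j → q i → (Q i →ₗ[S] R j), f = entryMap h := by
  refine ⟨fun j i b a => LinearMap.proj b ∘ₗ LinearMap.proj j ∘ₗ f ∘ₗ
    LinearMap.single S (fun i => q i → Q i) i ∘ₗ LinearMap.single S (fun _ => Q i) a, ?_⟩
  refine single_single_ext fun i a x => ?_
  funext j b
  rw [entryMap_single]
  rfl

theorem entryMap_comp {L : Type} [Fintype L] [DecidableEq L] {X : L → Type}
    [∀ l, AddCommGroup (X l)] [∀ l, Module S (X l)] {s : L → Type}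
    [∀ l, Fintype (s l)] [∀ l, DecidableEq (s l)]
    (h : ∀ j i, r j → q i → (Q i →ₗ[S] R j)) (h' : ∀ l j, s l → r j → (R j →ₗ[S] X l)) :
    entryMap h' ∘ₗ entryMap h =
      entryMap fun l i c a => ∑ j, ∑ b, h' l j c b ∘ₗ h j i b a := by
  refine single_single_ext fun i a x => ?_
  funext l c
  change entryMap h' (entryMap h (Pi.single i (Pi.single a x))) l c =
    entryMap _ (Pi.single i (Pi.single a x)) l c
  rw [entryMap_single, entryMap_apply]
  simp only [entryMap_single, LinearMap.sum_apply, LinearMap.comp_apply]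

theorem entryMap_add (h h' : ∀ j i, r j → q i → (Q i →ₗ[S] R j)) :
    entryMap h + entryMap h' = entryMap fun j i b a => h j i b a + h' j i b a := by
  refine single_single_ext fun i a x => ?_
  funext j b
  change entryMap h (Pi.single i (Pi.single a x)) j b +
    entryMap h' (Pi.single i (Pi.single a x)) j b =
    entryMap _ (Pi.single i (Pi.single a x)) j b
  rw [entryMap_single, entryMap_single, entryMap_single, LinearMap.add_apply]

variable (k S Q R) in
/-- Bipartite families of modules for which all morphisms between different modules are
controlled by scalar matrices supported on the edges of a graph. -/
structure BipartiteHom (E : J → I → Prop) where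
  α : ∀ j i, Q i →ₗ[S] R j
  ne_zero : ∀ j i, E j i → α j i ≠ 0
  eq_zero : ∀ j i, ¬ E j i → α j i = 0
  hom : ∀ j i (h : Q i →ₗ[S] R j), ∃ c : k, h = c • α j i
  source_ne : ∀ j i i' (σ : Q i →ₗ[S] Q i'), i ≠ i' → α j i' ∘ₗ σ = 0
  source : ∀ i (σ : Q i →ₗ[S] Q i), ∃ c : k, ∀ j, α j i ∘ₗ σ = c • α j i
  target_ne : ∀ j j' i (ρ : R j →ₗ[S] R j'), j ≠ j' → ρ ∘ₗ α j i = 0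
  target : ∀ j (ρ : R j →ₗ[S] R j), ∃ c : k, ∀ i, ρ ∘ₗ α j i = c • α j i

namespace BipartiteHom

variable {E : J → I → Prop} (D : BipartiteHom k S Q R E)

/-- The map between products of powers given by scalar matrices. -/
def map (F : ∀ j i, Matrix (r j) (q i) k) : (∀ i, q i → Q i) →ₗ[S] (∀ j, r j → R j) :=
  entryMap fun j i b a => F j i b a • D.α j i

theorem exists_map (f : (∀ i, q i → Q i) →ₗ[S] (∀ j, r j → R j)) :
    ∃ F : ∀ j i, Matrix (r j) (q i) k, f = D.map F := by
  obtain ⟨h, rfl⟩ := exists_entryMap f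
  choose F hF using D.hom
  refine ⟨fun j i b a => F j i (h j i b a), ?_⟩
  exact congrArg entryMap (funext fun j => funext fun i => funext fun b => funext fun a =>
    hF j i (h j i b a))

theorem map_injective {F G : ∀ j i, Matrix (r j) (q i) k} (h : D.map F = D.map G) (j : J) (i : I)
    (hE : E j i) : F j i = G j i := by
  ext b a
  have h1 : F j i b a • D.α j i = G j i b a • D.α j i := by
    ext x
    have := congrFun (congrFun (LinearMap.congr_fun h (Pi.single i (Pi.single a x))) j) b
    rwa [map, map, entryMap_single, entryMap_single] at this
  exact smul_left_injective k (D.ne_zero j i hE) h1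

theorem map_congr {F G : ∀ j i, Matrix (r j) (q i) k} (h : ∀ j i, E j i → F j i = G j i) :
    D.map F = D.map G := by
  refine congrArg entryMap (funext fun j => funext fun i => funext fun b => funext fun a => ?_)
  by_cases hE : E j i
  · rw [h j i hE]
  · rw [D.eq_zero j i hE, smul_zero, smul_zero]

theorem map_add (F G : ∀ j i, Matrix (r j) (q i) k) :
    D.map F + D.map G = D.map fun j i => F j i + G j i := by
  rw [map, map, entryMap_add]
  refine congrArg entryMap (funext fun j => funext fun i => funext fun b => funext fun a => ?_)
  change _ = (F j i + G j i) b a • D.α j i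
  rw [Matrix.add_apply, add_smul]

theorem exists_map_comp (F : ∀ j i, Matrix (r j) (q' i) k)
    (s : (∀ i, q i → Q i) →ₗ[S] (∀ i, q' i → Q i)) :
    ∃ M : ∀ i, Matrix (q' i) (q i) k, D.map F ∘ₗ s = D.map fun j i => F j i * M i := by
  obtain ⟨h, rfl⟩ := exists_entryMap s
  choose M hM using D.source
  refine ⟨fun i b a => M i (h i i b a), ?_⟩
  rw [map, entryMap_comp]
  refine congrArg entryMap (funext fun j => funext fun i => funext fun b => funext fun a => ?_)
  change _ = (F j i * Matrix.of (fun b a => M i (h i i b a))) b a • D.α j i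
  rw [Finset.sum_eq_single i, Matrix.mul_apply, Finset.sum_smul]
  · refine Finset.sum_congr rfl fun c _ => ?_
    rw [mul_smul, Matrix.of_apply, ← hM, LinearMap.smul_comp]
  · intro i' _ hi
    refine Finset.sum_eq_zero fun c _ => ?_
    rw [LinearMap.smul_comp, D.source_ne j i i' _ hi.symm, smul_zero]
  · simp

theorem exists_comp_map (F : ∀ j i, Matrix (r j) (q i) k)
    (t : (∀ j, r j → R j) →ₗ[S] (∀ j, r' j → R j)) :
    ∃ M : ∀ j, Matrix (r' j) (r j) k, t ∘ₗ D.map F = D.map fun j i => M j * F j i := by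
  obtain ⟨h, rfl⟩ := exists_entryMap t
  choose M hM using D.target
  refine ⟨fun j b a => M j (h j j b a), ?_⟩
  rw [map, entryMap_comp]
  refine congrArg entryMap (funext fun j => funext fun i => funext fun b => funext fun a => ?_)
  change _ = (Matrix.of (fun b a => M j (h j j b a)) * F j i) b a • D.α j i
  rw [Finset.sum_eq_single j, Matrix.mul_apply, Finset.sum_smul]
  · refine Finset.sum_congr rfl fun c _ => ?_
    rw [mul_comm, mul_smul, Matrix.of_apply, ← hM, LinearMap.comp_smul]
  · intro j' _ hj
    refine Finset.sum_eq_zero fun c _ => ?_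
    rw [LinearMap.comp_smul, D.target_ne j' j i _ hj, smul_zero]
  · simp

theorem exists_source_map (F : ∀ j i, Matrix (r j) (q' i) k) (M : ∀ i, Matrix (q' i) (q i) k) :
    ∃ s : (∀ i, q i → Q i) →ₗ[S] (∀ i, q' i → Q i),
      D.map F ∘ₗ s = D.map fun j i => F j i * M i := by
  refine ⟨entryMap fun i' i b a => if h : i' = i then
    M i' b (h ▸ a) • (h ▸ LinearMap.id : Q i →ₗ[S] Q i') else 0, ?_⟩
  rw [map, entryMap_comp]
  refine congrArg entryMap (funext fun j => funext fun i => funext fun b => funext fun a => ?_)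
  change _ = (F j i * M i) b a • D.α j i
  rw [Finset.sum_eq_single i, Matrix.mul_apply, Finset.sum_smul]
  · refine Finset.sum_congr rfl fun c _ => ?_
    rw [dif_pos rfl, mul_smul, LinearMap.smul_comp, LinearMap.comp_smul, LinearMap.comp_id]
  · intro i' _ hi
    refine Finset.sum_eq_zero fun c _ => ?_
    rw [dif_neg hi, LinearMap.comp_zero]
  · simp

theorem exists_target_map (F : ∀ j i, Matrix (r j) (q i) k) (M : ∀ j, Matrix (r' j) (r j) k) :
    ∃ t : (∀ j, r j → R j) →ₗ[S] (∀ j, r' j → R j),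
      t ∘ₗ D.map F = D.map fun j i => M j * F j i := by
  refine ⟨entryMap fun j' j b a => if h : j' = j then
    M j' b (h ▸ a) • (h ▸ LinearMap.id : R j →ₗ[S] R j') else 0, ?_⟩
  rw [map, entryMap_comp]
  refine congrArg entryMap (funext fun j => funext fun i => funext fun b => funext fun a => ?_)
  change _ = (M j * F j i) b a • D.α j i
  rw [Finset.sum_eq_single j, Matrix.mul_apply, Finset.sum_smul]
  · refine Finset.sum_congr rfl fun c _ => ?_
    rw [dif_pos rfl, mul_smul, LinearMap.smul_comp, LinearMap.comp_smul, LinearMap.id_comp]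
  · intro j' _ hj
    refine Finset.sum_eq_zero fun c _ => ?_
    rw [dif_neg hj.symm, LinearMap.zero_comp]
  · simp

variable [∀ i, Module.Projective S (Q i)] [∀ j, Module.Projective S (R j)]

theorem homVanish_of_solvable (F : ∀ j i, Matrix (r j) (q i) k)
    (hF : ∀ H : ∀ j i, Matrix (r j) (q i) k, ∃ (M : ∀ i, Matrix (q i) (q i) k)
      (M' : ∀ j, Matrix (r j) (r j) k), ∀ j i, E j i → H j i = F j i * M i + M' j * F j i) :
    HomVanish (D.map F) ((∀ j, r j → R j) ⧸ LinearMap.range (D.map F)) := by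
  have : ∀ i, Module.Projective S (q i → Q i) := fun i => projective_pi _
  have : Module.Projective S (∀ i, q i → Q i) := projective_pi _
  intro h
  obtain ⟨h', hh'⟩ := Module.projective_lifting_property
    (LinearMap.range (D.map F)).mkQ h (Submodule.mkQ_surjective _)
  obtain ⟨H, rfl⟩ := D.exists_map h'
  obtain ⟨M, M', hM⟩ := hF H
  obtain ⟨s, hs⟩ := D.exists_source_map F M
  obtain ⟨t, ht⟩ := D.exists_target_map F M'
  refine ⟨(LinearMap.range (D.map F)).mkQ ∘ₗ t, ?_⟩
  rw [LinearMap.comp_assoc, ← hh', D.map_congr hM, ← D.map_add, ← hs, ← ht, LinearMap.comp_add,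
    ← LinearMap.comp_assoc s, LinearMap.range_mkQ_comp, LinearMap.zero_comp, zero_add]

theorem solvable_of_homVanish (F : ∀ j i, Matrix (r j) (q i) k)
    (F' : ∀ j i, Matrix (r' j) (q' i) k)
    (h : HomVanish (D.map F) ((∀ j, r' j → R j) ⧸ LinearMap.range (D.map F')))
    (H : ∀ j i, Matrix (r' j) (q i) k) :
    ∃ (M : ∀ i, Matrix (q' i) (q i) k) (M' : ∀ j, Matrix (r' j) (r j) k),
      ∀ j i, E j i → H j i = F' j i * M i + M' j * F j i := by
  have : ∀ i, Module.Projective S (q i → Q i) := fun i => projective_pi _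
  have : Module.Projective S (∀ i, q i → Q i) := projective_pi _
  have : ∀ j, Module.Projective S (r j → R j) := fun j => projective_pi _
  have : Module.Projective S (∀ j, r j → R j) := projective_pi _
  obtain ⟨u, hu⟩ := h ((LinearMap.range (D.map F')).mkQ ∘ₗ D.map H)
  obtain ⟨t, ht⟩ := Module.projective_lifting_property
    (LinearMap.range (D.map F')).mkQ u (Submodule.mkQ_surjective _)
  have h1 : ∀ p, (D.map H - t ∘ₗ D.map F) p ∈ LinearMap.range (D.map F') := by
    intro p
    rw [← Submodule.ker_mkQ (LinearMap.range (D.map F')), LinearMap.mem_ker,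
      LinearMap.sub_apply, _root_.map_sub, sub_eq_zero]
    have h2 := LinearMap.congr_fun hu p
    rw [← ht] at h2
    exact h2.symm
  obtain ⟨s, hs⟩ := Module.projective_lifting_property (D.map F').rangeRestrict
    ((D.map H - t ∘ₗ D.map F).codRestrict _ h1) (D.map F').surjective_rangeRestrict
  have hs' : D.map F' ∘ₗ s = D.map H - t ∘ₗ D.map F :=
    LinearMap.ext fun p => congrArg Subtype.val (LinearMap.congr_fun hs p)
  obtain ⟨M, hM⟩ := D.exists_map_comp F' s
  obtain ⟨M', hM'⟩ := D.exists_comp_map F t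
  refine ⟨M, M', fun j i hE => D.map_injective (F := H)
    (G := fun j i => F' j i * M i + M' j * F j i) ?_ j i hE⟩
  rw [← D.map_add, ← hM, ← hM', hs', sub_add_cancel]

end BipartiteHom

end BlockMaps

section PreprojectiveFamily

variable {k : Type} [Field k]

/-- Matrices with entries given by a function of natural numbers. -/
def natMat (p q : ℕ) (f : ℕ → ℕ → k) : Matrix (Fin p) (Fin q) k := Matrix.of fun b a => f b a

theorem exists_natMat {p q : ℕ} (M : Matrix (Fin p) (Fin q) k) : ∃ f, M = natMat p q f := by
  refine ⟨fun b a => if h : b < p ∧ a < q then M ⟨b, h.1⟩ ⟨a, h.2⟩ else 0, ?_⟩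
  ext b a
  simp [natMat]

theorem natMat_eq_mul_add_mul {p q p' q' : ℕ} {h f s t f' : ℕ → ℕ → k}
    (H : ∀ b < p, ∀ a < q, h b a = ∑ c ∈ Finset.range q', f b c * s c a +
      ∑ c ∈ Finset.range p', t b c * f' c a) :
    natMat p q h = natMat p q' f * natMat q' q s + natMat p p' t * natMat p' q f' := by
  ext b a
  rw [Matrix.add_apply, Matrix.mul_apply, Matrix.mul_apply]
  simp only [natMat, Matrix.of_apply]
  rw [H b b.2 a a.2, ← Fin.sum_univ_eq_sum_range (fun c => f b c * s c a),
    ← Fin.sum_univ_eq_sum_range (fun c => t b c * f' c a)]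

theorem sum_ite_mul_of_iff {n c₀ : ℕ} {P : ℕ → Prop} [DecidablePred P] {R : Prop} [Decidable R]
    {f : ℕ → k} (h : ∀ c < n, P c ↔ R ∧ c = c₀) :
    ∑ c ∈ Finset.range n, (if P c then f c else 0) = if R ∧ c₀ < n then f c₀ else 0 := by
  rw [Finset.sum_congr rfl fun c hc => if_congr (h c (Finset.mem_range.1 hc)) rfl rfl]
  by_cases hR : R
  · simp [hR]
  · simp [hR]

theorem exists_kronecker_solution (m : ℕ) (K₁ K₂ : ℕ → ℕ → k) :
    ∃ X Y : ℕ → ℕ → k, ∀ b ≤ m, ∀ a < m,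
      X b a - (if b < m then Y b a else 0) = K₁ b a ∧
      X b (a + 1) - (if 1 ≤ b then Y (b - 1) a else 0) = K₂ b a := by
  let D : ℕ → ℕ → k := fun i j => K₂ (i + 1) j - K₁ i j
  let c : ℕ → k := fun d => K₁ m (m - d) - ∑ t ∈ Finset.range (m - d), D (d + t) t
  let X : ℕ → ℕ → k := fun i j => if j ≤ i then c (i - j) + ∑ t ∈ Finset.range j, D (i - j + t) t
    else K₂ 0 (j - i - 1) + ∑ t ∈ Finset.range i, D t (j - i + t)
  have hX : ∀ i j, X (i + 1) (j + 1) = X i j + D i j := by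
    intro i j
    by_cases h : j ≤ i
    · have h1 : i + 1 - (j + 1) = i - j := by omega
      simp only [X, if_pos h, if_pos (Nat.succ_le_succ h), h1, Finset.sum_range_succ,
        Nat.sub_add_cancel h, add_assoc]
    · have h1 : j + 1 - (i + 1) = j - i := by omega
      have h2 : ¬ j + 1 ≤ i + 1 := by omega
      have h3 : j - i + i = j := by omega
      simp only [X, if_neg h, if_neg h2, h1, Finset.sum_range_succ, h3, add_assoc]
  refine ⟨X, fun i j => X i j - K₁ i j, fun b hb a ha => ⟨?_, ?_⟩⟩
  · split_ifs with h
    · ring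
    · obtain rfl : b = m := by omega
      have h1 : b - (b - a) = a := by omega
      simp only [X, if_pos ha.le, c, h1]
      ring
  · rcases b with _ | b
    · simp [X]
    · rw [hX, if_pos (by omega), Nat.add_sub_cancel]
      simp only [D]
      ring

/-- The dimensions at the sources. -/
def srcDim (m : ℕ) : Fin 3 → ℕ := ![m + 1, m, 2 * m + 1]

/-- The dimensions at the targets. -/
def tgtDim (m : ℕ) : Fin 3 → ℕ := ![2 * m + 1, m + 1, m + 1]

/-- The edges of the extended Dynkin diagram of type `D₅`. -/
def IsEdge (j i : Fin 3) : Prop := j = 0 ∨ i = 2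

variable (k) in
/-- The entries of the preprojective representations. -/
def preprojEntry (m : ℕ) : Fin 3 → Fin 3 → ℕ → ℕ → k :=
  ![![fun b a => if b = m + a then 1 else 0, fun b a => if b = a then 1 else 0,
      fun b a => if b = a then 1 else 0],
    ![0, 0, fun b a => (if a = m + b then 1 else 0) - if b = a ∧ b < m then 1 else 0],
    ![0, 0, fun b a => (if a = m + b then 1 else 0) - if b = a + 1 ∧ a < m then 1 else 0]]

variable (k) in
/-- A family of preprojective representations of the extended Dynkin quiver of type `D₅`. -/
def preprojRep (m : ℕ) (j i : Fin 3) : Matrix (Fin (tgtDim m j)) (Fin (srcDim m i)) k :=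
  natMat _ _ (preprojEntry k m j i)

theorem preprojRep_solvable (m : ℕ)
    (H : ∀ j i, Matrix (Fin (tgtDim m j)) (Fin (srcDim m i)) k) :
    ∃ (M : ∀ i, Matrix (Fin (srcDim m i)) (Fin (srcDim m i)) k)
      (M' : ∀ j, Matrix (Fin (tgtDim m j)) (Fin (tgtDim m j)) k),
      ∀ j i, IsEdge j i → H j i = preprojRep k m j i * M i + M' j * preprojRep k m j i := by
  choose h hh using fun j i => exists_natMat (H j i)
  obtain rfl : H = fun j i => natMat _ _ (h j i) := funext fun j => funext fun i => hh j i
  obtain ⟨X, Y, hXY⟩ := exists_kronecker_solution (k := k) m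
    (fun b a => -h 1 2 b a - h 1 2 b (m + a) + (h 0 2 (m + b) a - h 0 1 (m + b) a) +
      h 0 2 (m + b) (m + a) -
      if b < m then h 0 2 b a + h 0 2 b (m + a) - h 0 0 b a else 0)
    (fun b a => -h 2 2 b a - h 2 2 b (m + (a + 1)) + (h 0 2 (m + b) a - h 0 1 (m + b) a) +
      h 0 2 (m + b) (m + (a + 1)) -
      if 1 ≤ b then h 0 2 (b - 1) a + h 0 2 (b - 1) (m + (a + 1)) - h 0 0 (b - 1) (a + 1) else 0)
  let t : ℕ → ℕ → k := fun b a =>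
    if b < m then if a < m then Y b a else h 0 0 b (a - m)
    else if a < m then h 0 1 b a else X (b - m) (a - m)
  let sy : ℕ → ℕ → k := fun b a => h 0 2 b a - t b a
  let tc : ℕ → ℕ → k := fun b a =>
    h 1 2 b (m + a) - sy (m + b) (m + a) + if b < m then sy b (m + a) else 0
  let td : ℕ → ℕ → k := fun b a =>
    h 2 2 b (m + a) - sy (m + b) (m + a) + if 1 ≤ b then sy (b - 1) (m + a) else 0
  let sn : Fin 3 → ℕ → ℕ → k :=
    ![fun b a => h 0 0 (m + b) a - t (m + b) (m + a), fun b a => h 0 1 b a - t b a, sy]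
  let tn : Fin 3 → ℕ → ℕ → k := ![t, tc, td]
  refine ⟨fun i => natMat _ _ (sn i), fun j => natMat _ _ (tn j), fun j i hE => ?_⟩
  refine natMat_eq_mul_add_mul fun b hb a ha => ?_
  fin_cases j <;> fin_cases i <;> simp [IsEdge] at hE <;>
    simp [tgtDim, srcDim] at hb ha <;>
    simp [tgtDim, srcDim, preprojEntry, sn, tn]
  · rw [sum_ite_mul_of_iff (P := fun c => b = m + c) (R := m ≤ b) (c₀ := b - m) (f := fun c => h 0 0 (m + c) a - t (m + c) (m + a))
      (by omega), if_pos (by omega : m + a ≤ 2 * m)]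
    rcases lt_or_ge b m with hbm | hbm
    · simp [t, hbm]
    · have h1 : b - m < m + 1 := by omega
      have h2 : m + (b - m) = b := by omega
      simp [t, hbm, hbm.not_gt, h1, h2]
  · rw [if_pos (by omega : a ≤ 2 * m)]
    rcases lt_or_ge b m with hbm | hbm
    · simp [hbm]
    · simp [hbm.not_gt, t, ha]
  · rw [if_pos (by omega : a ≤ 2 * m), if_pos (by omega : b ≤ 2 * m)]
    simp [sy]
  · simp only [sub_mul, mul_sub, Finset.sum_sub_distrib, ite_mul, mul_ite, mul_one, one_mul,
      zero_mul, mul_zero]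
    rw [sum_ite_mul_of_iff (P := fun c => c = m + b) (R := True) (c₀ := m + b) (by simp),
      sum_ite_mul_of_iff (P := fun c => b = c ∧ b < m) (R := b < m) (c₀ := b) (by omega),
      sum_ite_mul_of_iff (P := fun c => a = m + c) (R := m ≤ a) (c₀ := a - m) (by omega),
      sum_ite_mul_of_iff (P := fun c => c = a ∧ c < m) (R := a < m) (c₀ := a) (by omega)]
    rcases lt_or_ge a m with ham | ham
    · have h1 := (hXY b hb a ham).1
      have h2 : a < m + 1 := by omega
      have h3 : m + b < 2 * m + 1 := by omega
      have h4 : b < 2 * m + 1 := by omega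
      have h5 : ¬ m + b < m := by omega
      simp only [h3, h4, ham, ham.not_ge, h2, and_self, and_true, false_and, if_true,
        if_false]
      rcases lt_or_ge b m with hbm | hbm
      · simp [hbm, tc, sy, t, ham] at h1 ⊢
        linear_combination h1
      · simp [hbm.not_gt, tc, sy, t, ham] at h1 ⊢
        linear_combination h1
    · obtain ⟨a, rfl⟩ := Nat.exists_eq_add_of_le ham
      have h2 : a < m + 1 := by omega
      have h3 : m + b < 2 * m + 1 := by omega
      have h4 : b < 2 * m + 1 := by omega
      simp [h2, h3, h4, tc]
  · simp only [sub_mul, mul_sub, Finset.sum_sub_distrib, ite_mul, mul_ite, mul_one, one_mul,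
      zero_mul, mul_zero]
    rw [sum_ite_mul_of_iff (P := fun c => c = m + b) (R := True) (c₀ := m + b) (by simp),
      sum_ite_mul_of_iff (P := fun c => b = c + 1 ∧ c < m) (R := 1 ≤ b) (c₀ := b - 1) (by omega),
      sum_ite_mul_of_iff (P := fun c => a = m + c) (R := m ≤ a) (c₀ := a - m) (by omega),
      sum_ite_mul_of_iff (P := fun c => c = a + 1 ∧ a < m) (R := a < m) (c₀ := a + 1) (by omega)]
    rcases lt_or_ge a m with ham | ham
    · have h1 := (hXY b hb a ham).2
      have h2 : a + 1 < m + 1 := by omega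
      have h3 : m + b < 2 * m + 1 := by omega
      have h4 : b - 1 < 2 * m + 1 := by omega
      simp only [h3, h4, ham, ham.not_ge, h2, and_self, and_true, false_and, if_true,
        if_false]
      rcases b with _ | b
      · simp [td, sy, t, ham] at h1 ⊢
        linear_combination h1
      · have h6 : b < m := by omega
        simp [td, sy, t, ham, h6] at h1 ⊢
        linear_combination h1
    · obtain ⟨a, rfl⟩ := Nat.exists_eq_add_of_le ham
      have h2 : a < m + 1 := by omega
      have h3 : m + b < 2 * m + 1 := by omega
      have h4 : b - 1 < 2 * m + 1 := by omega
      simp [h2, h3, h4, td]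

theorem preprojRep_not_solvable {m m' : ℕ} (hm : m' + 2 ≤ m) :
    ¬ ∀ H : ∀ j i, Matrix (Fin (tgtDim m' j)) (Fin (srcDim m i)) k,
      ∃ (M : ∀ i, Matrix (Fin (srcDim m' i)) (Fin (srcDim m i)) k)
        (M' : ∀ j, Matrix (Fin (tgtDim m' j)) (Fin (tgtDim m j)) k),
        ∀ j i, IsEdge j i → H j i = preprojRep k m' j i * M i + M' j * preprojRep k m j i := by
  intro hsol
  let ej : Fin 5 → Fin 3 := ![0, 0, 0, 1, 2]
  let ei : Fin 5 → Fin 3 := ![0, 1, 2, 2, 2]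
  have hE : ∀ e, IsEdge (ej e) (ei e) := by
    intro e
    fin_cases e <;> simp [IsEdge, ej, ei]
  let L : ((∀ i, Matrix (Fin (srcDim m' i)) (Fin (srcDim m i)) k) ×
      (∀ j, Matrix (Fin (tgtDim m' j)) (Fin (tgtDim m j)) k)) →ₗ[k]
      (∀ e, Matrix (Fin (tgtDim m' (ej e))) (Fin (srcDim m (ei e))) k) :=
    { toFun := fun M e => preprojRep k m' (ej e) (ei e) * M.1 (ei e) +
        M.2 (ej e) * preprojRep k m (ej e) (ei e)
      map_add' := by
        intro M N
        funext e
        simp only [Prod.fst_add, Prod.snd_add, Pi.add_apply, Matrix.mul_add, Matrix.add_mul]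
        abel
      map_smul' := by
        intro c M
        funext e
        simp [smul_add] }
  have hL : Function.Surjective L := by
    intro G
    choose f hf using fun e => exists_natMat (G e)
    let h : Fin 3 → Fin 3 → ℕ → ℕ → k := ![![f 0, f 1, f 2], ![0, 0, f 3], ![0, 0, f 4]]
    obtain ⟨M, M', hM⟩ := hsol fun j i => natMat _ _ (h j i)
    refine ⟨(M, M'), funext fun e => ?_⟩
    rw [hf]
    refine (hM _ _ (hE e)).symm.trans ?_
    have : h (ej e) (ei e) = f e := by
      fin_cases e <;> rfl
    rw [this]
  have h := LinearMap.finrank_le_finrank_of_surjective hL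
  rw [Module.finrank_prod, Module.finrank_pi_fintype, Module.finrank_pi_fintype,
    Module.finrank_pi_fintype] at h
  simp only [Module.finrank_matrix, Module.finrank_self, Fintype.card_fin, mul_one,
    Fin.sum_univ_three, Fin.sum_univ_five] at h
  simp [srcDim, tgtDim, ej, ei] at h
  nlinarith

end PreprojectiveFamily

section CornerIdeals

variable {k A : Type} [Field k] [Ring A] [Algebra k A]

instance : IsScalarTower k Aᵐᵒᵖ A :=
  ⟨fun c s a => by
    rw [MulOpposite.smul_eq_mul_unop, MulOpposite.smul_eq_mul_unop, MulOpposite.unop_smul,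
      mul_smul_comm]⟩

/-- The right ideal generated by an idempotent. -/
def cornerIdeal (e : A) : Submodule Aᵐᵒᵖ A where
  carrier := {x | e * x = x}
  add_mem' {x y} hx hy := by
    change e * (x + y) = x + y
    rw [mul_add, hx, hy]
  zero_mem' := mul_zero e
  smul_mem' s x hx := by
    change e * (s • x) = s • x
    rw [MulOpposite.smul_eq_mul_unop, ← mul_assoc, hx]

theorem mem_cornerIdeal {e x : A} : x ∈ cornerIdeal e ↔ e * x = x := Iff.rfl

/-- Left multiplication between the right ideals generated by idempotents. -/
def cornerMap {g a : A} (e : A) (h : g * a = a) : cornerIdeal e →ₗ[Aᵐᵒᵖ] cornerIdeal g where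
  toFun x := ⟨a * x, by rw [mem_cornerIdeal, ← mul_assoc, h]⟩
  map_add' x y := Subtype.ext (mul_add a x y)
  map_smul' s x := Subtype.ext <| by
    change a * (s • (x : A)) = s • (a * (x : A))
    rw [MulOpposite.smul_eq_mul_unop, MulOpposite.smul_eq_mul_unop, mul_assoc]

theorem cornerMap_apply {g a e : A} (h : g * a = a) (x : cornerIdeal e) :
    (cornerMap e h x : A) = a * x := rfl

/-- The projection onto the right ideal generated by an idempotent. -/
def cornerProj {e : A} (he : e * e = e) : A →ₗ[Aᵐᵒᵖ] cornerIdeal e where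
  toFun x := ⟨e * x, by rw [mem_cornerIdeal, ← mul_assoc, he]⟩
  map_add' x y := Subtype.ext (mul_add e x y)
  map_smul' s x := Subtype.ext <| by
    change e * (s • x) = s • (e * x)
    rw [MulOpposite.smul_eq_mul_unop, MulOpposite.smul_eq_mul_unop, mul_assoc]

theorem cornerProj_comp_subtype {e : A} (he : e * e = e) :
    cornerProj he ∘ₗ (cornerIdeal e).subtype = LinearMap.id :=
  LinearMap.ext fun x => Subtype.ext x.2

theorem exists_mul_eq_of_cornerIdeal {e g : A} (he : e * e = e)
    (f : cornerIdeal e →ₗ[Aᵐᵒᵖ] cornerIdeal g) :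
    ∃ b, g * b * e = b ∧ ∀ x, (f x : A) = b * x := by
  let e' : cornerIdeal e := ⟨e, he⟩
  have h : ∀ x : cornerIdeal e, (f x : A) = (f e' : A) * x := by
    intro x
    have h1 : x = op (x : A) • e' := Subtype.ext x.2.symm
    conv_lhs => rw [h1, map_smul]
    rfl
  refine ⟨f e', ?_, h⟩
  have h2 := h e'
  rw [mem_cornerIdeal.1 (f e').2]
  exact h2.symm

theorem projective_cornerIdeal {e : A} (he : e * e = e) :
    Module.Projective Aᵐᵒᵖ (cornerIdeal e) := by
  have : Module.Projective Aᵐᵒᵖ A :=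
    Module.Projective.of_equiv (MulOpposite.opLinearEquiv Aᵐᵒᵖ (M := A)).symm
  exact Module.Projective.of_split _ _ (cornerProj_comp_subtype he)

theorem finite_cornerIdeal {e : A} (he : e * e = e) : Module.Finite Aᵐᵒᵖ (cornerIdeal e) := by
  have : Module.Finite Aᵐᵒᵖ A :=
    Module.Finite.equiv (MulOpposite.opLinearEquiv Aᵐᵒᵖ (M := A)).symm
  refine Module.Finite.of_surjective (cornerProj he) fun x => ⟨x, Subtype.ext x.2⟩

end CornerIdeals

section ExtendedDynkin

variable (k : Type) {A : Type} [Field k] [Ring A] [Algebra k A]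

/-- Idempotents of an algebra whose morphism spaces are controlled by the extended Dynkin
diagram of type `D₅`. -/
structure DynkinData (e g : Fin 3 → A) (α : Fin 3 → Fin 3 → A) : Prop where
  idem_left : ∀ i, e i * e i = e i
  idem_right : ∀ j, g j * g j = g j
  mul_left : ∀ j i, g j * α j i = α j i
  mul_right : ∀ j i, α j i * e i = α j i
  ne_zero : ∀ j i, IsEdge j i → α j i ≠ 0
  eq_zero : ∀ j i, ¬ IsEdge j i → α j i = 0
  hom : ∀ j i a, ∃ c : k, g j * a * e i = c • α j i
  source_ne : ∀ j i i' a, i ≠ i' → α j i' * a * e i = 0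
  source : ∀ i a, ∃ c : k, ∀ j, α j i * a * e i = c • α j i
  target_ne : ∀ j j' i a, j ≠ j' → g j' * a * α j i = 0
  target : ∀ j a, ∃ c : k, ∀ i, g j * a * α j i = c • α j i

variable {k} {e g : Fin 3 → A} {α : Fin 3 → Fin 3 → A}

/-- The morphisms between right ideals given by a configuration of idempotents. -/
def DynkinData.bipartiteHom (D : DynkinData k e g α) :
    BipartiteHom k Aᵐᵒᵖ (fun i => cornerIdeal (e i)) (fun j => cornerIdeal (g j)) IsEdge where
  α j i := cornerMap (e i) (D.mul_left j i)
  ne_zero j i hE h := by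
    refine D.ne_zero j i hE ?_
    have := congrArg Subtype.val (LinearMap.congr_fun h ⟨e i, D.idem_left i⟩)
    rw [cornerMap_apply, D.mul_right] at this
    exact this
  eq_zero j i hE := LinearMap.ext fun x => Subtype.ext <| by
    rw [cornerMap_apply, D.eq_zero j i hE, zero_mul]
    rfl
  hom j i h := by
    obtain ⟨b, hb, hf⟩ := exists_mul_eq_of_cornerIdeal (D.idem_left i) h
    obtain ⟨c, hc⟩ := D.hom j i b
    refine ⟨c, LinearMap.ext fun x => Subtype.ext ?_⟩
    rw [hf, ← hb, hc]
    exact smul_mul_assoc c _ _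
  source_ne j i i' σ hi := LinearMap.ext fun x => Subtype.ext <| by
    obtain ⟨b, hb, hf⟩ := exists_mul_eq_of_cornerIdeal (D.idem_left i) σ
    change α j i' * (σ x : A) = 0
    rw [hf, ← hb, ← mul_assoc, mul_assoc (e i'), ← mul_assoc, D.mul_right, ← mul_assoc,
      D.source_ne j i i' b hi, zero_mul]
  source i σ := by
    obtain ⟨b, hb, hf⟩ := exists_mul_eq_of_cornerIdeal (D.idem_left i) σ
    obtain ⟨c, hc⟩ := D.source i b
    refine ⟨c, fun j => LinearMap.ext fun x => Subtype.ext ?_⟩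
    change α j i * (σ x : A) = c • (α j i * (x : A))
    rw [hf, ← hb, ← mul_assoc, mul_assoc (e i), ← mul_assoc, D.mul_right, ← mul_assoc, hc,
      smul_mul_assoc]
  target_ne j j' i ρ hj := LinearMap.ext fun x => Subtype.ext <| by
    obtain ⟨b, hb, hf⟩ := exists_mul_eq_of_cornerIdeal (D.idem_right j) ρ
    rw [LinearMap.comp_apply, hf, cornerMap_apply, ← hb, ← mul_assoc, mul_assoc (g j' * b),
      D.mul_left, D.target_ne j j' i b hj, zero_mul]
    rfl
  target j ρ := by
    obtain ⟨b, hb, hf⟩ := exists_mul_eq_of_cornerIdeal (D.idem_right j) ρ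
    obtain ⟨c, hc⟩ := D.target j b
    refine ⟨c, fun i => LinearMap.ext fun x => Subtype.ext ?_⟩
    rw [LinearMap.comp_apply, hf, cornerMap_apply, ← hb, ← mul_assoc, mul_assoc (g j * b),
      D.mul_left, hc]
    exact smul_mul_assoc c _ _

theorem DynkinData.not_tauTiltingFinite [Module.Finite k A] (D : DynkinData k e g α) :
    ¬ TauTiltingFinite k A := by
  rintro ⟨n, R, hR⟩
  have hp1 : ∀ i, Module.Projective Aᵐᵒᵖ (cornerIdeal (e i)) :=
    fun i => projective_cornerIdeal (D.idem_left i)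
  have hp0 : ∀ i, Module.Projective Aᵐᵒᵖ (cornerIdeal (g i)) :=
    fun i => projective_cornerIdeal (D.idem_right i)
  have hf1 : ∀ i, Module.Finite Aᵐᵒᵖ (cornerIdeal (e i)) :=
    fun i => finite_cornerIdeal (D.idem_left i)
  have hf0 : ∀ i, Module.Finite Aᵐᵒᵖ (cornerIdeal (g i)) :=
    fun i => finite_cornerIdeal (D.idem_right i)
  let f := fun m => D.bipartiteHom.map (preprojRep k m)
  have hpres : ∀ m, IsVanishingPres (_ ⧸ LinearMap.range (f m)) (f m)
      (LinearMap.range (f m)).mkQ := fun m =>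
    { fin1 := inferInstance
      fin0 := inferInstance
      proj1 := by
        have : ∀ i, Module.Projective Aᵐᵒᵖ (Fin (srcDim m i) → cornerIdeal (e i)) :=
          fun i => projective_pi _
        exact projective_pi _
      proj0 := by
        have : ∀ i, Module.Projective Aᵐᵒᵖ (Fin (tgtDim m i) → cornerIdeal (g i)) :=
          fun i => projective_pi _
        exact projective_pi _
      surj := Submodule.mkQ_surjective _
      exact := (Submodule.ker_mkQ _).symm
      vanish := D.bipartiteHom.homVanish_of_solvable _ (preprojRep_solvable m) }
  choose M hM hb hN hv using fun m => exists_supportTauTilting_completion k (hpres m)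
  choose i hi using fun m => hR (M m) (hM m) (hb m)
  have key : ∀ m m', m < m' → i (2 * m) ≠ i (2 * m') := by
    intro m m' hlt heq
    obtain ⟨φ⟩ := hi (2 * m)
    obtain ⟨φ'⟩ := hi (2 * m')
    rw [← heq] at φ'
    obtain ⟨N, hr⟩ := hN (2 * m)
    have h1 : HomVanish (f (2 * m')) (M (2 * m)) :=
      (hv (2 * m')).retract (φ.trans φ'.symm).isRetract
    have h2 := (HomVanish.pi fun _ : Fin N => h1).retract hr
    exact preprojRep_not_solvable (k := k) (m := 2 * m') (m' := 2 * m) (by omega)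
      (D.bipartiteHom.solvable_of_homVanish _ _ h2)
  obtain ⟨m, m', hne, heq⟩ := Finite.exists_ne_map_eq_of_infinite fun m => i (2 * m)
  rcases hne.lt_or_gt with h | h
  · exact key _ _ h heq
  · exact key _ _ h heq.symm

end ExtendedDynkin

section HeckeBasics

variable {k : Type} [Field k] {r : ℕ}

variable (k r) in
/-- The quotient map from the free algebra. -/
def heckeMk : FreeAlgebra k (AGen r) →ₐ[k] HeckeA k r := RingQuot.mkAlgHom k (heckeARel k r)

theorem heckeMk_ι (i : AGen r) : heckeMk k r (FreeAlgebra.ι k i) = TGen k r i := rfl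

theorem heckeMk_rel {x y : FreeAlgebra k (AGen r)} (h : heckeARel k r x y) :
    heckeMk k r x = heckeMk k r y :=
  RingQuot.mkAlgHom_rel k h

theorem TGen_mul_self (i : AGen r) : TGen k r i * TGen k r i = -TGen k r i := by
  simpa [heckeMk_ι] using heckeMk_rel (heckeARel.sq (k := k) i)

theorem TGen_braid (i j : AGen r) (h : i.1 + 1 = j.1 ∨ j.1 + 1 = i.1) :
    TGen k r i * TGen k r j * TGen k r i = TGen k r j * TGen k r i * TGen k r j := by
  simpa [heckeMk_ι] using heckeMk_rel (heckeARel.braid (k := k) i j h)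

theorem TGen_comm (i j : AGen r) (h : i.1 + 2 ≤ j.1 ∨ j.1 + 2 ≤ i.1) :
    TGen k r i * TGen k r j = TGen k r j * TGen k r i := by
  simpa [heckeMk_ι] using heckeMk_rel (heckeARel.comm (k := k) i j h)

/-- The universal property of the Hecke algebra. -/
def heckeLift {B : Type} [Ring B] [Algebra k B] (t : AGen r → B) (sq : ∀ i, t i * t i = -t i)
    (braid : ∀ i j : AGen r, i.1 + 1 = j.1 ∨ j.1 + 1 = i.1 → t i * t j * t i = t j * t i * t j)
    (comm : ∀ i j : AGen r, i.1 + 2 ≤ j.1 ∨ j.1 + 2 ≤ i.1 → t i * t j = t j * t i) :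
    HeckeA k r →ₐ[k] B :=
  RingQuot.liftAlgHom k ⟨FreeAlgebra.lift k t, by
    intro x y h
    induction h with
    | sq i => simpa using sq i
    | braid i j h => simpa using braid i j h
    | comm i j h => simpa using comm i j h⟩

theorem heckeLift_TGen {B : Type} [Ring B] [Algebra k B] (t : AGen r → B)
    (sq : ∀ i, t i * t i = -t i)
    (braid : ∀ i j : AGen r, i.1 + 1 = j.1 ∨ j.1 + 1 = i.1 → t i * t j * t i = t j * t i * t j)
    (comm : ∀ i j : AGen r, i.1 + 2 ≤ j.1 ∨ j.1 + 2 ≤ i.1 → t i * t j = t j * t i)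
    (i : AGen r) : heckeLift t sq braid comm (TGen k r i) = t i := by
  rw [heckeLift, TGen]
  erw [RingQuot.liftAlgHom_mkAlgHom_apply]
  simp

theorem hecke_induction {P : HeckeA k r → Prop} (scalar : ∀ c : k, P (algebraMap k _ c))
    (gen : ∀ i, P (TGen k r i)) (mul : ∀ a b, P a → P b → P (a * b))
    (add : ∀ a b, P a → P b → P (a + b)) (a : HeckeA k r) : P a := by
  obtain ⟨a, rfl⟩ := RingQuot.mkAlgHom_surjective k (heckeARel k r) a
  induction a using FreeAlgebra.induction with
  | grade0 c =>
    rw [AlgHom.commutes]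
    exact scalar c
  | grade1 i => exact gen i
  | mul a b ha hb =>
    rw [map_mul]
    exact mul _ _ ha hb
  | add a b ha hb =>
    rw [map_add]
    exact add _ _ ha hb

variable (k r) in
/-- The anti-automorphism fixing the generators, as a homomorphism to the opposite algebra. -/
def starHom : HeckeA k r →ₐ[k] (HeckeA k r)ᵐᵒᵖ :=
  heckeLift (fun i => op (TGen k r i))
    (fun i => by rw [← op_mul, TGen_mul_self, MulOpposite.op_neg])
    (fun i j h => by simp only [← op_mul, ← mul_assoc, TGen_braid i j h])
    (fun i j h => by simp only [← op_mul, TGen_comm i j h])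

/-- The anti-automorphism fixing the generators. -/
def heckeStar (a : HeckeA k r) : HeckeA k r := (starHom k r a).unop

theorem heckeStar_TGen (i : AGen r) : heckeStar (TGen k r i) = TGen k r i := by
  rw [heckeStar, starHom, heckeLift_TGen]
  rfl

theorem heckeStar_mul (a b : HeckeA k r) : heckeStar (a * b) = heckeStar b * heckeStar a := by
  simp [heckeStar]

theorem heckeStar_add (a b : HeckeA k r) : heckeStar (a + b) = heckeStar a + heckeStar b := by
  simp [heckeStar]

theorem heckeStar_sub (a b : HeckeA k r) : heckeStar (a - b) = heckeStar a - heckeStar b := by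
  simp [heckeStar]

theorem heckeStar_zero : heckeStar (0 : HeckeA k r) = 0 := by
  simp [heckeStar]

theorem heckeStar_one : heckeStar (1 : HeckeA k r) = 1 := by
  simp [heckeStar]

theorem heckeStar_smul (c : k) (a : HeckeA k r) : heckeStar (c • a) = c • heckeStar a := by
  simp [heckeStar]

theorem heckeStar_heckeStar (a : HeckeA k r) : heckeStar (heckeStar a) = a := by
  induction a using hecke_induction with
  | scalar c => simp [Algebra.algebraMap_eq_smul_one, heckeStar_smul, heckeStar_one]
  | gen i => rw [heckeStar_TGen, heckeStar_TGen]
  | mul a b ha hb => rw [heckeStar_mul, heckeStar_mul, ha, hb]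
  | add a b ha hb => rw [heckeStar_add, heckeStar_add, ha, hb]

theorem heckeStar_injective {a b : HeckeA k r} (h : heckeStar a = heckeStar b) : a = b := by
  rw [← heckeStar_heckeStar a, h, heckeStar_heckeStar]

open Classical in
variable (k r) in
/-- The one-dimensional representation sending the generators in `M` to `-1` and the others
to zero. -/
def heckeChar (M : Set ℕ) : HeckeA k r →ₐ[k] k :=
  heckeLift (fun i => if i.1 ∈ M then -1 else 0)
    (fun i => by split_ifs <;> simp)
    (fun i j _ => by split_ifs <;> simp)
    (fun i j _ => mul_comm _ _)

theorem heckeChar_of_mem {M : Set ℕ} {i : AGen r} (h : i.1 ∈ M) :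
    heckeChar k r M (TGen k r i) = -1 := by
  rw [heckeChar, heckeLift_TGen, if_pos h]

theorem heckeChar_of_not_mem {M : Set ℕ} {i : AGen r} (h : i.1 ∉ M) :
    heckeChar k r M (TGen k r i) = 0 := by
  rw [heckeChar, heckeLift_TGen, if_neg h]

theorem heckeChar_heckeStar (M : Set ℕ) (a : HeckeA k r) :
    heckeChar k r M (heckeStar a) = heckeChar k r M a := by
  induction a using hecke_induction with
  | scalar c => simp [Algebra.algebraMap_eq_smul_one, heckeStar_smul, heckeStar_one]
  | gen i => rw [heckeStar_TGen]
  | mul a b ha hb => rw [heckeStar_mul, map_mul, map_mul, ha, hb, mul_comm]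
  | add a b ha hb => rw [heckeStar_add, map_add, map_add, ha, hb]

end HeckeBasics

section Words

/-- Exchange two adjacent letters. -/
def swapW (i : ℕ) (s : ℕ → ℕ) : ℕ → ℕ := fun j =>
  if j = i then s (i + 1) else if j = i + 1 then s i else s j

/-- Sort two adjacent letters in decreasing order. -/
def sortW (i : ℕ) (s : ℕ → ℕ) : ℕ → ℕ := if s i < s (i + 1) then swapW i s else s

theorem swapW_swapW (i : ℕ) (s : ℕ → ℕ) : swapW i (swapW i s) = s := by
  funext j
  simp only [swapW]
  split_ifs <;> grind

theorem swapW_comm {i j : ℕ} (h : i + 2 ≤ j) (s : ℕ → ℕ) :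
    swapW i (swapW j s) = swapW j (swapW i s) := by
  funext l
  simp only [swapW]
  grind

theorem swapW_braid (i : ℕ) (s : ℕ → ℕ) :
    swapW i (swapW (i + 1) (swapW i s)) = swapW (i + 1) (swapW i (swapW (i + 1) s)) := by
  funext l
  simp only [swapW]
  grind

theorem swapW_left (i : ℕ) (s : ℕ → ℕ) : swapW i s i = s (i + 1) := by simp [swapW]

theorem swapW_right (i : ℕ) (s : ℕ → ℕ) : swapW i s (i + 1) = s i := by simp [swapW]

theorem swapW_of_ne {i j : ℕ} (h : j ≠ i) (h' : j ≠ i + 1) (s : ℕ → ℕ) : swapW i s j = s j := by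
  simp [swapW, h, h']

theorem sortW_of_lt {i : ℕ} {s : ℕ → ℕ} (h : s i < s (i + 1)) : sortW i s = swapW i s := if_pos h

theorem sortW_of_le {i : ℕ} {s : ℕ → ℕ} (h : s (i + 1) ≤ s i) : sortW i s = s := if_neg h.not_gt

theorem sortW_sortW (i : ℕ) (s : ℕ → ℕ) : sortW i (sortW i s) = sortW i s := by
  by_cases h : s i < s (i + 1)
  · rw [sortW_of_lt h, sortW_of_le]
    rw [swapW_left, swapW_right]
    exact h.le
  · rw [sortW_of_le (not_lt.1 h), sortW_of_le (not_lt.1 h)]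

theorem sortW_comm {i j : ℕ} (h : i + 2 ≤ j) (s : ℕ → ℕ) :
    sortW i (sortW j s) = sortW j (sortW i s) := by
  have h1 : swapW i s j = s j := swapW_of_ne (by omega) (by omega) s
  have h2 : swapW i s (j + 1) = s (j + 1) := swapW_of_ne (by omega) (by omega) s
  have h3 : swapW j s i = s i := swapW_of_ne (by omega) (by omega) s
  have h4 : swapW j s (i + 1) = s (i + 1) := swapW_of_ne (by omega) (by omega) s
  by_cases hi : s i < s (i + 1) <;> by_cases hj : s j < s (j + 1) <;>
    simp [sortW, hi, hj, h1, h2, h3, h4, swapW_comm h]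

theorem sortW_braid (i : ℕ) (s : ℕ → ℕ) :
    sortW i (sortW (i + 1) (sortW i s)) = sortW (i + 1) (sortW i (sortW (i + 1) s)) := by
  have hb := swapW_braid i s
  have e1 : ∀ s, swapW i s (i + 2) = s (i + 2) := fun s => swapW_of_ne (by omega) (by omega) s
  have e2 : ∀ s, swapW (i + 1) s i = s i := fun s => swapW_of_ne (by omega) (by omega) s
  have e3 : ∀ s, swapW (i + 1) s (i + 2) = s (i + 1) := fun s => swapW_right (i + 1) s
  by_cases h1 : s i < s (i + 1) <;> by_cases h2 : s (i + 1) < s (i + 2) <;>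
    by_cases h3 : s i < s (i + 2) <;>
    first
    | omega
    | (simp [sortW, h1, h2, h3, e1, e2, e3, swapW_left, swapW_right, hb]; done)
    | (simp [sortW, h1, h2, h3, e1, e2, e3, swapW_left, swapW_right, h1.not_gt]; done)
    | (simp [sortW, h1, h2, h3, e1, e2, e3, swapW_left, swapW_right, show ¬ s (i + 1 + 1) < s (i + 1) from h2.not_gt]; done)

end Words

section WordRep

variable {k : Type} [Field k] {r : ℕ}

variable (k) in
/-- Sorting two adjacent letters, extended linearly. -/
def sortOp (i : ℕ) : Module.End k ((ℕ → ℕ) →₀ k) := Finsupp.lmapDomain k k (sortW i)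

theorem sortOp_mul (i j : ℕ) :
    sortOp k i * sortOp k j = Finsupp.lmapDomain k k (sortW i ∘ sortW j) :=
  (Finsupp.lmapDomain_comp k k _ _).symm

theorem sortOp_mul_mul (i j l : ℕ) :
    sortOp k i * sortOp k j * sortOp k l
      = Finsupp.lmapDomain k k (sortW i ∘ sortW j ∘ sortW l) := by
  rw [mul_assoc, sortOp_mul, sortOp, Module.End.mul_eq_comp, ← Finsupp.lmapDomain_comp]

theorem sub_one_braid {B : Type} [Ring B] {p q : B} (hp : p * p = p) (hq : q * q = q)
    (h : p * q * p = q * p * q) :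
    (p - 1) * (q - 1) * (p - 1) = (q - 1) * (p - 1) * (q - 1) := by
  have : (p - 1) * (q - 1) * (p - 1) - (q - 1) * (p - 1) * (q - 1)
      = (p * q * p - q * p * q) - (p * p - p) + (q * q - q) := by noncomm_ring
  rw [← sub_eq_zero, this, hp, hq, h]
  simp

theorem sub_one_sq {B : Type} [Ring B] {p : B} (hp : p * p = p) :
    (p - 1) * (p - 1) = -(p - 1) := by
  rw [sub_mul, mul_sub, hp]
  simp

theorem sub_one_comm {B : Type} [Ring B] {p q : B} (h : p * q = q * p) :
    (p - 1) * (q - 1) = (q - 1) * (p - 1) := by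
  have : (p - 1) * (q - 1) - (q - 1) * (p - 1) = p * q - q * p := by noncomm_ring
  rw [← sub_eq_zero, this, h, sub_self]

variable (k r) in
/-- The representation of the Hecke algebra on words. -/
def wordRep : HeckeA k r →ₐ[k] Module.End k ((ℕ → ℕ) →₀ k) :=
  have hsq : ∀ i, sortOp k i * sortOp k i = sortOp k i := fun i => by
    rw [sortOp_mul, sortOp]
    congr 1
    exact funext (sortW_sortW i)
  have hb : ∀ i, sortOp k i * sortOp k (i + 1) * sortOp k i
      = sortOp k (i + 1) * sortOp k i * sortOp k (i + 1) := fun i => by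
    rw [sortOp_mul_mul, sortOp_mul_mul]
    congr 1
    exact funext (sortW_braid i)
  have hc : ∀ i j, i + 2 ≤ j → sortOp k i * sortOp k j = sortOp k j * sortOp k i := fun i j h => by
    rw [sortOp_mul, sortOp_mul]
    congr 1
    exact funext (sortW_comm h)
  heckeLift (fun i => sortOp k i.1 - 1)
    (fun i => sub_one_sq (B := Module.End k ((ℕ → ℕ) →₀ k)) (hsq i.1))
    (fun i j h => by
      obtain ⟨i, hi⟩ := i
      obtain ⟨j, hj⟩ := j
      simp only at h ⊢
      rcases h with rfl | rfl
      · exact sub_one_braid (B := Module.End k ((ℕ → ℕ) →₀ k)) (hsq _) (hsq _) (hb i)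
      · exact (sub_one_braid (B := Module.End k ((ℕ → ℕ) →₀ k)) (hsq _) (hsq _) (hb j)).symm)
    (fun i j h => sub_one_comm (B := Module.End k ((ℕ → ℕ) →₀ k))
      (h.elim (hc _ _) fun h => (hc _ _ h).symm))

theorem wordRep_TGen (i : AGen r) (s : ℕ → ℕ) (c : k) :
    wordRep k r (TGen k r i) (Finsupp.single s c)
      = Finsupp.single (sortW i.1 s) c - Finsupp.single s c := by
  rw [wordRep, heckeLift_TGen]
  simp [sortOp]

theorem swapW_braid' {i j : ℕ} (h : i + 1 = j ∨ j + 1 = i) (s : ℕ → ℕ) :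
    swapW i (swapW j (swapW i s)) = swapW j (swapW i (swapW j s)) := by
  rcases h with rfl | rfl
  · exact swapW_braid i s
  · exact (swapW_braid j s).symm

theorem swapW_comm' {i j : ℕ} (h : i + 2 ≤ j ∨ j + 2 ≤ i) (s : ℕ → ℕ) :
    swapW i (swapW j s) = swapW j (swapW i s) := by
  rcases h with h | h
  · exact swapW_comm h s
  · exact (swapW_comm h s).symm

/-- `Reach b x n s y`: the word `s` is obtained from `b` by exchanging `n` ascents, and `y` is
obtained from `x` by multiplying with the corresponding elements `1 + T_i`. -/
inductive Reach (b : ℕ → ℕ) (x : HeckeA k r) : ℕ → (ℕ → ℕ) → HeckeA k r → Prop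
  | base : Reach b x 0 b x
  | step {n : ℕ} {s : ℕ → ℕ} {y : HeckeA k r} (i : AGen r) (h : Reach b x n s y)
      (hs : s i.1 < s (i.1 + 1)) : Reach b x (n + 1) (swapW i.1 s) ((1 + TGen k r i) * y)

theorem TGen_mul_one_add_mul (i : AGen r) (y : HeckeA k r) :
    TGen k r i * ((1 + TGen k r i) * y) = 0 := by
  rw [← mul_assoc, mul_add, mul_one, TGen_mul_self, add_neg_cancel, zero_mul]

theorem one_add_TGen_mul_self (i : AGen r) :
    (1 + TGen k r i) * (1 + TGen k r i) = 1 + TGen k r i := by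
  rw [add_mul, one_mul]
  simpa using TGen_mul_one_add_mul i 1

theorem one_add_TGen_comm (i j : AGen r) (h : i.1 + 2 ≤ j.1 ∨ j.1 + 2 ≤ i.1) :
    (1 + TGen k r i) * (1 + TGen k r j) = (1 + TGen k r j) * (1 + TGen k r i) := by
  have := TGen_comm (k := k) i j h
  rw [add_mul, mul_add, mul_add, this]
  noncomm_ring

theorem one_add_TGen_braid (i j : AGen r) (h : i.1 + 1 = j.1 ∨ j.1 + 1 = i.1) :
    (1 + TGen k r i) * (1 + TGen k r j) * (1 + TGen k r i)
      = (1 + TGen k r j) * (1 + TGen k r i) * (1 + TGen k r j) := by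
  have h1 := TGen_braid (k := k) i j h
  have h2 := TGen_mul_self (k := k) i
  have h3 := TGen_mul_self (k := k) j
  set a := TGen k r i
  set b := TGen k r j
  have : (1 + a) * (1 + b) * (1 + a) - (1 + b) * (1 + a) * (1 + b)
    = (a * b * a - b * a * b) + (a * a + a) - (b * b + b) := by noncomm_ring
  rw [← sub_eq_zero, this, h1, h2, h3]
  simp

section Faithful

variable {b : ℕ → ℕ} {x : HeckeA k r} (hb : ∀ i : AGen r, b i.1 ≤ b (i.1 + 1))
  (hx : ∀ i : AGen r, b i.1 = b (i.1 + 1) → TGen k r i * x = 0)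
include hb hx

theorem Reach.key (n : ℕ) : ∀ {s : ℕ → ℕ} {y : HeckeA k r}, Reach b x n s y → ∀ i : AGen r,
    (s i.1 = s (i.1 + 1) → TGen k r i * y = 0) ∧
    (s (i.1 + 1) < s i.1 → ∃ m y', n = m + 1 ∧ Reach b x m (swapW i.1 s) y' ∧
      y = (1 + TGen k r i) * y') := by
  induction n using Nat.strong_induction_on with
  | _ n ih =>
  intro s' y' h i
  cases h with
  | base => exact ⟨hx i, fun h => absurd (hb i) (not_le.2 h)⟩
  | @step n s y j h hs =>
    by_cases hij : i = j
    · subst hij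
      rw [swapW_left, swapW_right]
      refine ⟨fun h => absurd h hs.ne', fun _ => ⟨n, y, rfl, ?_, rfl⟩⟩
      rwa [swapW_swapW]
    have hij' : i.1 ≠ j.1 := fun h => hij (Subtype.ext h)
    by_cases hfar : i.1 + 2 ≤ j.1 ∨ j.1 + 2 ≤ i.1
    · rw [swapW_of_ne hij' (by omega), swapW_of_ne (by omega) (by omega)]
      obtain ⟨h1, h2⟩ := ih n (by omega) h i
      refine ⟨fun he => ?_, fun he => ?_⟩
      · rw [← mul_assoc, mul_add, mul_one, TGen_comm i j hfar, ← one_add_mul, mul_assoc, h1 he,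
          mul_zero]
      · obtain ⟨m, y0, rfl, h3, rfl⟩ := h2 he
        refine ⟨m + 1, (1 + TGen k r j) * y0, rfl, ?_, ?_⟩
        · rw [swapW_comm' hfar]
          refine Reach.step j h3 ?_
          rwa [swapW_of_ne (by omega) (by omega), swapW_of_ne (by omega) (by omega)]
        · rw [← mul_assoc, ← mul_assoc, one_add_TGen_comm i j hfar]
    · have hadj : i.1 + 1 = j.1 ∨ j.1 + 1 = i.1 := by omega
      have hbr := one_add_TGen_braid (k := k) i j hadj
      have hswap := swapW_braid' hadj
      obtain ⟨_, h2⟩ := ih n (by omega) h i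
      refine ⟨fun he => ?_, fun he => ?_⟩
      · have h3 : s (i.1 + 1) < s i.1 ∧ swapW i.1 s j.1 = swapW i.1 s (j.1 + 1) := by
          simp only [swapW] at he ⊢
          grind
        obtain ⟨m, y0, rfl, h4, rfl⟩ := h2 h3.1
        have h5 := (ih m (by omega) h4 j).1 h3.2
        have h6 : (1 + TGen k r j) * y0 = y0 := by rw [add_mul, h5, one_mul, add_zero]
        have h7 : (1 + TGen k r i) * ((1 + TGen k r j) * ((1 + TGen k r i) * y0))
            = (1 + TGen k r j) * ((1 + TGen k r i) * y0) := by
          rw [← mul_assoc, ← mul_assoc, hbr, mul_assoc, h6, mul_assoc]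
        rwa [add_mul, one_mul, add_eq_left] at h7
      · have h3 : s (i.1 + 1) < s i.1 ∧ swapW i.1 s (j.1 + 1) < swapW i.1 s j.1 ∧
            swapW j.1 (swapW i.1 s) i.1 < swapW j.1 (swapW i.1 s) (i.1 + 1) ∧
            swapW i.1 (swapW j.1 (swapW i.1 s)) j.1
              < swapW i.1 (swapW j.1 (swapW i.1 s)) (j.1 + 1) := by
          simp only [swapW] at he ⊢
          grind
        obtain ⟨m, y0, rfl, h4, rfl⟩ := h2 h3.1
        obtain ⟨m', y1, rfl, h5, rfl⟩ := (ih m (by omega) h4 j).2 h3.2.1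
        refine ⟨m' + 2, (1 + TGen k r j) * ((1 + TGen k r i) * y1), rfl, ?_, ?_⟩
        · have := Reach.step j (Reach.step i h5 h3.2.2.1) h3.2.2.2
          rwa [hswap (swapW i.1 s) |>.symm.trans (by rw [swapW_swapW])] at this
        · simp only [← mul_assoc, hbr]

theorem Reach.unique {n m : ℕ} {s : ℕ → ℕ} {y y' : HeckeA k r} (h : Reach b x n s y)
    (h' : Reach b x m s y') : y = y' := by
  induction h generalizing m y' with
  | base =>
    cases h' with
    | base => rfl
    | @step n s y j h hs =>
      have := hb j
      rw [swapW_left, swapW_right] at this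
      omega
  | @step n s y j h hs ih =>
    obtain ⟨m, y0, rfl, h1, rfl⟩ := (Reach.key hb hx m h' j).2 (by rwa [swapW_left, swapW_right])
    rw [swapW_swapW] at h1
    rw [ih h1]

omit hb hx in
open Classical in
/-- The linear map sending a reachable word to the corresponding element. -/
def reachMap (b : ℕ → ℕ) (x : HeckeA k r) : ((ℕ → ℕ) →₀ k) →ₗ[k] HeckeA k r :=
  Finsupp.linearCombination k
    (fun s => if h : ∃ y n, Reach b x n s y then h.choose else 0)

theorem reachMap_single {n : ℕ} {s : ℕ → ℕ} {y : HeckeA k r} (h : Reach b x n s y) :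
    reachMap b x (Finsupp.single s 1) = y := by
  have h' : ∃ y n, Reach b x n s y := ⟨y, n, h⟩
  rw [reachMap, Finsupp.linearCombination_single, one_smul, dif_pos h']
  exact Reach.unique hb hx h'.choose_spec.choose_spec h

theorem wordRep_reach (a : HeckeA k r) :
    ∀ v ∈ Submodule.span k {v | ∃ n s y, Reach b x n s y ∧ v = Finsupp.single s (1 : k)},
      wordRep k r a v ∈ Submodule.span k
        {v | ∃ n s y, Reach b x n s y ∧ v = Finsupp.single s (1 : k)} ∧
      reachMap b x (wordRep k r a v) = a * reachMap b x v := by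
  induction a using hecke_induction with
  | scalar c =>
    intro v hv
    rw [AlgHom.commutes, Module.algebraMap_end_apply, map_smul, Algebra.smul_def]
    exact ⟨Submodule.smul_mem _ _ hv, rfl⟩
  | gen i =>
    intro v hv
    induction hv using Submodule.span_induction with
    | zero => simp
    | add v w _ _ hv hw =>
      rw [map_add, map_add, map_add, hv.2, hw.2, mul_add]
      exact ⟨Submodule.add_mem _ hv.1 hw.1, rfl⟩
    | smul c v _ hv =>
      rw [map_smul, map_smul, map_smul, hv.2, mul_smul_comm]
      exact ⟨Submodule.smul_mem _ _ hv.1, rfl⟩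
    | mem v hv =>
      obtain ⟨n, s, y, h, rfl⟩ := hv
      rw [wordRep_TGen, map_sub, reachMap_single hb hx h]
      have hmem : Finsupp.single s (1 : k) ∈ Submodule.span k
        {v | ∃ n s y, Reach b x n s y ∧ v = Finsupp.single s (1 : k)} :=
        Submodule.subset_span ⟨n, s, y, h, rfl⟩
      rcases lt_or_ge (s i.1) (s (i.1 + 1)) with hs | hs
      · rw [sortW_of_lt hs, reachMap_single hb hx (h.step i hs)]
        refine ⟨Submodule.sub_mem _ (Submodule.subset_span ⟨_, _, _, h.step i hs, rfl⟩) hmem, ?_⟩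
        rw [add_mul, one_mul, add_sub_cancel_left]
      · rw [sortW_of_le hs, sub_self, reachMap_single hb hx h, sub_self]
        refine ⟨Submodule.zero_mem _, ?_⟩
        rcases hs.eq_or_lt with hs | hs
        · exact ((Reach.key hb hx n h i).1 hs.symm).symm
        · obtain ⟨m, y', rfl, h1, rfl⟩ := (Reach.key hb hx n h i).2 hs
          exact (TGen_mul_one_add_mul i y').symm
  | mul a c ha hc =>
    intro v hv
    rw [map_mul, Module.End.mul_apply]
    obtain ⟨h1, h2⟩ := hc v hv
    obtain ⟨h3, h4⟩ := ha _ h1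
    exact ⟨h3, by rw [h4, h2, mul_assoc]⟩
  | add a c ha hc =>
    intro v hv
    obtain ⟨h1, h2⟩ := hc v hv
    obtain ⟨h3, h4⟩ := ha v hv
    rw [map_add, LinearMap.add_apply, map_add, h2, h4, add_mul]
    exact ⟨Submodule.add_mem _ h3 h1, rfl⟩

/-- If `x` is fixed by the elements `1 + T_i` which fix the weakly increasing word `b`, then an
element annihilating `b` annihilates `x`. -/
theorem mul_eq_zero_of_wordRep {a : HeckeA k r}
    (h : wordRep k r a (Finsupp.single b 1) = 0) : a * x = 0 := by
  have := (wordRep_reach hb hx a (Finsupp.single b 1)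
    (Submodule.subset_span ⟨0, b, x, Reach.base, rfl⟩)).2
  rw [h, map_zero, reachMap_single hb hx Reach.base] at this
  exact this.symm

end Faithful

end WordRep

section YoungElements

variable {k : Type} [Field k] {r : ℕ}

/-- The characteristic properties of the sum of the standard basis over the parabolic subgroup
generated by the adjacent transpositions which are not in `M`. -/
structure IsYoungElt (M : Set ℕ) (x : HeckeA k r) : Prop where
  right : ∀ i : AGen r, i.1 ∉ M → x * TGen k r i = 0
  sub_mem : x - 1 ∈ Ideal.span {t | ∃ i : AGen r, i.1 ∉ M ∧ t = TGen k r i}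

namespace IsYoungElt

variable {M M' : Set ℕ} {x x' y : HeckeA k r}

theorem mul_eq (hx : IsYoungElt M x) (hy : ∀ i : AGen r, i.1 ∉ M → TGen k r i * y = 0) :
    x * y = y := by
  have : ∀ t ∈ Ideal.span {t | ∃ i : AGen r, i.1 ∉ M ∧ t = TGen k r i}, t * y = 0 := by
    intro t ht
    induction ht using Submodule.span_induction with
    | zero => rw [zero_mul]
    | add a b _ _ ha hb => rw [add_mul, ha, hb, add_zero]
    | smul c a _ ha => rw [smul_eq_mul, mul_assoc, ha, mul_zero]
    | mem t ht =>
      obtain ⟨i, hi, rfl⟩ := ht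
      exact hy i hi
  have := this _ hx.sub_mem
  rwa [sub_mul, one_mul, sub_eq_zero] at this

theorem star_eq (hx : IsYoungElt M x) : heckeStar x = x := by
  have h : x * heckeStar x = heckeStar x := hx.mul_eq fun i hi => by
    apply heckeStar_injective
    rw [heckeStar_mul, heckeStar_heckeStar, heckeStar_TGen, hx.right i hi, heckeStar_zero]
  have h' := congrArg heckeStar h
  rw [heckeStar_mul, heckeStar_heckeStar] at h'
  exact h.symm.trans h'

theorem left (hx : IsYoungElt M x) (i : AGen r) (hi : i.1 ∉ M) : TGen k r i * x = 0 := by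
  apply heckeStar_injective
  rw [heckeStar_mul, hx.star_eq, heckeStar_TGen, hx.right i hi, heckeStar_zero]

theorem eq_mul (hx : IsYoungElt M x) (hy : ∀ i : AGen r, i.1 ∉ M → y * TGen k r i = 0) :
    y * x = y := by
  apply heckeStar_injective
  rw [heckeStar_mul, hx.star_eq]
  refine hx.mul_eq fun i hi => ?_
  rw [← heckeStar_TGen, ← heckeStar_mul, hy i hi, heckeStar_zero]

theorem mul_self (hx : IsYoungElt M x) : x * x = x := hx.mul_eq hx.left

theorem mul_of_subset (hx : IsYoungElt M x) (hx' : IsYoungElt M' x') (h : M ⊆ M') :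
    x * x' = x :=
  hx'.eq_mul fun i hi => hx.right i fun h' => hi (h h')

theorem mul_of_subset' (hx : IsYoungElt M x) (hx' : IsYoungElt M' x') (h : M ⊆ M') :
    x' * x = x :=
  hx'.mul_eq fun i hi => hx.left i fun h' => hi (h h')

theorem heckeChar (hx : IsYoungElt M x) : heckeChar k r M x = 1 := by
  have h : ∀ t ∈ Ideal.span {t | ∃ i : AGen r, i.1 ∉ M ∧ t = TGen k r i},
      _root_.heckeChar k r M t = 0 := by
    intro t ht
    induction ht using Submodule.span_induction with
    | zero => rw [map_zero]
    | add a b _ _ ha hb => rw [map_add, ha, hb, add_zero]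
    | smul c a _ ha => rw [smul_eq_mul, map_mul, ha, mul_zero]
    | mem t ht =>
      obtain ⟨i, hi, rfl⟩ := ht
      exact heckeChar_of_not_mem hi
  have := h _ hx.sub_mem
  rwa [map_sub, map_one, sub_eq_zero] at this

theorem heckeChar_eq_zero (hx : IsYoungElt M x) (i : AGen r) (hi : i.1 ∉ M) (hi' : i.1 ∈ M') :
    _root_.heckeChar k r M' x = 0 := by
  have := congrArg (_root_.heckeChar k r M') (hx.right i hi)
  rw [map_mul, map_zero, heckeChar_of_mem hi'] at this
  simpa using this

theorem eq_one (hx : IsYoungElt M x) (h : ∀ i : AGen r, i.1 ∈ M) : x = 1 := by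
  have := hx.mul_eq (y := 1) fun i hi => absurd (h i) hi
  rwa [mul_one] at this

theorem congr (hx : IsYoungElt M x) (h : ∀ i : AGen r, i.1 ∈ M ↔ i.1 ∈ M') :
    IsYoungElt M' x := by
  have : {t | ∃ i : AGen r, i.1 ∉ M ∧ t = TGen k r i}
      = {t | ∃ i : AGen r, i.1 ∉ M' ∧ t = TGen k r i} := by
    simp only [h]
  exact ⟨fun i hi => hx.right i fun h' => hi ((h i).1 h'), this ▸ hx.sub_mem⟩

end IsYoungElt

theorem AGen.lt (i : AGen r) : i.1 < r := by
  have := i.2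
  omega

theorem adjSwap_left (i : AGen r) (h : i.1 < r) :
    adjSwap r i ⟨i.1, h⟩ = ⟨i.1 + 1, i.2⟩ := Equiv.swap_apply_left _ _

theorem adjSwap_right (i : AGen r) :
    adjSwap r i ⟨i.1 + 1, i.2⟩ = ⟨i.1, i.lt⟩ := Equiv.swap_apply_right _ _

theorem adjSwap_of_ne (i : AGen r) (x : Fin r) (h : x.1 ≠ i.1) (h' : x.1 ≠ i.1 + 1) :
    adjSwap r i x = x :=
  Equiv.swap_apply_of_ne_of_ne (fun e => h (congrArg Fin.val e)) (fun e => h' (congrArg Fin.val e))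

theorem adjSwap_val (i : AGen r) (x : Fin r) :
    (adjSwap r i x).1 = if x.1 = i.1 then i.1 + 1 else if x.1 = i.1 + 1 then i.1 else x.1 := by
  split_ifs with h h'
  · obtain ⟨x, hx⟩ := x
    subst h
    rw [adjSwap_left]
  · obtain ⟨x, hx⟩ := x
    subst h'
    rw [adjSwap_right]
  · rw [adjSwap_of_ne i x h h']

theorem adjSwap_mul_self (i : AGen r) : adjSwap r i * adjSwap r i = 1 := Equiv.swap_mul_self _ _

theorem adjSwap_adjSwap (i : AGen r) (x : Fin r) : adjSwap r i (adjSwap r i x) = x := by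
  rw [← Equiv.Perm.mul_apply, adjSwap_mul_self, Equiv.Perm.one_apply]

theorem invCount_mul_adjSwap (w : Equiv.Perm (Fin r)) (i : AGen r)
    (h : w ⟨i.1, i.lt⟩ < w ⟨i.1 + 1, i.2⟩) :
    invCount (w * adjSwap r i) = invCount w + 1 := by
  classical
  set a : Fin r := ⟨i.1, i.lt⟩ with ha
  set b : Fin r := ⟨i.1 + 1, i.2⟩ with hb
  have hsa : adjSwap r i a = b := adjSwap_left i _
  have hsb : adjSwap r i b = a := adjSwap_right i
  have hinj : Function.Injective (fun p : Fin r × Fin r => (adjSwap r i p.1, adjSwap r i p.2)) := by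
    intro p q hpq
    simpa [Prod.ext_iff] using hpq
  have hset : Finset.univ.filter (fun p : Fin r × Fin r =>
      p.1 < p.2 ∧ (w * adjSwap r i) p.2 < (w * adjSwap r i) p.1)
      = insert (a, b) ((Finset.univ.filter (fun p : Fin r × Fin r => p.1 < p.2 ∧ w p.2 < w p.1)).map
        ⟨_, hinj⟩) := by
    have hlt : ∀ p q : Fin r, p < q → ¬ (p = a ∧ q = b) → adjSwap r i p < adjSwap r i q := by
      intro p q hpq hne
      rw [Fin.lt_def, adjSwap_val, adjSwap_val]
      rw [Fin.ext_iff, Fin.ext_iff, ha, hb] at hne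
      rw [Fin.lt_def] at hpq
      simp only at hne
      split_ifs <;> omega
    ext ⟨p, q⟩
    simp only [Finset.mem_filter, Finset.mem_univ, true_and, Finset.mem_insert, Finset.mem_map,
      Function.Embedding.coeFn_mk, Prod.mk.injEq, Prod.exists]
    simp only [Equiv.Perm.mul_apply]
    constructor
    · rintro ⟨h1, h2⟩
      by_cases hne : p = a ∧ q = b
      · exact Or.inl hne
      · exact Or.inr ⟨_, _, ⟨hlt p q h1 hne, h2⟩, adjSwap_adjSwap i p, adjSwap_adjSwap i q⟩
    · rintro (⟨rfl, rfl⟩ | ⟨p', q', ⟨h1, h2⟩, rfl, rfl⟩)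
      · rw [hsa, hsb]
        exact ⟨by rw [Fin.lt_def]; simp [ha, hb], h⟩
      · rw [adjSwap_adjSwap, adjSwap_adjSwap]
        refine ⟨hlt _ _ h1 ?_, h2⟩
        rintro ⟨rfl, rfl⟩
        exact absurd h2 h.not_gt
  rw [invCount, hset, Finset.card_insert_of_notMem, Finset.card_map, invCount]
  simp only [Finset.mem_map, Finset.mem_filter, Finset.mem_univ, true_and,
    Function.Embedding.coeFn_mk, Prod.mk.injEq, Prod.exists, not_exists, not_and]
  rintro p q ⟨h1, -⟩ h3 h4
  rw [← hsb, (adjSwap r i).injective.eq_iff] at h3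
  rw [← hsa, (adjSwap r i).injective.eq_iff] at h4
  rw [h3, h4, Fin.lt_def, ha, hb] at h1
  simp at h1

/-- The sum of the first `j` parts. -/
def psumNat {n : ℕ} (lam : Fin n → ℕ) (j : ℕ) : ℕ :=
  ∑ i ∈ Finset.univ.filter (fun i : Fin n => (i : ℕ) < j), lam i

theorem psumNat_zero {n : ℕ} (lam : Fin n → ℕ) : psumNat lam 0 = 0 := by simp [psumNat]

theorem psumNat_succ {n : ℕ} (lam : Fin n → ℕ) (j : Fin n) :
    psumNat lam (j + 1) = psumNat lam j + lam j := by
  classical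
  have : Finset.univ.filter (fun i : Fin n => (i : ℕ) < j + 1)
      = insert j (Finset.univ.filter (fun i : Fin n => (i : ℕ) < j)) := by
    ext i
    simp only [Finset.mem_filter, Finset.mem_univ, true_and, Finset.mem_insert, Fin.ext_iff]
    omega
  rw [psumNat, this, Finset.sum_insert (by simp), add_comm, psumNat]

theorem psumNat_mono {n : ℕ} (lam : Fin n → ℕ) : Monotone (psumNat lam) := fun a b h =>
  Finset.sum_le_sum_of_subset fun i hi => by
    simp only [Finset.mem_filter, Finset.mem_univ, true_and] at hi ⊢
    omega

theorem psumNat_all {n : ℕ} (lam : Fin n → ℕ) : psumNat lam n = ∑ i, lam i := by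
  simp [psumNat]

/-- The indices `i` such that `i` and `i + 1` are not in the same block. -/
def missing {n : ℕ} (lam : Fin n → ℕ) : Set ℕ :=
  {i | ∀ m : Fin n, psum lam m ≤ i → psum lam m + lam m ≤ i + 1}

theorem exists_block {n r : ℕ} (lam : Comp n r) (x : Fin r) :
    ∃ m : Fin n, psum lam.1 m ≤ x ∧ (x : ℕ) < psum lam.1 m + lam.1 m := by
  classical
  have hn : (x : ℕ) < psumNat lam.1 n := by rw [psumNat_all, lam.2]; exact x.2
  have hex : ∃ j, (x : ℕ) < psumNat lam.1 j := ⟨n, hn⟩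
  obtain ⟨m, hm⟩ : ∃ m, Nat.find hex = m + 1 := Nat.exists_eq_succ_of_ne_zero fun h0 => by
    have := Nat.find_spec hex
    rw [h0, psumNat_zero] at this
    omega
  have hmn : m < n := by
    have := Nat.find_le (h := hex) hn
    omega
  have h1 := Nat.find_spec hex
  rw [hm, psumNat_succ lam.1 ⟨m, hmn⟩] at h1
  exact ⟨⟨m, hmn⟩, not_lt.1 (Nat.find_min hex (m := m) (by omega)), h1⟩

theorem block_unique {n : ℕ} (lam : Fin n → ℕ) {x : ℕ} {m m' : Fin n}
    (h : psum lam m ≤ x ∧ x < psum lam m + lam m)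
    (h' : psum lam m' ≤ x ∧ x < psum lam m' + lam m') : m = m' := by
  by_contra hne
  have key : ∀ a b : Fin n, a < b → psum lam a + lam a ≤ psum lam b := fun a b hab => by
    have := psumNat_mono lam (show (a : ℕ) + 1 ≤ b from hab)
    rwa [psumNat_succ] at this
  rcases lt_or_gt_of_ne hne with hlt | hlt
  · have := key _ _ hlt
    omega
  · have := key _ _ hlt
    omega

variable {T : Equiv.Perm (Fin r) → HeckeA k r} {n : ℕ}

theorem mul_adjSwap_mem_young {lam : Comp n r} {w : Equiv.Perm (Fin r)}
    (hw : w ∈ YoungFinset lam.1) {i : AGen r} (hi : i.1 ∉ missing lam.1) :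
    w * adjSwap r i ∈ YoungFinset lam.1 := by
  simp only [missing, Set.mem_ofPred_eq, not_forall, not_le] at hi
  obtain ⟨m0, h1, h2⟩ := hi
  simp only [YoungFinset, Finset.mem_filter, Finset.mem_univ, true_and] at hw ⊢
  intro x m hx
  rw [Equiv.Perm.mul_apply]
  apply hw
  rw [adjSwap_val]
  split_ifs with h h'
  · have := block_unique lam.1 (x := i.1) (m := m) (m' := m0) (by omega) (by omega)
    subst this
    omega
  · have := block_unique lam.1 (x := i.1 + 1) (m := m) (m' := m0) (by omega) (by omega)
    subst this
    omega
  · exact hx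

theorem exists_descent {lam : Comp n r} {w : Equiv.Perm (Fin r)} (hw : w ∈ YoungFinset lam.1)
    (h1 : w ≠ 1) : ∃ i : AGen r, i.1 ∉ missing lam.1 ∧
      w ⟨i.1 + 1, i.2⟩ < w ⟨i.1, i.lt⟩ := by
  by_contra! hcon
  apply h1
  simp only [YoungFinset, Finset.mem_filter, Finset.mem_univ, true_and] at hw
  have hle : ∀ (x : ℕ) (hx : x < r), x ≤ w ⟨x, hx⟩ := by
    intro x
    induction x with
    | zero => intro _; omega
    | succ x ih =>
      intro hx
      obtain ⟨m, hm1, hm2⟩ := exists_block lam ⟨x + 1, hx⟩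
      simp only at hm1 hm2
      by_cases hxm : psum lam.1 m ≤ x
      · have h2 := hcon ⟨x, hx⟩ (by
          simp only [missing, Set.mem_ofPred_eq, not_forall, not_le]
          exact ⟨m, hxm, hm2⟩)
        have h3 := ih (by omega)
        have h4 : w ⟨x, by omega⟩ ≠ w ⟨x + 1, hx⟩ := fun h => by
          simpa using w.injective h
        have h5 : w ⟨x, by omega⟩ < w ⟨x + 1, hx⟩ := lt_of_le_of_ne h2 h4
        rw [Fin.lt_def] at h5
        omega
      · have := (hw ⟨x + 1, hx⟩ m ⟨hm1, hm2⟩).1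
        omega
  have hsum := (Finset.sum_eq_sum_iff_of_le (s := Finset.univ) (f := fun x : Fin r => (x : ℕ))
    (g := fun x => ((w x : Fin r) : ℕ)) (fun x _ => hle x.1 x.2)).1
    (Equiv.sum_comp w (fun x : Fin r => (x : ℕ))).symm
  ext x
  simpa using (hsum x (Finset.mem_univ x)).symm

theorem isYoungElt_xElt (hT : IsHeckeBasis k r T) (lam : Comp n r) :
    IsYoungElt (missing lam.1) (xElt k T lam) := by
  classical
  have hlt : ∀ (w : Equiv.Perm (Fin r)) (i : AGen r),
      w ⟨i.1, i.lt⟩ < w ⟨i.1 + 1, i.2⟩ →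
      T (w * adjSwap r i) = T w * TGen k r i := fun w i h =>
    hT.2.2 w i (invCount_mul_adjSwap w i h)
  have hgt : ∀ (w : Equiv.Perm (Fin r)) (i : AGen r),
      w ⟨i.1 + 1, i.2⟩ < w ⟨i.1, i.lt⟩ →
      T w = T (w * adjSwap r i) * TGen k r i := fun w i h => by
    have := hlt (w * adjSwap r i) i (by
      rwa [Equiv.Perm.mul_apply, Equiv.Perm.mul_apply, adjSwap_left, adjSwap_right])
    rwa [mul_assoc, adjSwap_mul_self, mul_one] at this
  refine ⟨fun i hi => ?_, ?_⟩
  · rw [xElt, Finset.sum_mul]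
    refine Finset.sum_involution (fun w _ => w * adjSwap r i) (fun w _ => ?_) (fun w _ _ h => ?_)
      (fun w hw => mul_adjSwap_mem_young hw hi) (fun w _ => ?_)
    · rcases lt_trichotomy (w ⟨i.1, i.lt⟩) (w ⟨i.1 + 1, i.2⟩) with h | h | h
      · rw [hlt w i h, mul_assoc, TGen_mul_self, mul_neg, add_neg_cancel]
      · simpa using w.injective h
      · rw [hgt w i h, mul_assoc, TGen_mul_self, mul_neg, neg_add_cancel]
    · have := congrArg (fun e : Equiv.Perm (Fin r) => e ⟨i.1 + 1, i.2⟩) (mul_eq_left.1 h)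
      simp only [adjSwap_right, Equiv.Perm.one_apply, Fin.mk.injEq] at this
      omega
    · rw [mul_assoc, adjSwap_mul_self, mul_one]
  · have h1 : (1 : Equiv.Perm (Fin r)) ∈ YoungFinset lam.1 := by
      simpa [YoungFinset] using fun x m h1 h2 => ⟨h1, h2⟩
    rw [xElt, ← Finset.add_sum_erase _ _ h1, hT.1, add_sub_cancel_left]
    refine Submodule.sum_mem _ fun w hw => ?_
    obtain ⟨i, hi, h⟩ := exists_descent (Finset.mem_of_mem_erase hw) (Finset.ne_of_mem_erase hw)
    rw [hgt w i h]
    exact Ideal.mul_mem_left _ _ (Ideal.subset_span ⟨i, hi, rfl⟩)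

end YoungElements

section Survivors

variable {k : Type} [Field k] {r : ℕ}

/-- A statistic which decreases when ascents are exchanged. -/
def wordStat (r : ℕ) (s : ℕ → ℕ) : ℕ := ∑ j ∈ Finset.range r, j * s j

theorem wordStat_swapW {i : ℕ} (h : i + 2 ≤ r) {s : ℕ → ℕ} (hs : s i < s (i + 1)) :
    wordStat r (swapW i s) < wordStat r s := by
  induction r, h using Nat.le_induction with
  | base =>
    rw [wordStat, wordStat, Finset.sum_range_succ, Finset.sum_range_succ, Finset.sum_range_succ,
      Finset.sum_range_succ, swapW_left, swapW_right]
    rw [Finset.sum_congr rfl (g := fun j => j * s j) fun j hj => by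
      rw [Finset.mem_range] at hj
      rw [swapW_of_ne (by omega) (by omega)]]
    simp only [add_mul, one_mul]
    omega
  | succ r h ih =>
    rw [wordStat, wordStat, Finset.sum_range_succ, Finset.sum_range_succ,
      swapW_of_ne (by omega) (by omega)]
    exact Nat.add_lt_add_right ih _

/-- A set of words which is stable under exchanging ascents. -/
def SwapClosed (r : ℕ) (N : Set (ℕ → ℕ)) : Prop :=
  ∀ s ∈ N, ∀ i : AGen r, s i.1 < s (i.1 + 1) → swapW i.1 s ∈ N

theorem SwapClosed.sortW_mem {N : Set (ℕ → ℕ)} (hN : SwapClosed r N) {s : ℕ → ℕ} (hs : s ∈ N)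
    (i : AGen r) : sortW i.1 s ∈ N := by
  rcases lt_or_ge (s i.1) (s (i.1 + 1)) with h | h
  · rw [sortW_of_lt h]
    exact hN s hs i h
  · rwa [sortW_of_le h]

theorem SwapClosed.wordStat_lt (c : ℕ) : SwapClosed r {t | wordStat r t < c} :=
  fun _ hs i h => (wordStat_swapW i.2 h).trans hs

variable (k) in
/-- The span of a set of words. -/
abbrev wordSpan (N : Set (ℕ → ℕ)) : Submodule k ((ℕ → ℕ) →₀ k) :=
  Submodule.span k ((fun s => Finsupp.single s (1 : k)) '' N)

theorem single_mem_wordSpan {N : Set (ℕ → ℕ)} {s : ℕ → ℕ} (h : s ∈ N) :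
    Finsupp.single s (1 : k) ∈ wordSpan k N :=
  Submodule.subset_span ⟨s, h, rfl⟩

theorem wordSpan_mono {N N' : Set (ℕ → ℕ)} (h : N ⊆ N') : wordSpan k N ≤ wordSpan k N' :=
  Submodule.span_mono (Set.image_mono h)

theorem wordSpan_le_iff {N : Set (ℕ → ℕ)} {V : Submodule k ((ℕ → ℕ) →₀ k)} :
    wordSpan k N ≤ V ↔ ∀ s ∈ N, Finsupp.single s (1 : k) ∈ V := by
  rw [Submodule.span_le, Set.image_subset_iff]
  rfl

theorem SwapClosed.wordRep_mem {N : Set (ℕ → ℕ)} (hN : SwapClosed r N) (a : HeckeA k r) :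
    ∀ v ∈ wordSpan k N, wordRep k r a v ∈ wordSpan k N := by
  induction a using hecke_induction with
  | scalar c =>
    intro v hv
    rw [AlgHom.commutes, Module.algebraMap_end_apply]
    exact Submodule.smul_mem _ _ hv
  | gen i =>
    change wordSpan k N ≤ (wordSpan k N).comap (wordRep k r (TGen k r i))
    rw [wordSpan_le_iff]
    intro s hs
    rw [Submodule.mem_comap, wordRep_TGen]
    exact Submodule.sub_mem _ (single_mem_wordSpan (hN.sortW_mem hs i)) (single_mem_wordSpan hs)
  | mul a b ha hb =>
    intro v hv
    rw [map_mul]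
    exact ha _ (hb v hv)
  | add a b ha hb =>
    intro v hv
    rw [map_add]
    exact Submodule.add_mem _ (ha v hv) (hb v hv)

/-- Exchanging ascents at positions outside `M`. -/
def SortStep (r : ℕ) (M : Set ℕ) (s t : ℕ → ℕ) : Prop :=
  ∃ i : AGen r, i.1 ∉ M ∧ s i.1 < s (i.1 + 1) ∧ t = swapW i.1 s

theorem SwapClosed.mem_of_sortStep {N : Set (ℕ → ℕ)} (hN : SwapClosed r N) {M : Set ℕ}
    {s t : ℕ → ℕ} (hst : Relation.ReflTransGen (SortStep r M) s t) (hs : s ∈ N) : t ∈ N := by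
  induction hst with
  | refl => exact hs
  | tail _ h ih =>
    obtain ⟨i, -, hi, rfl⟩ := h
    exact hN _ ih i hi

theorem eq_or_wordStat_lt {M : Set ℕ} {s t : ℕ → ℕ}
    (hst : Relation.ReflTransGen (SortStep r M) s t) : t = s ∨ wordStat r t < wordStat r s := by
  induction hst with
  | refl => exact Or.inl rfl
  | tail _ h ih =>
    obtain ⟨i, -, hi, rfl⟩ := h
    have := wordStat_swapW i.2 hi
    rcases ih with rfl | ih
    · exact Or.inr this
    · exact Or.inr (this.trans ih)

theorem exists_sorted (M : Set ℕ) (s : ℕ → ℕ) :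
    ∃ t, Relation.ReflTransGen (SortStep r M) s t ∧ ∀ i : AGen r, i.1 ∉ M → t (i.1 + 1) ≤ t i.1 := by
  induction hn : wordStat r s using Nat.strong_induction_on generalizing s with
  | _ n ih =>
  by_cases h : ∀ i : AGen r, i.1 ∉ M → s (i.1 + 1) ≤ s i.1
  · exact ⟨s, Relation.ReflTransGen.refl, h⟩
  · push Not at h
    obtain ⟨i, hi, hs⟩ := h
    obtain ⟨t, h1, h2⟩ := ih _ (hn ▸ wordStat_swapW i.2 hs) _ rfl
    exact ⟨t, Relation.ReflTransGen.head ⟨i, hi, hs, rfl⟩ h1, h2⟩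

theorem wordRep_sortStep {M : Set ℕ} {x : HeckeA k r}
    (hx : ∀ i : AGen r, i.1 ∉ M → x * TGen k r i = 0) {s t : ℕ → ℕ}
    (hst : Relation.ReflTransGen (SortStep r M) s t) :
    wordRep k r x (Finsupp.single t 1) = wordRep k r x (Finsupp.single s 1) := by
  induction hst with
  | refl => rfl
  | @tail t u _ h ih =>
    obtain ⟨i, hi, hlt, rfl⟩ := h
    have h0 : wordRep k r x (wordRep k r (TGen k r i) (Finsupp.single t 1)) = 0 := by
      rw [← Module.End.mul_apply, ← map_mul, hx i hi, map_zero, LinearMap.zero_apply]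
    rw [wordRep_TGen, map_sub, sub_eq_zero, sortW_of_lt hlt] at h0
    rw [h0, ih]

theorem IsYoungElt.wordRep_sorted {M : Set ℕ} {x : HeckeA k r} (hx : IsYoungElt M x) {s : ℕ → ℕ}
    (hs : ∀ i : AGen r, i.1 ∉ M → s (i.1 + 1) ≤ s i.1) :
    wordRep k r x (Finsupp.single s 1) = Finsupp.single s 1 := by
  have h : ∀ t ∈ Ideal.span {t | ∃ i : AGen r, i.1 ∉ M ∧ t = TGen k r i},
      wordRep k r t (Finsupp.single s 1) = 0 := by
    intro t ht
    induction ht using Submodule.span_induction with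
    | zero => rw [map_zero, LinearMap.zero_apply]
    | add a b _ _ ha hb => rw [map_add, LinearMap.add_apply, ha, hb, add_zero]
    | smul c a _ ha => rw [smul_eq_mul, map_mul, Module.End.mul_apply, ha, map_zero]
    | mem t ht =>
      obtain ⟨i, hi, rfl⟩ := ht
      rw [wordRep_TGen, sortW_of_le (hs i hi), sub_self]
  have := h _ hx.sub_mem
  rwa [map_sub, map_one, LinearMap.sub_apply, sub_eq_zero] at this

theorem IsYoungElt.exists_wordRep {M : Set ℕ} {x : HeckeA k r} (hx : IsYoungElt M x)
    (s : ℕ → ℕ) : ∃ t, Relation.ReflTransGen (SortStep r M) s t ∧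
      (∀ i : AGen r, i.1 ∉ M → t (i.1 + 1) ≤ t i.1) ∧
      wordRep k r x (Finsupp.single s 1) = Finsupp.single t 1 := by
  obtain ⟨t, h1, h2⟩ := exists_sorted (r := r) M s
  exact ⟨t, h1, h2, by rw [← wordRep_sortStep hx.right h1, hx.wordRep_sorted h2]⟩

theorem IsYoungElt.unique {M : Set ℕ} {x x' : HeckeA k r} (hx : IsYoungElt M x)
    (hx' : IsYoungElt M x') : x = x' :=
  (hx.mul_of_subset hx' subset_rfl).symm.trans (hx.mul_eq hx'.left)

/-- The words which have their ascents exactly in `M`. -/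
def IsSurvivor (r : ℕ) (M : Set ℕ) (s : ℕ → ℕ) : Prop :=
  ∀ i : AGen r, (i.1 ∈ M → s i.1 < s (i.1 + 1)) ∧ (i.1 ∉ M → s (i.1 + 1) ≤ s i.1)

/-- The characteristic properties of the idempotent obtained from the Young element of `M` by
removing the contribution of the larger Young subgroups. -/
structure IsPrimElt (M : Set ℕ) (e : HeckeA k r) : Prop where
  star : heckeStar e = e
  right : ∀ i : AGen r, i.1 ∉ M → e * TGen k r i = 0
  kill : ∀ l : AGen r, l.1 ∈ M → ∃ x, IsYoungElt (M \ {l.1}) x ∧ e * x = 0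
  sub_mem : ∃ x, IsYoungElt M x ∧
    e - x ∈ Ideal.span {y | ∃ l : AGen r, l.1 ∈ M ∧ IsYoungElt (M \ {l.1}) y}

namespace IsPrimElt

variable {M : Set ℕ} {e : HeckeA k r} (he : IsPrimElt M e)
include he

theorem left (i : AGen r) (hi : i.1 ∉ M) : TGen k r i * e = 0 := by
  apply heckeStar_injective
  rw [heckeStar_mul, he.star, heckeStar_TGen, he.right i hi, heckeStar_zero]

theorem kill_of_young (l : AGen r) (hl : l.1 ∈ M) {x : HeckeA k r}
    (hx : IsYoungElt (M \ {l.1}) x) : e * x = 0 := by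
  obtain ⟨x', hx', h⟩ := he.kill l hl
  rwa [hx.unique hx']

theorem isIdempotent : e * e = e := by
  obtain ⟨x, hx, h⟩ := he.sub_mem
  have h0 : ∀ t ∈ Ideal.span {y | ∃ l : AGen r, l.1 ∈ M ∧ IsYoungElt (M \ {l.1}) y},
      t * e = 0 := by
    intro t ht
    induction ht using Submodule.span_induction with
    | zero => rw [zero_mul]
    | add a b _ _ ha hb => rw [add_mul, ha, hb, add_zero]
    | smul c a _ ha => rw [smul_eq_mul, mul_assoc, ha, mul_zero]
    | mem t ht =>
      obtain ⟨l, hl, hy⟩ := ht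
      apply heckeStar_injective
      rw [heckeStar_mul, he.star, hy.star_eq, he.kill_of_young l hl hy, heckeStar_zero]
  have := h0 _ h
  rw [sub_mul, hx.mul_eq he.left, sub_eq_zero] at this
  exact this

theorem heckeChar : heckeChar k r M e = 1 := by
  obtain ⟨x, hx, h⟩ := he.sub_mem
  have h0 : ∀ t ∈ Ideal.span {y | ∃ l : AGen r, l.1 ∈ M ∧ IsYoungElt (M \ {l.1}) y},
      _root_.heckeChar k r M t = 0 := by
    intro t ht
    induction ht using Submodule.span_induction with
    | zero => rw [map_zero]
    | add a b _ _ ha hb => rw [map_add, ha, hb, add_zero]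
    | smul c a _ ha => rw [smul_eq_mul, map_mul, ha, mul_zero]
    | mem t ht =>
      obtain ⟨l, hl, hy⟩ := ht
      exact hy.heckeChar_eq_zero l (by simp) hl
  have := h0 _ h
  rwa [map_sub, hx.heckeChar, sub_eq_zero] at this

/-- Up to sorting, the element kills all words except for the survivors. -/
theorem wordRep_single (s : ℕ → ℕ) : wordRep k r e (Finsupp.single s 1) = 0 ∨
    ∃ t, Relation.ReflTransGen (SortStep r M) s t ∧ IsSurvivor r M t ∧
      wordRep k r e (Finsupp.single s 1) = wordRep k r e (Finsupp.single t 1) := by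
  obtain ⟨t, h1, h2⟩ := exists_sorted (r := r) M s
  rw [← wordRep_sortStep he.right h1]
  by_cases h : ∀ i : AGen r, i.1 ∈ M → t i.1 < t (i.1 + 1)
  · exact Or.inr ⟨t, h1, fun i => ⟨h i, h2 i⟩, rfl⟩
  · push Not at h
    obtain ⟨l, hl, hlt⟩ := h
    obtain ⟨x, hx, hex⟩ := he.kill l hl
    refine Or.inl ?_
    have : wordRep k r x (Finsupp.single t 1) = Finsupp.single t 1 := hx.wordRep_sorted
      fun i hi => by
        by_cases hil : i.1 = l.1
        · rwa [hil]
        · exact h2 i fun hiM => hi ⟨hiM, hil⟩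
    rw [← this, ← Module.End.mul_apply, ← map_mul, hex, map_zero, LinearMap.zero_apply]

/-- If all survivors in the closed set `U` lie in the closed set `N`, then the element maps words
of `U` to `N`. -/
theorem wordRep_mem {U N : Set (ℕ → ℕ)} (hU : SwapClosed r U) (hN : SwapClosed r N)
    (h : ∀ s ∈ U, IsSurvivor r M s → s ∈ N) :
    ∀ v ∈ wordSpan k U, wordRep k r e v ∈ wordSpan k N := by
  change wordSpan k U ≤ (wordSpan k N).comap (wordRep k r e)
  rw [wordSpan_le_iff]
  intro s hs
  rw [Submodule.mem_comap]
  rcases he.wordRep_single s with h0 | ⟨t, h1, h2, h3⟩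
  · rw [h0]
    exact Submodule.zero_mem _
  · rw [h3]
    exact hN.wordRep_mem e _ (single_mem_wordSpan (h t (hU.mem_of_sortStep h1 hs) h2))

theorem wordRep_eq_zero {U : Set (ℕ → ℕ)} (hU : SwapClosed r U)
    (h : ∀ s ∈ U, ¬ IsSurvivor r M s) : ∀ v ∈ wordSpan k U, wordRep k r e v = 0 := by
  intro v hv
  have := he.wordRep_mem hU (N := ∅) (fun s hs => hs.elim) (fun s hs h' => h s hs h') v hv
  rwa [wordSpan, Set.image_empty, Submodule.span_empty, Submodule.mem_bot] at this

theorem wordRep_eq_smul {U : Set (ℕ → ℕ)} (hU : SwapClosed r U) {s₀ : ℕ → ℕ}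
    (h : ∀ s ∈ U, IsSurvivor r M s → s = s₀) :
    ∀ v ∈ wordSpan k U, ∃ c : k, wordRep k r e v = c • wordRep k r e (Finsupp.single s₀ 1) := by
  have : wordSpan k U ≤ (k ∙ wordRep k r e (Finsupp.single s₀ 1)).comap (wordRep k r e) := by
    rw [wordSpan_le_iff]
    intro s hs
    rw [Submodule.mem_comap]
    rcases he.wordRep_single s with h0 | ⟨t, h1, h2, h3⟩
    · rw [h0]
      exact Submodule.zero_mem _
    · rw [h3, h t (hU.mem_of_sortStep h1 hs) h2]
      exact Submodule.mem_span_singleton_self _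
  intro v hv
  obtain ⟨c, hc⟩ := Submodule.mem_span_singleton.1 (this hv)
  exact ⟨c, hc.symm⟩

/-- The difference of a word with ascents only in `M` and its image. -/
theorem wordRep_sub_mem {U N : Set (ℕ → ℕ)} (hU : SwapClosed r U) (hN : SwapClosed r N)
    {s : ℕ → ℕ} (hs : s ∈ U) (hs' : ∀ i : AGen r, i.1 ∉ M → s (i.1 + 1) ≤ s i.1)
    (h : ∀ l : AGen r, l.1 ∈ M → ∀ t ∈ U,
      Relation.ReflTransGen (SortStep r (M \ {l.1})) s t →
      (∀ i : AGen r, i.1 ∉ M ∨ i.1 = l.1 → t (i.1 + 1) ≤ t i.1) → t ∈ N) :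
    wordRep k r e (Finsupp.single s 1) - Finsupp.single s 1 ∈ wordSpan k N := by
  obtain ⟨x, hx, hex⟩ := he.sub_mem
  have h0 : ∀ t ∈ Ideal.span {y | ∃ l : AGen r, l.1 ∈ M ∧ IsYoungElt (M \ {l.1}) y},
      wordRep k r t (Finsupp.single s 1) ∈ wordSpan k N := by
    intro t ht
    induction ht using Submodule.span_induction with
    | zero =>
      rw [map_zero, LinearMap.zero_apply]
      exact Submodule.zero_mem _
    | add a b _ _ ha hb =>
      rw [map_add, LinearMap.add_apply]
      exact Submodule.add_mem _ ha hb
    | smul c a _ ha =>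
      rw [smul_eq_mul, map_mul, Module.End.mul_apply]
      exact hN.wordRep_mem c _ ha
    | mem t ht =>
      obtain ⟨l, hl, hy⟩ := ht
      obtain ⟨u, h1, h2, h3⟩ := hy.exists_wordRep s
      rw [h3]
      refine single_mem_wordSpan (h l hl u (hU.mem_of_sortStep h1 hs) h1 fun i hi => h2 i ?_)
      rintro ⟨h4, h5⟩
      rcases hi with hi | hi
      · exact hi h4
      · exact h5 hi
  have := h0 _ hex
  rwa [map_sub, LinearMap.sub_apply, hx.wordRep_sorted hs'] at this

theorem wordRep_ne_zero {s : ℕ → ℕ} (hs : IsSurvivor r M s) :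
    wordRep k r e (Finsupp.single s 1) ≠ 0 := by
  have h := he.wordRep_sub_mem (U := Set.univ) (fun _ _ _ _ => trivial)
    (SwapClosed.wordStat_lt (wordStat r s)) (s := s) trivial (fun i => (hs i).2)
    fun l hl t _ h1 h2 => by
      rcases eq_or_wordStat_lt h1 with rfl | h
      · exact absurd ((hs l).1 hl) (h2 l (Or.inr rfl)).not_gt
      · exact h
  intro h0
  rw [h0, zero_sub] at h
  have key : wordSpan k {t | wordStat r t < wordStat r s}
      ≤ LinearMap.ker (Finsupp.lapply s : ((ℕ → ℕ) →₀ k) →ₗ[k] k) := by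
    rw [wordSpan_le_iff]
    intro t ht
    rw [LinearMap.mem_ker, Finsupp.lapply_apply, Finsupp.single_eq_of_ne]
    rintro rfl
    exact lt_irrefl (wordStat r s) ht
  have := key h
  simp at this

end IsPrimElt

/-- On a word whose proper images lie in `N`, the algebra acts through a character modulo `N`. -/
theorem wordRep_sub_heckeChar_mem {M : Set ℕ} {N : Set (ℕ → ℕ)} (hN : SwapClosed r N)
    {s : ℕ → ℕ} (h : ∀ i : AGen r, (i.1 ∈ M → sortW i.1 s ∈ N) ∧ (i.1 ∉ M → sortW i.1 s = s))
    (a : HeckeA k r) :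
    wordRep k r a (Finsupp.single s 1) - heckeChar k r M a • Finsupp.single s 1
      ∈ wordSpan k N := by
  induction a using hecke_induction with
  | scalar c =>
    rw [AlgHom.commutes, AlgHom.commutes, Module.algebraMap_end_apply]
    simp
  | gen i =>
    rw [wordRep_TGen]
    by_cases hi : i.1 ∈ M
    · rw [heckeChar_of_mem hi, neg_one_smul, sub_neg_eq_add, sub_add_cancel]
      exact single_mem_wordSpan ((h i).1 hi)
    · rw [heckeChar_of_not_mem hi, (h i).2 hi]
      simp
  | mul a b ha hb =>
    have h1 := hN.wordRep_mem a _ hb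
    have h2 := Submodule.smul_mem _ (heckeChar k r M b) ha
    rw [map_sub, map_smul] at h1
    have h3 := Submodule.add_mem _ h1 h2
    rw [smul_sub, sub_add_sub_cancel, smul_smul] at h3
    rwa [map_mul, map_mul, Module.End.mul_apply, mul_comm]
  | add a b ha hb =>
    rw [map_add, map_add, LinearMap.add_apply, add_smul, add_sub_add_comm]
    exact Submodule.add_mem _ ha hb

end Survivors

section HomSpaces

variable {k : Type} [Field k] {r : ℕ}

/-- The weakly increasing word `b` has its ascents exactly in `M`. -/
structure IsBaseWord (r : ℕ) (M : Set ℕ) (b : ℕ → ℕ) : Prop where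
  mono : ∀ i : AGen r, b i.1 ≤ b (i.1 + 1)
  mem_iff : ∀ i : AGen r, i.1 ∈ M ↔ b i.1 < b (i.1 + 1)

theorem IsBaseWord.isSurvivor {M : Set ℕ} {b : ℕ → ℕ} (h : IsBaseWord r M b) :
    IsSurvivor r M b :=
  fun i => ⟨(h.mem_iff i).1, fun hi => not_lt.1 fun h' => hi ((h.mem_iff i).2 h')⟩

theorem IsYoungElt.mul_eq_zero {M : Set ℕ} {x : HeckeA k r} (hx : IsYoungElt M x)
    {b : ℕ → ℕ} (hb : IsBaseWord r M b) {a : HeckeA k r}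
    (h : wordRep k r a (Finsupp.single b 1) = 0) : a * x = 0 :=
  mul_eq_zero_of_wordRep hb.mono
    (fun i hi => hx.left i fun h' => ((hb.mem_iff i).1 h').ne hi) h

theorem IsPrimElt.mul_eq_zero {M : Set ℕ} {e : HeckeA k r} (he : IsPrimElt M e)
    {b : ℕ → ℕ} (hb : IsBaseWord r M b) {a : HeckeA k r}
    (h : wordRep k r (a * e) (Finsupp.single b 1) = 0) : a * e = 0 := by
  obtain ⟨x, hx, -⟩ := he.sub_mem
  have := hx.mul_eq_zero hb h
  rwa [mul_assoc, hx.eq_mul he.right] at this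

theorem IsPrimElt.mul_mul_eq_zero {Mg M : Set ℕ} {g e : HeckeA k r} (hg : IsPrimElt Mg g)
    (he : IsPrimElt M e) {b : ℕ → ℕ} (hb : IsBaseWord r M b) {U : Set (ℕ → ℕ)}
    (hU : SwapClosed r U) (hbU : b ∈ U) (h : ∀ s ∈ U, ¬ IsSurvivor r Mg s) (a : HeckeA k r) :
    g * a * e = 0 := by
  refine he.mul_eq_zero hb ?_
  rw [mul_assoc, map_mul, Module.End.mul_apply]
  exact hg.wordRep_eq_zero hU h _ (hU.wordRep_mem _ _ (single_mem_wordSpan hbU))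

/-- The combinatorial data showing that the space `g H e` is one-dimensional. -/
structure HomData (r : ℕ) (Mg M : Set ℕ) (b s₀ : ℕ → ℕ) (U N : Set (ℕ → ℕ)) : Prop where
  base : IsBaseWord r M b
  U_closed : SwapClosed r U
  base_mem : b ∈ U
  N_subset : N ⊆ U
  N_closed : SwapClosed r N
  survivor : IsSurvivor r Mg s₀
  eq_of_survivor : ∀ s ∈ U, IsSurvivor r Mg s → s = s₀
  not_mem : s₀ ∉ N
  swap_mem : ∀ i : AGen r, i.1 ∈ Mg → swapW i.1 s₀ ∈ N
  reach : Relation.ReflTransGen (SortStep r Mg) b s₀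
  lower : ∀ l : AGen r, l.1 ∈ M → ∀ t ∈ U,
    (∀ i : AGen r, i.1 ∉ M ∨ i.1 = l.1 → t (i.1 + 1) ≤ t i.1) → t ∈ N

namespace HomData

variable {Mg M : Set ℕ} {b s₀ : ℕ → ℕ} {U N : Set (ℕ → ℕ)} (D : HomData r Mg M b s₀ U N)
  {g e : HeckeA k r} (hg : IsPrimElt Mg g) (he : IsPrimElt M e)
include D

include hg in
theorem wordRep_eq_zero : ∀ v ∈ wordSpan k N, wordRep k r g v = 0 :=
  hg.wordRep_eq_zero D.N_closed fun s hs h =>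
    D.not_mem (D.eq_of_survivor s (D.N_subset hs) h ▸ hs)

include hg he

theorem wordRep_mul : wordRep k r (g * e) (Finsupp.single b 1)
    = wordRep k r g (Finsupp.single s₀ 1) := by
  have h := D.wordRep_eq_zero hg _ (he.wordRep_sub_mem D.U_closed D.N_closed D.base_mem
    (fun i => (D.base.isSurvivor i).2) fun l hl t ht _ h => D.lower l hl t ht h)
  rw [map_sub, sub_eq_zero] at h
  rw [map_mul, Module.End.mul_apply, h, wordRep_sortStep hg.right D.reach]

theorem ne_zero : g * e ≠ 0 := by
  intro h
  apply hg.wordRep_ne_zero D.survivor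
  rw [← D.wordRep_mul hg he, h, map_zero, LinearMap.zero_apply]

theorem exists_smul (a : HeckeA k r) : ∃ c : k, g * a * e = c • (g * e) := by
  obtain ⟨c, hc⟩ := hg.wordRep_eq_smul D.U_closed D.eq_of_survivor
    (wordRep k r (a * e) (Finsupp.single b 1))
    (D.U_closed.wordRep_mem _ _ (single_mem_wordSpan D.base_mem))
  refine ⟨c, ?_⟩
  rw [← sub_eq_zero, ← smul_mul_assoc, ← sub_mul]
  refine he.mul_eq_zero D.base ?_
  rw [sub_mul, smul_mul_assoc, map_sub, LinearMap.sub_apply, map_smul, LinearMap.smul_apply,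
    D.wordRep_mul hg he, ← hc, mul_assoc, map_mul, Module.End.mul_apply, sub_self]

theorem comp_eq_zero {M' : Set ℕ} {e' : HeckeA k r} (he' : IsPrimElt M' e')
    (h : ∀ s ∈ U, IsSurvivor r M' s → s ∈ N) (a a' : HeckeA k r) :
    g * a * e' * a' * e = 0 := by
  refine he.mul_eq_zero D.base ?_
  have h1 := D.U_closed.wordRep_mem (a' * e) _ (single_mem_wordSpan D.base_mem)
  have h2 := D.N_closed.wordRep_mem a _ (he'.wordRep_mem D.U_closed D.N_closed h _ h1)
  have h3 := D.wordRep_eq_zero hg _ h2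
  rw [mul_assoc, mul_assoc, mul_assoc]
  simpa only [map_mul, Module.End.mul_apply] using h3

theorem target (a : HeckeA k r) : g * a * (g * e) = heckeChar k r Mg a • (g * e) := by
  rw [← sub_eq_zero, ← smul_mul_assoc, ← mul_assoc, ← sub_mul]
  refine he.mul_eq_zero D.base ?_
  have hχ := wordRep_sub_heckeChar_mem (k := k) D.N_closed (M := Mg) (s := s₀)
    (fun i => ⟨fun hi => by
      rw [sortW_of_lt ((D.survivor i).1 hi)]
      exact D.swap_mem i hi, fun hi => sortW_of_le ((D.survivor i).2 hi)⟩) (a * g)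
  have h2 := D.wordRep_eq_zero hg _ hχ
  have hc : heckeChar k r Mg (a * g) = heckeChar k r Mg a := by
    rw [map_mul, hg.heckeChar, mul_one]
  rw [hc] at h2
  have h3 := D.wordRep_mul hg he
  rw [map_mul, Module.End.mul_apply] at h3
  rw [sub_mul, map_sub, LinearMap.sub_apply, smul_mul_assoc, map_smul, LinearMap.smul_apply,
    D.wordRep_mul hg he, map_mul, map_mul, map_mul, Module.End.mul_apply, Module.End.mul_apply,
    Module.End.mul_apply, h3]
  rwa [map_sub, map_smul, map_mul, Module.End.mul_apply] at h2

theorem source (h : ∀ s ∈ U, s ≠ b → IsSurvivor r M s → s ∈ N) (a : HeckeA k r) :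
    g * e * a * e = heckeChar k r M a • (g * e) := by
  rw [← sub_eq_zero, ← smul_mul_assoc, ← sub_mul]
  refine he.mul_eq_zero D.base ?_
  have hU' : SwapClosed r {s | s ∈ U ∧ s ≠ b} := fun s hs i hi =>
    ⟨D.U_closed s hs.1 i hi, fun h' => by
      have := D.base.mono i
      rw [← h', swapW_left, swapW_right] at this
      exact this.not_gt hi⟩
  have hχ := wordRep_sub_heckeChar_mem (k := k) hU' (M := M) (s := b)
    (fun i => ⟨fun hi => by
      have hlt := (D.base.mem_iff i).1 hi
      rw [sortW_of_lt hlt]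
      refine ⟨D.U_closed b D.base_mem i hlt, fun h' => ?_⟩
      have h1 := congrFun h' i.1
      rw [swapW_left] at h1
      exact hlt.ne' h1, fun hi => sortW_of_le ((D.base.isSurvivor i).2 hi)⟩) (a * e)
  have h2 := D.wordRep_eq_zero hg _ (he.wordRep_mem hU' D.N_closed
    (fun s hs => h s hs.1 hs.2) _ hχ)
  have hc : heckeChar k r M (a * e) = heckeChar k r M a := by
    rw [map_mul, he.heckeChar, mul_one]
  rw [hc, map_sub, map_smul, map_sub, map_smul, sub_eq_zero] at h2
  rw [sub_mul, map_sub, LinearMap.sub_apply, sub_eq_zero, smul_mul_assoc, map_smul,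
    LinearMap.smul_apply]
  simp only [map_mul, Module.End.mul_apply] at h2 ⊢
  exact h2

end HomData

end HomSpaces

section PrimElements

variable {k : Type} [Field k] {r : ℕ}

theorem IsYoungElt.isPrimElt_sub {l : AGen r} {x z : HeckeA k r} (hx : IsYoungElt {l.1} x)
    (hz : IsYoungElt ∅ z) : IsPrimElt {l.1} (x - z) where
  star := by rw [heckeStar_sub, hx.star_eq, hz.star_eq]
  right i hi := by rw [sub_mul, hx.right i hi, hz.right i (Set.notMem_empty _), sub_self]
  kill l' hl' := by
    refine ⟨z, ?_, ?_⟩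
    · rwa [Set.mem_singleton_iff.1 hl', Set.sdiff_self]
    · rw [sub_mul, hz.mul_of_subset' hx (Set.empty_subset _), hz.mul_self, sub_self]
  sub_mem := by
    refine ⟨x, hx, ?_⟩
    rw [sub_sub_cancel_left]
    refine neg_mem (Ideal.subset_span ⟨l, rfl, ?_⟩)
    rwa [Set.sdiff_self]

theorem IsYoungElt.isPrimElt_pair {l l' : AGen r} (hl : l.1 ≠ l'.1) {x p q z : HeckeA k r}
    (hx : IsYoungElt {l.1, l'.1} x) (hp : IsYoungElt {l.1} p) (hq : IsYoungElt {l'.1} q)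
    (hz : IsYoungElt ∅ z) (h : q * p * q = z) :
    IsPrimElt {l.1, l'.1} (x - p - q + p * q + q * p - p * q * p) := by
  have h1 : ({l.1, l'.1} : Set ℕ) \ {l.1} = {l'.1} := by
    ext i; simp only [Set.mem_sdiff, Set.mem_insert_iff, Set.mem_singleton_iff]; omega
  have h2 : ({l.1, l'.1} : Set ℕ) \ {l'.1} = {l.1} := by
    ext i; simp only [Set.mem_sdiff, Set.mem_insert_iff, Set.mem_singleton_iff]; omega
  refine ⟨?_, fun i hi => ?_, fun m hm => ?_, x, hx, ?_⟩
  · simp only [heckeStar_sub, heckeStar_add, heckeStar_mul, hx.star_eq, hp.star_eq, hq.star_eq]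
    simp only [mul_assoc]
    abel
  · have hpi : p * TGen k r i = 0 := hp.right i fun h => hi (Or.inl h)
    have hqi : q * TGen k r i = 0 := hq.right i fun h => hi (Or.inr h)
    simp only [sub_mul, add_mul, mul_assoc, hx.right i hi, hpi, hqi, mul_zero, sub_zero, add_zero]
  · have hxp : x * p = p := hp.mul_of_subset' hx (by simp)
    have hxq : x * q = q := hq.mul_of_subset' hx (by simp)
    rcases hm with hm | hm
    · rw [hm, h1]
      refine ⟨q, hq, ?_⟩
      rw [mul_assoc] at h
      simp only [sub_mul, add_mul, mul_assoc, hxq, hq.mul_self, h,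
        hz.mul_of_subset' hp (Set.empty_subset _)]
      abel
    · rw [Set.mem_singleton_iff.1 hm, h2]
      refine ⟨p, hp, ?_⟩
      simp only [sub_mul, add_mul, mul_assoc, hxp, hp.mul_self]
      abel
  · have hp' : p ∈ Ideal.span {y | ∃ m : AGen r, m.1 ∈ ({l.1, l'.1} : Set ℕ) ∧
        IsYoungElt (({l.1, l'.1} : Set ℕ) \ {m.1}) y} :=
      Ideal.subset_span ⟨l', by simp, by rwa [h2]⟩
    have hq' : q ∈ Ideal.span {y | ∃ m : AGen r, m.1 ∈ ({l.1, l'.1} : Set ℕ) ∧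
        IsYoungElt (({l.1, l'.1} : Set ℕ) \ {m.1}) y} :=
      Ideal.subset_span ⟨l, by simp, by rwa [h1]⟩
    rw [show x - p - q + p * q + q * p - p * q * p - x = p * q + q * p - p * q * p - p - q by
      abel]
    exact _root_.sub_mem (_root_.sub_mem (_root_.sub_mem (add_mem (Ideal.mul_mem_left _ _ hq')
      (Ideal.mul_mem_left _ _ hp')) (Ideal.mul_mem_left _ _ hp')) hp') hq'

theorem SortStep.invariant {M : Set ℕ} {B : Set (ℕ → ℕ)}
    (hB : ∀ s ∈ B, ∀ i : AGen r, i.1 ∉ M → s i.1 < s (i.1 + 1) → swapW i.1 s ∈ B)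
    {s t : ℕ → ℕ} (h : Relation.ReflTransGen (SortStep r M) s t) (hs : s ∈ B) : t ∈ B := by
  induction h with
  | refl => exact hs
  | tail _ h ih =>
    obtain ⟨i, hi, hlt, rfl⟩ := h
    exact hB _ ih i hi hlt

theorem IsYoungElt.mul_mul_eq {M M' : Set ℕ} {p q z : HeckeA k r} (hp : IsYoungElt M p)
    (hq : IsYoungElt M' q) (hz : IsYoungElt ∅ z) {b : ℕ → ℕ} (hb : IsBaseWord r M' b)
    (h : ∀ t t', Relation.ReflTransGen (SortStep r M) b t →
      (∀ i : AGen r, i.1 ∉ M → t (i.1 + 1) ≤ t i.1) →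
      Relation.ReflTransGen (SortStep r M') t t' →
      (∀ i : AGen r, i.1 ∉ M' → t' (i.1 + 1) ≤ t' i.1) →
      ∀ i : AGen r, t' (i.1 + 1) ≤ t' i.1) : q * p * q = z := by
  obtain ⟨t, ht, hs, h1⟩ := hp.exists_wordRep b
  obtain ⟨t', ht', hs', h2⟩ := hq.exists_wordRep t
  have h3 : wordRep k r (q * p) (Finsupp.single b 1) = Finsupp.single t' 1 := by
    rw [map_mul, Module.End.mul_apply, h1, h2]
  have h4 : z * (q * p) = z := by
    rw [← mul_assoc, hz.mul_of_subset hq (Set.empty_subset _),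
      hz.mul_of_subset hp (Set.empty_subset _)]
  have h5 : (q * p - z) * q = 0 := by
    refine hq.mul_eq_zero hb ?_
    rw [← h4, map_sub, LinearMap.sub_apply, map_mul _ z, Module.End.mul_apply, h3,
      hz.wordRep_sorted fun i _ => h t t' ht hs ht' hs' i, sub_self]
  rw [sub_mul, sub_eq_zero] at h5
  rw [h5, hz.mul_of_subset hq (Set.empty_subset _)]

end PrimElements

section WordFamilies

/-- The word with a single letter zero, all other letters being one. -/
def wordA (p : ℕ) : ℕ → ℕ := fun j => if j = p then 0 else 1

/-- The word with a single letter one, all other letters being zero. -/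
def wordB (p : ℕ) : ℕ → ℕ := fun j => if j = p then 1 else 0

/-- The word with two letters zero, all other letters being one. -/
def wordX (p q : ℕ) : ℕ → ℕ := fun j => if j = p ∨ j = q then 0 else 1

/-- The word with one letter zero and one letter two, all other letters being one. -/
def wordY (p q : ℕ) : ℕ → ℕ := fun j => if j = p then 0 else if j = q then 2 else 1

theorem wordA_lt {p i : ℕ} : wordA p i < wordA p (i + 1) ↔ i = p := by
  unfold wordA; split_ifs <;> omega

theorem wordB_lt {p i : ℕ} : wordB p i < wordB p (i + 1) ↔ i + 1 = p := by
  unfold wordB; split_ifs <;> omega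

theorem wordX_lt {p q i : ℕ} : wordX p q i < wordX p q (i + 1) ↔
    (i = p ∨ i = q) ∧ i + 1 ≠ p ∧ i + 1 ≠ q := by
  unfold wordX; split_ifs <;> omega

theorem wordY_lt {p q i : ℕ} (h : p ≠ q) : wordY p q i < wordY p q (i + 1) ↔
    i = p ∨ i + 1 = q := by
  unfold wordY; split_ifs <;> omega

theorem swapW_wordA (p : ℕ) : swapW p (wordA p) = wordA (p + 1) := by
  funext j; unfold swapW wordA; split_ifs <;> omega

theorem swapW_wordB (p : ℕ) : swapW p (wordB (p + 1)) = wordB p := by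
  funext j; unfold swapW wordB; split_ifs <;> omega

theorem swapW_wordX_left {p q : ℕ} (h : p + 1 < q) : swapW p (wordX p q) = wordX (p + 1) q := by
  funext j; unfold swapW wordX; split_ifs <;> omega

theorem swapW_wordX_right {p q : ℕ} (h : p < q) : swapW q (wordX p q) = wordX p (q + 1) := by
  funext j; unfold swapW wordX; split_ifs <;> omega

theorem swapW_wordY_left {p q : ℕ} (h : p + 1 ≠ q) (h' : p ≠ q) :
    swapW p (wordY p q) = wordY (p + 1) q := by
  funext j; unfold swapW wordY; split_ifs <;> omega

theorem swapW_wordY_right {p q : ℕ} (h : p ≠ q) (h' : p ≠ q + 1) :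
    swapW q (wordY p (q + 1)) = wordY p q := by
  funext j; unfold swapW wordY; split_ifs <;> omega

theorem swapW_wordY_both (p : ℕ) : swapW p (wordY p (p + 1)) = wordY (p + 1) p := by
  funext j; unfold swapW wordY; split_ifs <;> omega

variable (r : ℕ)

def famA (P : ℕ → Prop) : Set (ℕ → ℕ) := {s | ∃ p, p < r ∧ P p ∧ s = wordA p}
def famB (P : ℕ → Prop) : Set (ℕ → ℕ) := {s | ∃ p, p < r ∧ P p ∧ s = wordB p}
def famX (P : ℕ → ℕ → Prop) : Set (ℕ → ℕ) :=
  {s | ∃ p q, p < q ∧ q < r ∧ P p q ∧ s = wordX p q}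
def famY (P : ℕ → ℕ → Prop) : Set (ℕ → ℕ) :=
  {s | ∃ p q, p ≠ q ∧ p < r ∧ q < r ∧ P p q ∧ s = wordY p q}

variable {r}

theorem swapClosed_famA {P : ℕ → Prop} (h : ∀ p, P p → P (p + 1)) : SwapClosed r (famA r P) := by
  rintro _ ⟨p, hp, hP, rfl⟩ i hi
  obtain rfl := wordA_lt.1 hi
  exact ⟨i.1 + 1, i.2, h _ hP, swapW_wordA _⟩

theorem swapClosed_famB {P : ℕ → Prop} (h : ∀ p, P (p + 1) → P p) : SwapClosed r (famB r P) := by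
  rintro _ ⟨p, hp, hP, rfl⟩ i hi
  obtain rfl := wordB_lt.1 hi
  exact ⟨i.1, i.lt, h _ hP, swapW_wordB _⟩

theorem swapClosed_famX {P : ℕ → ℕ → Prop} (h : ∀ p q, p + 1 < q → q < r → P p q → P (p + 1) q)
    (h' : ∀ p q, p < q → q + 1 < r → P p q → P p (q + 1)) : SwapClosed r (famX r P) := by
  rintro _ ⟨p, q, hpq, hq, hP, rfl⟩ i hi
  obtain ⟨hi | hi, h1, h2⟩ := wordX_lt.1 hi
  · have h3 : p + 1 < q := by omega
    exact ⟨p + 1, q, h3, hq, h _ _ h3 hq hP, by rw [hi, swapW_wordX_left h3]⟩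
  · have h3 : q + 1 < r := by have := i.2; omega
    exact ⟨p, q + 1, by omega, h3, h' _ _ hpq h3 hP, by rw [hi, swapW_wordX_right hpq]⟩

theorem swapClosed_famY {P : ℕ → ℕ → Prop}
    (h : ∀ p q, p + 1 ≠ q → p ≠ q → p + 1 < r → q < r → P p q → P (p + 1) q)
    (h' : ∀ p q, p ≠ q + 1 → p ≠ q → p < r → q + 1 < r → P p (q + 1) → P p q)
    (h'' : ∀ p, p + 1 < r → P p (p + 1) → P (p + 1) p) : SwapClosed r (famY r P) := by
  rintro _ ⟨p, q, hpq, hp, hq, hP, rfl⟩ i hi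
  have hir := i.2
  rcases (wordY_lt hpq).1 hi with hi' | hi'
  · by_cases h3 : p + 1 = q
    · subst h3
      exact ⟨p + 1, p, by omega, by omega, hp, h'' _ hq hP, by rw [hi', swapW_wordY_both]⟩
    · exact ⟨p + 1, q, h3, by omega, hq, h _ _ h3 hpq (by omega) hq hP,
        by rw [hi', swapW_wordY_left h3 hpq]⟩
  · subst hi'
    by_cases h3 : p = i.1
    · subst h3
      exact ⟨i.1 + 1, i.1, by omega, hq, hp, h'' _ hq hP, swapW_wordY_both _⟩
    · exact ⟨p, i.1, h3, hp, i.lt, h' _ _ hpq h3 hp hq hP, swapW_wordY_right h3 hpq⟩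

end WordFamilies

section Configurations

variable {r : ℕ}

theorem wordA_mono (i : ℕ) : wordA 0 i ≤ wordA 0 (i + 1) := by
  unfold wordA; split_ifs <;> first | omega | contradiction

theorem wordB_mono (i : ℕ) (h : i + 2 ≤ r) : wordB (r - 1) i ≤ wordB (r - 1) (i + 1) := by
  unfold wordB; split_ifs <;> omega

theorem wordX_mono (i : ℕ) : wordX 0 1 i ≤ wordX 0 1 (i + 1) := by
  unfold wordX; split_ifs <;> simp_all

theorem wordY_mono (i : ℕ) (h : i + 2 ≤ r) : wordY 0 (r - 1) i ≤ wordY 0 (r - 1) (i + 1) := by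
  unfold wordY; split_ifs <;> first | omega | contradiction

theorem isBaseWord_wordA (l : ℕ) : IsBaseWord r {l} (wordA 0) ↔ (2 ≤ r → l = 0) := by
  constructor
  · intro h hr
    have := (h.mem_iff ⟨0, hr⟩).2 (wordA_lt.2 rfl)
    exact (Set.mem_singleton_iff.1 this).symm
  · intro h
    refine ⟨fun i => wordA_mono i.1, fun i => ?_⟩
    rw [wordA_lt, h (by have := i.2; omega), Set.mem_singleton_iff]

theorem isBaseWord_wordB {l : ℕ} (h : l + 2 = r) : IsBaseWord r {l} (wordB (r - 1)) := by
  refine ⟨fun i => ?_, fun i => ?_⟩ <;> have := i.2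
  · exact wordB_mono i.1 i.2
  · rw [wordB_lt, Set.mem_singleton_iff]
    omega

theorem isBaseWord_wordX : IsBaseWord r {1} (wordX 0 1) := by
  refine ⟨fun i => ?_, fun i => ?_⟩
  · exact wordX_mono i.1
  · rw [wordX_lt, Set.mem_singleton_iff]
    omega

theorem isBaseWord_wordY {l : ℕ} (hl : 0 < l) (h : l + 2 = r) :
    IsBaseWord r {0, l} (wordY 0 (r - 1)) := by
  refine ⟨fun i => ?_, fun i => ?_⟩ <;> have := i.2
  · exact wordY_mono i.1 i.2
  · rw [wordY_lt (by omega), Set.mem_insert_iff, Set.mem_singleton_iff]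
    omega

theorem homData_xa (hr : 4 ≤ r) : HomData r {1} {0} (wordA 0) (wordA 1)
    (famA r fun _ => True) (famA r fun p => 2 ≤ p) where
  base := (isBaseWord_wordA 0).2 fun _ => rfl
  U_closed := swapClosed_famA fun _ h => h
  base_mem := ⟨0, by omega, trivial, rfl⟩
  N_subset := fun _ ⟨p, hp, _, hs⟩ => ⟨p, hp, trivial, hs⟩
  N_closed := swapClosed_famA fun _ h => h.trans (Nat.le_succ _)
  survivor i := by
    rw [← not_lt, wordA_lt, Set.mem_singleton_iff]
    omega
  eq_of_survivor := by
    rintro _ ⟨p, hp, -, rfl⟩ h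
    rw [← wordA_lt.1 ((h ⟨1, by omega⟩).1 rfl)]
  not_mem := by
    rintro ⟨p, hp, hp2, h⟩
    have := congrFun h p
    unfold wordA at this
    split_ifs at this <;> omega
  swap_mem i hi := by
    rw [Set.mem_singleton_iff.1 hi]
    exact ⟨2, by omega, le_rfl, swapW_wordA 1⟩
  reach := .single ⟨⟨0, by omega⟩, by simp, wordA_lt.2 rfl, (swapW_wordA 0).symm⟩
  lower := by
    rintro l hl _ ⟨p, hp, -, rfl⟩ h
    refine ⟨p, hp, ?_, rfl⟩
    by_contra hlt
    have hp' : p + 2 ≤ r := by omega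
    refine (h ⟨p, hp'⟩ ?_).not_gt (wordA_lt.2 rfl)
    rw [Set.mem_singleton_iff.1 hl, Set.mem_singleton_iff]
    omega

theorem homData_xb {l : ℕ} (hr : 4 ≤ r) (hl : l + 2 = r) :
    HomData r {1} {l} (wordB (r - 1)) (wordB 2)
    (famB r fun _ => True) (famB r fun p => p ≤ 1) where
  base := isBaseWord_wordB hl
  U_closed := swapClosed_famB fun _ h => h
  base_mem := ⟨r - 1, by omega, trivial, rfl⟩
  N_subset := fun _ ⟨p, hp, _, hs⟩ => ⟨p, hp, trivial, hs⟩
  N_closed := swapClosed_famB fun _ h => (Nat.le_succ _).trans h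
  survivor i := by
    rw [← not_lt, wordB_lt, Set.mem_singleton_iff]
    omega
  eq_of_survivor := by
    rintro _ ⟨p, hp, -, rfl⟩ h
    rw [← wordB_lt.1 ((h ⟨1, by omega⟩).1 rfl)]
  not_mem := by
    rintro ⟨p, hp, hp2, h⟩
    have := congrFun h p
    unfold wordB at this
    split_ifs at this <;> omega
  swap_mem i hi := by
    rw [Set.mem_singleton_iff.1 hi]
    exact ⟨1, by omega, le_rfl, swapW_wordB 1⟩
  reach := by
    have : ∀ m, m + 2 < r →
        Relation.ReflTransGen (SortStep r {1}) (wordB (m + 2)) (wordB 2) := by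
      intro m
      induction m with
      | zero => exact fun _ => .refl
      | succ m ih =>
        intro hm
        refine .head ⟨⟨m + 2, by omega⟩, ?_, wordB_lt.2 rfl, (swapW_wordB _).symm⟩ (ih (by omega))
        simp
    have h := this (r - 3) (by omega)
    rwa [show r - 3 + 2 = r - 1 by omega] at h
  lower := by
    rintro m hm _ ⟨p, hp, -, rfl⟩ h
    refine ⟨p, hp, ?_, rfl⟩
    by_contra hlt
    refine (h ⟨p - 1, by omega⟩ ?_).not_gt (wordB_lt.2 (by show p - 1 + 1 = p; omega))
    rw [Set.mem_singleton_iff.1 hm, Set.mem_singleton_iff]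
    omega

theorem homData_cy {l : ℕ} (hr : 4 ≤ r) (hl : l + 2 = r) :
    HomData r {0, 1} {0, l} (wordY 0 (r - 1)) (wordY 0 2)
    (famY r fun _ _ => True) (famY r fun p q => p ≠ 0 ∨ q = 1) where
  base := isBaseWord_wordY (by omega) hl
  U_closed := swapClosed_famY (fun _ _ _ _ _ _ h => h) (fun _ _ _ _ _ _ h => h) fun _ _ h => h
  base_mem := ⟨0, r - 1, by omega, by omega, by omega, trivial, rfl⟩
  N_subset := fun _ ⟨p, q, hpq, hp, hq, _, hs⟩ => ⟨p, q, hpq, hp, hq, trivial, hs⟩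
  N_closed := swapClosed_famY (by omega) (by omega) (by omega)
  survivor i := by
    rw [← not_lt, wordY_lt (by omega), Set.mem_insert_iff, Set.mem_singleton_iff]
    omega
  eq_of_survivor := by
    rintro _ ⟨p, q, hpq, hp, hq, -, rfl⟩ h
    have h0 := (wordY_lt hpq).1 ((h ⟨0, by omega⟩).1 (by simp))
    have h1 := (wordY_lt hpq).1 ((h ⟨1, by omega⟩).1 (by simp))
    dsimp only at h0 h1
    rw [show p = 0 by omega, show q = 2 by omega]
  not_mem := by
    rintro ⟨p, q, hpq, hp, hq, h1, h⟩
    have h2 := congrFun h p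
    have h3 := congrFun h q
    unfold wordY at h2 h3
    split_ifs at h2 h3 <;> omega
  swap_mem i hi := by
    rcases hi with hi | hi
    · rw [hi]
      exact ⟨1, 2, by omega, by omega, by omega, by omega, swapW_wordY_left (by omega) (by omega)⟩
    · rw [Set.mem_singleton_iff.1 hi]
      exact ⟨0, 1, by omega, by omega, by omega, by omega,
        swapW_wordY_right (by omega) (by omega)⟩
  reach := by
    have : ∀ m, m + 2 < r →
        Relation.ReflTransGen (SortStep r {0, 1}) (wordY 0 (m + 2)) (wordY 0 2) := by
      intro m
      induction m with
      | zero => exact fun _ => .refl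
      | succ m ih =>
        intro hm
        refine .head ⟨⟨m + 2, by omega⟩, ?_, (wordY_lt (by omega)).2 (.inr rfl),
          (swapW_wordY_right (p := 0) (q := m + 2) (by omega) (by omega)).symm⟩ (ih (by omega))
        simp
    have h := this (r - 3) (by omega)
    rwa [show r - 3 + 2 = r - 1 by omega] at h
  lower := by
    rintro m hm _ ⟨p, q, hpq, hp, hq, -, rfl⟩ h
    refine ⟨p, q, hpq, hp, hq, ?_, rfl⟩
    by_contra hlt
    simp only [Set.mem_insert_iff, Set.mem_singleton_iff] at h hm
    rcases hm with hm | hm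
    · refine (h ⟨0, by omega⟩ (.inr hm.symm)).not_gt ((wordY_lt hpq).2 (.inl ?_))
      show 0 = p
      omega
    · refine (h ⟨q - 1, by omega⟩ ?_).not_gt ((wordY_lt hpq).2 (.inr ?_)) <;> dsimp only <;> omega

theorem homData_dy {l : ℕ} (hr : 4 ≤ r) (hl : l + 3 = r) :
    HomData r {l, l + 1} {0, l + 1} (wordY 0 (r - 1)) (wordY l (r - 1))
    (famY r fun _ _ => True) (famY r fun p q => q ≠ r - 1 ∨ p = l + 1) where
  base := isBaseWord_wordY (by omega) (by omega)
  U_closed := swapClosed_famY (fun _ _ _ _ _ _ h => h) (fun _ _ _ _ _ _ h => h) fun _ _ h => h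
  base_mem := ⟨0, r - 1, by omega, by omega, by omega, trivial, rfl⟩
  N_subset := fun _ ⟨p, q, hpq, hp, hq, _, hs⟩ => ⟨p, q, hpq, hp, hq, trivial, hs⟩
  N_closed := swapClosed_famY (by omega) (by omega) (by omega)
  survivor i := by
    have := i.2
    rw [← not_lt, wordY_lt (by omega), Set.mem_insert_iff, Set.mem_singleton_iff]
    omega
  eq_of_survivor := by
    rintro _ ⟨p, q, hpq, hp, hq, -, rfl⟩ h
    have h0 := (wordY_lt hpq).1 ((h ⟨l, by omega⟩).1 (by simp))
    have h1 := (wordY_lt hpq).1 ((h ⟨l + 1, by omega⟩).1 (by simp))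
    dsimp only at h0 h1
    rw [show p = l by omega, show q = r - 1 by omega]
  not_mem := by
    rintro ⟨p, q, hpq, hp, hq, h1, h⟩
    have h2 := congrFun h p
    have h3 := congrFun h q
    unfold wordY at h2 h3
    split_ifs at h2 h3 <;> omega
  swap_mem i hi := by
    rcases hi with hi | hi
    · rw [hi]
      exact ⟨l + 1, r - 1, by omega, by omega, by omega, by omega,
        swapW_wordY_left (by omega) (by omega)⟩
    · rw [Set.mem_singleton_iff.1 hi]
      refine ⟨l, l + 1, by omega, by omega, by omega, by omega, ?_⟩
      rw [show r - 1 = l + 1 + 1 by omega]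
      exact swapW_wordY_right (by omega) (by omega)
  reach := by
    have : ∀ m, m ≤ l →
        Relation.ReflTransGen (SortStep r {l, l + 1}) (wordY 0 (r - 1)) (wordY m (r - 1)) := by
      intro m
      induction m with
      | zero => exact fun _ => .refl
      | succ m ih =>
        intro hm
        refine .tail (ih (by omega)) ⟨⟨m, by omega⟩, ?_, (wordY_lt (by omega)).2 (.inl rfl),
          (swapW_wordY_left (by omega) (by omega)).symm⟩
        rw [Set.mem_insert_iff, Set.mem_singleton_iff]
        dsimp only
        omega
    exact this l le_rfl
  lower := by
    rintro m hm _ ⟨p, q, hpq, hp, hq, -, rfl⟩ h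
    refine ⟨p, q, hpq, hp, hq, ?_, rfl⟩
    by_contra hlt
    simp only [Set.mem_insert_iff, Set.mem_singleton_iff] at h hm
    rcases hm with hm | hm
    · refine (h ⟨p, by omega⟩ ?_).not_gt ((wordY_lt hpq).2 (.inl rfl))
      dsimp only
      omega
    · refine (h ⟨l + 1, by omega⟩ (.inr hm.symm)).not_gt ((wordY_lt hpq).2 (.inr ?_))
      dsimp only
      omega

theorem homData_yx {l : ℕ} (hr : 4 ≤ r) (hl : l + 2 = r) :
    HomData r {0, l} {1} (wordX 0 1) (wordX 0 l)
    (famX r fun _ _ => True) (famX r fun p q => p ≠ 0 ∨ q = r - 1) where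
  base := isBaseWord_wordX
  U_closed := swapClosed_famX (fun _ _ _ _ h => h) (fun _ _ _ _ h => h)
  base_mem := ⟨0, 1, by omega, by omega, trivial, rfl⟩
  N_subset := fun _ ⟨p, q, hpq, hq, _, hs⟩ => ⟨p, q, hpq, hq, trivial, hs⟩
  N_closed := swapClosed_famX (by omega) (by omega)
  survivor i := by
    have := i.2
    rw [← not_lt, wordX_lt, Set.mem_insert_iff, Set.mem_singleton_iff]
    omega
  eq_of_survivor := by
    rintro _ ⟨p, q, hpq, hq, -, rfl⟩ h
    have h0 := wordX_lt.1 ((h ⟨0, by omega⟩).1 (by simp))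
    have h1 := wordX_lt.1 ((h ⟨l, by omega⟩).1 (by simp))
    dsimp only at h0 h1
    rw [show p = 0 by omega, show q = l by omega]
  not_mem := by
    rintro ⟨p, q, hpq, hq, h1, h⟩
    have h2 := congrFun h p
    have h3 := congrFun h q
    unfold wordX at h2 h3
    split_ifs at h2 h3 <;> omega
  swap_mem i hi := by
    rcases hi with hi | hi
    · rw [hi]
      exact ⟨1, l, by omega, by omega, by omega, swapW_wordX_left (by omega)⟩
    · rw [Set.mem_singleton_iff.1 hi]
      exact ⟨0, l + 1, by omega, by omega, by omega, swapW_wordX_right (by omega)⟩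
  reach := by
    have : ∀ m, m + 3 ≤ r →
        Relation.ReflTransGen (SortStep r {0, l}) (wordX 0 1) (wordX 0 (m + 1)) := by
      intro m
      induction m with
      | zero => exact fun _ => .refl
      | succ m ih =>
        intro hm
        refine .tail (ih (by omega)) ⟨⟨m + 1, by omega⟩, ?_, wordX_lt.2 (by dsimp only; omega),
          (swapW_wordX_right (by omega)).symm⟩
        rw [Set.mem_insert_iff, Set.mem_singleton_iff]
        dsimp only
        omega
    have h := this (r - 3) (by omega)
    rwa [show r - 3 + 1 = l by omega] at h
  lower := by
    rintro m hm _ ⟨p, q, hpq, hq, -, rfl⟩ h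
    refine ⟨p, q, hpq, hq, ?_, rfl⟩
    by_contra hlt
    refine (h ⟨q, by omega⟩ ?_).not_gt (wordX_lt.2 (by dsimp only; omega))
    rw [Set.mem_singleton_iff.1 hm, Set.mem_singleton_iff]
    dsimp only
    omega

end Configurations

section HeckeDynkin

variable {k : Type} [Field k] {r l : ℕ}

theorem IsPrimElt.mul_mul_eq_zero_symm {Mg M : Set ℕ} {g e : HeckeA k r} (hg : IsPrimElt Mg g)
    (he : IsPrimElt M e) (h : ∀ a : HeckeA k r, g * a * e = 0) (a : HeckeA k r) :
    e * a * g = 0 := by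
  apply heckeStar_injective
  rw [heckeStar_mul, heckeStar_mul, he.star, hg.star, heckeStar_zero, ← mul_assoc, h]

variable {ea eb ey gx gc gd : HeckeA k r}

/-- The idempotents of the Hecke algebra spanning a configuration of type `D̃₅`. -/
theorem dynkinData_hecke (hr : 4 ≤ r) (hl : l + 3 = r)
    (ha : IsPrimElt {0} ea) (hb : IsPrimElt {l + 1} eb) (hy : IsPrimElt {0, l + 1} ey)
    (hx : IsPrimElt {1} gx) (hc : IsPrimElt {0, 1} gc) (hd : IsPrimElt {l, l + 1} gd) :
    DynkinData k ![ea, eb, ey] ![gx, gc, gd]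
      (fun j i => ![gx, gc, gd] j * ![ea, eb, ey] i) := by
  have Dxa := homData_xa hr
  have Dxb := homData_xb (l := l + 1) hr hl
  have Dcy := homData_cy (l := l + 1) hr hl
  have Ddy := homData_dy hr hl
  have Dyx := homData_yx (l := l + 1) hr hl
  have sA : ∀ {M : Set ℕ} {p i : ℕ}, p < r → i + 2 ≤ r → IsSurvivor r M (wordA p) → i ∈ M →
      i = p := fun _ hi h hm => wordA_lt.1 ((h ⟨_, hi⟩).1 hm)
  have sB : ∀ {M : Set ℕ} {p i : ℕ}, p < r → i + 2 ≤ r → IsSurvivor r M (wordB p) → i ∈ M →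
      i + 1 = p := fun _ hi h hm => wordB_lt.1 ((h ⟨_, hi⟩).1 hm)
  have sY : ∀ {M : Set ℕ} {p q i : ℕ}, p ≠ q → i + 2 ≤ r → IsSurvivor r M (wordY p q) → i ∈ M →
      i = p ∨ i + 1 = q := fun hpq hi h hm => (wordY_lt hpq).1 ((h ⟨_, hi⟩).1 hm)
  have sX : ∀ {M : Set ℕ} {p q i : ℕ}, i + 2 ≤ r → IsSurvivor r M (wordX p q) → i ∈ M →
      (i = p ∨ i = q) ∧ i + 1 ≠ p ∧ i + 1 ≠ q := fun hi h hm => wordX_lt.1 ((h ⟨_, hi⟩).1 hm)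
  have zya : ∀ a, ey * a * ea = 0 := hy.mul_mul_eq_zero ha Dxa.base Dxa.U_closed Dxa.base_mem (by
    rintro _ ⟨p, hp, -, rfl⟩ h
    have h0 := sA (i := 0) hp (by omega) h (by simp)
    have h1 := sA (i := l + 1) hp (by omega) h (by simp)
    omega)
  have zca : ∀ a, gc * a * ea = 0 := hc.mul_mul_eq_zero ha Dxa.base Dxa.U_closed Dxa.base_mem (by
    rintro _ ⟨p, hp, -, rfl⟩ h
    have h0 := sA (i := 0) hp (by omega) h (by simp)
    have h1 := sA (i := 1) hp (by omega) h (by simp)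
    omega)
  have zda : ∀ a, gd * a * ea = 0 := hd.mul_mul_eq_zero ha Dxa.base Dxa.U_closed Dxa.base_mem (by
    rintro _ ⟨p, hp, -, rfl⟩ h
    have h0 := sA (i := l) hp (by omega) h (by simp)
    have h1 := sA (i := l + 1) hp (by omega) h (by simp)
    omega)
  have zyb : ∀ a, ey * a * eb = 0 := hy.mul_mul_eq_zero hb Dxb.base Dxb.U_closed Dxb.base_mem (by
    rintro _ ⟨p, hp, -, rfl⟩ h
    have h0 := sB (i := 0) hp (by omega) h (by simp)
    have h1 := sB (i := l + 1) hp (by omega) h (by simp)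
    omega)
  have zcb : ∀ a, gc * a * eb = 0 := hc.mul_mul_eq_zero hb Dxb.base Dxb.U_closed Dxb.base_mem (by
    rintro _ ⟨p, hp, -, rfl⟩ h
    have h0 := sB (i := 0) hp (by omega) h (by simp)
    have h1 := sB (i := 1) hp (by omega) h (by simp)
    omega)
  have zdb : ∀ a, gd * a * eb = 0 := hd.mul_mul_eq_zero hb Dxb.base Dxb.U_closed Dxb.base_mem (by
    rintro _ ⟨p, hp, -, rfl⟩ h
    have h0 := sB (i := l) hp (by omega) h (by simp)
    have h1 := sB (i := l + 1) hp (by omega) h (by simp)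
    omega)
  have zcx : ∀ a, gc * a * gx = 0 := hc.mul_mul_eq_zero hx Dyx.base Dyx.U_closed Dyx.base_mem (by
    rintro _ ⟨p, q, hpq, hq, -, rfl⟩ h
    have h0 := sX (i := 0) (by omega) h (by simp)
    have h1 := sX (i := 1) (by omega) h (by simp)
    omega)
  have zdx : ∀ a, gd * a * gx = 0 := hd.mul_mul_eq_zero hx Dyx.base Dyx.U_closed Dyx.base_mem (by
    rintro _ ⟨p, q, hpq, hq, -, rfl⟩ h
    have h0 := sX (i := l) (by omega) h (by simp)
    have h1 := sX (i := l + 1) (by omega) h (by simp)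
    omega)
  have zay := hy.mul_mul_eq_zero_symm ha zya
  have zby := hy.mul_mul_eq_zero_symm hb zyb
  have zxc := hc.mul_mul_eq_zero_symm hx zcx
  have zxd := hd.mul_mul_eq_zero_symm hx zdx
  have oca : gc * ea = 0 := by simpa using zca 1
  have ocb : gc * eb = 0 := by simpa using zcb 1
  have oda : gd * ea = 0 := by simpa using zda 1
  have odb : gd * eb = 0 := by simpa using zdb 1
  have cba : ∀ a, gx * eb * a * ea = 0 := fun a => by
    have := Dxa.comp_eq_zero hx ha hb (by
      rintro _ ⟨p, hp, -, rfl⟩ h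
      have h0 := sA (i := l + 1) hp (by omega) h (by simp)
      exact ⟨p, hp, by omega, rfl⟩) 1 a
    rwa [mul_one] at this
  have cab : ∀ a, gx * ea * a * eb = 0 := fun a => by
    have := Dxb.comp_eq_zero hx hb ha (by
      rintro _ ⟨p, hp, -, rfl⟩ h
      have h0 := sB (i := 0) hp (by omega) h (by simp)
      exact ⟨p, hp, by omega, rfl⟩) 1 a
    rwa [mul_one] at this
  have ccd : ∀ a, gc * a * (gd * ey) = 0 := fun a => by
    have := Dcy.comp_eq_zero hc hy hd (by
      rintro _ ⟨p, q, hpq, hp, hq, -, rfl⟩ h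
      have h0 := sY (i := l) hpq (by omega) h (by simp)
      have h1 := sY (i := l + 1) hpq (by omega) h (by simp)
      exact ⟨p, q, hpq, hp, hq, by omega, rfl⟩) a 1
    rwa [mul_one, mul_assoc] at this
  have cdc : ∀ a, gd * a * (gc * ey) = 0 := fun a => by
    have := Ddy.comp_eq_zero hd hy hc (by
      rintro _ ⟨p, q, hpq, hp, hq, -, rfl⟩ h
      have h0 := sY (i := 0) hpq (by omega) h (by simp)
      have h1 := sY (i := 1) hpq (by omega) h (by simp)
      exact ⟨p, q, hpq, hp, hq, by omega, rfl⟩) a 1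
    rwa [mul_one, mul_assoc] at this
  have srca := Dxa.source hx ha (by
    rintro _ ⟨p, hp, -, rfl⟩ hne h
    have h0 := sA (i := 0) hp (by omega) h (by simp)
    exact absurd (by rw [h0]) hne)
  have srcb := Dxb.source hx hb (by
    rintro _ ⟨p, hp, -, rfl⟩ hne h
    have h0 := sB (i := l + 1) hp (by omega) h (by simp)
    exact absurd (by rw [← h0]; congr 1; omega) hne)
  have survY : ∀ p q, p ≠ q → wordY p q ≠ wordY 0 (r - 1) → IsSurvivor r {0, l + 1} (wordY p q) →
      p ≠ 0 ∧ q ≠ r - 1 := by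
    intro p q hpq hne h
    have h0 := sY (i := 0) hpq (by omega) h (by simp)
    have h1 := sY (i := l + 1) hpq (by omega) h (by simp)
    have h2 : ¬ (p = 0 ∧ q = r - 1) := by
      rintro ⟨rfl, rfl⟩
      exact hne rfl
    omega
  have srcc := Dcy.source hc hy (by
    rintro _ ⟨p, q, hpq, hp, hq, -, rfl⟩ hne h
    exact ⟨p, q, hpq, hp, hq, .inl (survY p q hpq hne h).1, rfl⟩)
  have srcd := Ddy.source hd hy (by
    rintro _ ⟨p, q, hpq, hp, hq, -, rfl⟩ hne h
    exact ⟨p, q, hpq, hp, hq, .inl (survY p q hpq hne h).2, rfl⟩)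
  have srcx := Dyx.source hy hx (by
    rintro _ ⟨p, q, hpq, hq, -, rfl⟩ hne h
    have h0 := sX (i := 1) (by omega) h (by simp)
    refine ⟨p, q, hpq, hq, .inl ?_, rfl⟩
    rintro rfl
    exact hne (by rw [show q = 1 by omega]))
  have srcxy : ∀ a, gx * ey * a * ey = heckeChar k r {0, l + 1} a • (gx * ey) := fun a => by
    apply heckeStar_injective
    rw [heckeStar_smul, heckeStar_mul, heckeStar_mul, heckeStar_mul, hx.star, hy.star,
      ← mul_assoc, Dyx.target hy hx, heckeChar_heckeStar]
  have tarxy : ∀ a, gx * a * (gx * ey) = heckeChar k r {1} a • (gx * ey) := fun a => by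
    apply heckeStar_injective
    rw [heckeStar_smul, heckeStar_mul, heckeStar_mul, heckeStar_mul, hx.star, hy.star,
      ← mul_assoc, srcx, heckeChar_heckeStar]
  have homxy : ∀ a, ∃ c : k, gx * a * ey = c • (gx * ey) := fun a => by
    obtain ⟨c, h⟩ := Dyx.exists_smul hy hx (heckeStar a)
    refine ⟨c, heckeStar_injective ?_⟩
    rw [heckeStar_smul, heckeStar_mul, heckeStar_mul, heckeStar_mul, hx.star, hy.star,
      ← mul_assoc, h]
  refine ⟨fun i => ?_, fun j => ?_, fun j i => ?_, fun j i => ?_, fun j i => ?_, fun j i => ?_,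
    fun j i a => ?_, fun j i i' a h => ?_, fun i a => ?_, fun j j' i a h => ?_, fun j a => ?_⟩
  · fin_cases i
    exacts [ha.isIdempotent, hb.isIdempotent, hy.isIdempotent]
  · fin_cases j
    exacts [hx.isIdempotent, hc.isIdempotent, hd.isIdempotent]
  · rw [← mul_assoc]
    congr 1
    fin_cases j
    exacts [hx.isIdempotent, hc.isIdempotent, hd.isIdempotent]
  · rw [mul_assoc]
    congr 1
    fin_cases i
    exacts [ha.isIdempotent, hb.isIdempotent, hy.isIdempotent]
  · have hxy : gx * ey ≠ 0 := fun h => Dyx.ne_zero hy hx (by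
      apply heckeStar_injective
      rw [heckeStar_mul, hx.star, hy.star, h, heckeStar_zero])
    fin_cases j <;> fin_cases i <;> simp [IsEdge, Dxa.ne_zero hx ha, Dxb.ne_zero hx hb, hxy,
      Dcy.ne_zero hc hy, Ddy.ne_zero hd hy]
  · fin_cases j <;> fin_cases i <;> simp [IsEdge, oca, ocb, oda, odb]
  · fin_cases j <;> fin_cases i
    exacts [Dxa.exists_smul hx ha a, Dxb.exists_smul hx hb a, homxy a,
      ⟨0, by simpa using zca a⟩, ⟨0, by simpa using zcb a⟩, Dcy.exists_smul hc hy a,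
      ⟨0, by simpa using zda a⟩, ⟨0, by simpa using zdb a⟩, Ddy.exists_smul hd hy a]
  · have zl : ∀ {u v : HeckeA k r}, (∀ a, u * a * v = 0) → ∀ w a, w * u * a * v = 0 :=
      fun h w a => by rw [mul_assoc w, mul_assoc w, h, mul_zero]
    have zr : ∀ {u : HeckeA k r}, u = 0 → ∀ a v, u * a * v = 0 := fun h a v => by
      rw [h, zero_mul, zero_mul]
    fin_cases i <;> fin_cases i' <;> fin_cases j
    exacts [absurd rfl h, absurd rfl h, absurd rfl h, cba a, zr ocb _ _, zr odb _ _,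
      zl zya _ _, zl zya _ _, zl zya _ _,
      cab a, zr oca _ _, zr oda _ _, absurd rfl h, absurd rfl h, absurd rfl h,
      zl zyb _ _, zl zyb _ _, zl zyb _ _,
      zl zay _ _, zl zay _ _, zl zay _ _, zl zby _ _, zl zby _ _, zl zby _ _,
      absurd rfl h, absurd rfl h, absurd rfl h]
  · have zr : ∀ {u : HeckeA k r}, u = 0 → ∀ a v (c : k), u * a * v = c • u := fun h a v c => by
      rw [h, zero_mul, zero_mul, smul_zero]
    fin_cases i
    · refine ⟨heckeChar k r {0} a, fun j => ?_⟩
      fin_cases j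
      exacts [srca a, zr oca _ _ _, zr oda _ _ _]
    · refine ⟨heckeChar k r {l + 1} a, fun j => ?_⟩
      fin_cases j
      exacts [srcb a, zr ocb _ _ _, zr odb _ _ _]
    · refine ⟨heckeChar k r {0, l + 1} a, fun j => ?_⟩
      fin_cases j
      exacts [srcxy a, srcc a, srcd a]
  · have zl : ∀ {u v : HeckeA k r}, (∀ a, u * a * v = 0) → ∀ a w, u * a * (v * w) = 0 :=
      fun h a w => by rw [← mul_assoc, h, zero_mul]
    have zr : ∀ {u : HeckeA k r}, u = 0 → ∀ a, a * u = 0 := fun h a => by rw [h, mul_zero]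
    fin_cases j <;> fin_cases j' <;> fin_cases i
    exacts [absurd rfl h, absurd rfl h, absurd rfl h, zl zcx _ _, zl zcx _ _, zl zcx _ _,
      zl zdx _ _, zl zdx _ _, zl zdx _ _,
      zl zxc _ _, zl zxc _ _, zl zxc _ _, absurd rfl h, absurd rfl h, absurd rfl h,
      zr oca _, zr ocb _, cdc a,
      zl zxd _ _, zl zxd _ _, zl zxd _ _, zr oda _, zr odb _, ccd a,
      absurd rfl h, absurd rfl h, absurd rfl h]
  · have zr : ∀ {u : HeckeA k r}, u = 0 → ∀ a (c : k), a * u = c • u := fun h a c => by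
      rw [h, mul_zero, smul_zero]
    fin_cases j
    · refine ⟨heckeChar k r {1} a, fun i => ?_⟩
      fin_cases i
      exacts [Dxa.target hx ha a, Dxb.target hx hb a, tarxy a]
    · refine ⟨heckeChar k r {0, 1} a, fun i => ?_⟩
      fin_cases i
      exacts [zr oca _ _, zr ocb _ _, Dcy.target hc hy a]
    · refine ⟨heckeChar k r {l, l + 1} a, fun i => ?_⟩
      fin_cases i
      exacts [zr oda _ _, zr odb _ _, Ddy.target hd hy a]

end HeckeDynkin

section PrimExistence

variable {k : Type} [Field k] {r : ℕ}

theorem exists_dynkinData_hecke {l : ℕ} (hr : 4 ≤ r) (hl : l + 3 = r)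
    {xa xb xy xx xc xd z : HeckeA k r} (ha : IsYoungElt {0} xa) (hb : IsYoungElt {l + 1} xb)
    (hy : IsYoungElt {0, l + 1} xy) (hx : IsYoungElt {1} xx) (hc : IsYoungElt {0, 1} xc)
    (hd : IsYoungElt {l, l + 1} xd) {xl : HeckeA k r} (hxl : IsYoungElt {l} xl)
    (hz : IsYoungElt ∅ z) :
    ∃ (e g : Fin 3 → HeckeA k r), (∀ i, ![xa, xb, xy] i * e i = e i) ∧
      (∀ i, e i * ![xa, xb, xy] i = e i) ∧ (∀ j, ![xx, xc, xd] j * g j = g j) ∧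
      (∀ j, g j * ![xx, xc, xd] j = g j) ∧ DynkinData k e g (fun j i => g j * e i) := by
  let i0 : AGen r := ⟨0, by omega⟩
  let i1 : AGen r := ⟨1, by omega⟩
  let il : AGen r := ⟨l, by omega⟩
  let il' : AGen r := ⟨l + 1, by omega⟩
  have key0 : ∀ {m : ℕ} {p : HeckeA k r}, m ≠ 0 → IsYoungElt {m} p → xa * p * xa = z := by
    intro m p hm hp
    refine hp.mul_mul_eq ha hz ((isBaseWord_wordA 0).2 fun _ => rfl) ?_
    intro t t' ht hs ht' hs' i
    obtain ⟨p, hp, -, rfl⟩ := SortStep.invariant (B := famA r fun _ => True)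
      (fun s hs i _ h => swapClosed_famA (fun _ h => h) s hs i h) ht ⟨0, by omega, trivial, rfl⟩
    have hp0 : p ≠ 0 := by
      rintro rfl
      exact (hs i0 (by simpa [i0] using hm.symm)).not_gt (wordA_lt.2 rfl)
    obtain ⟨p, hp, hp0, rfl⟩ := SortStep.invariant (B := famA r fun p => p ≠ 0)
      (fun s hs i _ h => swapClosed_famA (fun _ _ => by omega) s hs i h) ht' ⟨p, hp, hp0, rfl⟩
    by_cases hi : i.1 = 0
    · exact not_lt.1 fun h => hp0 ((wordA_lt.1 h).symm.trans hi)
    · exact hs' i hi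
  have key1 : ∀ {m : ℕ} {p : HeckeA k r}, m ≠ l + 1 → IsYoungElt {m} p → xb * p * xb = z := by
    intro m p hm hp
    refine hp.mul_mul_eq hb hz (isBaseWord_wordB (by omega)) ?_
    intro t t' ht hs ht' hs' i
    obtain ⟨p, hp, -, rfl⟩ := SortStep.invariant (B := famB r fun _ => True)
      (fun s hs i _ h => swapClosed_famB (fun _ h => h) s hs i h) ht
        ⟨r - 1, by omega, trivial, rfl⟩
    have hp0 : p ≠ r - 1 := by
      rintro rfl
      exact (hs il' hm.symm).not_gt (wordB_lt.2 (by dsimp only [il']; omega))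
    obtain ⟨p, hp, hp0, rfl⟩ := SortStep.invariant (B := famB r fun p => p + 1 < r)
      (fun s hs i _ h => swapClosed_famB (fun _ _ => by omega) s hs i h) ht'
        ⟨p, hp, by omega, rfl⟩
    by_cases hi : i.1 = l + 1
    · refine not_lt.1 fun h => ?_
      have := wordB_lt.1 h
      omega
    · exact hs' i hi
  have pa : IsPrimElt {0} (xa - z) := ha.isPrimElt_sub (l := i0) hz
  have pb : IsPrimElt {l + 1} (xb - z) := hb.isPrimElt_sub (l := il') hz
  have px : IsPrimElt {1} (xx - z) := hx.isPrimElt_sub (l := i1) hz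
  have py := IsYoungElt.isPrimElt_pair (l := il') (l' := i0) (by simp [il', i0])
    (by rwa [Set.pair_comm] at hy) hb ha hz (key0 (by omega) hb)
  have pc := IsYoungElt.isPrimElt_pair (l := i1) (l' := i0) (by simp [i1, i0])
    (by rwa [Set.pair_comm] at hc) hx ha hz (key0 (by omega) hx)
  have pd := IsYoungElt.isPrimElt_pair (l := il) (l' := il') (by simp [il, il'])
    hd hxl hb hz (key1 (by omega) hxl)
  rw [Set.pair_comm] at py pc
  refine ⟨_, _, ?_, ?_, ?_, ?_, dynkinData_hecke hr hl pa pb py px pc pd⟩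
  · intro i
    fin_cases i
    exacts [ha.mul_eq pa.left, hb.mul_eq pb.left, hy.mul_eq py.left]
  · intro i
    fin_cases i
    exacts [ha.eq_mul pa.right, hb.eq_mul pb.right, hy.eq_mul py.right]
  · intro i
    fin_cases i
    exacts [hx.mul_eq px.left, hc.mul_eq pc.left, hd.mul_eq pd.left]
  · intro i
    fin_cases i
    exacts [hx.eq_mul px.right, hc.eq_mul pc.right, hd.eq_mul pd.right]

end PrimExistence

section Compositions

variable {n r : ℕ}

instance : Finite (Comp n r) :=
  Finite.of_injective (fun (lam : Comp n r) (i : Fin n) =>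
      (⟨lam.1 i, Nat.lt_succ_of_le
        ((Finset.single_le_sum (fun _ _ => Nat.zero_le _) (Finset.mem_univ i)).trans lam.2.le)⟩ :
        Fin (r + 1)))
    fun _ _ h => Subtype.ext (funext fun i => congrArg Fin.val (congrFun h i))

theorem psum_eq_psumNat (lam : Fin n → ℕ) (m : Fin n) : psum lam m = psumNat lam m.1 := rfl

theorem exists_comp_three (hn : 3 ≤ n) {a b : ℕ} (h : a + b ≤ r) :
    ∃ lam : Comp n r, ∀ i : AGen r, i.1 ∈ missing lam.1 ↔ i.1 + 1 = a ∨ i.1 + 1 = a + b := by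
  obtain ⟨n, rfl⟩ := Nat.exists_eq_add_of_le' hn
  obtain ⟨lam, l0, l1, l2, l3⟩ : ∃ lam : Fin (n + 3) → ℕ, lam ⟨0, by omega⟩ = a ∧
      lam ⟨1, by omega⟩ = b ∧ lam ⟨2, by omega⟩ = r - (a + b) ∧
      ∀ i : Fin n, lam i.succ.succ.succ = 0 :=
    ⟨fun i => if i.1 = 0 then a else if i.1 = 1 then b else if i.1 = 2 then r - (a + b) else 0,
      rfl, rfl, rfl, fun i => by simp⟩
  have hsum : ∑ i, lam i = r := by
    rw [Fin.sum_univ_succ, Fin.sum_univ_succ, Fin.sum_univ_succ,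
      Finset.sum_eq_zero fun i _ => l3 i]
    have e0 : lam 0 = a := l0
    have e1 : lam (Fin.succ 0) = b := l1
    have e2 : lam (Fin.succ (Fin.succ 0)) = r - (a + b) := l2
    omega
  have h0 : psumNat lam 0 = 0 := psumNat_zero lam
  have h1 : psumNat lam 1 = a := by
    have := psumNat_succ lam ⟨0, by omega⟩
    rw [l0] at this
    simpa [h0] using this
  have h2 : psumNat lam 2 = a + b := by
    have := psumNat_succ lam ⟨1, by omega⟩
    rw [l1] at this
    simpa [h1] using this
  refine ⟨⟨lam, hsum⟩, fun i => ?_⟩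
  have hi := i.2
  constructor
  · intro h'
    have k0 := h' ⟨0, by omega⟩
    have k1 := h' ⟨1, by omega⟩
    have k2 := h' ⟨2, by omega⟩
    simp only [psum_eq_psumNat, h0, h1, h2, l0, l1, l2] at k0 k1 k2
    omega
  · rintro h' ⟨m, hm⟩
    match m with
    | 0 =>
      simp only [psum_eq_psumNat, h0, l0]
      omega
    | 1 =>
      simp only [psum_eq_psumNat, h1, l1]
      omega
    | m + 2 =>
      intro h''
      have := psumNat_mono lam (show 2 ≤ m + 2 by omega)
      simp only [psum_eq_psumNat] at h''
      omega

theorem exists_comp_two (a : ℕ) (h : a ≤ r) : ∃ lam : Comp 2 r, lam.1 0 = a :=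
  ⟨⟨![a, r - a], by simp [h]⟩, rfl⟩

theorem mem_missing_two (lam : Comp 2 r) (i : AGen r) :
    i.1 ∈ missing lam.1 ↔ i.1 + 1 = lam.1 0 := by
  have hi := i.2
  have hs := lam.2
  rw [Fin.sum_univ_two] at hs
  have h0 : psumNat lam.1 0 = 0 := psumNat_zero lam.1
  have h1 : psumNat lam.1 1 = lam.1 0 := by
    have := psumNat_succ lam.1 0
    simpa [h0] using this
  constructor
  · intro h'
    have k0 := h' 0
    have k1 := h' 1
    simp only [psum_eq_psumNat, Fin.val_zero, Fin.val_one, h0, h1] at k0 k1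
    omega
  · intro h' m
    fin_cases m
    · simp only [psum_eq_psumNat, Fin.zero_eta, Fin.val_zero, h0]
      omega
    · simp only [psum_eq_psumNat, Fin.mk_one, Fin.val_one, h1]
      omega

end Compositions

section HeckeFinite

variable {k : Type} [Field k] {r : ℕ} {T : Equiv.Perm (Fin r) → HeckeA k r}

theorem IsHeckeBasis.mul_mem_span (hT : IsHeckeBasis k r T) (a : HeckeA k r) :
    ∀ v ∈ Submodule.span k (Set.range T), v * a ∈ Submodule.span k (Set.range T) := by
  induction a using hecke_induction with
  | scalar c =>
    intro v hv
    rw [← Algebra.commutes, ← Algebra.smul_def]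
    exact Submodule.smul_mem _ c hv
  | gen i =>
    intro v hv
    induction hv using Submodule.span_induction with
    | mem x hx =>
      obtain ⟨w, rfl⟩ := hx
      rcases lt_trichotomy (w ⟨i.1, i.lt⟩) (w ⟨i.1 + 1, i.2⟩) with h | h | h
      · rw [← hT.2.2 w i (invCount_mul_adjSwap w i h)]
        exact Submodule.subset_span ⟨_, rfl⟩
      · have := congrArg Fin.val (w.injective h)
        simp at this
      · have h' : w = w * adjSwap r i * adjSwap r i := by
          rw [mul_assoc, adjSwap_mul_self, mul_one]
        have h2 : T w = T (w * adjSwap r i) * TGen k r i := by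
          have h3 := hT.2.2 (w * adjSwap r i) i (invCount_mul_adjSwap _ i (by
            rw [Equiv.Perm.mul_apply, Equiv.Perm.mul_apply, adjSwap_left, adjSwap_right]
            exact h))
          rwa [← h'] at h3
        have h4 : T w * TGen k r i = -T w := by
          rw [h2, mul_assoc, TGen_mul_self, mul_neg]
        rw [h4]
        exact neg_mem (Submodule.subset_span ⟨_, rfl⟩)
    | zero => rw [zero_mul]; exact zero_mem _
    | add x y _ _ hx hy => rw [add_mul]; exact add_mem hx hy
    | smul c x _ hx => rw [smul_mul_assoc]; exact Submodule.smul_mem _ c hx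
  | mul a b ha hb =>
    intro v hv
    rw [← mul_assoc]
    exact hb _ (ha v hv)
  | add a b ha hb =>
    intro v hv
    rw [mul_add]
    exact add_mem (ha v hv) (hb v hv)

theorem IsHeckeBasis.finite (hT : IsHeckeBasis k r T) : Module.Finite k (HeckeA k r) := by
  have h : Submodule.span k (Set.range T) = ⊤ := by
    refine eq_top_iff.2 fun a _ => ?_
    rw [← one_mul a]
    exact hT.mul_mem_span a 1 (Submodule.subset_span ⟨1, hT.1⟩)
  exact ⟨⟨(Set.finite_range T).toFinset, by rw [Set.Finite.coe_toFinset, h]⟩⟩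

end HeckeFinite

section PeirceData

/-- The algebra `A` is the algebra of matrices with entries in the spaces `X_i H X_j`. -/
structure PeirceData (k : Type) [Field k] {H A ι : Type} [Ring H] [Algebra k H] [Ring A]
    [Algebra k A] [Fintype ι] (X : ι → H) (θ : ι → ι → H →ₗ[k] A) : Prop where
  idem : ∀ i, X i * X i = X i
  mul : ∀ i j l h h', θ i j h * θ j l h' = θ i l (h * X j * h')
  mul_ne : ∀ i j j' l h h', j ≠ j' → θ i j h * θ j' l h' = 0
  sandwich : ∀ i j h, θ i j (X i * h * X j) = θ i j h
  eq_zero : ∀ i j h, θ i j h = 0 → X i * h * X j = 0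
  one : ∑ i, θ i i 1 = 1
  corner : ∀ i j a, ∃ h, θ i i 1 * a * θ j j 1 = θ i j h

end PeirceData

section SchurPeirce

variable {k : Type} [Field k] {n r : ℕ} {T : Equiv.Perm (Fin r) → HeckeA k r}

instance : Fintype (Comp n r) := Fintype.ofFinite _

theorem mem_xIdeal_iff (hT : IsHeckeBasis k r T) (lam : Comp n r) (v : HeckeA k r) :
    v ∈ xIdeal k T lam ↔ xElt k T lam * v = v := by
  rw [xIdeal, Submodule.mem_span_singleton]
  constructor
  · rintro ⟨a, rfl⟩
    rw [← op_unop a, op_smul_eq_mul, ← mul_assoc, (isYoungElt_xElt hT lam).mul_self]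
  · intro h
    exact ⟨op v, by rw [op_smul_eq_mul, h]⟩

/-- The action of the Schur algebra on its defining module. -/
def schurApp (f : Schur0 k n r T) : SchurModule k n r T →ₗ[(HeckeA k r)ᵐᵒᵖ] SchurModule k n r T :=
  f

theorem schurApp_mul (f g : Schur0 k n r T) (v : SchurModule k n r T) :
    schurApp (f * g) v = schurApp f (schurApp g v) := rfl

theorem schur_ext {f g : Schur0 k n r T}
    (h : ∀ v lam, (schurApp f v lam).1 = (schurApp g v lam).1) : f = g :=
  LinearMap.ext fun v => funext fun lam => Subtype.ext (h v lam)

/-- Left multiplication between two of the right ideals. -/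
def xIdealMul (T : Equiv.Perm (Fin r) → HeckeA k r) (lam mu : Comp n r) (h : HeckeA k r) :
    xIdeal k T mu →ₗ[(HeckeA k r)ᵐᵒᵖ] xIdeal k T lam where
  toFun v := ⟨xElt k T lam * h * v.1, by
    rw [mul_assoc]
    exact (xIdeal k T lam).smul_mem (op (h * v.1)) (Submodule.mem_span_singleton_self _)⟩
  map_add' v w := Subtype.ext (mul_add _ _ _)
  map_smul' a v := Subtype.ext (mul_smul_comm a (xElt k T lam * h) v.1)

open Classical in
/-- The endomorphism of the direct sum given by left multiplication from one summand to
another. -/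
def schurUnitEnd (T : Equiv.Perm (Fin r) → HeckeA k r) (lam mu : Comp n r) (h : HeckeA k r) :
    Schur0 k n r T :=
  (LinearMap.single (HeckeA k r)ᵐᵒᵖ (fun lam : Comp n r => (xIdeal k T lam : Type)) lam) ∘ₗ
    (xIdealMul T lam mu h) ∘ₗ
    (LinearMap.proj mu : (∀ lam : Comp n r, (xIdeal k T lam : Type)) →ₗ[(HeckeA k r)ᵐᵒᵖ] _)

theorem schurUnitEnd_apply_same (lam mu : Comp n r) (h : HeckeA k r)
    (v : SchurModule k n r T) :
    (schurApp (schurUnitEnd T lam mu h) v lam).1 = xElt k T lam * h * (v mu).1 := by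
  classical
  exact congrArg Subtype.val (Pi.single_eq_same (M := fun lam : Comp n r => xIdeal k T lam) lam
    (xIdealMul T lam mu h (v mu)))

theorem schurUnitEnd_apply_ne (lam lam' mu : Comp n r) (hne : lam' ≠ lam) (h : HeckeA k r)
    (v : SchurModule k n r T) : schurApp (schurUnitEnd T lam mu h) v lam' = 0 := by
  classical
  exact Pi.single_eq_of_ne hne _

theorem schurUnitEnd_ext {lam mu : Comp n r} {h : HeckeA k r} {f : Schur0 k n r T}
    (h1 : ∀ v, (schurApp f v lam).1 = xElt k T lam * h * (v mu).1)
    (h2 : ∀ v lam', lam' ≠ lam → schurApp f v lam' = 0) :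
    f = schurUnitEnd T lam mu h := by
  refine schur_ext fun v lam' => ?_
  by_cases hl : lam' = lam
  · subst hl
    rw [h1, schurUnitEnd_apply_same]
  · rw [h2 v lam' hl, schurUnitEnd_apply_ne _ _ _ hl]

/-- The matrix units of the Schur algebra. -/
def schurUnit (T : Equiv.Perm (Fin r) → HeckeA k r) (lam mu : Comp n r) :
    HeckeA k r →ₗ[k] Schur0 k n r T where
  toFun := schurUnitEnd T lam mu
  map_add' h h' := by
    refine (schurUnitEnd_ext (fun v => ?_) (fun v lam' hl => ?_)).symm
    · have h1 : (schurApp (schurUnitEnd T lam mu h + schurUnitEnd T lam mu h') v lam).1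
        = (schurApp (schurUnitEnd T lam mu h) v lam).1
          + (schurApp (schurUnitEnd T lam mu h') v lam).1 := rfl
      rw [h1, schurUnitEnd_apply_same, schurUnitEnd_apply_same, mul_add, add_mul]
    · have h1 : schurApp (schurUnitEnd T lam mu h + schurUnitEnd T lam mu h') v lam'
        = schurApp (schurUnitEnd T lam mu h) v lam' + schurApp (schurUnitEnd T lam mu h') v lam' :=
        rfl
      rw [h1, schurUnitEnd_apply_ne _ _ _ hl, schurUnitEnd_apply_ne _ _ _ hl, add_zero]
  map_smul' c h := by
    rw [RingHom.id_apply]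
    refine (schurUnitEnd_ext (fun v => ?_) (fun v lam' hl => ?_)).symm
    · have h1 : (schurApp (c • schurUnitEnd T lam mu h) v lam).1
        = c • (schurApp (schurUnitEnd T lam mu h) v lam).1 := rfl
      rw [h1, schurUnitEnd_apply_same, mul_smul_comm, smul_mul_assoc]
    · have h1 : schurApp (c • schurUnitEnd T lam mu h) v lam'
        = c • schurApp (schurUnitEnd T lam mu h) v lam' := rfl
      rw [h1, schurUnitEnd_apply_ne _ _ _ hl, smul_zero]

theorem schurUnit_apply_same (lam mu : Comp n r) (h : HeckeA k r) (v : SchurModule k n r T) :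
    (schurApp (schurUnit T lam mu h) v lam).1 = xElt k T lam * h * (v mu).1 :=
  schurUnitEnd_apply_same lam mu h v

theorem schurUnit_apply_ne (lam lam' mu : Comp n r) (hne : lam' ≠ lam) (h : HeckeA k r)
    (v : SchurModule k n r T) : schurApp (schurUnit T lam mu h) v lam' = 0 :=
  schurUnitEnd_apply_ne lam lam' mu hne h v

theorem schurUnit_ext {lam mu : Comp n r} {h : HeckeA k r} {f : Schur0 k n r T}
    (h1 : ∀ v, (schurApp f v lam).1 = xElt k T lam * h * (v mu).1)
    (h2 : ∀ v lam', lam' ≠ lam → schurApp f v lam' = 0) :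
    f = schurUnit T lam mu h :=
  schurUnitEnd_ext h1 h2

/-- The summand inclusion of the generator. -/
def schurGen (T : Equiv.Perm (Fin r) → HeckeA k r) (mu : Comp n r) : SchurModule k n r T :=
  open Classical in
  (Pi.single mu ⟨xElt k T mu, Submodule.mem_span_singleton_self _⟩ :
    ∀ lam : Comp n r, (xIdeal k T lam : Type))

theorem schurGen_same (mu : Comp n r) : (schurGen T mu mu).1 = xElt k T mu := by
  classical
  have : schurGen T mu mu = (⟨xElt k T mu, Submodule.mem_span_singleton_self _⟩ :
    xIdeal k T mu) := Pi.single_eq_same _ _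
  rw [this]

theorem schurUnit_one_apply (hT : IsHeckeBasis k r T) (mu : Comp n r)
    (v : SchurModule k n r T) :
    schurApp (schurUnit T mu mu 1) v
      = (op (v mu).1) • schurGen T mu := by
  classical
  have hv := (mem_xIdeal_iff hT mu _).1 (v mu).2
  funext lam'
  by_cases hl : lam' = mu
  · subst hl
    apply Subtype.ext
    rw [schurUnit_apply_same]
    show _ = (op (v lam').1) • (schurGen T lam' lam').1
    rw [schurGen_same, op_smul_eq_mul, mul_one]
  · rw [schurUnit_apply_ne _ _ _ hl]
    show _ = (op (v mu).1) • (schurGen T mu lam')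
    have : schurGen T mu lam' = 0 := Pi.single_eq_of_ne hl _
    rw [this, smul_zero]

theorem peirceData_schur (hT : IsHeckeBasis k r T) :
    PeirceData k (fun lam : Comp n r => xElt k T lam) (schurUnit T) where
  idem lam := (isYoungElt_xElt hT lam).mul_self
  mul i j l h h' := by
    refine schurUnit_ext (fun v => ?_) (fun v lam' hl => ?_)
    · rw [schurApp_mul, schurUnit_apply_same, schurUnit_apply_same]
      simp only [mul_assoc]
    · exact schurUnit_apply_ne _ _ _ hl _ _
  mul_ne i j j' l h h' hne := by
    refine schur_ext fun v lam' => ?_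
    by_cases hl : lam' = i
    · subst hl
      rw [schurApp_mul, schurUnit_apply_same, schurUnit_apply_ne _ _ _ hne]
      exact mul_zero _
    · exact congrArg Subtype.val (schurUnit_apply_ne _ _ _ hl _ _)
  sandwich i j h := by
    refine schurUnit_ext (fun v => ?_) (fun v lam' hl => ?_)
    · have hv := (mem_xIdeal_iff hT j _).1 (v j).2
      rw [schurUnit_apply_same, ← mul_assoc, ← mul_assoc, (isYoungElt_xElt hT i).mul_self,
        mul_assoc, hv]
    · exact schurUnit_apply_ne _ _ _ hl _ _
  eq_zero i j h h0 := by
    have h1 := schurUnit_apply_same (T := T) i j h (schurGen T j)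
    rw [schurGen_same, h0] at h1
    exact h1.symm
  one := by
    refine schur_ext fun v lam => ?_
    have h1 : schurApp (∑ i, schurUnit T i i 1 : Schur0 k n r T) v
          = ∑ i, schurApp (schurUnit T i i 1) v :=
      LinearMap.sum_apply _ _ _
    have h2 : (∑ i, schurApp (schurUnit T i i 1) v) lam
        = ∑ i, (schurApp (schurUnit T i i 1) v) lam :=
      Finset.sum_apply _ _ _
    rw [h1, h2, Finset.sum_eq_single lam, schurUnit_apply_same, mul_one,
      (mem_xIdeal_iff hT lam _).1 (v lam).2]
    · rfl
    · intro i _ hi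
      exact schurUnit_apply_ne _ _ _ hi.symm _ _
    · exact fun h => absurd (Finset.mem_univ _) h
  corner i j a := by
    let w : HeckeA k r :=
      (schurApp a (schurGen T j) i).1
    refine ⟨w, schurUnit_ext (fun v => ?_) (fun v lam' hl => ?_)⟩
    · refine (schurUnit_apply_same i i 1 (schurApp a
        (schurApp (schurUnit T j j 1) v))).trans ?_
      rw [schurUnit_one_apply hT, _root_.map_smul, mul_one, mul_assoc]
      rfl
    · exact schurUnit_apply_ne i lam' i hl _ _

end SchurPeirce

section ChainTransport

variable {k : Type} [Field k]

theorem upPath_op {S : Type} [Ring S] (γ F : ℕ → S) (a n : ℕ) :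
    upPath (fun i => op (γ i)) (fun i => op (F i)) a n = op (downPath γ F a n) := by
  induction n with
  | zero => rfl
  | succ n ih => rw [upPath, downPath, ih, op_mul]

theorem downPath_op {S : Type} [Ring S] (γ E : ℕ → S) (a n : ℕ) :
    downPath (fun i => op (γ i)) (fun i => op (E i)) a n = op (upPath γ E a n) := by
  induction n with
  | zero => rfl
  | succ n ih => rw [upPath, downPath, ih, op_mul]

theorem ChainData.op {S : Type} [Ring S] [Algebra k S] {c : S} (hcS : ∀ s, c * s = s * c) {N : ℕ}
    {γ E F : ℕ → S} (h : ChainData k c N γ E F) :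
    ChainData k (op c) N (fun i => op (γ i)) (fun i => op (F i)) (fun i => op (E i)) where
  idem a := by rw [← op_mul, h.idem]
  vanish a ha := by rw [h.vanish a ha, MulOpposite.op_zero]
  left_E a := by rw [← op_mul, h.F_right]
  E_right a := by rw [← op_mul, h.left_F]
  left_F a := by rw [← op_mul, h.E_right]
  F_right a := by rw [← op_mul, h.left_E]
  EF a := by
    obtain ⟨s, hs⟩ := h.EF a
    exact ⟨MulOpposite.op s, by rw [← op_mul, ← op_mul, hs, hcS]⟩
  FE a := by
    obtain ⟨s, hs⟩ := h.FE a
    exact ⟨MulOpposite.op s, by rw [← op_mul, ← op_mul, hs, hcS]⟩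
  full := by
    obtain ⟨m, u, v, a, hs⟩ := h.full
    refine ⟨m, fun i => MulOpposite.op (v i), fun i => MulOpposite.op (u i), a, ?_⟩
    rw [← op_one, ← hs, ← MulOpposite.opAddEquiv_apply, _root_.map_sum]
    simp only [MulOpposite.opAddEquiv_apply, op_mul, mul_assoc]
  up a n s := by
    obtain ⟨κ, s', hs⟩ := h.down a n s.unop
    refine ⟨κ, MulOpposite.op s', ?_⟩
    rw [upPath_op, ← op_mul, ← hcS, ← op_smul, ← MulOpposite.op_add, ← hs, op_mul, op_mul,
      op_unop, mul_assoc]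
  down b n s := by
    obtain ⟨κ, s', hs⟩ := h.up b n s.unop
    refine ⟨κ, MulOpposite.op s', ?_⟩
    rw [downPath_op, ← op_mul, ← hcS, ← op_smul, ← MulOpposite.op_add, ← hs, op_mul, op_mul,
      op_unop, mul_assoc]

theorem ChainData.tauTiltingFinite_self {A : Type} [Ring A] [Algebra k A] [Module.Finite k A]
    {c : A} (hcS : ∀ s, c * s = s * c) (hn : IsNilpotent c) {N : ℕ} {γ E F : ℕ → A}
    (h : ChainData k c N γ E F) : TauTiltingFinite k A := by
  refine (h.op hcS).tauTiltingFinite (fun s => ?_) ?_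
  · rw [← op_unop s, ← op_mul, ← op_mul, hcS]
  · obtain ⟨n, hn⟩ := hn
    exact ⟨n, by rw [← op_pow, hn, MulOpposite.op_zero]⟩

end ChainTransport

namespace PeirceData

variable {k : Type} [Field k] {H A ι : Type} [Ring H] [Algebra k H] [Ring A]
  [Algebra k A] [Fintype ι] {X : ι → H} {θ : ι → ι → H →ₗ[k] A} (P : PeirceData k X θ)
include P

theorem one_mul (i j : ι) (h : H) : θ i i 1 * θ i j h = θ i j h := by
  rw [P.mul, _root_.one_mul, ← P.sandwich, ← mul_assoc, P.idem, P.sandwich]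

theorem mul_one (i j : ι) (h : H) : θ i j h * θ j j 1 = θ i j h := by
  rw [P.mul, _root_.mul_one, ← P.sandwich, mul_assoc, mul_assoc, P.idem, ← mul_assoc, P.sandwich]

theorem mul_mul (i j l m : ι) (a : A) : ∃ h, ∀ u v, u * X j = u → X l * v = v →
    θ i j u * a * θ l m v = θ i m (u * h * v) := by
  obtain ⟨h, hh⟩ := P.corner j l a
  refine ⟨h, fun u v hu hv => ?_⟩
  rw [← P.mul_one i j u, ← P.one_mul l m v, ← mul_assoc, mul_assoc (θ i j u), mul_assoc (θ i j u),
    hh, P.mul, P.mul, hu, mul_assoc _ (X l), hv]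

theorem eq_sum (a : A) : a = ∑ i, ∑ j, θ i i 1 * a * θ j j 1 := by
  simp_rw [← Finset.mul_sum, ← Finset.sum_mul, P.one, _root_.one_mul, _root_.mul_one]

theorem finite [Module.Finite k H] : Module.Finite k A := by
  let f : (ι → ι → H) →ₗ[k] A :=
    { toFun := fun u => ∑ i, ∑ j, θ i j (u i j)
      map_add' := fun u v => by simp [Finset.sum_add_distrib]
      map_smul' := fun c u => by simp [Finset.smul_sum] }
  refine Module.Finite.of_surjective f fun a => ?_
  choose w hw using fun i j => P.corner i j a
  refine ⟨w, ?_⟩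
  rw [P.eq_sum a]
  exact Finset.sum_congr rfl fun i _ => Finset.sum_congr rfl fun j _ => (hw i j).symm

theorem dynkinData {e g : Fin 3 → H} (D : DynkinData k e g fun j i => g j * e i)
    (lam mu : Fin 3 → ι) (he : ∀ i, X (lam i) * e i = e i) (he' : ∀ i, e i * X (lam i) = e i)
    (hg : ∀ i, X (mu i) * g i = g i) (hg' : ∀ i, g i * X (mu i) = g i) :
    DynkinData k (fun i => θ (lam i) (lam i) (e i)) (fun j => θ (mu j) (mu j) (g j))
      fun j i => θ (mu j) (lam i) (g j * e i) where
  idem_left i := by rw [P.mul, he', D.idem_left]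
  idem_right j := by rw [P.mul, hg', D.idem_right]
  mul_left j i := by rw [P.mul, hg', D.mul_left]
  mul_right j i := by rw [P.mul, mul_assoc _ (X _), he, D.mul_right]
  ne_zero j i h h0 := by
    refine D.ne_zero j i h ?_
    have := P.eq_zero _ _ _ h0
    rwa [← mul_assoc, hg, mul_assoc, he'] at this
  eq_zero j i h := by rw [D.eq_zero j i h, map_zero]
  hom j i a := by
    obtain ⟨h, hh⟩ := P.mul_mul (mu j) (mu j) (lam i) (lam i) a
    obtain ⟨c, hc⟩ := D.hom j i h
    exact ⟨c, by rw [hh _ _ (hg' j) (he i), hc, _root_.map_smul]⟩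
  source_ne j i i' a hi := by
    obtain ⟨h, hh⟩ := P.mul_mul (mu j) (lam i') (lam i) (lam i) a
    rw [hh _ _ (by rw [mul_assoc, he']) (he i), D.source_ne j i i' h hi, map_zero]
  source i a := by
    obtain ⟨h, hh⟩ := P.corner (lam i) (lam i) a
    obtain ⟨c, hc⟩ := D.source i h
    refine ⟨c, fun j => ?_⟩
    rw [← P.mul_one (mu j) (lam i), ← P.one_mul (lam i) (lam i) (e i), ← mul_assoc,
      mul_assoc (θ (mu j) (lam i) _), mul_assoc (θ (mu j) (lam i) _), hh, P.mul, P.mul,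
      mul_assoc _ (X _) (e i), he, mul_assoc (g j), he', hc, _root_.map_smul, P.mul_one]
  target_ne j j' i a hj := by
    obtain ⟨h, hh⟩ := P.mul_mul (mu j') (mu j') (mu j) (lam i) a
    rw [hh _ _ (hg' j') (by rw [← mul_assoc, hg]), D.target_ne j j' i h hj, map_zero]
  target j a := by
    obtain ⟨h, hh⟩ := P.corner (mu j) (mu j) a
    obtain ⟨c, hc⟩ := D.target j h
    refine ⟨c, fun i => ?_⟩
    rw [← P.mul_one (mu j) (mu j) (g j), ← P.one_mul (mu j) (lam i), ← mul_assoc,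
      mul_assoc (θ (mu j) (mu j) _), mul_assoc (θ (mu j) (mu j) _), hh, P.mul, P.mul,
      mul_assoc _ (X _) (g j * e i), ← mul_assoc (X _), hg, hg', hc, _root_.map_smul, P.one_mul]

theorem upPath_map {i₀ : ι} (h0 : X i₀ = 1) (γ E : ℕ → H) (a n : ℕ) :
    upPath (fun i => θ i₀ i₀ (γ i)) (fun i => θ i₀ i₀ (E i)) a n = θ i₀ i₀ (upPath γ E a n) := by
  induction n with
  | zero => rfl
  | succ n ih => rw [upPath, upPath, ih, P.mul, h0, _root_.mul_one]

theorem downPath_map {i₀ : ι} (h0 : X i₀ = 1) (γ F : ℕ → H) (a n : ℕ) :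
    downPath (fun i => θ i₀ i₀ (γ i)) (fun i => θ i₀ i₀ (F i)) a n
      = θ i₀ i₀ (downPath γ F a n) := by
  induction n with
  | zero => rfl
  | succ n ih => rw [downPath, downPath, ih, P.mul, h0, _root_.mul_one]

theorem chainData {i₀ : ι} (h0 : X i₀ = 1) {N : ℕ} {γ E F : ℕ → H}
    (h : ChainData k 0 N γ E F) :
    ChainData k 0 N (fun i => θ i₀ i₀ (γ i)) (fun i => θ i₀ i₀ (E i))
      (fun i => θ i₀ i₀ (F i)) where
  idem a := by rw [P.mul, h0, _root_.mul_one, h.idem]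
  vanish a ha := by rw [h.vanish a ha, map_zero]
  left_E a := by rw [P.mul, h0, _root_.mul_one, h.left_E]
  E_right a := by rw [P.mul, h0, _root_.mul_one, h.E_right]
  left_F a := by rw [P.mul, h0, _root_.mul_one, h.left_F]
  F_right a := by rw [P.mul, h0, _root_.mul_one, h.F_right]
  EF a := by
    obtain ⟨s, hs⟩ := h.EF a
    exact ⟨0, by rw [P.mul, h0, _root_.mul_one, hs, zero_mul, zero_mul, map_zero]⟩
  FE a := by
    obtain ⟨s, hs⟩ := h.FE a
    exact ⟨0, by rw [P.mul, h0, _root_.mul_one, hs, zero_mul, zero_mul, map_zero]⟩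
  full := by
    obtain ⟨m, u, v, a, hs⟩ := h.full
    let w := Fintype.equivFin ι
    let q := finProdFinEquiv (m := Fintype.card ι) (n := m)
    refine ⟨Fintype.card ι * m, fun t => θ (w.symm (q.symm t).1) i₀ (u (q.symm t).2),
      fun t => θ i₀ (w.symm (q.symm t).1) (v (q.symm t).2), fun t => a (q.symm t).2, ?_⟩
    rw [Equiv.sum_comp q.symm fun t : Fin (Fintype.card ι) × Fin m =>
      θ (w.symm t.1) i₀ (u t.2) * θ i₀ i₀ (γ (a t.2)) * θ i₀ (w.symm t.1) (v t.2),
      Fintype.sum_prod_type, Equiv.sum_comp w.symm fun i : ι =>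
        ∑ y, θ i i₀ (u y) * θ i₀ i₀ (γ (a y)) * θ i₀ i (v y), ← P.one]
    refine Finset.sum_congr rfl fun i _ => ?_
    rw [← hs, _root_.map_sum]
    refine Finset.sum_congr rfl fun y _ => ?_
    rw [P.mul, P.mul, h0, _root_.mul_one, _root_.mul_one]
  up a n s := by
    obtain ⟨s₁, hs₁⟩ := P.mul_mul i₀ i₀ i₀ i₀ s
    obtain ⟨κ, s', hs⟩ := h.up a n s₁
    refine ⟨κ, 0, ?_⟩
    rw [hs₁ _ _ (by rw [h0, _root_.mul_one]) (by rw [h0, _root_.one_mul]), hs, P.upPath_map h0,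
      zero_mul, zero_mul, add_zero, add_zero, _root_.map_smul]
  down a n s := by
    obtain ⟨s₁, hs₁⟩ := P.mul_mul i₀ i₀ i₀ i₀ s
    obtain ⟨κ, s', hs⟩ := h.down a n s₁
    refine ⟨κ, 0, ?_⟩
    rw [hs₁ _ _ (by rw [h0, _root_.mul_one]) (by rw [h0, _root_.one_mul]), hs, P.downPath_map h0,
      zero_mul, zero_mul, add_zero, add_zero, _root_.map_smul]

end PeirceData

section ThreeParts

variable {k : Type} [Field k] {n r : ℕ} {T : Equiv.Perm (Fin r) → HeckeA k r}

theorem exists_comp_isYoungElt (hn : 3 ≤ n) (hT : IsHeckeBasis k r T) {a b : ℕ} (h : a + b ≤ r)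
    (M : Set ℕ) (hM : ∀ i : AGen r, i.1 ∈ M ↔ i.1 + 1 = a ∨ i.1 + 1 = a + b) :
    ∃ lam : Comp n r, IsYoungElt M (xElt k T lam) := by
  obtain ⟨lam, hl⟩ := exists_comp_three hn h
  exact ⟨lam, (isYoungElt_xElt hT lam).congr fun i => (hl i).trans (hM i).symm⟩

theorem schur_not_tauTiltingFinite (hn : 3 ≤ n) (hr : 4 ≤ r) (hT : IsHeckeBasis k r T) :
    ¬ TauTiltingFinite k (Schur0 k n r T) := by
  obtain ⟨l, rfl⟩ := Nat.exists_eq_add_of_le' (show 3 ≤ r by omega)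
  have P := peirceData_schur (n := n) hT
  have : Module.Finite k (HeckeA k (l + 3)) := hT.finite
  have := P.finite
  have key : ∀ (a b : ℕ) (M : Set ℕ), a + b ≤ l + 3 →
      (∀ i : ℕ, i + 2 ≤ l + 3 → (i ∈ M ↔ i + 1 = a ∨ i + 1 = a + b)) →
      ∃ lam : Comp n (l + 3), IsYoungElt M (xElt k T lam) :=
    fun a b M h hM => exists_comp_isYoungElt hn hT h M fun i => hM i.1 i.2
  obtain ⟨la, ha⟩ := key 1 0 {0} (by omega) (fun i hi => by
    simp only [Set.mem_singleton_iff]; omega)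
  obtain ⟨lb, hb⟩ := key (l + 2) 0 {l + 1} (by omega) (fun i hi => by
    simp only [Set.mem_singleton_iff]; omega)
  obtain ⟨ly, hy⟩ := key 1 (l + 1) {0, l + 1} (by omega) (fun i hi => by
    simp only [Set.mem_singleton_iff, Set.mem_insert_iff]; omega)
  obtain ⟨lx, hx⟩ := key 2 0 {1} (by omega) (fun i hi => by
    simp only [Set.mem_singleton_iff]; omega)
  obtain ⟨lc, hc⟩ := key 1 1 {0, 1} (by omega) (fun i hi => by
    simp only [Set.mem_singleton_iff, Set.mem_insert_iff]; omega)
  obtain ⟨ld, hd⟩ := key (l + 1) 1 {l, l + 1} (by omega) (fun i hi => by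
    simp only [Set.mem_singleton_iff, Set.mem_insert_iff]; omega)
  obtain ⟨_, hl⟩ := key (l + 1) 0 {l} (by omega) (fun i hi => by
    simp only [Set.mem_singleton_iff]; omega)
  obtain ⟨_, hz⟩ := key 0 0 ∅ (by omega) (fun i hi => by
    simp only [Set.mem_empty_iff_false, false_iff]; omega)
  obtain ⟨e, g, h1, h2, h3, h4, D⟩ := exists_dynkinData_hecke hr rfl ha hb hy hx hc hd hl hz
  refine (P.dynkinData D ![la, lb, ly] ![lx, lc, ld] (fun i => ?_) (fun i => ?_) (fun i => ?_)
    fun i => ?_).not_tauTiltingFinite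
  · have := h1 i
    fin_cases i <;> exact this
  · have := h2 i
    fin_cases i <;> exact this
  · have := h3 i
    fin_cases i <;> exact this
  · have := h4 i
    fin_cases i <;> exact this

end ThreeParts

section SmallRank

variable {k : Type} [Field k] {H : Type} [Ring H] [Algebra k H]

/-- The idempotents of the 0-Hecke algebra of rank at most two. -/
def smallIdem (p q : H) : ℕ → H
  | 0 => q - p * q * p
  | 1 => p - p * q * p
  | 2 => p * q * p
  | 3 => 1 - p - q + p * q + q * p - p * q * p
  | _ => 0

/-- The upward arrow of the 0-Hecke algebra of rank at most two. -/
def smallUp (p q : H) : ℕ → H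
  | 0 => p * q - p * q * p
  | _ => 0

/-- The downward arrow of the 0-Hecke algebra of rank at most two. -/
def smallDown (p q : H) : ℕ → H
  | 0 => q * p - p * q * p
  | _ => 0

variable {p q : H} (hp : p * p = p) (hq : q * q = q) (hpq : p * q * p = q * p * q)
  (hspan : ∀ h : H, ∃ c₁ c₂ c₃ c₄ c₅ c₆ : k, h = c₁ • 1 + c₂ • p + c₃ • q + c₄ • (p * q)
    + c₅ • (q * p) + c₆ • (p * q * p))
include hp hq hpq

omit [Algebra k H] in
theorem smallRank_rules : (∀ x, p * (p * x) = p * x) ∧ (∀ x, q * (q * x) = q * x) ∧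
    q * (p * q) = p * (q * p) ∧ (∀ x, q * (p * (q * x)) = p * (q * (p * x))) := by
  refine ⟨fun x => by rw [← mul_assoc, hp], fun x => by rw [← mul_assoc, hq],
    by rw [← mul_assoc, ← hpq, mul_assoc], fun x => ?_⟩
  rw [← mul_assoc p, ← mul_assoc q, ← mul_assoc q, ← hpq]
  simp only [mul_assoc]

include hspan

theorem smallIdem_diag (a : ℕ) (h : H) :
    ∃ κ : k, smallIdem p q a * h * smallIdem p q a = κ • smallIdem p q a := by
  obtain ⟨c₁, c₂, c₃, c₄, c₅, c₆, rfl⟩ := hspan h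
  obtain ⟨h1, h2, h3, h4⟩ := smallRank_rules hp hq hpq
  match a with
  | 0 =>
    refine ⟨c₁ + c₃, ?_⟩
    simp only [smallIdem, mul_add, add_mul, mul_sub, sub_mul, mul_smul_comm, smul_mul_assoc,
      mul_assoc, hp, hq, h1, h2, h3, h4, mul_one, one_mul]
    module
  | 1 =>
    refine ⟨c₁ + c₂, ?_⟩
    simp only [smallIdem, mul_add, add_mul, mul_sub, sub_mul, mul_smul_comm, smul_mul_assoc,
      mul_assoc, hp, hq, h1, h2, h3, h4, mul_one, one_mul]
    module
  | 2 =>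
    refine ⟨c₁ + c₂ + c₃ + c₄ + c₅ + c₆, ?_⟩
    simp only [smallIdem, mul_add, add_mul, mul_smul_comm, smul_mul_assoc,
      mul_assoc, hp, hq, h1, h2, h3, h4, mul_one]
    module
  | 3 =>
    refine ⟨c₁, ?_⟩
    simp only [smallIdem, mul_add, add_mul, mul_sub, sub_mul, mul_smul_comm, smul_mul_assoc,
      mul_assoc, hp, hq, h1, h2, h3, h4, mul_one, one_mul]
    module
  | n + 4 => exact ⟨0, by simp [smallIdem]⟩

theorem smallIdem_off (a b : ℕ) (hab : a ≠ b) (ha : 2 ≤ a ∨ 2 ≤ b) (h : H) :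
    smallIdem p q a * h * smallIdem p q b = 0 := by
  obtain ⟨c₁, c₂, c₃, c₄, c₅, c₆, rfl⟩ := hspan h
  obtain ⟨h1, h2, h3, h4⟩ := smallRank_rules hp hq hpq
  match a, b, hab, ha with
  | n + 4, b, _, _ => simp [smallIdem]
  | a, n + 4, _, _ => simp [smallIdem]
  | 0, 2, _, _ | 0, 3, _, _ | 1, 2, _, _ | 1, 3, _, _ | 2, 3, _, _ | 2, 0, _, _ | 2, 1, _, _
  | 3, 0, _, _ | 3, 1, _, _ | 3, 2, _, _ =>
    simp only [smallIdem, mul_add, add_mul, mul_sub, sub_mul, mul_smul_comm, smul_mul_assoc,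
      mul_assoc, hp, hq, h1, h2, h3, h4, mul_one, one_mul]
    module
  | 0, 0, h, _ | 1, 1, h, _ | 2, 2, h, _ | 3, 3, h, _ => exact absurd rfl h
  | 0, 1, _, h | 1, 0, _, h => omega

theorem smallIdem_up (h : H) :
    ∃ κ : k, smallIdem p q 1 * h * smallIdem p q 0 = κ • smallUp p q 0 := by
  obtain ⟨c₁, c₂, c₃, c₄, c₅, c₆, rfl⟩ := hspan h
  obtain ⟨h1, h2, h3, h4⟩ := smallRank_rules hp hq hpq
  refine ⟨c₁ + c₂ + c₃ + c₄, ?_⟩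
  simp only [smallIdem, smallUp, mul_add, add_mul, mul_sub, sub_mul, mul_smul_comm,
    smul_mul_assoc, mul_assoc, hp, hq, h1, h2, h3, h4, mul_one]
  module

theorem smallIdem_down (h : H) :
    ∃ κ : k, smallIdem p q 0 * h * smallIdem p q 1 = κ • smallDown p q 0 := by
  obtain ⟨c₁, c₂, c₃, c₄, c₅, c₆, rfl⟩ := hspan h
  obtain ⟨h1, h2, h3, h4⟩ := smallRank_rules hp hq hpq
  refine ⟨c₁ + c₂ + c₃ + c₅, ?_⟩
  simp only [smallIdem, smallDown, mul_add, add_mul, mul_sub, sub_mul, mul_smul_comm,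
    smul_mul_assoc, mul_assoc, hp, hq, h1, h2, h3, h4, mul_one]
  module

theorem chainData_small :
    ChainData k 0 4 (smallIdem p q) (smallUp p q) (smallDown p q) := by
  obtain ⟨h1, h2, h3, h4⟩ := smallRank_rules hp hq hpq
  have hid : ∀ a, smallIdem p q a * smallIdem p q a = smallIdem p q a := by
    intro a
    match a with
    | 0 | 1 | 3 =>
      simp only [smallIdem, mul_add, add_mul, mul_sub, sub_mul,
        mul_assoc, hp, hq, h1, h2, h3, h4, mul_one, one_mul]
      abel
    | 2 => simp only [smallIdem, mul_assoc, hp, h1, h3, h4]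
    | n + 4 => simp [smallIdem]
  have hup : smallIdem p q 1 * smallUp p q 0 = smallUp p q 0 ∧
      smallUp p q 0 * smallIdem p q 0 = smallUp p q 0 := by
    constructor <;> simp [smallIdem, smallUp, mul_sub, sub_mul, mul_assoc, hp, hq, h1, h2, h3, h4]
  have hdown : smallIdem p q 0 * smallDown p q 0 = smallDown p q 0 ∧
      smallDown p q 0 * smallIdem p q 1 = smallDown p q 0 := by
    constructor <;>
      simp [smallIdem, smallDown, mul_sub, sub_mul, mul_assoc, hp, hq, h1, h2, h3, h4]
  refine ⟨hid, fun a ha => ?_, fun a => ?_, fun a => ?_, fun a => ?_, fun a => ?_, fun a => ⟨0, ?_⟩,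
    fun a => ⟨0, ?_⟩, ?_, fun a n s => ?_, fun a n s => ?_⟩
  · obtain ⟨a, rfl⟩ := Nat.exists_eq_add_of_le' ha
    rfl
  · cases a with
    | zero => exact hup.1
    | succ a => simp [smallUp]
  · cases a with
    | zero => exact hup.2
    | succ a => simp [smallUp]
  · cases a with
    | zero => exact hdown.1
    | succ a => simp [smallDown]
  · cases a with
    | zero => exact hdown.2
    | succ a => simp [smallDown]
  · cases a with
    | zero => simp [smallUp, smallDown, mul_sub, sub_mul, mul_assoc, hp, hq, h1, h2, h3, h4]
    | succ a => simp [smallUp]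
  · cases a with
    | zero => simp [smallUp, smallDown, mul_sub, sub_mul, mul_assoc, hp, hq, h1, h2, h3, h4]
    | succ a => simp [smallUp]
  · refine ⟨4, ![1, 1, 1, 1], ![1 - p, 1 - q, 1, 1], ![0, 1, 2, 3], ?_⟩
    rw [Fin.sum_univ_four]
    simp [smallIdem, mul_sub, sub_mul, mul_assoc, hp, hq, h1, h2, h3, h4]
    abel
  · match n with
    | 0 =>
      obtain ⟨κ, hκ⟩ := smallIdem_diag hp hq hpq hspan a s
      exact ⟨κ, 0, by rw [zero_mul, add_zero (κ • _)]; exact hκ⟩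
    | 1 =>
      cases a with
      | zero =>
        obtain ⟨κ, hκ⟩ := smallIdem_up hp hq hpq hspan s
        exact ⟨κ, 0, by rw [zero_mul, add_zero, upPath, upPath, add_zero, hup.2]; exact hκ⟩
      | succ a =>
        exact ⟨0, 0, by
          rw [smallIdem_off hp hq hpq hspan _ _ (by omega) (by omega), zero_smul, zero_mul,
            add_zero]⟩
    | n + 2 =>
      exact ⟨0, 0, by
        rw [smallIdem_off hp hq hpq hspan _ _ (by omega) (by omega), zero_smul, zero_mul,
          add_zero]⟩
  · match n with
    | 0 =>
      obtain ⟨κ, hκ⟩ := smallIdem_diag hp hq hpq hspan a s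
      exact ⟨κ, 0, by rw [zero_mul, add_zero (κ • _)]; exact hκ⟩
    | 1 =>
      cases a with
      | zero =>
        obtain ⟨κ, hκ⟩ := smallIdem_down hp hq hpq hspan s
        exact ⟨κ, 0, by rw [zero_mul, add_zero, downPath, downPath, add_zero, hdown.1]; exact hκ⟩
      | succ a =>
        exact ⟨0, 0, by
          rw [smallIdem_off hp hq hpq hspan _ _ (by omega) (by omega), zero_smul, zero_mul,
            add_zero]⟩
    | n + 2 =>
      exact ⟨0, 0, by
        rw [smallIdem_off hp hq hpq hspan _ _ (by omega) (by omega), zero_smul, zero_mul,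
          add_zero]⟩

end SmallRank

section SmallSchur

variable {k : Type} [Field k] {n r : ℕ} {T : Equiv.Perm (Fin r) → HeckeA k r}

/-- The span of the words in two elements. -/
theorem exists_hecke_small (hr : r ≤ 3) : ∃ p q : HeckeA k r, p * p = p ∧ q * q = q ∧
    p * q * p = q * p * q ∧ ∀ h : HeckeA k r, ∃ c₁ c₂ c₃ c₄ c₅ c₆ : k,
      h = c₁ • 1 + c₂ • p + c₃ • q + c₄ • (p * q) + c₅ • (q * p) + c₆ • (p * q * p) := by
  obtain ⟨p, q, hp, hq, hpq, hg⟩ : ∃ p q : HeckeA k r, p * p = p ∧ q * q = q ∧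
      p * q * p = q * p * q ∧ ∀ i : AGen r, TGen k r i = p - 1 ∨ TGen k r i = q - 1 := by
    interval_cases r
    · exact ⟨1, 1, by simp, by simp, by simp, fun i => absurd i.2 (by omega)⟩
    · exact ⟨1, 1, by simp, by simp, by simp, fun i => absurd i.2 (by omega)⟩
    · have h := one_add_TGen_mul_self (k := k) (r := 2) ⟨0, by omega⟩
      refine ⟨_, _, h, h, rfl, fun i => Or.inl ?_⟩
      obtain ⟨i, hi⟩ := i
      obtain rfl : i = 0 := by omega
      abel
    · refine ⟨_, _, one_add_TGen_mul_self (k := k) (r := 3) ⟨0, by omega⟩,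
        one_add_TGen_mul_self (k := k) (r := 3) ⟨1, by omega⟩,
        one_add_TGen_braid _ _ (Or.inl rfl), fun i => ?_⟩
      obtain ⟨i, hi⟩ := i
      obtain rfl | rfl : i = 0 ∨ i = 1 := by omega
      · exact Or.inl (by abel)
      · exact Or.inr (by abel)
  refine ⟨p, q, hp, hq, hpq, fun h => ?_⟩
  obtain ⟨h1, h2, h3, h4⟩ := smallRank_rules hp hq hpq
  induction h using hecke_induction with
  | scalar c => exact ⟨c, 0, 0, 0, 0, 0, by simp [Algebra.algebraMap_eq_smul_one]⟩
  | gen i =>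
    rcases hg i with h | h
    · exact ⟨-1, 1, 0, 0, 0, 0, by rw [h]; module⟩
    · exact ⟨-1, 0, 1, 0, 0, 0, by rw [h]; module⟩
  | mul a b ha hb =>
    obtain ⟨a₁, a₂, a₃, a₄, a₅, a₆, rfl⟩ := ha
    obtain ⟨b₁, b₂, b₃, b₄, b₅, b₆, rfl⟩ := hb
    refine ⟨a₁ * b₁, a₁ * b₂ + a₂ * b₁ + a₂ * b₂, a₁ * b₃ + a₃ * b₁ + a₃ * b₃,
      a₁ * b₄ + a₂ * b₃ + a₂ * b₄ + a₄ * b₁ + a₄ * b₃,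
      a₁ * b₅ + a₅ * b₁ + a₃ * b₂ + a₃ * b₅ + a₅ * b₂,
      a₁ * b₆ + a₂ * (b₅ + b₆) + a₃ * (b₄ + b₆) + a₄ * (b₂ + b₄ + b₅ + b₆)
        + a₅ * (b₃ + b₄ + b₅ + b₆) + a₆ * (b₁ + b₂ + b₃ + b₄ + b₅ + b₆), ?_⟩
    simp only [mul_add, add_mul, mul_smul_comm, smul_mul_assoc, mul_assoc, hp, hq, h1, h2, h3, h4,
      mul_one, one_mul]
    module
  | add a b ha hb =>
    obtain ⟨a₁, a₂, a₃, a₄, a₅, a₆, rfl⟩ := ha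
    obtain ⟨b₁, b₂, b₃, b₄, b₅, b₆, rfl⟩ := hb
    exact ⟨a₁ + b₁, a₂ + b₂, a₃ + b₃, a₄ + b₄, a₅ + b₅, a₆ + b₆, by module⟩

theorem schur_small_tauTiltingFinite (hn : 3 ≤ n) (hr : r ≤ 3) (hT : IsHeckeBasis k r T) :
    TauTiltingFinite k (Schur0 k n r T) := by
  have P := peirceData_schur (n := n) hT
  have : Module.Finite k (HeckeA k r) := hT.finite
  have := P.finite
  obtain ⟨p, q, hp, hq, hpq, hspan⟩ := exists_hecke_small (k := k) hr
  obtain ⟨lam, hlam⟩ : ∃ lam : Comp n r, xElt k T lam = 1 := by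
    obtain ⟨lam, hl⟩ := exists_comp_isYoungElt (a := min 1 r) (b := min 1 (r - 1)) hn hT
      (by omega) Set.univ fun i => by
        have := i.2
        simp only [Set.mem_univ, true_iff]
        omega
    exact ⟨lam, hl.eq_one fun i => Set.mem_univ _⟩
  exact (P.chainData hlam (chainData_small hp hq hpq hspan)).tauTiltingFinite_self
    (by simp) ⟨1, by simp⟩

end SmallSchur

section BinaryWords

/-- The number of zeros among the first `i` letters. -/
def zeroCount (s : ℕ → ℕ) (i : ℕ) : ℕ := Nat.count (fun q => s q = 0) i

theorem zeroCount_zero (s : ℕ → ℕ) : zeroCount s 0 = 0 := Nat.count_zero _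

theorem zeroCount_succ (s : ℕ → ℕ) (i : ℕ) :
    zeroCount s (i + 1) = zeroCount s i + if s i = 0 then 1 else 0 := Nat.count_succ _ _

theorem zeroCount_le_add (s : ℕ → ℕ) (i n : ℕ) :
    zeroCount s i ≤ zeroCount s (i + n) ∧ zeroCount s (i + n) ≤ zeroCount s i + n := by
  induction n with
  | zero => simp
  | succ n ih =>
    rw [← add_assoc, zeroCount_succ]
    split_ifs <;> omega

theorem zeroCount_bounds (s : ℕ → ℕ) {i j : ℕ} (h : i ≤ j) :
    zeroCount s i ≤ zeroCount s j ∧ zeroCount s j ≤ zeroCount s i + (j - i) := by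
  obtain ⟨n, rfl⟩ := Nat.exists_eq_add_of_le h
  simpa using zeroCount_le_add s i n

theorem zeroCount_swapW {i j : ℕ} (h : j ≠ i + 1) (s : ℕ → ℕ) :
    zeroCount (swapW i s) j = zeroCount s j := by
  have below : ∀ j ≤ i, zeroCount (swapW i s) j = zeroCount s j := by
    intro j
    induction j with
    | zero => intro _; simp [zeroCount_zero]
    | succ j ih =>
      intro hj
      rw [zeroCount_succ, zeroCount_succ, ih (by omega),
        swapW_of_ne (by omega) (by omega)]
  rcases Nat.lt_or_ge i j with hj | hj
  · obtain ⟨n, rfl⟩ := Nat.exists_eq_add_of_le (show i + 2 ≤ j by omega)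
    clear h hj
    induction n with
    | zero =>
      rw [add_zero, zeroCount_succ, zeroCount_succ, zeroCount_succ, zeroCount_succ,
        swapW_left, swapW_right, below i le_rfl]
      omega
    | succ n ih =>
      rw [← add_assoc, zeroCount_succ, zeroCount_succ, ih, swapW_of_ne (by omega) (by omega)]
  · exact below j hj

/-- Words in the letters `0` and `1` that are constantly `1` from position `r` on. -/
def IsBinary (r : ℕ) (s : ℕ → ℕ) : Prop := (∀ q, s q ≤ 1) ∧ ∀ q, r ≤ q → s q = 1

theorem IsBinary.swapW {r i : ℕ} (hi : i + 2 ≤ r) {s : ℕ → ℕ} (hs : IsBinary r s) :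
    IsBinary r (swapW i s) := by
  refine ⟨fun q => ?_, fun q hq => ?_⟩
  · rcases eq_or_ne q i with rfl | h
    · rw [swapW_left]; exact hs.1 _
    rcases eq_or_ne q (i + 1) with rfl | h'
    · rw [swapW_right]; exact hs.1 _
    · rw [swapW_of_ne h h']; exact hs.1 _
  · rw [swapW_of_ne (by omega) (by omega)]; exact hs.2 q hq

theorem IsBinary.eq_of_zeroCount {r : ℕ} {s t : ℕ → ℕ} (hs : IsBinary r s) (ht : IsBinary r t)
    (h : ∀ i ≤ r, zeroCount s i = zeroCount t i) : s = t := by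
  funext q
  rcases Nat.lt_or_ge q r with hq | hq
  · have h1 := h (q + 1) hq
    rw [zeroCount_succ, zeroCount_succ, h q hq.le] at h1
    have := hs.1 q
    have := ht.1 q
    split_ifs at h1 <;> omega
  · rw [hs.2 q hq, ht.2 q hq]

theorem zeroCount_antitone_block {s : ℕ → ℕ} {p q : ℕ}
    (h : ∀ u, p ≤ u → u + 1 < q → s (u + 1) ≤ s u) {i : ℕ} (hp : p ≤ i) (hq : i ≤ q) :
    zeroCount s i = zeroCount s p + (i - (q - (zeroCount s q - zeroCount s p))) := by
  have zeros : ∀ n u, p ≤ u → u + n = q → (n = 0 ∨ s u = 0) →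
      zeroCount s q = zeroCount s u + n := by
    intro n
    induction n with
    | zero => rintro u - rfl -; rfl
    | succ n ih =>
      intro u hu hn h0
      have h0 : s u = 0 := by simpa using h0
      rw [ih (u + 1) (by omega) (by omega), zeroCount_succ, if_pos h0]
      · ring
      · rcases Nat.eq_zero_or_pos n with hn' | hn'
        · exact Or.inl hn'
        · have := h u hu (by omega)
          exact Or.inr (by omega)
  have key : ∀ n, p + n ≤ q → zeroCount s (p + n) = zeroCount s p ∨
      zeroCount s q = zeroCount s (p + n) + (q - (p + n)) := by
    intro n
    induction n with
    | zero => intro _; exact Or.inl rfl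
    | succ n ih =>
      intro hn
      rw [← add_assoc, zeroCount_succ]
      by_cases h0 : s (p + n) = 0
      · have := zeros (q - (p + n)) (p + n) (by omega) (by omega) (Or.inr h0)
        rw [if_pos h0]
        omega
      · have := zeroCount_bounds s (show p + n + 1 ≤ q by omega)
        rw [zeroCount_succ, if_neg h0] at this
        rw [if_neg h0]
        have := ih (by omega)
        omega
  obtain ⟨n, rfl⟩ := Nat.exists_eq_add_of_le hp
  have := key n hq
  have := zeroCount_bounds s hp
  have := zeroCount_bounds s hq
  omega

/-- The effect on zero counts of sorting the blocks to the left and to the right of `b`. -/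
def sortedCount (r b : ℕ) (c : ℕ → ℕ) (i : ℕ) : ℕ :=
  if i ≤ b then i - (b - c b) else c b + (i - (r - (c r - c b)))

variable {k : Type} [Field k] {r : ℕ}

variable (k) in
/-- A vector that is the binary word with given zero counts. -/
def HasCount (r : ℕ) (c : ℕ → ℕ) (v : (ℕ → ℕ) →₀ k) : Prop :=
  ∃ s, IsBinary r s ∧ (∀ i ≤ r, zeroCount s i = c i) ∧ v = Finsupp.single s 1

theorem HasCount.unique {c c' : ℕ → ℕ} {v v' : (ℕ → ℕ) →₀ k} (h : HasCount k r c v)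
    (h' : HasCount k r c' v') (hc : ∀ i ≤ r, c i = c' i) : v = v' := by
  obtain ⟨s, hs, hsc, rfl⟩ := h
  obtain ⟨t, ht, htc, rfl⟩ := h'
  rw [hs.eq_of_zeroCount ht fun i hi => by rw [hsc i hi, htc i hi, hc i hi]]

theorem HasCount.wordRep {b : ℕ} {x : HeckeA k r} (hx : IsYoungElt {i | i + 1 = b} x)
    (hb : b ≤ r) {c : ℕ → ℕ} {v : (ℕ → ℕ) →₀ k} (h : HasCount k r c v) :
    HasCount k r (sortedCount r b c) (wordRep k r x v) := by
  obtain ⟨s, hs, hsc, rfl⟩ := h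
  obtain ⟨t, hst, hsort, ht⟩ := hx.exists_wordRep s
  have hB : t ∈ {t | IsBinary r t ∧ zeroCount t b = c b ∧ zeroCount t r = c r} := by
    refine SortStep.invariant ?_ hst ⟨hs, hsc b hb, hsc r le_rfl⟩
    rintro u ⟨hu, hub, hur⟩ i hi -
    have hi : i.1 + 1 ≠ b := hi
    have h2 := i.2
    exact ⟨hu.swapW h2, by rw [zeroCount_swapW (by omega), hub],
      by rw [zeroCount_swapW (by omega), hur]⟩
  obtain ⟨htb, h1, h2⟩ := hB
  refine ⟨t, htb, fun i hi => ?_, ht⟩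
  rw [sortedCount, ← h1, ← h2]
  split_ifs with hib
  · have := zeroCount_antitone_block (p := 0) (q := b) (fun u _ hu =>
      hsort ⟨u, by omega⟩ (show ¬ u + 1 = b by omega)) (Nat.zero_le i) hib
    simpa [zeroCount_zero] using this
  · exact zeroCount_antitone_block (p := b) (q := r) (fun u hu hu' =>
      hsort ⟨u, by omega⟩ (show ¬ u + 1 = b by omega)) (by omega) hi

/-- The word with zeros exactly in the first `a` positions. -/
def stepWord (a : ℕ) : ℕ → ℕ := fun q => if q < a then 0 else 1

theorem zeroCount_stepWord (a i : ℕ) : zeroCount (stepWord a) i = min i a := by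
  induction i with
  | zero => simp [zeroCount_zero]
  | succ i ih =>
    have : stepWord a i = 0 ↔ i < a := by
      unfold stepWord
      split_ifs with h <;> simp [h]
    simp only [zeroCount_succ, ih, this]
    split_ifs <;> omega

variable (k) in
theorem hasCount_stepWord {a : ℕ} (ha : a ≤ r) :
    HasCount k r (fun i => min i a) (Finsupp.single (stepWord a) 1) := by
  refine ⟨_, ⟨fun q => ?_, fun q hq => ?_⟩, fun i _ => zeroCount_stepWord a i, rfl⟩
  · unfold stepWord; split_ifs <;> omega
  · unfold stepWord; rw [if_neg (by omega)]

theorem IsYoungElt.mul_eq_zero_of_stepWord {a : ℕ} {x y : HeckeA k r}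
    (hx : IsYoungElt {i | i + 1 = a} x)
    (h : wordRep k r y (Finsupp.single (stepWord a) 1) = 0) : y * x = 0 := by
  refine mul_eq_zero_of_wordRep (b := stepWord a) (fun i => ?_) (fun i hi => ?_) h
  · unfold stepWord; split_ifs <;> omega
  · refine hx.left i fun hia => ?_
    have hia : i.1 + 1 = a := hia
    unfold stepWord at hi
    rw [if_pos (by omega), if_neg (by omega)] at hi
    omega

end BinaryWords

section CutElements

/-- The Young elements of the two-block compositions, indexed by the size of the first block. -/
def IsCutFamily {k : Type} [Field k] {r : ℕ} (Y : ℕ → HeckeA k r) : Prop :=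
  ∀ a, IsYoungElt {i | i + 1 = a} (Y a)

variable {k : Type} [Field k] {r : ℕ} {Y : ℕ → HeckeA k r} (hY : IsCutFamily Y)
include hY

namespace IsCutFamily

theorem mul_mul_eq_of_count {b a : ℕ} {u v : HeckeA k r} {c c' : ℕ → ℕ}
    (hu : HasCount k r c (wordRep k r u (Finsupp.single (stepWord a) 1)))
    (hv : HasCount k r c' (wordRep k r v (Finsupp.single (stepWord a) 1)))
    (hb : b ≤ r) (h : c b = c' b) (h' : c r = c' r) :
    Y b * u * Y a = Y b * v * Y a := by
  rw [← sub_eq_zero, ← sub_mul]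
  refine (hY a).mul_eq_zero_of_stepWord ?_
  rw [_root_.map_sub, LinearMap.sub_apply, sub_eq_zero, _root_.map_mul, _root_.map_mul,
    Module.End.mul_apply, Module.End.mul_apply]
  exact (hu.wordRep (hY b) hb).unique (hv.wordRep (hY b) hb) fun i _ => by
    rw [sortedCount, sortedCount, h, h']

theorem hasCount {a j : ℕ} (ha : a ≤ r) (hj : j ≤ r) :
    HasCount k r (sortedCount r j fun i => min i a)
      (wordRep k r (Y j) (Finsupp.single (stepWord a) 1)) :=
  (hasCount_stepWord k ha).wordRep (hY j) hj

theorem mul_succ_mul {b : ℕ} (hb : b + 1 < r) :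
    Y (b + 1) * Y (b + 2) * Y (b + 1) = Y (b + 1) * Y b * Y (b + 1) := by
  refine hY.mul_mul_eq_of_count (hY.hasCount (by omega) (by omega))
    (hY.hasCount (by omega) (by omega)) (by omega) ?_ ?_ <;> simp only [sortedCount] <;>
    split_ifs <;> omega

theorem mul_between {a j b : ℕ} (haj : a ≤ j) (hjb : j ≤ b) (hb : b ≤ r) :
    Y b * Y j * Y a = Y b * Y a := by
  have h := hY.mul_mul_eq_of_count (b := b) (a := a) (u := Y j) (v := 1)
    (hY.hasCount (by omega) (by omega))
    (by rw [_root_.map_one]; exact hasCount_stepWord k (by omega)) hb ?_ ?_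
  · rwa [mul_one] at h
  all_goals
    simp only [sortedCount]
    split_ifs <;> omega

theorem mul_between' {a j b : ℕ} (haj : a ≤ j) (hjb : j ≤ b) (hb : b ≤ r) :
    Y a * Y j * Y b = Y a * Y b := by
  apply heckeStar_injective
  simp only [heckeStar_mul, (hY _).star_eq, ← mul_assoc]
  exact hY.mul_between haj hjb hb

theorem sandwich_mem {a b : ℕ} (ha : a ≤ r) (hb : b ≤ r) (h : HeckeA k r) :
    Y b * h * Y a ∈ Submodule.span k {y | ∃ j, j ≤ a ∧ j ≤ b ∧ y = Y b * Y j * Y a} := by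
  set V := Submodule.span k {y | ∃ j, j ≤ a ∧ j ≤ b ∧ y = Y b * Y j} with hV
  set δ : (ℕ → ℕ) →₀ k := Finsupp.single (stepWord a) 1 with hδ
  let ev : HeckeA k r →ₗ[k] ((ℕ → ℕ) →₀ k) := LinearMap.applyₗ δ ∘ₗ (wordRep k r).toLinearMap
  have hev : ∀ y, ev y = wordRep k r y δ := fun y => rfl
  let N : Set (ℕ → ℕ) := {s | IsBinary r s ∧ zeroCount s r = a}
  have hN : SwapClosed r N := by
    rintro s ⟨hs, hsa⟩ i hi
    exact ⟨hs.swapW i.2, by rw [zeroCount_swapW (by have := i.2; omega), hsa]⟩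
  have hle : wordSpan k N ≤ (V.map ev).comap (wordRep k r (Y b)) := by
    rw [wordSpan_le_iff]
    rintro s ⟨hs, hsa⟩
    have h1 := zeroCount_bounds s (Nat.zero_le b)
    have h2 := zeroCount_bounds s hb
    rw [zeroCount_zero] at h1
    refine ⟨Y b * Y (zeroCount s b), Submodule.subset_span ⟨_, by omega, by omega, rfl⟩, ?_⟩
    rw [hev, _root_.map_mul, Module.End.mul_apply]
    refine ((hY.hasCount ha (by omega)).wordRep (hY b) hb).unique
      (HasCount.wordRep (hY b) hb ⟨s, hs, fun i _ => rfl, rfl⟩) fun i _ => ?_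
    have e1 : sortedCount r (zeroCount s b) (fun i => min i a) b = zeroCount s b := by
      simp only [sortedCount]
      split_ifs <;> omega
    have e2 : sortedCount r (zeroCount s b) (fun i => min i a) r = zeroCount s r := by
      simp only [sortedCount]
      split_ifs <;> omega
    rw [sortedCount, e1, e2, sortedCount]
  have hδN : δ ∈ wordSpan k N := single_mem_wordSpan
    ⟨⟨fun q => by unfold stepWord; split_ifs <;> omega,
      fun q hq => by unfold stepWord; rw [if_neg (by omega)]⟩,
      by rw [zeroCount_stepWord]; omega⟩
  obtain ⟨y, hyV, hy⟩ := hle (hN.wordRep_mem h δ hδN)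
  have hz : (Y b * h - y) * Y a = 0 := by
    refine (hY a).mul_eq_zero_of_stepWord ?_
    rw [_root_.map_sub, LinearMap.sub_apply, sub_eq_zero, _root_.map_mul, Module.End.mul_apply]
    exact hy.symm
  rw [sub_mul, sub_eq_zero] at hz
  rw [hz]
  clear hz hy hδN hle
  have : V ≤ (Submodule.span k {y | ∃ j, j ≤ a ∧ j ≤ b ∧ y = Y b * Y j * Y a}).comap
      (LinearMap.mulRight k (Y a)) := by
    rw [hV, Submodule.span_le]
    rintro _ ⟨j, hja, hjb, rfl⟩
    exact Submodule.subset_span ⟨j, hja, hjb, rfl⟩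
  exact this hyV

end IsCutFamily

end CutElements

namespace PeirceData

variable {k : Type} [Field k] {H A ι : Type} [Ring H] [Algebra k H] [Ring A] [Algebra k A]
  [Fintype ι] {X : ι → H} {θ : ι → ι → H →ₗ[k] A} (P : PeirceData k X θ)
  {d : ι → H} (hd : ∀ i, X i * d i = d i) (hd' : ∀ i, d i * X i = d i)

include P hd' in
theorem diag_mul (i j : ι) (h : H) : (∑ l, θ l l (d l)) * θ i j h = θ i j (d i * h) := by
  rw [Finset.sum_mul, Finset.sum_eq_single i]
  · rw [P.mul, hd']
  · intro l _ hl
    exact P.mul_ne _ _ _ _ _ _ hl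
  · exact fun h => absurd (Finset.mem_univ i) h

include P hd in
theorem mul_diag (i j : ι) (h : H) : θ i j h * (∑ l, θ l l (d l)) = θ i j (h * d j) := by
  rw [Finset.mul_sum, Finset.sum_eq_single j]
  · rw [P.mul, mul_assoc, hd]
  · intro l _ hl
    exact P.mul_ne _ _ _ _ _ _ hl.symm
  · exact fun h => absurd (Finset.mem_univ j) h

include P hd hd' in
theorem diag_central (hc : ∀ i j h, d i * (X i * h * X j) = X i * h * X j * d j) (a : A) :
    (∑ l, θ l l (d l)) * a = a * ∑ l, θ l l (d l) := by
  rw [P.eq_sum a, Finset.mul_sum, Finset.sum_mul]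
  refine Finset.sum_congr rfl fun i _ => ?_
  rw [Finset.mul_sum, Finset.sum_mul]
  refine Finset.sum_congr rfl fun j _ => ?_
  obtain ⟨h, hh⟩ := P.corner i j a
  rw [hh, ← P.sandwich, P.diag_mul hd', P.mul_diag hd, hc]

include P hd' in
theorem diag_nilpotent {m : ℕ} (hn : ∀ i, d i ^ (m + 1) = 0) :
    IsNilpotent (∑ l, θ l l (d l)) := by
  have hpow : ∀ m, (∑ l, θ l l (d l)) ^ (m + 1) = ∑ l, θ l l (d l ^ (m + 1)) := by
    intro m
    induction m with
    | zero => simp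
    | succ m ih =>
      rw [pow_succ', ih, Finset.mul_sum]
      refine Finset.sum_congr rfl fun i _ => ?_
      rw [P.diag_mul hd', ← pow_succ']
  exact ⟨m + 1, by rw [hpow, Finset.sum_eq_zero fun i _ => by rw [hn, map_zero]]⟩

end PeirceData

section CutAlgebra

variable {k : Type} [Field k] {r : ℕ} {Y : ℕ → HeckeA k r} (hY : IsCutFamily Y)

/-- The central element of the cut `a`. -/
def cutDefect (Y : ℕ → HeckeA k r) (a : ℕ) : HeckeA k r := Y a * Y (a + 1) * Y a - Y 0

include hY

namespace IsCutFamily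

theorem eq_zero_cut {a : ℕ} (ha : r ≤ a) : Y a = Y 0 :=
  (hY a).unique ((hY 0).congr fun i => by
    have := i.2
    simp only [Set.mem_ofPred_eq]
    omega)

theorem mul_self (a : ℕ) : Y a * Y a = Y a := (hY a).mul_self

theorem zero_cut_mul (a : ℕ) : Y 0 * Y a = Y 0 :=
  (hY 0).mul_of_subset (hY a) fun i hi => absurd hi (Nat.succ_ne_zero i)

theorem mul_zero_cut (a : ℕ) : Y a * Y 0 = Y 0 :=
  (hY 0).mul_of_subset' (hY a) fun i hi => absurd hi (Nat.succ_ne_zero i)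

theorem mul_self_assoc (a : ℕ) (h : HeckeA k r) : Y a * (Y a * h) = Y a * h := by
  rw [← mul_assoc, hY.mul_self]

theorem zero_cut_mul_assoc (a : ℕ) (h : HeckeA k r) : Y 0 * (Y a * h) = Y 0 * h := by
  rw [← mul_assoc, hY.zero_cut_mul]

theorem mul_zero_cut_assoc (a : ℕ) (h : HeckeA k r) : Y a * (Y 0 * h) = Y 0 * h := by
  rw [← mul_assoc, hY.mul_zero_cut]

theorem defect_succ {b : ℕ} : cutDefect Y (b + 1) = Y (b + 1) * Y b * Y (b + 1) - Y 0 := by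
  rcases Nat.lt_or_ge (b + 1) r with hb | hb
  · rw [cutDefect, hY.mul_succ_mul hb]
  · rw [cutDefect, hY.eq_zero_cut hb]
    simp only [hY.zero_cut_mul]

theorem defect_zero : cutDefect Y 0 = 0 := by
  rw [cutDefect, hY.zero_cut_mul, hY.mul_self, sub_self]

theorem mul_defect_self (a : ℕ) : Y a * cutDefect Y a = cutDefect Y a := by
  rw [cutDefect, mul_sub, ← mul_assoc, ← mul_assoc, hY.mul_self, hY.mul_zero_cut]

theorem defect_mul_self (a : ℕ) : cutDefect Y a * Y a = cutDefect Y a := by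
  rw [cutDefect, sub_mul, mul_assoc _ (Y a), hY.mul_self, hY.zero_cut_mul]

theorem star_defect (a : ℕ) : heckeStar (cutDefect Y a) = cutDefect Y a := by
  simp only [cutDefect, heckeStar_sub, heckeStar_mul, (hY _).star_eq, mul_assoc]

theorem defect_mul_zero (a : ℕ) : cutDefect Y a * Y 0 = 0 := by
  rw [cutDefect, sub_mul, mul_assoc, mul_assoc, hY.mul_zero_cut, hY.mul_zero_cut, hY.mul_zero_cut,
    hY.mul_self, sub_self]

theorem zero_mul_defect (a : ℕ) : Y 0 * cutDefect Y a = 0 := by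
  apply heckeStar_injective
  rw [heckeStar_mul, hY.star_defect, (hY 0).star_eq, hY.defect_mul_zero, heckeStar_zero]

theorem defect_mul_of_le {a n : ℕ} (h : a + n ≤ r) :
    cutDefect Y (a + n) * Y a = Y (a + n) * cutDefect Y a := by
  induction n with
  | zero => rw [add_zero, hY.defect_mul_self, hY.mul_defect_self]
  | succ n ih =>
    have e : Y (a + (n + 1)) * Y (a + n) * Y a = Y (a + (n + 1)) * Y a :=
      hY.mul_between (by omega) (by omega) h
    calc cutDefect Y (a + (n + 1)) * Y a
        = (Y (a + n + 1) * Y (a + n) * Y (a + n + 1) - Y 0) * Y a := by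
          rw [← add_assoc, hY.defect_succ]
      _ = Y (a + n + 1) * Y (a + n) * (Y (a + (n + 1)) * Y (a + n) * Y a) - Y 0 := by
          rw [e, sub_mul, hY.zero_cut_mul, mul_assoc _ _ (Y a), add_assoc]
      _ = Y (a + n + 1) * ((Y (a + n) * Y (a + n + 1) * Y (a + n) - Y 0) * Y a) := by
          rw [← add_assoc, sub_mul, mul_sub, hY.zero_cut_mul, hY.mul_zero_cut]
          simp only [mul_assoc]
      _ = Y (a + (n + 1)) * Y (a + n) * Y a * cutDefect Y a := by
          have := ih (by omega)
          rw [cutDefect] at this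
          rw [this, mul_assoc _ (Y a), hY.mul_defect_self, mul_assoc, add_assoc]
      _ = Y (a + (n + 1)) * cutDefect Y a := by
          rw [e, mul_assoc, hY.mul_defect_self]

theorem defect_mul {a b : ℕ} (ha : a ≤ r) (hb : b ≤ r) :
    cutDefect Y b * Y a = Y b * cutDefect Y a := by
  rcases le_total a b with h | h
  · obtain ⟨n, rfl⟩ := Nat.exists_eq_add_of_le h
    exact hY.defect_mul_of_le hb
  · obtain ⟨n, rfl⟩ := Nat.exists_eq_add_of_le h
    apply heckeStar_injective
    rw [heckeStar_mul, heckeStar_mul, hY.star_defect, hY.star_defect, (hY _).star_eq,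
      (hY _).star_eq, hY.defect_mul_of_le ha]

theorem defect_central {a b : ℕ} (ha : a ≤ r) (hb : b ≤ r) (h : HeckeA k r) :
    cutDefect Y b * (Y b * h * Y a) = Y b * h * Y a * cutDefect Y a := by
  have hle : Submodule.span k {y | ∃ j, j ≤ a ∧ j ≤ b ∧ y = Y b * Y j * Y a} ≤
      LinearMap.eqLocus (LinearMap.mulLeft k (cutDefect Y b))
        (LinearMap.mulRight k (cutDefect Y a)) := by
    rw [Submodule.span_le]
    rintro _ ⟨j, hja, hjb, rfl⟩
    change cutDefect Y b * (Y b * Y j * Y a) = Y b * Y j * Y a * cutDefect Y a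
    rw [← mul_assoc, ← mul_assoc, hY.defect_mul_self, hY.defect_mul (by omega) hb, mul_assoc,
      hY.defect_mul ha (by omega)]
    simp only [mul_assoc, hY.mul_defect_self]
  exact hle (hY.sandwich_mem ha hb h)

theorem defect_mul_sub {a b j : ℕ} (ha : a ≤ r) (hb : b ≤ r) (hja : j + 1 ≤ a)
    (hjb : j + 1 ≤ b) :
    cutDefect Y b * (Y b * Y (j + 1) * Y a - Y 0) = Y b * Y j * Y a - Y 0 := by
  have e1 := hY.mul_between (a := j) (j := j + 1) (by omega) hjb hb
  have e2 := hY.mul_between' (a := j) (j := j + 1) (by omega) hja ha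
  rw [mul_sub, hY.defect_mul_zero, sub_zero, ← mul_assoc, ← mul_assoc, hY.defect_mul_self,
    hY.defect_mul (by omega) hb, hY.defect_succ, mul_sub, sub_mul, hY.mul_zero_cut, hY.zero_cut_mul,
    ← mul_assoc, ← mul_assoc, e1, mul_assoc, mul_assoc, ← mul_assoc (Y j), e2, mul_assoc]

theorem defect_pow {a : ℕ} (ha : a ≤ r) : cutDefect Y a ^ (r + 1) = 0 := by
  have h : ∀ j ≤ a, cutDefect Y a ^ j * (Y a * Y j * Y a - Y 0) = 0 := by
    intro j
    induction j with
    | zero => intro _; rw [hY.mul_zero_cut, hY.zero_cut_mul, sub_self, mul_zero]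
    | succ j ih =>
      intro hj
      rw [pow_succ, mul_assoc, hY.defect_mul_sub ha ha hj hj, ih (by omega)]
  have h1 := h a le_rfl
  have h2 : cutDefect Y a ^ (a + 1) = 0 := by
    calc cutDefect Y a ^ (a + 1)
        = cutDefect Y a ^ a * ((Y a * Y a * Y a - Y 0) * cutDefect Y a) := by
          rw [hY.mul_self, hY.mul_self, sub_mul, hY.mul_defect_self, hY.zero_mul_defect,
            sub_zero, pow_succ]
      _ = 0 := by rw [← mul_assoc, h1, zero_mul]
  exact pow_eq_zero_of_le (by omega) h2

theorem exists_sandwich_sub {a b : ℕ} (ha : a ≤ r) (hb : b ≤ r) (h : HeckeA k r) :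
    ∃ (κ : k) (h' : HeckeA k r), (Y b - Y 0) * h * (Y a - Y 0)
      = κ • (Y b * Y a - Y 0) + cutDefect Y b * h' := by
  have key : ∀ y ∈ Submodule.span k {y | ∃ j, j ≤ a ∧ j ≤ b ∧ y = Y b * Y j * Y a},
      ∃ (κ : k) (h' : HeckeA k r), (Y b - Y 0) * y * (Y a - Y 0)
      = κ • (Y b * Y a - Y 0) + cutDefect Y b * h' := by
    intro y hy
    induction hy using Submodule.span_induction with
    | mem y hy =>
      obtain ⟨j, hja, hjb, rfl⟩ := hy
      have e : (Y b - Y 0) * (Y b * Y j * Y a) * (Y a - Y 0) = Y b * Y j * Y a - Y 0 := by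
        simp only [mul_sub, sub_mul, mul_assoc, hY.mul_self, hY.zero_cut_mul, hY.mul_zero_cut,
          hY.mul_self_assoc, hY.zero_cut_mul_assoc]
        abel
      rw [e]
      rcases eq_or_ne j a with rfl | hja'
      · exact ⟨1, 0, by rw [mul_assoc, hY.mul_self, one_smul, mul_zero, add_zero]⟩
      rcases eq_or_ne j b with rfl | hjb'
      · exact ⟨1, 0, by rw [hY.mul_self, one_smul, mul_zero, add_zero]⟩
      exact ⟨0, Y b * Y (j + 1) * Y a - Y 0, by
        rw [zero_smul, zero_add, hY.defect_mul_sub ha hb (by omega) (by omega)]⟩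
    | zero => exact ⟨0, 0, by simp⟩
    | add y y' _ _ ih ih' =>
      obtain ⟨κ, h, e⟩ := ih
      obtain ⟨κ', h', e'⟩ := ih'
      refine ⟨κ + κ', h + h', ?_⟩
      rw [mul_add, add_mul, e, e', add_smul, mul_add]
      abel
    | smul c y _ ih =>
      obtain ⟨κ, h, e⟩ := ih
      exact ⟨c * κ, c • h, by
        rw [mul_smul_comm, smul_mul_assoc, e, smul_add, mul_smul, mul_smul_comm]⟩
  obtain ⟨κ, h', e⟩ := key _ (hY.sandwich_mem ha hb h)
  refine ⟨κ, h', e ▸ ?_⟩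
  simp only [mul_sub, sub_mul, mul_assoc, hY.mul_self, hY.mul_zero_cut,
    hY.mul_self_assoc, hY.zero_cut_mul_assoc]

theorem exists_mul_zero {b : ℕ} (hb : b ≤ r) (h : HeckeA k r) :
    ∃ κ : k, Y b * h * Y 0 = κ • Y 0 := by
  have hle : Submodule.span k {y | ∃ j, j ≤ 0 ∧ j ≤ b ∧ y = Y b * Y j * Y 0} ≤
      Submodule.span k {Y 0} := by
    rw [Submodule.span_le]
    rintro _ ⟨j, hj, -, rfl⟩
    obtain rfl : j = 0 := by omega
    rw [hY.mul_zero_cut, hY.mul_self]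
    exact Submodule.mem_span_singleton_self _
  obtain ⟨κ, hκ⟩ := Submodule.mem_span_singleton.1 (hle (hY.sandwich_mem (Nat.zero_le r) hb h))
  exact ⟨κ, hκ.symm⟩

theorem sub_mul_zero {b : ℕ} (hb : b ≤ r) (h : HeckeA k r) : (Y b - Y 0) * h * Y 0 = 0 := by
  obtain ⟨κ, hκ⟩ := hY.exists_mul_zero hb h
  have : Y 0 * h * Y 0 = Y 0 * (Y b * h * Y 0) := by
    rw [← mul_assoc, ← mul_assoc, hY.zero_cut_mul]
  rw [sub_mul, sub_mul, this, hκ, mul_smul_comm, hY.mul_self, sub_self]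

theorem zero_mul_sub {b : ℕ} (hb : b ≤ r) (h : HeckeA k r) : Y 0 * h * (Y b - Y 0) = 0 := by
  apply heckeStar_injective
  simp only [heckeStar_mul, heckeStar_sub, (hY _).star_eq, heckeStar_zero, ← mul_assoc]
  exact hY.sub_mul_zero hb _

end IsCutFamily

end CutAlgebra

section CutChain

variable {k : Type} [Field k] {r : ℕ}

/-- The idempotents of the chain in the two-block case. -/
def cutIdem (Y : ℕ → HeckeA k r) (a : ℕ) : HeckeA k r := if a = 0 then Y 0 else Y a - Y 0

/-- The arrow from `a` to `b` of the chain in the two-block case. -/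
def cutArrow (Y : ℕ → HeckeA k r) (b a : ℕ) : HeckeA k r :=
  if a = 0 ∨ b = 0 then 0 else Y b * Y a - Y 0

variable {Y : ℕ → HeckeA k r} (hY : IsCutFamily Y)
include hY

namespace IsCutFamily

theorem mul_cutIdem (a : ℕ) : Y a * cutIdem Y a = cutIdem Y a := by
  unfold cutIdem
  split_ifs with h
  · rw [hY.mul_zero_cut]
  · rw [mul_sub, hY.mul_self, hY.mul_zero_cut]

theorem cutIdem_mul (a : ℕ) : cutIdem Y a * Y a = cutIdem Y a := by
  unfold cutIdem
  split_ifs with h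
  · rw [hY.zero_cut_mul]
  · rw [sub_mul, hY.mul_self, hY.zero_cut_mul]

theorem cutIdem_mul_self (a : ℕ) : cutIdem Y a * cutIdem Y a = cutIdem Y a := by
  unfold cutIdem
  split_ifs with h
  · rw [hY.mul_self]
  · rw [mul_sub, sub_mul, sub_mul, hY.mul_self, hY.mul_zero_cut, hY.zero_cut_mul, hY.mul_self,
      sub_self, sub_zero]

theorem cutIdem_eq_zero {a : ℕ} (h : r ≤ a) (hr : 0 < r) : cutIdem Y a = 0 := by
  rw [cutIdem, if_neg (by omega), hY.eq_zero_cut h, sub_self]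

theorem cutIdem_mul_arrow (b a : ℕ) : cutIdem Y b * cutArrow Y b a = cutArrow Y b a := by
  unfold cutIdem cutArrow
  by_cases hb : b = 0
  · simp [hb]
  by_cases ha : a = 0
  · simp [ha]
  simp only [ha, hb, or_self, if_false, mul_sub, sub_mul, hY.mul_self, hY.zero_cut_mul,
    hY.mul_zero_cut, hY.mul_self_assoc, hY.zero_cut_mul_assoc, sub_self, sub_zero]

theorem arrow_mul_cutIdem (b a : ℕ) : cutArrow Y b a * cutIdem Y a = cutArrow Y b a := by
  unfold cutIdem cutArrow
  by_cases hb : b = 0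
  · simp [hb]
  by_cases ha : a = 0
  · simp [ha]
  simp only [ha, hb, or_self, if_false, mul_sub, sub_mul, mul_assoc, hY.mul_self,
    hY.zero_cut_mul, hY.mul_zero_cut, sub_self, sub_zero]

theorem mul_arrow (b a : ℕ) : Y b * cutArrow Y b a = cutArrow Y b a := by
  rw [← hY.cutIdem_mul_arrow, ← mul_assoc, hY.mul_cutIdem]

theorem arrow_mul (b a : ℕ) : cutArrow Y b a * Y a = cutArrow Y b a := by
  rw [← hY.arrow_mul_cutIdem, mul_assoc, hY.cutIdem_mul]

theorem arrow_mul_arrow {b j a : ℕ} (hb : b ≠ 0) (hj : j ≠ 0) (ha : a ≠ 0) :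
    cutArrow Y b j * cutArrow Y j a = Y b * Y j * Y a - Y 0 := by
  simp only [cutArrow, ha, hb, hj, or_self, if_false, mul_sub, sub_mul, mul_assoc,
    hY.zero_cut_mul, hY.mul_zero_cut, hY.mul_self_assoc, hY.zero_cut_mul_assoc, sub_self,
    sub_zero]

theorem defect_eq_zero {a : ℕ} (h : r ≤ a) : cutDefect Y a = 0 := by
  rw [cutDefect, hY.eq_zero_cut h, hY.zero_cut_mul, hY.mul_self, sub_self]

theorem arrow_mul_arrow_up (a : ℕ) :
    cutArrow Y (a + 1) a * cutArrow Y a (a + 1) = cutDefect Y (a + 1) ∨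
      cutArrow Y (a + 1) a * cutArrow Y a (a + 1) = 0 := by
  rcases Nat.eq_zero_or_pos a with rfl | ha
  · exact Or.inr (by simp [cutArrow])
  · exact Or.inl (by rw [hY.arrow_mul_arrow (by omega) (by omega) (by omega), hY.defect_succ])

theorem arrow_mul_arrow_down (a : ℕ) :
    cutArrow Y a (a + 1) * cutArrow Y (a + 1) a = cutDefect Y a := by
  rcases Nat.eq_zero_or_pos a with rfl | ha
  · rw [hY.defect_zero]; simp [cutArrow]
  · rw [hY.arrow_mul_arrow (by omega) (by omega) (by omega), cutDefect]

theorem arrow_comp (a n : ℕ) :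
    cutArrow Y (a + n + 1) (a + n) * cutArrow Y (a + n) a = cutArrow Y (a + n + 1) a := by
  rcases Nat.eq_zero_or_pos a with rfl | ha
  · simp [cutArrow]
  rw [hY.arrow_mul_arrow (by omega) (by omega) (by omega), cutArrow, if_neg (by omega)]
  rcases Nat.lt_or_ge r (a + n + 1) with h | h
  · rw [hY.eq_zero_cut h.le]
    simp only [hY.zero_cut_mul]
  · rw [hY.mul_between (by omega) (by omega) h]

theorem star_arrow (a b : ℕ) : heckeStar (cutArrow Y b a) = cutArrow Y a b := by
  unfold cutArrow
  split_ifs with h h' h'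
  · exact heckeStar_zero
  · exact absurd h.symm h'
  · exact absurd h'.symm h
  · rw [heckeStar_sub, heckeStar_mul, (hY _).star_eq, (hY _).star_eq, (hY _).star_eq]

theorem arrow_comp' (a n : ℕ) :
    cutArrow Y a (a + n) * cutArrow Y (a + n) (a + n + 1) = cutArrow Y a (a + n + 1) := by
  apply heckeStar_injective
  rw [heckeStar_mul, hY.star_arrow, hY.star_arrow, hY.star_arrow, hY.arrow_comp]

theorem cutIdem_sandwich (b a : ℕ) (h : HeckeA k r) :
    (∃ (κ : k) (h' : HeckeA k r), cutIdem Y b * h * cutIdem Y a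
      = κ • cutArrow Y b a + cutDefect Y b * h') ∨
    (a = 0 ∧ b = 0 ∧ ∃ κ : k, cutIdem Y b * h * cutIdem Y a = κ • cutIdem Y 0) := by
  have zero : cutIdem Y b * h * cutIdem Y a = 0 →
      ∃ (κ : k) (h' : HeckeA k r), cutIdem Y b * h * cutIdem Y a
      = κ • cutArrow Y b a + cutDefect Y b * h' := fun e => ⟨0, 0, by simp [e]⟩
  rcases Nat.eq_zero_or_pos a with rfl | ha <;> rcases Nat.eq_zero_or_pos b with rfl | hb
  · exact Or.inr ⟨rfl, rfl, hY.exists_mul_zero (Nat.zero_le r) h⟩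
  · refine Or.inl (zero ?_)
    rw [cutIdem, cutIdem, if_neg hb.ne', if_pos rfl]
    rcases Nat.lt_or_ge r b with hbr | hbr
    · rw [hY.eq_zero_cut hbr.le, sub_self, zero_mul, zero_mul]
    · exact hY.sub_mul_zero hbr h
  · refine Or.inl (zero ?_)
    rw [cutIdem, cutIdem, if_neg ha.ne', if_pos rfl]
    rcases Nat.lt_or_ge r a with har | har
    · rw [hY.eq_zero_cut har.le, sub_self, mul_zero]
    · exact hY.zero_mul_sub har h
  · left
    rcases Nat.lt_or_ge r a with har | har
    · exact zero (by rw [cutIdem, cutIdem, if_neg ha.ne', hY.eq_zero_cut har.le, sub_self,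
        mul_zero])
    rcases Nat.lt_or_ge r b with hbr | hbr
    · exact zero (by rw [cutIdem, if_neg hb.ne', hY.eq_zero_cut hbr.le, sub_self,
        zero_mul, zero_mul])
    rw [cutIdem, cutIdem, cutArrow, if_neg hb.ne', if_neg ha.ne', if_neg (by omega)]
    exact hY.exists_sandwich_sub har hbr h

end IsCutFamily

end CutChain

section CutPeirce

variable {k : Type} [Field k] {r : ℕ} {Y : ℕ → HeckeA k r} (hY : IsCutFamily Y)
  {A ι : Type} [Ring A] [Algebra k A] [Fintype ι] {X : ι → HeckeA k r}
  {θ : ι → ι → HeckeA k r →ₗ[k] A} (P : PeirceData k X θ)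
  {cut : ι → ℕ} (hX : ∀ i, X i = Y (cut i)) {v : ℕ → ι} (hv : ∀ a, X (v a) = Y a)

include hY P hv

theorem upPath_cut {a : ℕ} (ha : a ≠ 0) (n : ℕ) :
    upPath (fun a => θ (v a) (v a) (cutIdem Y a))
      (fun a => θ (v (a + 1)) (v a) (cutArrow Y (a + 1) a)) a n
      = θ (v (a + n)) (v a) (cutArrow Y (a + n) a) := by
  induction n with
  | zero => simp [upPath, cutIdem, cutArrow, ha, hY.mul_self]
  | succ n ih => rw [upPath, ih, P.mul, hv, hY.arrow_mul, hY.arrow_comp]; rfl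

theorem downPath_cut {a : ℕ} (ha : a ≠ 0) (n : ℕ) :
    downPath (fun a => θ (v a) (v a) (cutIdem Y a))
      (fun a => θ (v a) (v (a + 1)) (cutArrow Y a (a + 1))) a n
      = θ (v a) (v (a + n)) (cutArrow Y a (a + n)) := by
  induction n with
  | zero => simp [downPath, cutIdem, cutArrow, ha, hY.mul_self]
  | succ n ih => rw [downPath, ih, P.mul, hv, hY.arrow_mul, hY.arrow_comp']; rfl

include hX

theorem cut_one_eq (i : ι) : (θ i (v 0) 1 * θ (v 0) (v 0) (cutIdem Y 0) * θ (v 0) i 1)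
    + (if cut i = 0 then 0 else θ i (v (cut i)) 1) *
      θ (v (cut i)) (v (cut i)) (cutIdem Y (cut i)) * θ (v (cut i)) i 1 = θ i i 1 := by
  have e : ∀ a, θ i (v a) 1 * θ (v a) (v a) (cutIdem Y a) * θ (v a) i 1
      = θ i i (cutIdem Y a) := fun a => by
    rw [P.mul, P.mul, hv, one_mul, hY.mul_cutIdem, mul_one, hY.cutIdem_mul]
  rw [e, ← P.sandwich i i 1, mul_one, hX, hY.mul_self]
  split_ifs with h
  · rw [h]; simp [cutIdem]
  · rw [e, ← map_add, cutIdem, cutIdem, if_pos rfl, if_neg h, add_sub_cancel]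

theorem chainData_cut (hcut : ∀ a, cut (v a) = min a r) (hr : 0 < r) :
    ChainData k (∑ i, θ i i (cutDefect Y (cut i))) r
      (fun a => θ (v a) (v a) (cutIdem Y a))
      (fun a => θ (v (a + 1)) (v a) (cutArrow Y (a + 1) a))
      (fun a => θ (v a) (v (a + 1)) (cutArrow Y a (a + 1))) := by
  have hd' : ∀ i, cutDefect Y (cut i) * X i = cutDefect Y (cut i) := fun i => by
    rw [hX, hY.defect_mul_self]
  have hdef : ∀ a, cutDefect Y (cut (v a)) = cutDefect Y a := fun a => by
    rcases le_total a r with h | h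
    · rw [hcut, min_eq_left h]
    · rw [hcut, min_eq_right h, hY.defect_eq_zero le_rfl, hY.defect_eq_zero h]
  have hc : ∀ a j h, (∑ i, θ i i (cutDefect Y (cut i))) * θ (v a) j h
      = θ (v a) j (cutDefect Y a * h) := fun a j h => by rw [P.diag_mul hd', hdef]
  have hsand : ∀ b a s, ∃ h, θ (v b) (v b) (cutIdem Y b) * s * θ (v a) (v a) (cutIdem Y a)
      = θ (v b) (v a) (cutIdem Y b * h * cutIdem Y a) := fun b a s => by
    obtain ⟨h, hh⟩ := P.mul_mul (v b) (v b) (v a) (v a) s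
    exact ⟨h, hh _ _ (by rw [hv, hY.cutIdem_mul]) (by rw [hv, hY.mul_cutIdem])⟩
  refine ⟨fun a => ?_, fun a ha => ?_, fun a => ?_, fun a => ?_, fun a => ?_, fun a => ?_,
    fun a => ?_, fun a => ?_, ?_, fun a n s => ?_, fun a n s => ?_⟩
  · rw [P.mul, hv, hY.cutIdem_mul, hY.cutIdem_mul_self]
  · rw [hY.cutIdem_eq_zero ha hr, map_zero]
  · rw [P.mul, hv, hY.cutIdem_mul, hY.cutIdem_mul_arrow]
  · rw [P.mul, hv, hY.arrow_mul, hY.arrow_mul_cutIdem]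
  · rw [P.mul, hv, hY.cutIdem_mul, hY.cutIdem_mul_arrow]
  · rw [P.mul, hv, hY.arrow_mul, hY.arrow_mul_cutIdem]
  · rw [P.mul, hv, hY.arrow_mul]
    rcases hY.arrow_mul_arrow_up a with e | e
    · exact ⟨θ (v (a + 1)) (v (a + 1)) 1, by rw [hc, e, mul_one]⟩
    · exact ⟨0, by rw [e, map_zero, mul_zero]⟩
  · rw [P.mul, hv, hY.arrow_mul, hY.arrow_mul_arrow_down]
    exact ⟨θ (v a) (v a) 1, by rw [hc, mul_one]⟩
  · let e := Fintype.equivFin (ι ⊕ ι)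
    let a : ι ⊕ ι → ℕ := Sum.elim (fun _ => 0) cut
    let u : ι ⊕ ι → A := Sum.elim (fun i => θ i (v 0) 1)
      fun i => if cut i = 0 then 0 else θ i (v (cut i)) 1
    let w : ι ⊕ ι → A := Sum.elim (fun i => θ (v 0) i 1) fun i => θ (v (cut i)) i 1
    refine ⟨_, u ∘ e.symm, w ∘ e.symm, a ∘ e.symm, ?_⟩
    rw [← P.one]
    refine (Equiv.sum_comp e.symm fun x =>
      u x * θ (v (a x)) (v (a x)) (cutIdem Y (a x)) * w x).trans ?_
    rw [Fintype.sum_sum_type, ← Finset.sum_add_distrib]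
    exact Finset.sum_congr rfl fun i _ => cut_one_eq hY P hX hv i
  · obtain ⟨h, hh⟩ := hsand (a + n) a s
    simp only [hh]
    rcases hY.cutIdem_sandwich (a + n) a h with ⟨κ, h', e⟩ | ⟨rfl, hn, κ, e⟩
    · rcases eq_or_ne a 0 with rfl | ha
      · refine ⟨0, θ (v (0 + n)) (v 0) h', ?_⟩
        rw [e, hc, cutArrow, if_pos (Or.inl rfl), smul_zero, zero_smul]
        simp only [zero_add]
      · refine ⟨κ, θ (v (a + n)) (v a) h', ?_⟩
        rw [e, hc, upPath_cut hY P hv ha, map_add, _root_.map_smul]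
    · obtain rfl : n = 0 := by omega
      refine ⟨κ, 0, ?_⟩
      simp only [e, mul_zero, add_zero, upPath, _root_.map_smul]
  · obtain ⟨h, hh⟩ := hsand a (a + n) s
    simp only [hh]
    rcases hY.cutIdem_sandwich a (a + n) h with ⟨κ, h', e⟩ | ⟨hn, rfl, κ, e⟩
    · rcases eq_or_ne a 0 with rfl | ha
      · refine ⟨0, θ (v 0) (v (0 + n)) h', ?_⟩
        rw [e, hc, cutArrow, if_pos (Or.inr rfl), smul_zero, zero_smul]
        simp only [zero_add]
      · refine ⟨κ, θ (v a) (v (a + n)) h', ?_⟩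
        rw [e, hc, downPath_cut hY P hv ha, map_add, _root_.map_smul]
    · obtain rfl : n = 0 := by omega
      refine ⟨κ, 0, ?_⟩
      simp only [e, mul_zero, add_zero, downPath, _root_.map_smul]

end CutPeirce

section SchurTwo

variable {k : Type} [Field k] {r : ℕ} {T : Equiv.Perm (Fin r) → HeckeA k r}

theorem exists_isCutFamily (hT : IsHeckeBasis k r T) :
    ∃ (Y : ℕ → HeckeA k r) (v : ℕ → Comp 2 r), IsCutFamily Y ∧
      (∀ lam : Comp 2 r, xElt k T lam = Y (lam.1 0)) ∧ (∀ a, xElt k T (v a) = Y a) ∧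
      ∀ a, (v a).1 0 = min a r := by
  choose v hv using fun a => exists_comp_two (min a r) (min_le_right a r)
  have hY : IsCutFamily fun a => xElt k T (v a) := fun a =>
    (isYoungElt_xElt hT (v a)).congr fun i => by
      have := i.2
      rw [mem_missing_two, hv, Set.mem_ofPred_eq]
      omega
  refine ⟨_, v, hY, fun lam => ?_, fun a => rfl, hv⟩
  exact (isYoungElt_xElt hT lam).unique ((hY _).congr fun i => (mem_missing_two lam i).symm)

theorem schur_two_tauTiltingFinite (hr : 0 < r) (hT : IsHeckeBasis k r T) :
    TauTiltingFinite k (Schur0 k 2 r T) := by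
  have := hT.finite
  have P : PeirceData k (fun lam : Comp 2 r => xElt k T lam) (schurUnit T) :=
    peirceData_schur hT
  have := P.finite
  obtain ⟨Y, v, hY, hX, hv, hcut⟩ := exists_isCutFamily hT
  have hle : ∀ lam : Comp 2 r, lam.1 0 ≤ r := fun lam =>
    (Finset.single_le_sum (fun _ _ => Nat.zero_le _) (Finset.mem_univ 0)).trans_eq lam.2
  refine ChainData.tauTiltingFinite_self (P.diag_central (d := fun lam => cutDefect Y (lam.1 0))
    (fun lam => ?_) (fun lam => ?_) fun lam mu h => ?_) (P.diag_nilpotent (m := r)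
      (fun lam => ?_) fun lam => ?_)
    (chainData_cut hY P (cut := fun lam => lam.1 0) hX hv hcut hr)
  · rw [hX, hY.mul_defect_self]
  · rw [hX, hY.defect_mul_self]
  · rw [hX, hX, hY.defect_central (hle mu) (hle lam)]
  · rw [hX, hY.defect_mul_self]
  · exact hY.defect_pow (hle lam)

end SchurTwo

/-- (1) For `n ≥ 3`, the 0-Schur algebra `S_0(n,r)` is τ-tilting finite iff `r ≤ 3`.
(2) For `n = 2` and every `r ≥ 2`, `S_0(2,r)` is τ-tilting finite. -/
theorem statement6 (k : Type) [Field k] [IsAlgClosed k] :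
    (∀ (n r : ℕ) (T : Equiv.Perm (Fin r) → HeckeA k r), 3 ≤ n → IsHeckeBasis k r T →
      (TauTiltingFinite k (Schur0 k n r T) ↔ r ≤ 3)) ∧
    (∀ (r : ℕ) (T : Equiv.Perm (Fin r) → HeckeA k r), 2 ≤ r → IsHeckeBasis k r T →
      TauTiltingFinite k (Schur0 k 2 r T)) := by
  refine ⟨fun n r T hn hT => ⟨fun h => ?_, fun hr => schur_small_tauTiltingFinite hn hr hT⟩,
    fun r T hr hT => schur_two_tauTiltingFinite (by omega) hT⟩
  by_contra hr
  exact schur_not_tauTiltingFinite hn (by omega) hT h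

end
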